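/- (Refined Kelvin–Hicks formula.) For every κ, W, δ₀, m₀ > 0 there exist ε₀, d₀, C > 0 such that: whenever ε ∈ (0, ε₀] and ψ is a centralized stream function of a steady vortex ring with parameters (ε, W, μ), μ ≥ m₀, whose circulation equals κ and whose cross-section A is simply connected, contained in {x : δ₀ ≤ x₁ ≤ 1/δ₀}, and of diameter at most d₀, and p = (p₁, 0) ∈ A is a point at which ψ attains its maximum over the closure of A, then, with σ := (1/2)·diam A, one has |W p₁ ln(1/ε) − (κ/(4π))(ln(8 p₁/σ) − 1/4)| ≤ C ε² (ln(1/ε))². -/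

import Mathlib

open MeasureTheory Real Filter
open scoped RealInnerProductSpace

noncomputable section

/-- The plane `ℝ²` with the Euclidean norm. -/
abbrev Plane : Type := EuclideanSpace ℝ (Fin 2)

/-- The point `(a, b)` of the plane. -/
def mk2 (a b : ℝ) : Plane := (WithLp.equiv 2 (Fin 2 → ℝ)).symm ![a, b]

/-- The open right half plane `Π = {x : x₁ > 0}`. -/
def halfPlane : Set Plane := {x : Plane | 0 < x 0}

/-- The reflection `x̄ = (−x₁, x₂)` of a point `x = (x₁, x₂)`. -/
def reflPt (x : Plane) : Plane := mk2 (-(x 0)) (x 1)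

/-- The Green function `G_*` on the half plane of the operator `−(1/x₁)div((1/x₁)∇)`. -/
def Gstar (x x' : Plane) : ℝ :=
  x 0 * (x' 0) ^ 2 / (4 * π) *
    ∫ θ in (-π)..π, Real.cos θ /
      Real.sqrt ((x 1 - x' 1) ^ 2 + (x 0) ^ 2 + (x' 0) ^ 2 - 2 * x 0 * x' 0 * Real.cos θ)

/-- The Green function of `−Δ` on the half plane. -/
def Gfun (x x' : Plane) : ℝ :=
  (1 / (4 * π)) * Real.log
    (((x 0 + x' 0) ^ 2 + (x 1 - x' 1) ^ 2) / ((x 0 - x' 0) ^ 2 + (x 1 - x' 1) ^ 2))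

/-- The regular part `H_c(x,x') = G_*(x,x') − c² G(x,x')`. -/
def Hker (c : ℝ) (x x' : Plane) : ℝ := Gstar x x' - c ^ 2 * Gfun x x'

/-- The regular part `H_c`, extended continuously to the diagonal. -/
def HkerExt (c : ℝ) (x x' : Plane) : ℝ := by
  classical
  exact if x = x' then limUnder (nhdsWithin x' {x'}ᶜ) (fun y => Hker c y x')
    else Hker c x x'

/-- The cross-section `A = {x ∈ Π : ψ(x) − (W/2) x₁² ln(1/ε) > μ}`. -/
def crossSection (ψ : Plane → ℝ) (ε W μ : ℝ) : Set Plane :=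
  {x : Plane | x ∈ halfPlane ∧ μ < ψ x - W / 2 * (x 0) ^ 2 * Real.log (1 / ε)}

/-- `ψ` is a stream function of a steady vortex ring with parameters `(ε, W, μ)`. -/
structure IsVortexRingStream (ψ : Plane → ℝ) (ε W μ : ℝ) : Prop where
  continuousOn : ContinuousOn ψ halfPlane
  bounded : Bornology.IsBounded (crossSection ψ ε W μ)
  closure_subset : closure (crossSection ψ ε W μ) ⊆ halfPlane
  repr : ∀ x ∈ halfPlane, ψ x = (∫ x' in crossSection ψ ε W μ, Gstar x x') / ε ^ 2

/-- The circulation `ε⁻² ∫_A x₁ dx` of a vortex ring. -/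
def circulation (ψ : Plane → ℝ) (ε W μ : ℝ) : ℝ :=
  (∫ x in crossSection ψ ε W μ, x 0) / ε ^ 2

/-- `ψ` is centralized: it is even in the second variable. -/
def Centralized (ψ : Plane → ℝ) : Prop :=
  ∀ a b : ℝ, ψ (mk2 a (-b)) = ψ (mk2 a b)

namespace VortexRing
open scoped Interval Topology

/-- The elliptic-type integral through which `Gstar` is expressed. -/
def ringF (ρ : ℝ) : ℝ :=
  1 / (4 * π) * ∫ θ in (-π)..π, cos θ / √(ρ + 2 - 2 * cos θ)

/-- The numerator of the regular part of `ringF`. -/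
def ringM (φ : ℝ) : ℝ := 1 - 2 * sin φ ^ 2 - cos φ

/-- The integral carrying the regular part of `ringF`. -/
def ringN (ρ : ℝ) : ℝ := ∫ φ in (0 : ℝ)..(π / 2), ringM φ / √(ρ + 4 * sin φ ^ 2)

/-- The regular part of `ringF`. -/
def ringR (ρ : ℝ) : ℝ :=
  1 / π * (1 / 2 * log (2 + √(4 + ρ)) - 1 / 2 * log 4 + (ringN ρ - (1 / 2 * log 2 - 1)))

/-- The constant in the expansion of `ringF` at `0`. -/
def ringB : ℝ := log 64 - 4

lemma cos_two_mul_eq_add_ringM (φ : ℝ) : cos (2 * φ) = cos φ + ringM φ := by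
  rw [cos_two_mul, ringM, sin_sq]; ring

lemma abs_ringM_le {φ : ℝ} (h0 : 0 ≤ φ) (h1 : φ ≤ π / 2) : |ringM φ| ≤ 2 * sin φ ^ 2 := by
  have hc : 0 ≤ cos φ := cos_nonneg_of_neg_pi_div_two_le_of_le (by linarith [pi_pos]) h1
  have hc1 := cos_le_one φ
  have := sin_sq_add_cos_sq φ
  rw [ringM, abs_le]; constructor <;> nlinarith

lemma continuous_div_sqrt_sin {ρ : ℝ} (hρ : 0 < ρ) {f : ℝ → ℝ} (hf : Continuous f) :
    Continuous fun φ => f φ / √(ρ + 4 * sin φ ^ 2) := by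
  refine hf.div (by fun_prop) fun φ => ?_
  have : 0 < ρ + 4 * sin φ ^ 2 := by positivity
  positivity

lemma ringF_half_angle {ρ : ℝ} (hρ : 0 < ρ) :
    ringF ρ = 1 / π * ∫ φ in (0 : ℝ)..(π / 2), cos (2 * φ) / √(ρ + 4 * sin φ ^ 2) := by
  set f : ℝ → ℝ := fun θ => cos θ / √(ρ + 2 - 2 * cos θ) with hf
  have hcont : Continuous f := by
    refine continuous_cos.div (by fun_prop) fun θ => ?_
    have : 0 < ρ + 2 - 2 * cos θ := by linarith [cos_le_one θ]
    positivity
  have heven : ∀ θ, f (-θ) = f θ := fun θ => by simp [hf]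
  have h1 : (∫ θ in (-π)..π, f θ) = 2 * ∫ θ in (0:ℝ)..π, f θ := by
    rw [← intervalIntegral.integral_add_adjacent_intervals
      (hcont.intervalIntegrable (-π) 0) (hcont.intervalIntegrable 0 π)]
    have := intervalIntegral.integral_comp_neg (a := 0) (b := π) f
    simp only [heven, neg_zero] at this
    rw [← this]; ring
  have h2 : (∫ θ in (0:ℝ)..π, f θ) = 2 * ∫ φ in (0 : ℝ)..(π / 2), f (2 * φ) := by
    rw [intervalIntegral.integral_comp_mul_left f (by norm_num : (2:ℝ) ≠ 0)]
    rw [mul_zero, mul_div_cancel₀ _ (by norm_num : (2:ℝ) ≠ 0), smul_eq_mul]; ring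
  have h3 : ∀ φ, f (2 * φ) = cos (2 * φ) / √(ρ + 4 * sin φ ^ 2) := fun φ => by
    simp only [hf]
    congr 2
    rw [cos_two_mul, sin_sq]; ring
  rw [ringF, h1, h2]
  simp only [h3]
  field_simp
  norm_num

lemma integral_cos_div_sqrt {ρ : ℝ} (hρ : 0 < ρ) :
    (∫ φ in (0 : ℝ)..(π / 2), cos φ / √(ρ + 4 * sin φ ^ 2))
      = 1 / 2 * log (2 + √(4 + ρ)) - 1 / 4 * log ρ := by
  have hd : ∀ φ ∈ Set.uIcc 0 (π / 2), HasDerivAt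
      (fun φ => 1 / 2 * log (2 * sin φ + √(ρ + 4 * sin φ ^ 2)))
      (cos φ / √(ρ + 4 * sin φ ^ 2)) φ := by
    intro φ hφ
    rw [Set.uIcc_of_le (by positivity)] at hφ
    have hs : 0 ≤ sin φ := sin_nonneg_of_nonneg_of_le_pi hφ.1 (by linarith [hφ.2, pi_pos])
    have hpos : 0 < ρ + 4 * sin φ ^ 2 := by positivity
    have h1 : HasDerivAt (fun φ => ρ + 4 * sin φ ^ 2) (4 * (2 * sin φ * cos φ)) φ := by
      have := ((hasDerivAt_sin φ).pow 2).const_mul 4 |>.const_add ρ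
      simpa using this
    have h2 := h1.sqrt hpos.ne'
    have h3 := ((hasDerivAt_sin φ).const_mul 2).add h2
    have hq : 0 < √(ρ + 4 * sin φ ^ 2) := by positivity
    have h4 := (h3.log (by simp only [Pi.add_apply]; positivity)).const_mul (1 / 2)
    refine h4.congr_deriv ?_
    simp only [Pi.add_apply]
    field_simp
    ring
  rw [intervalIntegral.integral_eq_sub_of_hasDerivAt hd
    ((continuous_div_sqrt_sin hρ continuous_cos).intervalIntegrable _ _)]
  simp only [sin_pi_div_two, sin_zero]
  have : log √ρ = 1 / 2 * log ρ := by rw [log_sqrt hρ.le]; ring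
  norm_num [this]
  rw [add_comm ρ 4]; ring

lemma abs_ringN_integrand_le {ρ φ : ℝ} (hρ : 0 ≤ ρ) (h0 : 0 ≤ φ) (h1 : φ ≤ π / 2) :
    |ringM φ / √(ρ + 4 * sin φ ^ 2)| ≤ 1 := by
  have hs : 0 ≤ sin φ := sin_nonneg_of_nonneg_of_le_pi h0 (by linarith [pi_pos])
  have h2 : 2 * sin φ ≤ √(ρ + 4 * sin φ ^ 2) := by
    refine le_sqrt_of_sq_le ?_
    nlinarith
  rw [abs_div, abs_of_nonneg (sqrt_nonneg _)]
  refine div_le_one_of_le₀ ?_ (sqrt_nonneg _)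
  nlinarith [abs_ringM_le h0 h1, sin_le_one φ]

lemma continuous_ringM : Continuous ringM := by unfold ringM; fun_prop

lemma intervalIntegrable_ringN {ρ : ℝ} (hρ : 0 ≤ ρ) :
    IntervalIntegrable (fun φ => ringM φ / √(ρ + 4 * sin φ ^ 2)) volume 0 (π / 2) := by
  refine (intervalIntegrable_const (c := (1 : ℝ))).mono_fun ?_ ?_
  · exact (continuous_ringM.measurable.div (by fun_prop)).aestronglyMeasurable
  · refine (ae_restrict_iff' measurableSet_uIoc).2 (Eventually.of_forall fun φ hφ => ?_)
    rw [Set.uIoc_of_le (by positivity)] at hφ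
    simpa only [norm_eq_abs, abs_one] using abs_ringN_integrand_le hρ hφ.1.le hφ.2

lemma ringN_zero : ringN 0 = 1 / 2 * log 2 - 1 := by
  have hd : ∀ φ ∈ Set.uIcc 0 (π / 2), HasDerivAt (fun φ => -log (cos (φ / 2)) + cos φ)
      (ringM φ / √(0 + 4 * sin φ ^ 2)) φ := by
    intro φ hφ
    rw [Set.uIcc_of_le (by positivity)] at hφ
    have hc : 0 < cos (φ / 2) := cos_pos_of_mem_Ioo ⟨by linarith [hφ.1, pi_pos], by
      linarith [hφ.2, pi_pos]⟩
    have h0 : HasDerivAt (fun φ => cos (φ / 2)) (-sin (φ / 2) * (1 / 2)) φ :=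
      ((hasDerivAt_id φ).div_const 2).cos
    have h1 := h0.log hc.ne'
    have h2 := h1.neg.add (hasDerivAt_cos φ)
    have hs2 : 0 ≤ sin (φ / 2) := sin_nonneg_of_nonneg_of_le_pi (by linarith [hφ.1])
      (by linarith [hφ.2, pi_pos])
    have e1 : sin φ = 2 * sin (φ / 2) * cos (φ / 2) := by rw [← sin_two_mul]; ring_nf
    have e2 : cos φ = 1 - 2 * sin (φ / 2) ^ 2 := by
      rw [show cos φ = cos (2 * (φ / 2)) by ring_nf, cos_two_mul, sin_sq]; ring
    refine h2.congr_deriv ?_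
    have e3 : √(0 + 4 * sin φ ^ 2) = 2 * sin φ := by
      rw [show 0 + 4 * sin φ ^ 2 = (2 * sin φ) ^ 2 by ring, sqrt_sq]
      rw [e1]; positivity
    rw [e3, ringM]
    rcases hs2.eq_or_lt with h | h
    · rw [e1, ← h]; simp
    · have : 0 < sin φ := by rw [e1]; positivity
      rw [e1, e2]
      have := sin_sq_add_cos_sq (φ / 2)
      field_simp
      ring_nf
  rw [ringN, intervalIntegral.integral_eq_sub_of_hasDerivAt hd (intervalIntegrable_ringN le_rfl)]
  have hl : log (√2 / 2) = -(1 / 2 * log 2) := by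
    rw [log_div (by positivity) (by norm_num), log_sqrt (by norm_num)]; ring
  rw [show π / 2 / 2 = π / 4 by ring, cos_pi_div_four, hl]
  simp

lemma ringF_eq {ρ : ℝ} (hρ : 0 < ρ) :
    ringF ρ = 1 / (4 * π) * (-log ρ + ringB) + ringR ρ := by
  rw [ringF_half_angle hρ]
  have : (∫ φ in (0 : ℝ)..(π / 2), cos (2 * φ) / √(ρ + 4 * sin φ ^ 2))
      = (1 / 2 * log (2 + √(4 + ρ)) - 1 / 4 * log ρ) + ringN ρ := by
    rw [← integral_cos_div_sqrt hρ, ringN, ← intervalIntegral.integral_add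
      ((continuous_div_sqrt_sin hρ continuous_cos).intervalIntegrable _ _)
      ((continuous_div_sqrt_sin hρ continuous_ringM).intervalIntegrable _ _)]
    simp only [cos_two_mul_eq_add_ringM, add_div]
  have h64 : log 64 = 6 * log 2 := by rw [← log_rpow (by norm_num)]; norm_num
  have h4 : log 4 = 2 * log 2 := by rw [← log_rpow (by norm_num)]; norm_num
  rw [this, ringR, ringB, h64, h4]
  field_simp
  ring

/-- The integral controlling `ringN` and its derivative. -/
def ringI (ρ : ℝ) : ℝ := ∫ φ in (0 : ℝ)..(π / 2), 1 / √(ρ + 4 * sin φ ^ 2)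

lemma sq_le_four_mul_sin_sq {φ : ℝ} (h0 : 0 ≤ φ) (h1 : φ ≤ π / 2) : φ ^ 2 ≤ 4 * sin φ ^ 2 := by
  have h2 := mul_le_sin h0 h1
  have h3 : φ ≤ 2 * sin φ := by
    have : φ ≤ 2 * (2 / π * φ) := by
      have : 1 ≤ 2 * (2 / π) := by
        rw [← mul_div_assoc, le_div_iff₀ pi_pos]; linarith [pi_le_four]
      nlinarith
    linarith
  nlinarith

lemma ringI_le {ρ : ℝ} (h0 : 0 < ρ) (h1 : ρ ≤ 1) : ringI ρ ≤ 4 * (1 + |log ρ|) := by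
  have hd : ∀ φ ∈ Set.uIcc 0 (π / 2), HasDerivAt (fun φ => log (φ + √(ρ + φ ^ 2)))
      (1 / √(ρ + φ ^ 2)) φ := by
    intro φ hφ
    rw [Set.uIcc_of_le (by positivity)] at hφ
    have hφ0 := hφ.1
    have hpos : 0 < ρ + φ ^ 2 := by positivity
    have h1 : HasDerivAt (fun φ : ℝ => ρ + φ ^ 2) (2 * φ) φ := by
      simpa using (hasDerivAt_pow 2 φ).const_add ρ
    have h3 := (hasDerivAt_id' φ).add (h1.sqrt hpos.ne')
    have h4 := h3.log (by simp only [Pi.add_apply]; positivity)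
    refine h4.congr_deriv ?_
    simp only [Pi.add_apply]
    have : 0 < √(ρ + φ ^ 2) := by positivity
    field_simp
    ring
  have hc : Continuous fun φ : ℝ => 1 / √(ρ + φ ^ 2) := by
    refine continuous_const.div (by fun_prop) fun φ => ?_
    have : 0 < ρ + φ ^ 2 := by positivity
    positivity
  have h2 : ringI ρ ≤ ∫ φ in (0 : ℝ)..(π / 2), 1 / √(ρ + φ ^ 2) := by
    refine intervalIntegral.integral_mono_on (by positivity)
      ((continuous_div_sqrt_sin h0 continuous_const).intervalIntegrable _ _)
      (hc.intervalIntegrable _ _) fun φ hφ => ?_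
    have := sq_le_four_mul_sin_sq hφ.1 hφ.2
    gcongr
  refine h2.trans ?_
  rw [intervalIntegral.integral_eq_sub_of_hasDerivAt hd (hc.intervalIntegrable _ _)]
  have h3 : √(ρ + (π / 2) ^ 2) ≤ 3 := by
    rw [sqrt_le_left (by norm_num)]
    nlinarith [pi_le_four, pi_pos]
  have h4 : log (π / 2 + √(ρ + (π / 2) ^ 2)) ≤ 4 := by
    refine (log_le_sub_one_of_pos (by positivity)).trans ?_
    linarith [pi_le_four]
  have h5 : log (0 + √(ρ + 0 ^ 2)) = log ρ / 2 := by
    rw [zero_add, zero_pow two_ne_zero, add_zero, log_sqrt h0.le]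
  rw [h5]
  linarith [neg_abs_le (log ρ), abs_nonneg (log ρ)]

lemma abs_ringN_sub_le {ρ : ℝ} (hρ : 0 < ρ) : |ringN ρ - ringN 0| ≤ ρ / 4 * ringI ρ := by
  rw [ringN, ringN, ← intervalIntegral.integral_sub (intervalIntegrable_ringN hρ.le)
    (intervalIntegrable_ringN le_rfl), ringI, ← intervalIntegral.integral_const_mul, ← norm_eq_abs]
  refine intervalIntegral.norm_integral_le_of_norm_le (by positivity)
    (Eventually.of_forall fun φ hφ => ?_)
    (((continuous_div_sqrt_sin hρ continuous_const).intervalIntegrable _ _).const_mul _)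
  have hφ0 := hφ.1
  have hs : 0 < sin φ := sin_pos_of_pos_of_lt_pi hφ.1 (by linarith [hφ.2, pi_pos])
  have hM := abs_ringM_le hφ.1.le hφ.2
  have e3 : √(0 + 4 * sin φ ^ 2) = 2 * sin φ := by
    rw [show 0 + 4 * sin φ ^ 2 = (2 * sin φ) ^ 2 by ring, sqrt_sq (by positivity)]
  rw [e3, norm_eq_abs]
  set r := √(ρ + 4 * sin φ ^ 2) with hr
  have hr2 : r ^ 2 = ρ + 4 * sin φ ^ 2 := sq_sqrt (by positivity)
  have hr0 : 0 < r := by positivity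
  have hrs : 2 * sin φ ≤ r := by
    refine le_sqrt_of_sq_le ?_
    nlinarith
  have : ringM φ / r - ringM φ / (2 * sin φ) = -(ringM φ * (r - 2 * sin φ) / (r * (2 * sin φ))) := by
    field_simp; ring
  rw [this, abs_neg, abs_div, abs_mul, abs_of_nonneg (sub_nonneg.2 hrs),
    abs_of_pos (by positivity : 0 < r * (2 * sin φ)), div_le_iff₀ (by positivity)]
  have h5 : r - 2 * sin φ = ρ / (r + 2 * sin φ) := by
    field_simp; linarith
  calc |ringM φ| * (r - 2 * sin φ) ≤ 2 * sin φ ^ 2 * (r - 2 * sin φ) := by gcongr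
    _ ≤ 2 * sin φ ^ 2 * (ρ / (2 * sin φ + 2 * sin φ)) := by rw [h5]; gcongr
    _ = ρ / 4 * (1 / r) * (r * (2 * sin φ)) := by field_simp; norm_num

lemma abs_log_aux {ρ : ℝ} (hρ : 0 < ρ) : |1 / 2 * log (2 + √(4 + ρ)) - 1 / 2 * log 4| ≤ ρ := by
  have h1 : 2 ≤ √(4 + ρ) := by
    refine le_sqrt_of_sq_le ?_
    linarith
  have h2 : √(4 + ρ) ≤ 2 + ρ := by
    rw [sqrt_le_left (by linarith)]; nlinarith
  have h3 : log 4 ≤ log (2 + √(4 + ρ)) := log_le_log (by norm_num) (by linarith)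
  have h4 : log (2 + √(4 + ρ)) - log 4 ≤ ρ := by
    rw [← log_div (by positivity) (by norm_num)]
    refine (log_le_sub_one_of_pos (by positivity)).trans ?_
    linarith
  rw [abs_of_nonneg (by linarith)]
  linarith

lemma abs_ringR_le {ρ : ℝ} (h0 : 0 < ρ) (h1 : ρ ≤ 1) : |ringR ρ| ≤ 2 * ρ * (1 + |log ρ|) := by
  rw [ringR, abs_mul, abs_of_pos (by positivity), ← ringN_zero]
  have h2 := abs_ringN_sub_le h0
  have h3 := ringI_le h0 h1
  have h4 := abs_log_aux h0
  have h5 := abs_nonneg (log ρ)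
  have h6 := abs_add_le (1 / 2 * log (2 + √(4 + ρ)) - 1 / 2 * log 4) (ringN ρ - ringN 0)
  have h7 : ρ / 4 * ringI ρ ≤ ρ * (1 + |log ρ|) := by nlinarith
  have h8 : 1 / π ≤ 1 := by
    rw [div_le_one pi_pos]; linarith [pi_gt_three]
  calc 1 / π * _ ≤ 1 * _ := by gcongr
    _ ≤ _ := by nlinarith

lemma hasDerivAt_ringN {ρ : ℝ} (hρ : 0 < ρ) : HasDerivAt ringN
    (∫ φ in (0 : ℝ)..(π / 2), -ringM φ / (2 * (ρ + 4 * sin φ ^ 2) * √(ρ + 4 * sin φ ^ 2))) ρ := by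
  have hpos : ∀ x ∈ Metric.ball ρ (ρ / 2), ρ / 2 < x := fun x hx => by
    rw [Metric.mem_ball, dist_eq, abs_lt] at hx; linarith
  refine (intervalIntegral.hasDerivAt_integral_of_dominated_loc_of_deriv_le
    (F := fun ρ φ => ringM φ / √(ρ + 4 * sin φ ^ 2))
    (F' := fun ρ φ => -ringM φ / (2 * (ρ + 4 * sin φ ^ 2) * √(ρ + 4 * sin φ ^ 2)))
    (bound := fun _ => 2 / (2 * (ρ / 2) * √(ρ / 2)))
    (s := Metric.ball ρ (ρ / 2)) (Metric.ball_mem_nhds ρ (by positivity)) ?_ (intervalIntegrable_ringN hρ.le) ?_ ?_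
    intervalIntegrable_const ?_).2
  · refine Eventually.of_forall fun x => ?_
    exact (continuous_ringM.measurable.div (by fun_prop)).aestronglyMeasurable
  · exact (continuous_ringM.measurable.neg.div (by fun_prop)).aestronglyMeasurable
  · refine Eventually.of_forall fun φ hφ x hx => ?_
    rw [Set.uIoc_of_le (by positivity)] at hφ
    have hx' := hpos x hx
    have h1 := abs_ringM_le hφ.1.le hφ.2
    have h2 : |ringM φ| ≤ 2 := by nlinarith [sin_sq_le_one φ]
    have h3 : ρ / 2 ≤ x + 4 * sin φ ^ 2 := by nlinarith [sq_nonneg (sin φ)]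
    have h4 : 0 ≤ x + 4 * sin φ ^ 2 := by linarith
    rw [norm_eq_abs, abs_div, abs_neg,
      abs_of_nonneg (by positivity : 0 ≤ 2 * (x + 4 * sin φ ^ 2) * √(x + 4 * sin φ ^ 2))]
    gcongr
  · refine Eventually.of_forall fun φ hφ x hx => ?_
    have hx' := hpos x hx
    have hp : 0 < x + 4 * sin φ ^ 2 := by
      have := sq_nonneg (sin φ); linarith
    have h1 : HasDerivAt (fun x => x + 4 * sin φ ^ 2) 1 x := (hasDerivAt_id x).add_const _
    have h2 := (hasDerivAt_const x (ringM φ)).div (h1.sqrt hp.ne') (by positivity)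
    refine h2.congr_deriv ?_
    have := sq_sqrt hp.le
    have h5 : 0 < √(x + 4 * sin φ ^ 2) := by positivity
    rw [this]
    field_simp
    ring

lemma abs_deriv_ringN_le {ρ : ℝ} (hρ : 0 < ρ) :
    |∫ φ in (0 : ℝ)..(π / 2), -ringM φ / (2 * (ρ + 4 * sin φ ^ 2) * √(ρ + 4 * sin φ ^ 2))|
      ≤ 1 / 4 * ringI ρ := by
  rw [ringI, ← intervalIntegral.integral_const_mul, ← norm_eq_abs]
  refine intervalIntegral.norm_integral_le_of_norm_le (by positivity)
    (Eventually.of_forall fun φ hφ => ?_)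
    (((continuous_div_sqrt_sin hρ continuous_const).intervalIntegrable _ _).const_mul _)
  have hM := abs_ringM_le hφ.1.le hφ.2
  have hp : 0 < ρ + 4 * sin φ ^ 2 := by positivity
  have hq : 0 < √(ρ + 4 * sin φ ^ 2) := by positivity
  rw [norm_eq_abs, abs_div, abs_neg,
    abs_of_nonneg (by positivity : 0 ≤ 2 * (ρ + 4 * sin φ ^ 2) * √(ρ + 4 * sin φ ^ 2)),
    div_le_iff₀ (by positivity)]
  have : 1 / 4 * (1 / √(ρ + 4 * sin φ ^ 2)) * (2 * (ρ + 4 * sin φ ^ 2) * √(ρ + 4 * sin φ ^ 2))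
      = (ρ + 4 * sin φ ^ 2) / 2 := by field_simp; norm_num
  rw [this]
  linarith

lemma hasDerivAt_ringR {ρ : ℝ} (h0 : 0 < ρ) : HasDerivAt ringR (deriv ringR ρ) ρ := by
  have h1 : HasDerivAt (fun ρ : ℝ => 4 + ρ) 1 ρ := (hasDerivAt_id ρ).const_add _
  have h2 := ((h1.sqrt (by positivity)).const_add 2).log (by positivity)
  have h3 := (((h2.const_mul (1 / 2)).sub_const (1 / 2 * log 4)).add
    ((hasDerivAt_ringN h0).sub_const (1 / 2 * log 2 - 1))).const_mul (1 / π)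
  exact (DifferentiableAt.hasDerivAt (f := ringR) h3.differentiableAt)

lemma abs_deriv_ringR_le {ρ : ℝ} (h0 : 0 < ρ) (h1 : ρ ≤ 1) :
    |deriv ringR ρ| ≤ 2 * (1 + |log ρ|) := by
  have h1' : HasDerivAt (fun ρ : ℝ => 4 + ρ) 1 ρ := (hasDerivAt_id ρ).const_add _
  have h2 := ((h1'.sqrt (by positivity)).const_add 2).log (by positivity)
  have h3 := (((h2.const_mul (1 / 2)).sub_const (1 / 2 * log 4)).add
    ((hasDerivAt_ringN h0).sub_const (1 / 2 * log 2 - 1))).const_mul (1 / π)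
  have h4 : deriv ringR ρ = _ := HasDerivAt.deriv (f := ringR) h3
  rw [h4, abs_mul, abs_of_pos (by positivity)]
  have h5 := abs_deriv_ringN_le h0
  have h6 := ringI_le h0 h1
  have h7 := abs_nonneg (log ρ)
  have h8 : 1 / π ≤ 1 := by
    rw [div_le_one pi_pos]; linarith [pi_gt_three]
  have h9 : 1 ≤ √(4 + ρ) := by
    refine le_sqrt_of_sq_le ?_
    linarith
  have h10 : |1 / 2 * (1 / (2 * √(4 + ρ)) / (2 + √(4 + ρ)))| ≤ 1 := by
    rw [abs_of_nonneg (by positivity), div_div, ← mul_div_assoc, mul_one]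
    refine div_le_one_of_le₀ ?_ (by positivity)
    nlinarith
  refine (mul_le_mul h8 (abs_add_le _ _) (by positivity) zero_le_one).trans ?_
  linarith

lemma integral_radial (g : ℝ → ℝ) (y : ℂ) :
    ∫ z, g ‖y - z‖ = 2 * π * ∫ s in Set.Ioi (0 : ℝ), s * g s := by
  rw [integral_sub_left_eq_self (fun z : ℂ => g ‖z‖) volume y, integral_fun_norm_addHaar volume g]
  simp [Complex.finrank_real_complex, Measure.real]
  ring

lemma integrable_radial {g : ℝ → ℝ} (y : ℂ) (hg : IntegrableOn (fun s => s * g s) (Set.Ioi 0)) :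
    Integrable fun z : ℂ => g ‖y - z‖ := by
  have := (integrable_fun_norm_addHaar (volume : Measure ℂ) (f := g)).2
    (by simpa [Complex.finrank_real_complex] using hg)
  exact this.comp_sub_left y

/-- The truncated power `s ↦ s ^ (-a)` on `s < r`. -/
def truncPow (a r s : ℝ) : ℝ := (Set.Iio r).indicator (fun s => s ^ (-a)) s

lemma truncPow_eqOn (a r : ℝ) : Set.EqOn (fun s => s * truncPow a r s)
    ((Set.Ioo 0 r).indicator fun s => s ^ (1 - a)) (Set.Ioi 0) := by
  intro s hs
  have hs : 0 < s := hs
  by_cases h : s < r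
  · simp only [truncPow]
    rw [Set.indicator_of_mem (by exact h), Set.indicator_of_mem (by exact ⟨hs, h⟩),
      sub_eq_add_neg, rpow_add hs, rpow_one]
  · simp only [truncPow]
    rw [Set.indicator_of_notMem (by exact h), Set.indicator_of_notMem (by exact fun h' => h h'.2),
      mul_zero]

lemma integrable_truncPow {a r : ℝ} (ha : a < 2) (hr : 0 ≤ r) (y : ℂ) :
    Integrable fun z : ℂ => truncPow a r ‖y - z‖ := by
  refine integrable_radial y ?_
  rw [integrableOn_congr_fun (truncPow_eqOn a r) measurableSet_Ioi]
  refine Integrable.integrableOn ?_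
  rw [integrable_indicator_iff measurableSet_Ioo]
  have := (intervalIntegral.intervalIntegrable_rpow' (a := 0) (b := r) (r := 1 - a) (by linarith))
  rw [intervalIntegrable_iff_integrableOn_Ioo_of_le hr] at this
  exact this

lemma integral_truncPow {a r : ℝ} (ha : a < 2) (hr : 0 ≤ r) (y : ℂ) :
    ∫ z : ℂ, truncPow a r ‖y - z‖ = 2 * π / (2 - a) * r ^ (2 - a) := by
  rw [integral_radial, setIntegral_congr_fun measurableSet_Ioi (truncPow_eqOn a r),
    setIntegral_indicator measurableSet_Ioo, Set.inter_eq_right.2 Set.Ioo_subset_Ioi_self,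
    ← integral_Ioc_eq_integral_Ioo, ← intervalIntegral.integral_of_le hr,
    integral_rpow (Or.inl (by linarith))]
  rw [show 1 - a + 1 = 2 - a by ring, zero_rpow (by linarith)]
  have : 2 - a ≠ 0 := by linarith
  field_simp
  ring

lemma abs_mul_pow_le {a r c s : ℝ} (hr : 0 < r) (ha : 0 ≤ a) (hs : 0 ≤ s) (hc : |c| ≤ 1) :
    |c| * s ^ (-a) ≤ truncPow a r s + r ^ (-a) * |c| := by
  by_cases h : s < r
  · rw [truncPow, Set.indicator_of_mem (by exact h)]
    have : 0 ≤ s ^ (-a) := by positivity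
    have : 0 ≤ r ^ (-a) * |c| := by positivity
    nlinarith
  · rw [truncPow, Set.indicator_of_notMem (by exact h), zero_add, mul_comm]
    refine mul_le_mul_of_nonneg_right ?_ (abs_nonneg _)
    exact rpow_le_rpow_of_nonpos hr (not_lt.1 h) (neg_nonpos.2 ha)

lemma integrable_abs_mul_pow {f : ℂ → ℝ} (hf : Integrable f) (h1 : ∀ z, |f z| ≤ 1)
    {a : ℝ} (ha : 0 ≤ a) (ha2 : a < 2) (y : ℂ) :
    Integrable fun z => |f z| * ‖y - z‖ ^ (-a) := by
  refine Integrable.mono' ((integrable_truncPow ha2 zero_le_one y).add (hf.abs.const_mul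
    ((1 : ℝ) ^ (-a)))) ?_ (Eventually.of_forall fun z => ?_)
  · exact hf.aestronglyMeasurable.norm.mul
      (Measurable.aestronglyMeasurable (by fun_prop))
  · rw [norm_eq_abs, abs_of_nonneg (by positivity)]
    exact abs_mul_pow_le one_pos ha (norm_nonneg _) (h1 z)

lemma integral_abs_mul_pow_le {f : ℂ → ℝ} (hf : Integrable f) (h1 : ∀ z, |f z| ≤ 1)
    {a m : ℝ} (ha : 0 ≤ a) (ha2 : a < 2) (hm : 0 < m) (hfm : ∫ z, |f z| ≤ m) (y : ℂ) :
    ∫ z, |f z| * ‖y - z‖ ^ (-a) ≤ (2 * π / (2 - a) + 1) * m ^ (1 - a / 2) := by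
  set r := m ^ (1 / 2 : ℝ) with hr
  have hr0 : 0 < r := by positivity
  calc ∫ z, |f z| * ‖y - z‖ ^ (-a) ≤ ∫ z, (truncPow a r ‖y - z‖ + r ^ (-a) * |f z|) := by
        refine integral_mono (integrable_abs_mul_pow hf h1 ha ha2 y)
          ((integrable_truncPow ha2 hr0.le y).add (hf.abs.const_mul _)) fun z => ?_
        exact abs_mul_pow_le hr0 ha (norm_nonneg _) (h1 z)
    _ = 2 * π / (2 - a) * r ^ (2 - a) + r ^ (-a) * ∫ z, |f z| := by
        rw [integral_add (integrable_truncPow ha2 hr0.le y) (hf.abs.const_mul _),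
          integral_truncPow ha2 hr0.le, integral_const_mul]
    _ ≤ 2 * π / (2 - a) * r ^ (2 - a) + r ^ (-a) * m := by gcongr
    _ = _ := by
        rw [hr, ← rpow_mul hm.le, ← rpow_mul hm.le]
        rw [show 1 / 2 * (2 - a) = 1 - a / 2 by ring, show 1 / 2 * -a = -(a / 2) by ring]
        rw [sub_eq_add_neg 1 (a / 2), rpow_add hm, rpow_one]
        ring

/-- The real-linear form `v ↦ Re (g v)`. -/
def reMul (g : ℂ) : ℂ →L[ℝ] ℝ := Complex.reCLM.comp (ContinuousLinearMap.mul ℝ ℂ g)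

@[simp] lemma reMul_apply (g v : ℂ) : reMul g v = (g * v).re := rfl

lemma abs_reMul_le (g v : ℂ) : |reMul g v| ≤ ‖g‖ * ‖v‖ := by
  rw [reMul_apply, ← norm_mul]; exact Complex.abs_re_le_norm _

lemma norm_reMul_le (g : ℂ) : ‖reMul g‖ ≤ ‖g‖ :=
  ContinuousLinearMap.opNorm_le_bound _ (norm_nonneg _) fun v => abs_reMul_le g v

lemma neg_log_le_rpow {s : ℝ} (hs : 0 < s) : -log s ≤ s ^ (-(3 / 2) : ℝ) := by
  have h := log_le_sub_one_of_pos (rpow_pos_of_pos hs (-(3 / 2) : ℝ))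
  rw [log_rpow hs] at h
  have : 0 < s ^ (-(3 / 2) : ℝ) := by positivity
  by_cases h0 : 0 ≤ log s <;> linarith

lemma abs_log_one_add_sub_re_le {w : ℂ} (hw : w ≠ -1) (h0 : w ≠ 0) :
    |log ‖1 + w‖ - w.re| ≤ 4 * (‖w‖ ^ (3 / 2 : ℝ) * (1 + ‖1 + w‖ ^ (-(3 / 2) : ℝ))) := by
  have hn : 0 < ‖w‖ := norm_pos_iff.2 h0
  have hn1 : 0 < ‖1 + w‖ := norm_pos_iff.2 fun h => hw (by linear_combination h)
  have hp : 0 < ‖1 + w‖ ^ (-(3 / 2) : ℝ) := by positivity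
  have hq : 0 < ‖w‖ ^ (3 / 2 : ℝ) := by positivity
  by_cases h : ‖w‖ ≤ 1 / 2
  · have h1 := Complex.norm_log_one_add_sub_self_le (z := w) (by linarith)
    have h2 : log ‖1 + w‖ - w.re = (Complex.log (1 + w) - w).re := by
      rw [Complex.sub_re, Complex.log_re]
    have h3 : (1 - ‖w‖)⁻¹ ≤ 2 := by
      rw [inv_le_comm₀ (by linarith) (by norm_num)]; linarith
    have h4 : ‖w‖ ^ 2 ≤ ‖w‖ ^ (3 / 2 : ℝ) := by
      rw [← rpow_natCast]
      exact rpow_le_rpow_of_exponent_ge hn (by linarith) (by norm_num)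
    have h5 := Complex.abs_re_le_norm (Complex.log (1 + w) - w)
    rw [h2]
    have h6 : ‖w‖ ^ 2 * (1 - ‖w‖)⁻¹ ≤ ‖w‖ ^ 2 * 2 := by gcongr
    nlinarith
  · push Not at h
    have h1 : 1 / 4 ≤ ‖w‖ ^ (3 / 2 : ℝ) := by
      have h2 : (1 / 2 : ℝ) ^ (2 : ℝ) ≤ (1 / 2 : ℝ) ^ (3 / 2 : ℝ) :=
        rpow_le_rpow_of_exponent_ge (by norm_num) (by norm_num) (by norm_num)
      have h3 : (1 / 2 : ℝ) ^ (3 / 2 : ℝ) ≤ ‖w‖ ^ (3 / 2 : ℝ) := by gcongr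
      norm_num at h2
      linarith
    have h2 : ‖w‖ ≤ 2 * ‖w‖ ^ (3 / 2 : ℝ) := by
      have e : ‖w‖ ^ (3 / 2 : ℝ) = ‖w‖ * √‖w‖ := by
        rw [show (3 / 2 : ℝ) = 1 + 1 / 2 by norm_num, rpow_add hn, rpow_one, sqrt_eq_rpow]
      have : 1 / 2 ≤ √‖w‖ := by
        refine le_sqrt_of_sq_le ?_
        linarith
      rw [e]; nlinarith
    have h3 : log ‖1 + w‖ ≤ ‖w‖ := by
      refine (log_le_sub_one_of_pos hn1).trans ?_
      have := norm_add_le 1 w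
      rw [norm_one] at this; linarith
    have h4 := neg_log_le_rpow hn1
    have h5 := Complex.abs_re_le_norm w
    rw [abs_le] at h5
    rw [abs_le]
    constructor <;> nlinarith

lemma abs_log_sub_sub_re_le {Y h : ℂ} (hY : Y ≠ 0) (hYh : Y + h ≠ 0) :
    |log ‖Y + h‖ - log ‖Y‖ - (h / Y).re|
      ≤ 4 * ‖h‖ ^ (3 / 2 : ℝ) * (‖Y‖ ^ (-(3 / 2) : ℝ) + ‖Y + h‖ ^ (-(3 / 2) : ℝ)) := by
  rcases eq_or_ne h 0 with rfl | h0
  · simp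
  have hYn : 0 < ‖Y‖ := norm_pos_iff.2 hY
  have e1 : Y + h = Y * (1 + h / Y) := by field_simp
  have h1 : 1 + h / Y ≠ 0 := fun h' => hYh (by rw [e1, h', mul_zero])
  have h2 := abs_log_one_add_sub_re_le (w := h / Y) (fun h' => h1 (by rw [h']; ring))
    (div_ne_zero h0 hY)
  have h3 : log ‖Y + h‖ - log ‖Y‖ = log ‖1 + h / Y‖ := by
    rw [e1, norm_mul, log_mul hYn.ne' (norm_ne_zero_iff.2 h1)]; ring
  rw [h3]
  refine h2.trans (le_of_eq ?_)
  rw [e1, norm_mul, norm_div, div_rpow (norm_nonneg _) (norm_nonneg _),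
    mul_rpow (norm_nonneg _) (norm_nonneg _), rpow_neg hYn.le]
  field_simp

/-- Bounded measurable densities with bounded support. -/
structure IsDensity (f : ℂ → ℝ) (M R : ℝ) : Prop where
  measurable : Measurable f
  pos : 0 < M
  bound : ∀ z, |f z| ≤ M
  supp : ∀ z, R < ‖z‖ → f z = 0

/-- The logarithmic potential `∫ f(z) log |y - z| dz`. -/
def logPot (f : ℂ → ℝ) (y : ℂ) : ℝ := ∫ z, f z * log ‖y - z‖

/-- The Cauchy transform `∫ f(z) / (y - z) dz`. -/
def cauPot (f : ℂ → ℝ) (y : ℂ) : ℂ := ∫ z, (f z : ℂ) * (y - z)⁻¹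

variable {f : ℂ → ℝ} {M R : ℝ}

lemma IsDensity.integrable (hf : IsDensity f M R) : Integrable f := by
  rw [← integrableOn_iff_integrable_of_support_subset (s := Metric.closedBall (0 : ℂ) R)]
  · exact Measure.integrableOn_of_bounded (M := M) measure_closedBall_lt_top.ne
      hf.measurable.aestronglyMeasurable (Eventually.of_forall hf.bound)
  · intro z hz
    by_contra h
    exact hz (hf.supp z (by simpa using h))

lemma IsDensity.integrable_pow (hf : IsDensity f M R) {a : ℝ} (ha : 0 ≤ a) (ha2 : a < 2) (y : ℂ) :
    Integrable fun z => |f z| * ‖y - z‖ ^ (-a) := by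
  have h := integrable_abs_mul_pow (f := fun z => f z / M) (hf.integrable.div_const M)
    (fun z => by rw [abs_div, abs_of_pos hf.pos, div_le_one hf.pos]; exact hf.bound z) ha ha2 y
  refine (h.const_mul M).congr (Eventually.of_forall fun z => ?_)
  have := hf.pos
  simp only [abs_div, abs_of_pos hf.pos]
  field_simp

lemma IsDensity.exists_pow_le (hf : IsDensity f M R) {a : ℝ} (ha : 0 ≤ a) (ha2 : a < 2) :
    ∃ C, 0 < C ∧ ∀ y, ∫ z, |f z| * ‖y - z‖ ^ (-a) ≤ C := by
  have hM := hf.pos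
  set m := (∫ z, |f z / M|) + 1 with hm
  have hm0 : 0 < m := by
    have : 0 ≤ ∫ z, |f z / M| := integral_nonneg fun _ => abs_nonneg _
    linarith
  have h2 : 0 < 2 - a := by linarith
  refine ⟨M * ((2 * π / (2 - a) + 1) * m ^ (1 - a / 2)), by positivity, fun y => ?_⟩
  have h := integral_abs_mul_pow_le (f := fun z => f z / M) (hf.integrable.div_const M)
    (fun z => by rw [abs_div, abs_of_pos hf.pos, div_le_one hf.pos]; exact hf.bound z) ha ha2 hm0
    (by linarith) y
  have e : ∫ z, |f z| * ‖y - z‖ ^ (-a) = M * ∫ z, |f z / M| * ‖y - z‖ ^ (-a) := by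
    rw [← integral_const_mul]
    congr 1 with z
    simp only [abs_div, abs_of_pos hf.pos]
    field_simp
  rw [e]
  gcongr

lemma abs_log_le_rpow {s : ℝ} (hs : 0 ≤ s) : |log s| ≤ s ^ (-(3 / 2) : ℝ) + s := by
  rcases hs.eq_or_lt with rfl | hs
  · simp
  have h1 := neg_log_le_rpow hs
  have h2 := log_le_sub_one_of_pos hs
  have : 0 < s ^ (-(3 / 2) : ℝ) := by positivity
  rw [abs_le]; constructor <;> linarith

lemma IsDensity.integrable_log (hf : IsDensity f M R) (y : ℂ) :
    Integrable fun z => f z * log ‖y - z‖ := by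
  refine Integrable.mono' ((hf.integrable_pow (a := 3 / 2) (by norm_num) (by norm_num) y).add
    (hf.integrable.abs.mul_const (‖y‖ + R))) ?_ (Eventually.of_forall fun z => ?_)
  · exact (hf.measurable.mul (by fun_prop)).aestronglyMeasurable
  · rw [norm_mul, norm_eq_abs, norm_eq_abs]
    by_cases h : R < ‖z‖
    · simp [hf.supp z h]
    · have h1 := abs_log_le_rpow (norm_nonneg (y - z))
      have h2 := norm_sub_le y z
      have := abs_nonneg (f z)
      simp only [Pi.add_apply]
      nlinarith

lemma IsDensity.integrable_inv (hf : IsDensity f M R) (y : ℂ) :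
    Integrable fun z => (f z : ℂ) * (y - z)⁻¹ := by
  refine Integrable.mono' (hf.integrable_pow (a := 1) (by norm_num) (by norm_num) y) ?_
    (Eventually.of_forall fun z => ?_)
  · exact (Measurable.mul (by have := hf.measurable; fun_prop) (by fun_prop)).aestronglyMeasurable
  · rw [norm_mul, norm_inv, Complex.norm_real, norm_eq_abs, rpow_neg_one]

lemma cauPot_mul_re (hf : IsDensity f M R) (y h : ℂ) :
    (cauPot f y * h).re = ∫ z, f z * (h / (y - z)).re := by
  rw [cauPot, ← integral_mul_const, ← RCLike.re_eq_complex_re,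
    ← integral_re ((hf.integrable_inv y).mul_const h)]
  congr 1 with z
  rw [RCLike.re_eq_complex_re, mul_assoc, Complex.re_ofReal_mul, div_eq_mul_inv, mul_comm h]

lemma exists_logPot_remainder (hf : IsDensity f M R) : ∃ C, 0 < C ∧ ∀ y h,
    |logPot f (y + h) - logPot f y - (cauPot f y * h).re| ≤ C * ‖h‖ ^ (3 / 2 : ℝ) := by
  obtain ⟨C, hC, hb⟩ := hf.exists_pow_le (a := 3 / 2) (by norm_num) (by norm_num)
  refine ⟨8 * C, by positivity, fun y h => ?_⟩
  have i1 := hf.integrable_log (y + h)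
  have i2 := hf.integrable_log y
  have i3 : Integrable fun z => f z * (h / (y - z)).re := by
    refine ((hf.integrable_inv y).mul_const h).re.congr (Eventually.of_forall fun z => ?_)
    simp only [RCLike.re_eq_complex_re, mul_assoc, Complex.re_ofReal_mul, div_eq_mul_inv,
      mul_comm h]
  have j1 := hf.integrable_pow (a := 3 / 2) (by norm_num) (by norm_num) y
  have j2 := hf.integrable_pow (a := 3 / 2) (by norm_num) (by norm_num) (y + h)
  rw [cauPot_mul_re hf, logPot, logPot, ← integral_sub i1 i2, ← integral_sub (by exact i1.sub i2) i3,
    ← norm_eq_abs]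
  calc _ ≤ ∫ z, 4 * ‖h‖ ^ (3 / 2 : ℝ) * (|f z| * ‖y - z‖ ^ (-(3 / 2) : ℝ)
        + |f z| * ‖y + h - z‖ ^ (-(3 / 2) : ℝ)) := by
        refine norm_integral_le_of_norm_le ((j1.add j2).const_mul _) ?_
        have hn : ∀ᵐ z : ℂ, z ≠ y ∧ z ≠ y + h := by
          have h1 := Measure.ae_ne (volume : Measure ℂ) y
          have h2 := Measure.ae_ne (volume : Measure ℂ) (y + h)
          exact h1.and h2
        filter_upwards [hn] with z hz
        have := abs_log_sub_sub_re_le (Y := y - z) (h := h) (sub_ne_zero.2 hz.1.symm)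
          (by rw [show y - z + h = y + h - z by ring]; exact sub_ne_zero.2 hz.2.symm)
        rw [show y - z + h = y + h - z by ring] at this
        rw [show f z * log ‖y + h - z‖ - f z * log ‖y - z‖ - f z * (h / (y - z)).re
          = f z * (log ‖y + h - z‖ - log ‖y - z‖ - (h / (y - z)).re) by ring, norm_mul,
          norm_eq_abs, norm_eq_abs]
        exact (mul_le_mul_of_nonneg_left this (abs_nonneg _)).trans_eq (by ring)
    _ = 4 * ‖h‖ ^ (3 / 2 : ℝ) * ((∫ z, |f z| * ‖y - z‖ ^ (-(3 / 2) : ℝ))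
        + ∫ z, |f z| * ‖y + h - z‖ ^ (-(3 / 2) : ℝ)) := by
        rw [integral_const_mul, integral_add j1 j2]
    _ ≤ 4 * ‖h‖ ^ (3 / 2 : ℝ) * (C + C) := by gcongr <;> exact hb _
    _ = _ := by ring

lemma hasFDerivAt_of_remainder {u : ℂ → ℝ} {L : ℂ →L[ℝ] ℝ} {y : ℂ} {C : ℝ}
    (h : ∀ᶠ h in 𝓝 0, |u (y + h) - u y - L h| ≤ C * ‖h‖ ^ (3 / 2 : ℝ)) : HasFDerivAt u L y := by
  rw [hasFDerivAt_iff_isLittleO_nhds_zero, Asymptotics.isLittleO_iff]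
  intro c hc
  have ht : Tendsto (fun h : ℂ => C * √‖h‖) (𝓝 0) (𝓝 0) := by
    have : Continuous fun h : ℂ => C * √‖h‖ := by fun_prop
    simpa using this.tendsto 0
  filter_upwards [ht.eventually_le_const hc, h] with v hv h
  refine h.trans ?_
  rcases (norm_nonneg v).eq_or_lt with h0 | h0
  · rw [← h0]; simp
  · rw [show (3 / 2 : ℝ) = 1 / 2 + 1 by norm_num, rpow_add h0, rpow_one, ← sqrt_eq_rpow,
      ← mul_assoc]
    gcongr

lemma hasFDerivAt_logPot (hf : IsDensity f M R) (y : ℂ) :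
    HasFDerivAt (logPot f) (reMul (cauPot f y)) y := by
  obtain ⟨C, hC, h⟩ := exists_logPot_remainder hf
  exact hasFDerivAt_of_remainder (Eventually.of_forall (h y))

lemma continuous_logPot (hf : IsDensity f M R) : Continuous (logPot f) :=
  continuous_iff_continuousAt.2 fun y => (hasFDerivAt_logPot hf y).continuousAt

lemma norm_inv_sub_inv_le (Y Z : ℂ) : ‖Y⁻¹ - Z⁻¹‖
    ≤ 2 * ‖Y - Z‖ ^ (1 / 2 : ℝ) * (‖Y‖ ^ (-(3 / 2) : ℝ) + ‖Z‖ ^ (-(3 / 2) : ℝ)) := by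
  have key : ∀ Z : ℂ, ‖Z‖⁻¹ ≤ 2 * ‖Z‖ ^ (1 / 2 : ℝ) * ‖Z‖ ^ (-(3 / 2) : ℝ) := fun Z => by
    rcases (norm_nonneg Z).eq_or_lt with h | h
    · rw [← h]; simp
    · rw [mul_assoc, ← rpow_add h, ← rpow_neg_one]
      norm_num
      linarith [rpow_pos_of_pos h (-1)]
  have h0 : (0 : ℝ) ^ (-(3 / 2) : ℝ) = 0 := zero_rpow (by norm_num)
  rcases eq_or_ne Y 0 with rfl | hY
  · simpa [h0] using key Z
  rcases eq_or_ne Z 0 with rfl | hZ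
  · simpa [h0] using key Y
  have hy : 0 < ‖Y‖ := norm_pos_iff.2 hY
  have hz : 0 < ‖Z‖ := norm_pos_iff.2 hZ
  have e : Y⁻¹ - Z⁻¹ = -((Y - Z) / (Y * Z)) := by field_simp; ring
  rw [e, norm_neg, norm_div, norm_mul]
  set d := ‖Y - Z‖ ^ (1 / 2 : ℝ) with hd
  have hd2 : ‖Y - Z‖ = d * d := by
    rw [hd, ← sqrt_eq_rpow, mul_self_sqrt (norm_nonneg _)]
  have hd0 : 0 ≤ d := by positivity
  set a := ‖Y‖ ^ (1 / 2 : ℝ) with ha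
  set b := ‖Z‖ ^ (1 / 2 : ℝ) with hb
  have ha0 : 0 < a := by positivity
  have hb0 : 0 < b := by positivity
  have ha2 : ‖Y‖ = a * a := by rw [ha, ← sqrt_eq_rpow, mul_self_sqrt (norm_nonneg _)]
  have hb2 : ‖Z‖ = b * b := by rw [hb, ← sqrt_eq_rpow, mul_self_sqrt (norm_nonneg _)]
  have ha3 : ‖Y‖ ^ (-(3 / 2) : ℝ) = 1 / a ^ 3 := by
    rw [ha, one_div, ← rpow_natCast, ← rpow_mul hy.le, ← rpow_neg hy.le]; norm_num
  have hb3 : ‖Z‖ ^ (-(3 / 2) : ℝ) = 1 / b ^ 3 := by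
    rw [hb, one_div, ← rpow_natCast, ← rpow_mul hz.le, ← rpow_neg hz.le]; norm_num
  have htri : d * d ≤ a * a + b * b := by
    rw [← hd2, ← ha2, ← hb2]; exact norm_sub_le _ _
  have hdab : d ≤ a + b := by nlinarith [mul_pos ha0 hb0]
  rw [ha3, hb3, hd2, ha2, hb2, div_add_div _ _ (by positivity) (by positivity), ← mul_div_assoc,
    div_le_div_iff₀ (by positivity) (by positivity)]
  have h1 : (a + b) * (a * b) ≤ 2 * (a ^ 3 + b ^ 3) := by
    nlinarith [mul_nonneg (add_pos ha0 hb0).le (sq_nonneg (a - b)), pow_pos ha0 3, pow_pos hb0 3]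
  calc d * d * (a ^ 3 * b ^ 3) ≤ d * (a + b) * (a ^ 3 * b ^ 3) := by gcongr
    _ = d * ((a + b) * (a * b)) * (a * b) ^ 2 := by ring
    _ ≤ d * (2 * (a ^ 3 + b ^ 3)) * (a * b) ^ 2 := by gcongr
    _ = _ := by ring

lemma exists_cauPot_holder (hf : IsDensity f M R) : ∃ C, 0 < C ∧ ∀ y y',
    ‖cauPot f y - cauPot f y'‖ ≤ C * ‖y - y'‖ ^ (1 / 2 : ℝ) := by
  obtain ⟨C, hC, hb⟩ := hf.exists_pow_le (a := 3 / 2) (by norm_num) (by norm_num)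
  refine ⟨4 * C, by positivity, fun y y' => ?_⟩
  have j1 := hf.integrable_pow (a := 3 / 2) (by norm_num) (by norm_num) y
  have j2 := hf.integrable_pow (a := 3 / 2) (by norm_num) (by norm_num) y'
  rw [cauPot, cauPot, ← integral_sub (hf.integrable_inv y) (hf.integrable_inv y')]
  calc _ ≤ ∫ z, 2 * ‖y - y'‖ ^ (1 / 2 : ℝ) * (|f z| * ‖y - z‖ ^ (-(3 / 2) : ℝ)
        + |f z| * ‖y' - z‖ ^ (-(3 / 2) : ℝ)) := by
        refine norm_integral_le_of_norm_le ((j1.add j2).const_mul _)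
          (Eventually.of_forall fun z => ?_)
        rw [← mul_sub, norm_mul, Complex.norm_real, norm_eq_abs]
        have := norm_inv_sub_inv_le (y - z) (y' - z)
        rw [sub_sub_sub_cancel_right] at this
        exact (mul_le_mul_of_nonneg_left this (abs_nonneg _)).trans_eq (by ring)
    _ = 2 * ‖y - y'‖ ^ (1 / 2 : ℝ) * ((∫ z, |f z| * ‖y - z‖ ^ (-(3 / 2) : ℝ))
        + ∫ z, |f z| * ‖y' - z‖ ^ (-(3 / 2) : ℝ)) := by
        rw [integral_const_mul, integral_add j1 j2]
    _ ≤ 2 * ‖y - y'‖ ^ (1 / 2 : ℝ) * (C + C) := by gcongr <;> exact hb _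
    _ = _ := by ring

lemma continuous_cauPot (hf : IsDensity f M R) : Continuous (cauPot f) := by
  obtain ⟨C, hC, h⟩ := exists_cauPot_holder hf
  rw [continuous_iff_continuousAt]
  intro y
  rw [ContinuousAt, tendsto_iff_norm_sub_tendsto_zero]
  have ht : Tendsto (fun x : ℂ => C * ‖x - y‖ ^ (1 / 2 : ℝ)) (𝓝 y) (𝓝 0) := by
    have : Continuous fun x : ℂ => C * √‖x - y‖ := by fun_prop
    simpa [sqrt_eq_rpow] using this.tendsto y
  exact squeeze_zero (fun _ => norm_nonneg _) (fun x => h x y) ht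

section Polar

variable {E : Type*} [NormedAddCommGroup E] [NormedSpace ℝ E]

lemma polarCoord_symm_eq_circleMap (p : ℝ × ℝ) :
    Complex.polarCoord.symm p = circleMap 0 p.1 p.2 := by
  rw [Complex.polarCoord_symm_apply, circleMap_zero, Complex.exp_mul_I]; simp

lemma integrableOn_polar {f : ℂ → E} (hm : StronglyMeasurable f) (hf : Integrable f) :
    Integrable (fun p : ℝ × ℝ => p.1 • f (circleMap 0 p.1 p.2))
      ((volume.restrict (Set.Ioi 0)).prod (volume.restrict (Set.Ioo (-π) π))) := by
  rw [Measure.prod_restrict]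
  have hcm : Continuous fun p : ℝ × ℝ => circleMap 0 p.1 p.2 := by
    simp only [circleMap]; fun_prop
  refine ⟨?_, ?_⟩
  · exact (measurable_fst.stronglyMeasurable.smul
      (hm.comp_measurable hcm.measurable)).aestronglyMeasurable
  · have h1 := Complex.lintegral_comp_polarCoord_symm (fun z => ‖f z‖ₑ)
    rw [HasFiniteIntegral]
    refine lt_of_eq_of_lt ?_ hf.hasFiniteIntegral
    rw [← h1]
    refine setLIntegral_congr_fun (measurableSet_Ioi.prod measurableSet_Ioo) fun p hp => ?_
    rw [enorm_smul, polarCoord_symm_eq_circleMap, smul_eq_mul]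
    congr 1
    rw [Real.enorm_eq_ofReal (le_of_lt hp.1)]

lemma integral_polar {f : ℂ → E} (hm : StronglyMeasurable f) (hf : Integrable f) :
    ∫ z, f z = ∫ s in Set.Ioi (0 : ℝ), ∫ θ in Set.Ioo (-π) π, s • f (circleMap 0 s θ) := by
  rw [← Complex.integral_comp_polarCoord_symm]
  simp only [polarCoord_symm_eq_circleMap]
  rw [← integral_prod _ (integrableOn_polar hm hf), Measure.prod_restrict]
  rfl

lemma integral_polar' {f : ℂ → E} (hm : StronglyMeasurable f) (hf : Integrable f) :
    ∫ z, f z = ∫ θ in Set.Ioo (-π) π, ∫ s in Set.Ioi (0 : ℝ), s • f (circleMap 0 s θ) := by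
  rw [← Complex.integral_comp_polarCoord_symm]
  simp only [polarCoord_symm_eq_circleMap]
  rw [← integral_prod_symm _ (integrableOn_polar hm hf), Measure.prod_restrict]
  rfl

lemma integral_Ioo_circleMap (f : ℂ → E) (c : ℂ) (s : ℝ) :
    ∫ θ in Set.Ioo (-π) π, f (circleMap c s θ) = (2 * π) • circleAverage f c s := by
  rw [← integral_Ioc_eq_integral_Ioo, ← intervalIntegral.integral_of_le (by linarith [pi_pos]),
    circleAverage_eq_integral_add (-π), smul_smul, mul_inv_cancel₀ (by positivity), one_smul]
  rw [intervalIntegral.integral_comp_add_right (fun θ => f (circleMap c s θ))]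
  congr 1 <;> ring

lemma integral_ball_eq_circleAverage {f : ℂ → E} (hm : StronglyMeasurable f) {c : ℂ} {r : ℝ}
    (hf : IntegrableOn f (Metric.ball c r)) :
    ∫ z in Metric.ball c r, f z = ∫ s in Set.Ioo 0 r, (2 * π * s) • circleAverage f c s := by
  have hg : Integrable ((Metric.ball c r).indicator f) := by
    rwa [integrable_indicator_iff Metric.isOpen_ball.measurableSet]
  have hgm : StronglyMeasurable ((Metric.ball c r).indicator f) :=
    hm.indicator Metric.isOpen_ball.measurableSet
  have h1 := integral_polar (f := fun z => (Metric.ball c r).indicator f (c + z))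
    (hgm.comp_measurable (by fun_prop)) (hg.comp_add_left c)
  rw [integral_add_left_eq_self (fun z => (Metric.ball c r).indicator f z) c,
    integral_indicator Metric.isOpen_ball.measurableSet] at h1
  rw [h1, show Set.Ioo 0 r = Set.Ioi 0 ∩ Set.Iio r from Set.Ioi_inter_Iio.symm,
    ← setIntegral_indicator measurableSet_Iio]
  refine setIntegral_congr_fun measurableSet_Ioi fun s hs => ?_
  have hs : 0 < s := hs
  have hmem : ∀ θ, c + circleMap 0 s θ ∈ Metric.ball c r ↔ s < r := fun θ => by
    rw [Metric.mem_ball, dist_eq_norm, add_sub_cancel_left, norm_circleMap_zero, abs_of_pos hs]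
  have hcm : ∀ θ, c + circleMap 0 s θ = circleMap c s θ := fun θ => by simp [circleMap]
  by_cases h : s < r
  · rw [Set.indicator_of_mem (by exact h)]
    rw [integral_smul, mul_comm (2 * π) s, mul_smul, ← integral_Ioo_circleMap]
    congr 1
    refine integral_congr_ae (Eventually.of_forall fun θ => ?_)
    simp only
    rw [Set.indicator_of_mem ((hmem θ).2 h), hcm]
  · rw [Set.indicator_of_notMem (by exact h)]
    refine integral_eq_zero_of_ae (Eventually.of_forall fun θ => ?_)
    simp only
    rw [Set.indicator_of_notMem (fun h' => h ((hmem θ).1 h')), smul_zero, Pi.zero_apply]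

end Polar

/-- The indicator function of a set, real valued. -/
def ind (B : Set ℂ) : ℂ → ℝ := B.indicator fun _ => 1

lemma isDensity_ind {B : Set ℂ} (hB : MeasurableSet B) {R : ℝ} (h : ∀ z ∈ B, ‖z‖ ≤ R) :
    IsDensity (ind B) 1 R where
  measurable := measurable_const.indicator hB
  pos := one_pos
  bound z := by by_cases hz : z ∈ B <;> simp [ind, hz]
  supp z hz := Set.indicator_of_notMem (fun hz' => absurd (h z hz') (not_le.2 hz)) _

lemma logPot_ind {B : Set ℂ} (hB : MeasurableSet B) (y : ℂ) :
    logPot (ind B) y = ∫ z in B, log ‖y - z‖ := by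
  rw [logPot, ← integral_indicator hB]
  congr 1 with z
  by_cases hz : z ∈ B <;> simp [ind, hz]

lemma cauPot_ind {B : Set ℂ} (hB : MeasurableSet B) (y : ℂ) :
    cauPot (ind B) y = ∫ z in B, (y - z)⁻¹ := by
  rw [cauPot, ← integral_indicator hB]
  congr 1 with z
  by_cases hz : z ∈ B <;> simp [ind, hz]

lemma isDensity_ball (c : ℂ) (r : ℝ) : IsDensity (ind (Metric.ball c r)) 1 (‖c‖ + r) :=
  isDensity_ind Metric.isOpen_ball.measurableSet fun z hz => by
    rw [Metric.mem_ball, dist_eq_norm] at hz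
    have := norm_add_le c (z - c)
    rw [add_sub_cancel] at this
    linarith

lemma integral_mul_log {d r : ℝ} (hd : 0 ≤ d) (hdr : d ≤ r) :
    ∫ s in d..r, s * log s = r ^ 2 * log r / 2 - r ^ 2 / 4 - (d ^ 2 * log d / 2 - d ^ 2 / 4) := by
  have hc : Continuous fun s : ℝ => s ^ 2 * log s / 2 - s ^ 2 / 4 := by
    have : Continuous fun s : ℝ => s * (s * log s) / 2 - s ^ 2 / 4 := by
      have := continuous_mul_log
      fun_prop
    refine this.congr fun s => by ring
  refine intervalIntegral.integral_eq_sub_of_hasDerivAt_of_le hdr hc.continuousOn (fun s hs => ?_)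
    (continuous_mul_log.intervalIntegrable _ _)
  have hs0 : 0 < s := hd.trans_lt hs.1
  have h := (((hasDerivAt_pow 2 s).mul (hasDerivAt_log hs0.ne')).div_const 2).sub
    ((hasDerivAt_pow 2 s).div_const 4)
  refine h.congr_deriv ?_
  norm_num
  field_simp
  ring

lemma logPot_ball (c y : ℂ) (r : ℝ) : logPot (ind (Metric.ball c r)) y
    = ∫ s in Set.Ioo 0 r, 2 * π * s * (log s + log⁺ (s⁻¹ * ‖c - y‖)) := by
  have hi := (isDensity_ball c r).integrable_log y
  have hi2 : IntegrableOn (fun z => log ‖z - y‖) (Metric.ball c r) := by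
    rw [← integrable_indicator_iff Metric.isOpen_ball.measurableSet]
    refine hi.congr (Eventually.of_forall fun z => ?_)
    by_cases hz : z ∈ Metric.ball c r <;> simp only [ind, Set.indicator_of_mem,
      Set.indicator_of_notMem, hz, norm_sub_rev, not_false_eq_true, one_mul, zero_mul]
  rw [logPot_ind Metric.isOpen_ball.measurableSet]
  simp only [norm_sub_rev y]
  rw [integral_ball_eq_circleAverage (by
    refine Measurable.stronglyMeasurable ?_
    fun_prop) hi2]
  refine setIntegral_congr_fun measurableSet_Ioo fun s hs => ?_
  simp only [smul_eq_mul]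
  rw [circleAverage_log_norm_sub_const_eq_log_radius_add_posLog hs.1.ne']

lemma logPot_ball_outside {c y : ℂ} {r : ℝ} (hr : 0 ≤ r) (h : r ≤ ‖y - c‖) :
    logPot (ind (Metric.ball c r)) y = π * r ^ 2 * log ‖y - c‖ := by
  rw [logPot_ball, norm_sub_rev c y]
  have : ∀ s ∈ Set.Ioo 0 r, 2 * π * s * (log s + log⁺ (s⁻¹ * ‖y - c‖))
      = s * (2 * π * log ‖y - c‖) := fun s hs => by
    have hd : s < ‖y - c‖ := hs.2.trans_le h
    have hs0 := hs.1
    rw [posLog_eq_log, log_mul (by positivity) (by linarith), log_inv]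
    · ring
    · rw [abs_of_nonneg (by positivity), ← div_eq_inv_mul, le_div_iff₀ hs0]; linarith
  rw [setIntegral_congr_fun measurableSet_Ioo this, ← integral_Ioc_eq_integral_Ioo,
    ← intervalIntegral.integral_of_le hr, intervalIntegral.integral_mul_const, integral_id]
  ring

lemma logPot_ball_inside {c y : ℂ} {r : ℝ} (h : ‖y - c‖ ≤ r) :
    logPot (ind (Metric.ball c r)) y
      = π * r ^ 2 * log r - π / 2 * (r ^ 2 - ‖y - c‖ ^ 2) := by
  set d := ‖y - c‖ with hd
  have hd0 : 0 ≤ d := norm_nonneg _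
  rw [logPot_ball, norm_sub_rev c y, ← hd, ← integral_Ioc_eq_integral_Ioo,
    ← intervalIntegral.integral_of_le (hd0.trans h)]
  have e1 : Set.EqOn (fun s => 2 * π * s * (log s + log⁺ (s⁻¹ * d)))
      (fun s => s * (2 * π * log d)) (Set.uIoc 0 d) := fun s hs => by
    rw [Set.uIoc_of_le hd0] at hs
    have hs0 := hs.1
    simp only
    rw [posLog_eq_log, log_mul (by positivity) (by linarith [hs.2]), log_inv]
    · ring
    · rw [abs_of_nonneg (by positivity), ← div_eq_inv_mul, le_div_iff₀ hs0]; linarith [hs.2]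
  have e2 : Set.EqOn (fun s => 2 * π * s * (log s + log⁺ (s⁻¹ * d)))
      (fun s => 2 * π * (s * log s)) (Set.uIoc d r) := fun s hs => by
    rw [Set.uIoc_of_le h] at hs
    have hs0 := hd0.trans_lt hs.1
    simp only
    rw [(posLog_eq_zero_iff _).2]
    · ring
    · rw [abs_of_nonneg (by positivity), ← div_eq_inv_mul, div_le_one hs0]; exact hs.1.le
  have c2 : Continuous fun s => 2 * π * (s * log s) := continuous_const.mul continuous_mul_log
  have i1 : IntervalIntegrable (fun s => 2 * π * s * (log s + log⁺ (s⁻¹ * d))) volume 0 d :=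
    (Continuous.intervalIntegrable (by fun_prop) _ _).congr e1.symm
  have i2 : IntervalIntegrable (fun s => 2 * π * s * (log s + log⁺ (s⁻¹ * d))) volume d r :=
    (c2.intervalIntegrable _ _).congr e2.symm
  rw [← intervalIntegral.integral_add_adjacent_intervals i1 i2,
    intervalIntegral.integral_congr_ae (Eventually.of_forall e1),
    intervalIntegral.integral_congr_ae (Eventually.of_forall e2),
    intervalIntegral.integral_mul_const, integral_id, intervalIntegral.integral_const_mul,
    integral_mul_log hd0 h]
  ring

lemma reMul_injective : Function.Injective reMul := fun g g' h => by
  have h1 := DFunLike.congr_fun h 1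
  have h2 := DFunLike.congr_fun h Complex.I
  simp at h1 h2
  exact Complex.ext h1 h2

lemma hasFDerivAt_normSq_sub (c y : ℂ) :
    HasFDerivAt (fun y => ‖y - c‖ ^ 2) (reMul (2 * (starRingEnd ℂ) (y - c))) y := by
  have h := ((hasFDerivAt_id (𝕜 := ℝ) y).sub_const c).norm_sq
  refine h.congr_fderiv ?_
  ext v
  simp [Complex.inner, mul_assoc]
  try ring

lemma hasFDerivAt_log_norm_sub {c y : ℂ} (h : y ≠ c) :
    HasFDerivAt (fun y => log ‖y - c‖) (reMul (y - c)⁻¹) y := by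
  have hn : ‖y - c‖ ^ 2 ≠ 0 := by simpa using sub_ne_zero.2 h
  have h1 := ((hasFDerivAt_normSq_sub c y).log hn).const_mul (1 / 2 : ℝ)
  have e : (fun y => log ‖y - c‖) = fun y => 1 / 2 * log (‖y - c‖ ^ 2) := by
    ext y; rw [log_pow]; ring
  rw [e]
  refine h1.congr_fderiv ?_
  ext v
  rw [Complex.inv_def, Complex.normSq_eq_norm_sq]
  simp only [reMul_apply, smul_apply, smul_eq_mul]
  rw [show 2 * (starRingEnd ℂ) (y - c) * v = ((2 : ℝ) : ℂ) * ((starRingEnd ℂ) (y - c) * v) by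
    push_cast; ring, show (starRingEnd ℂ) (y - c) * (((‖y - c‖ ^ 2)⁻¹ : ℝ) : ℂ) * v
    = (((‖y - c‖ ^ 2)⁻¹ : ℝ) : ℂ) * ((starRingEnd ℂ) (y - c) * v) by ring,
    Complex.re_ofReal_mul, Complex.re_ofReal_mul]
  ring

lemma cauPot_ball_inside {c y : ℂ} {r : ℝ} (h : ‖y - c‖ < r) :
    cauPot (ind (Metric.ball c r)) y = π * (starRingEnd ℂ) (y - c) := by
  have h1 := hasFDerivAt_logPot (isDensity_ball c r) y
  have h2 : HasFDerivAt (logPot (ind (Metric.ball c r)))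
      (reMul (π * (starRingEnd ℂ) (y - c))) y := by
    have h3 := ((hasFDerivAt_normSq_sub c y).const_mul (π / 2)).const_add
      (π * r ^ 2 * log r - π / 2 * r ^ 2)
    refine (h3.congr_fderiv ?_).congr_of_eventuallyEq ?_
    · ext v
      simp only [reMul_apply, smul_apply, smul_eq_mul]
      rw [show 2 * (starRingEnd ℂ) (y - c) * v = ((2 : ℝ) : ℂ) * ((starRingEnd ℂ) (y - c) * v) by
        push_cast; ring, mul_assoc (π : ℂ), Complex.re_ofReal_mul, Complex.re_ofReal_mul]
      ring
    · filter_upwards [Metric.isOpen_ball.mem_nhds (show y ∈ Metric.ball c r by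
        rwa [Metric.mem_ball, dist_eq_norm])] with x hx
      rw [Metric.mem_ball, dist_eq_norm] at hx
      rw [logPot_ball_inside hx.le]; ring
  exact reMul_injective (h1.unique h2)

lemma cauPot_ball_outside {c y : ℂ} {r : ℝ} (hr : 0 ≤ r) (h : r < ‖y - c‖) :
    cauPot (ind (Metric.ball c r)) y = π * r ^ 2 * (y - c)⁻¹ := by
  have h1 := hasFDerivAt_logPot (isDensity_ball c r) y
  have hne : y ≠ c := fun h' => by rw [h'] at h; simp at h; linarith
  have h2 : HasFDerivAt (logPot (ind (Metric.ball c r))) (reMul (π * r ^ 2 * (y - c)⁻¹)) y := by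
    have h3 := (hasFDerivAt_log_norm_sub hne).const_mul (π * r ^ 2)
    refine (h3.congr_fderiv ?_).congr_of_eventuallyEq ?_
    · ext v
      simp only [reMul_apply, smul_apply, smul_eq_mul]
      rw [show (π : ℂ) * r ^ 2 * (y - c)⁻¹ * v = ((π * r ^ 2 : ℝ) : ℂ) * ((y - c)⁻¹ * v) by
        push_cast; ring, Complex.re_ofReal_mul]
    · have : IsOpen {x : ℂ | r < ‖x - c‖} := isOpen_lt continuous_const (by fun_prop)
      filter_upwards [this.mem_nhds h] with x hx
      exact logPot_ball_outside hr (le_of_lt hx)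
  exact reMul_injective (h1.unique h2)

/-- The distance to the symmetry axis in rescaled coordinates. -/
def hgt (τ : ℝ) (y : ℂ) : ℝ := 1 + τ * y.re

/-- The argument of `ringF` in rescaled coordinates. -/
def rho (τ : ℝ) (y z : ℂ) : ℝ := τ ^ 2 * ‖y - z‖ ^ 2 / (hgt τ y * hgt τ z)

/-- The rescaled Green function. -/
def kern (τ : ℝ) (y z : ℂ) : ℝ := hgt τ z * √(hgt τ y * hgt τ z) * ringF (rho τ y z)

/-- The product `ρ F'(ρ)`. -/
def ringP (ρ : ℝ) : ℝ := -1 / (4 * π) + ρ * deriv ringR ρ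

/-- The gradient of `kern` in its first variable, as a complex number for use with `reMul`. -/
def kernGrad (τ : ℝ) (y z : ℂ) : ℂ :=
  ((hgt τ z * √(hgt τ y * hgt τ z) : ℝ) : ℂ) *
    ((τ / (2 * hgt τ y) * ringF (rho τ y z) : ℝ)
      + (ringP (rho τ y z) : ℂ) * (2 * (y - z)⁻¹ - ((τ / hgt τ y : ℝ) : ℂ)))

/-- The logarithmic weight controlling the kernel. -/
def wlog (τ : ℝ) (y z : ℂ) : ℝ := -log τ + |log ‖y - z‖|

/-- Two distinct points in the region where the kernel expansions hold. -/
structure NearPair (τ η : ℝ) (y z : ℂ) : Prop where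
  τ_pos : 0 < τ
  one_le : 1 ≤ -log τ
  η_le : η ≤ 1 / 4
  left : τ * ‖y‖ ≤ η
  right : τ * ‖z‖ ≤ η
  ne : y ≠ z

namespace NearPair
variable {τ η : ℝ} {y z : ℂ}

lemma symm (h : NearPair τ η y z) : NearPair τ η z y :=
  ⟨h.τ_pos, h.one_le, h.η_le, h.right, h.left, h.ne.symm⟩

lemma η_nonneg (h : NearPair τ η y z) : 0 ≤ η :=
  (mul_nonneg h.τ_pos.le (norm_nonneg _)).trans h.left

lemma abs_re_le (h : NearPair τ η y z) : |τ * y.re| ≤ η := by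
  rw [abs_mul, abs_of_pos h.τ_pos]
  exact (mul_le_mul_of_nonneg_left (Complex.abs_re_le_norm y) h.τ_pos.le).trans h.left

lemma hgt_sub_one (h : NearPair τ η y z) : |hgt τ y - 1| ≤ η := by
  simpa [hgt] using h.abs_re_le

lemma hgt_ge (h : NearPair τ η y z) : 3 / 4 ≤ hgt τ y := by
  have := abs_le.1 h.hgt_sub_one; linarith [h.η_le, this.1]

lemma hgt_le (h : NearPair τ η y z) : hgt τ y ≤ 5 / 4 := by
  have := abs_le.1 h.hgt_sub_one; linarith [h.η_le, this.2]

lemma one_le_wlog (h : NearPair τ η y z) : 1 ≤ wlog τ y z := by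
  have := h.one_le; have := abs_nonneg (log ‖y - z‖); rw [wlog]; linarith

lemma norm_sub_pos (h : NearPair τ η y z) : 0 < ‖y - z‖ := norm_pos_iff.2 (sub_ne_zero.2 h.ne)

lemma mul_norm_sub_le (h : NearPair τ η y z) : τ * ‖y - z‖ ≤ 2 * η := by
  have h1 := mul_le_mul_of_nonneg_left (norm_sub_le y z) h.τ_pos.le
  linarith [h.left, h.right]

lemma rho_pos (h : NearPair τ η y z) : 0 < rho τ y z := by
  have h1 := h.norm_sub_pos
  have h2 := h.hgt_ge
  have h3 := h.symm.hgt_ge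
  have := h.τ_pos
  rw [rho]; positivity

lemma hgt_mul_ge (h : NearPair τ η y z) : 9 / 16 ≤ hgt τ y * hgt τ z := by
  nlinarith [h.hgt_ge, h.symm.hgt_ge]

lemma hgt_mul_le (h : NearPair τ η y z) : hgt τ y * hgt τ z ≤ 25 / 16 := by
  nlinarith [h.hgt_ge, h.symm.hgt_ge, h.hgt_le, h.symm.hgt_le]

lemma rho_le' (h : NearPair τ η y z) : rho τ y z ≤ 2 * (τ * ‖y - z‖) ^ 2 := by
  rw [rho, div_le_iff₀ (by linarith [h.hgt_mul_ge])]
  nlinarith [sq_nonneg (τ * ‖y - z‖), h.hgt_mul_ge]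

lemma rho_le (h : NearPair τ η y z) : rho τ y z ≤ 8 * η ^ 2 := by
  have h1 := h.rho_le'
  have h2 : 0 ≤ τ * ‖y - z‖ := mul_nonneg h.τ_pos.le (norm_nonneg _)
  have h3 := pow_le_pow_left₀ h2 h.mul_norm_sub_le 2
  nlinarith

lemma rho_le_one (h : NearPair τ η y z) : rho τ y z ≤ 1 := by
  have h1 := h.rho_le
  have h2 := pow_le_pow_left₀ h.η_nonneg h.η_le 2
  linarith

lemma log_rho (h : NearPair τ η y z) :
    log (rho τ y z) = 2 * log τ + 2 * log ‖y - z‖ - log (hgt τ y) - log (hgt τ z) := by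
  have h1 := h.norm_sub_pos
  have h2 := h.hgt_ge
  have h3 := h.symm.hgt_ge
  have := h.τ_pos
  rw [rho, log_div (by positivity) (by positivity), log_mul (by positivity) (by positivity),
    log_mul (by positivity) (by positivity), log_pow, log_pow]
  push_cast; ring

lemma abs_log_hgt_sub (h : NearPair τ η y z) : |log (hgt τ y) - τ * y.re| ≤ 2 * η ^ 2 := by
  have h0 := h.hgt_ge
  have hp : 0 < hgt τ y := by linarith
  have h1 := log_le_sub_one_of_pos hp
  have h2 := one_sub_inv_le_log_of_pos hp
  have h3 := h.abs_re_le
  have h5 : (τ * y.re) ^ 2 ≤ η ^ 2 := by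
    rw [← sq_abs (τ * y.re)]; exact pow_le_pow_left₀ (abs_nonneg _) h3 2
  have h4 : τ * y.re - 2 * η ^ 2 ≤ 1 - (hgt τ y)⁻¹ := by
    have : (hgt τ y)⁻¹ ≤ 1 - τ * y.re + 2 * η ^ 2 := by
      rw [inv_le_iff_one_le_mul₀ hp]
      have : hgt τ y = 1 + τ * y.re := rfl
      nlinarith [sq_nonneg η]
    linarith
  rw [abs_le]; constructor
  · linarith
  · simp only [hgt] at h1 ⊢; nlinarith [sq_nonneg η]

lemma abs_log_hgt_le (h : NearPair τ η y z) : |log (hgt τ y)| ≤ 2 * η := by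
  have h1 := abs_le.1 h.abs_log_hgt_sub
  have h2 := abs_le.1 h.abs_re_le
  have h3 : 2 * η ^ 2 ≤ η := by nlinarith [h.η_nonneg, h.η_le]
  rw [abs_le]; constructor <;> linarith [h1.1, h1.2, h2.1, h2.2]

lemma abs_log_rho_le (h : NearPair τ η y z) : |log (rho τ y z)| ≤ 3 * wlog τ y z := by
  have h1 := abs_le.1 h.abs_log_hgt_le
  have h2 := abs_le.1 h.symm.abs_log_hgt_le
  have h3 := abs_le.1 (le_refl |log ‖y - z‖|)
  have := h.η_le
  have := h.one_le
  have := abs_nonneg (log ‖y - z‖)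
  rw [h.log_rho, wlog, abs_le]
  constructor <;> linarith [h1.1, h1.2, h2.1, h2.2, h3.1, h3.2]

lemma abs_ringR_rho_le' (h : NearPair τ η y z) :
    |ringR (rho τ y z)| ≤ 8 * rho τ y z * wlog τ y z := by
  have h1 := abs_ringR_le h.rho_pos h.rho_le_one
  have h2 := h.abs_log_rho_le
  have h3 := h.one_le_wlog
  have h4 := h.rho_pos
  nlinarith [mul_le_mul_of_nonneg_left (show 1 + |log (rho τ y z)| ≤ 4 * wlog τ y z by linarith)
    (show 0 ≤ 2 * rho τ y z by linarith)]

lemma abs_ringR_rho_le (h : NearPair τ η y z) :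
    |ringR (rho τ y z)| ≤ 64 * (η ^ 2 * wlog τ y z) := by
  have h1 := h.abs_ringR_rho_le'
  have h3 := h.one_le_wlog
  nlinarith [mul_le_mul_of_nonneg_right h.rho_le (show 0 ≤ wlog τ y z by linarith)]

lemma abs_deriv_ringR_rho_le (h : NearPair τ η y z) :
    |deriv ringR (rho τ y z)| ≤ 8 * wlog τ y z := by
  have h1 := abs_deriv_ringR_le h.rho_pos h.rho_le_one
  have h2 := h.abs_log_rho_le
  have h3 := h.one_le_wlog
  linarith

lemma abs_ringP_add_le' (h : NearPair τ η y z) :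
    |ringP (rho τ y z) + 1 / (4 * π)| ≤ 8 * rho τ y z * wlog τ y z := by
  have h1 := h.abs_deriv_ringR_rho_le
  rw [ringP, show -1 / (4 * π) + rho τ y z * deriv ringR (rho τ y z) + 1 / (4 * π)
    = rho τ y z * deriv ringR (rho τ y z) by ring, abs_mul, abs_of_pos h.rho_pos]
  nlinarith [mul_le_mul_of_nonneg_left h1 h.rho_pos.le]

lemma abs_ringP_add_le (h : NearPair τ η y z) :
    |ringP (rho τ y z) + 1 / (4 * π)| ≤ 64 * (η ^ 2 * wlog τ y z) := by
  have h1 := h.abs_ringP_add_le'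
  have h3 := h.one_le_wlog
  nlinarith [mul_le_mul_of_nonneg_right h.rho_le (show 0 ≤ wlog τ y z by linarith)]

end NearPair

lemma inv_pi_le : 1 / π ≤ 1 / 3 := one_div_le_one_div_of_le (by norm_num) pi_gt_three.le

lemma ringB_mem : 0 ≤ ringB ∧ ringB ≤ 1 := by
  have h1 := log_two_gt_d9
  have h2 := log_two_lt_d9
  have : log 64 = 6 * log 2 := by
    rw [show (64 : ℝ) = 2 ^ 6 by norm_num, log_pow]; norm_num
  rw [ringB, this]
  constructor <;> linarith

/-- The leading part of `ringF ∘ rho`. -/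
def mainF (τ : ℝ) (y z : ℂ) : ℝ := 1 / (2 * π) * (-log τ + ringB / 2 - log ‖y - z‖)

namespace NearPair
variable {τ η : ℝ} {y z : ℂ}

lemma abs_mainF_le (h : NearPair τ η y z) : |mainF τ y z| ≤ wlog τ y z := by
  have h1 := ringB_mem
  have h2 := abs_le.1 (le_refl |log ‖y - z‖|)
  have h3 := h.one_le
  have h4 : |(-log τ + ringB / 2 - log ‖y - z‖)| ≤ 2 * wlog τ y z := by
    rw [wlog, abs_le]; constructor <;> linarith [h1.1, h1.2, h2.1, h2.2, abs_nonneg (log ‖y - z‖)]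
  rw [mainF, abs_mul, abs_of_pos (by positivity)]
  have h5 : 1 / (2 * π) ≤ 1 / 2 := by
    rw [show 1 / (2 * π) = 1 / 2 * (1 / π) by ring]; linarith [inv_pi_le]
  have := h.one_le_wlog
  nlinarith [abs_nonneg (-log τ + ringB / 2 - log ‖y - z‖)]

lemma abs_ringF_sub_le (h : NearPair τ η y z) :
    |ringF (rho τ y z) - (mainF τ y z + (τ * y.re + τ * z.re) / (4 * π))|
      ≤ 70 * (η ^ 2 * wlog τ y z) := by
  have h1 := h.abs_log_hgt_sub
  have h2 := h.symm.abs_log_hgt_sub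
  have h3 := h.abs_ringR_rho_le
  have h4 : ringF (rho τ y z) - (mainF τ y z + (τ * y.re + τ * z.re) / (4 * π))
      = 1 / (4 * π) * ((log (hgt τ y) - τ * y.re) + (log (hgt τ z) - τ * z.re))
        + ringR (rho τ y z) := by
    rw [ringF_eq h.rho_pos, h.log_rho, mainF]; field_simp; ring
  rw [h4]
  refine (abs_add_le _ _).trans ?_
  rw [abs_mul, abs_of_pos (show 0 < 1 / (4 * π) by positivity)]
  have h5 := abs_add_le (log (hgt τ y) - τ * y.re) (log (hgt τ z) - τ * z.re)
  have h6 : 1 / (4 * π) ≤ 1 := by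
    rw [show 1 / (4 * π) = 1 / 4 * (1 / π) by ring]; linarith [inv_pi_le]
  have h7 : 0 ≤ 1 / (4 * π) := by positivity
  have h8 : η ^ 2 ≤ η ^ 2 * wlog τ y z := le_mul_of_one_le_right (by positivity) h.one_le_wlog
  nlinarith [abs_nonneg (log (hgt τ y) - τ * y.re + (log (hgt τ z) - τ * z.re))]

lemma abs_ringF_sub_mainF_le (h : NearPair τ η y z) :
    |ringF (rho τ y z) - mainF τ y z| ≤ 19 * (η * wlog τ y z) := by
  have h1 := h.abs_ringF_sub_le
  have h2 := h.abs_re_le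
  have h3 := h.symm.abs_re_le
  have h4 : |(τ * y.re + τ * z.re) / (4 * π)| ≤ η := by
    rw [abs_div, abs_of_pos (show 0 < 4 * π by positivity), div_le_iff₀ (by positivity)]
    have := abs_add_le (τ * y.re) (τ * z.re)
    nlinarith [pi_gt_three, h.η_nonneg]
  have h5 := abs_add_le (ringF (rho τ y z) - (mainF τ y z + (τ * y.re + τ * z.re) / (4 * π)))
    ((τ * y.re + τ * z.re) / (4 * π))
  rw [show ringF (rho τ y z) - (mainF τ y z + (τ * y.re + τ * z.re) / (4 * π))
    + (τ * y.re + τ * z.re) / (4 * π) = ringF (rho τ y z) - mainF τ y z by ring] at h5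
  have h6 := h.one_le_wlog
  have h7 := h.η_nonneg
  have h8 : η ^ 2 * wlog τ y z ≤ 1 / 4 * (η * wlog τ y z) := by
    have := h.η_le
    have : 0 ≤ η * wlog τ y z := by positivity
    nlinarith
  have h9 : η ≤ η * wlog τ y z := le_mul_of_one_le_right h7 h6
  linarith

lemma abs_ringF_le (h : NearPair τ η y z) : |ringF (rho τ y z)| ≤ 6 * wlog τ y z := by
  have h1 := h.abs_ringF_sub_mainF_le
  have h2 := h.abs_mainF_le
  have h3 := abs_add_le (ringF (rho τ y z) - mainF τ y z) (mainF τ y z)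
  rw [sub_add_cancel] at h3
  have h6 := h.one_le_wlog
  nlinarith [mul_le_mul_of_nonneg_right h.η_le (show 0 ≤ wlog τ y z by linarith)]

lemma abs_sqrt_sub_le (h : NearPair τ η y z) :
    |√(hgt τ y * hgt τ z) - 1 - (τ * y.re + τ * z.re) / 2| ≤ 2 * η ^ 2 := by
  have h2 := h.abs_re_le
  have h3 := h.symm.abs_re_le
  have e1 := h.hgt_mul_ge
  have h5 : (τ * y.re) ^ 2 ≤ η ^ 2 := by
    rw [← sq_abs (τ * y.re)]; exact pow_le_pow_left₀ (abs_nonneg _) h2 2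
  have h6 : (τ * z.re) ^ 2 ≤ η ^ 2 := by
    rw [← sq_abs (τ * z.re)]; exact pow_le_pow_left₀ (abs_nonneg _) h3 2
  have hη := h.η_le
  have hη0 := h.η_nonneg
  set a := τ * y.re
  set b := τ * z.re
  have e2 : hgt τ y * hgt τ z = (1 + a) * (1 + b) := rfl
  have h2' := abs_le.1 h2
  have h3' := abs_le.1 h3
  rw [abs_le]
  constructor
  · have : 1 + (a + b) / 2 - 2 * η ^ 2 ≤ √(hgt τ y * hgt τ z) := by
      refine le_sqrt_of_sq_le ?_
      rw [e2]
      have q1 : (a - b) ^ 2 ≤ 4 * η ^ 2 := by nlinarith [sq_nonneg (a + b)]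
      have q2 : η ^ 2 * η ^ 2 ≤ 1 / 16 * η ^ 2 := by
        refine mul_le_mul_of_nonneg_right ?_ (sq_nonneg η)
        nlinarith
      have q3 : η ^ 2 * (3 / 4) ≤ η ^ 2 * (1 + (a + b) / 2) :=
        mul_le_mul_of_nonneg_left (by linarith [h2'.1, h3'.1]) (sq_nonneg η)
      nlinarith
    linarith
  · have : √(hgt τ y * hgt τ z) ≤ 1 + (a + b) / 2 := by
      refine sqrt_le_iff.2 ⟨by linarith [h2'.1, h3'.1], ?_⟩
      rw [e2]
      nlinarith [sq_nonneg (a - b)]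
    nlinarith

lemma sqrt_ge (h : NearPair τ η y z) : 3 / 4 ≤ √(hgt τ y * hgt τ z) :=
  le_sqrt_of_sq_le (by have := h.hgt_mul_ge; linarith)

lemma sqrt_le (h : NearPair τ η y z) : √(hgt τ y * hgt τ z) ≤ 5 / 4 :=
  sqrt_le_iff.2 ⟨by norm_num, by have := h.hgt_mul_le; linarith⟩

lemma abs_sqrt_sub_one_le (h : NearPair τ η y z) : |√(hgt τ y * hgt τ z) - 1| ≤ 2 * η := by
  have h1 := abs_le.1 h.abs_sqrt_sub_le
  have h2 := abs_le.1 h.abs_re_le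
  have h3 := abs_le.1 h.symm.abs_re_le
  have h4 : 2 * η ^ 2 ≤ 1 / 2 * η := by nlinarith [h.η_nonneg, h.η_le]
  rw [abs_le]; constructor <;> linarith [h1.1, h1.2, h2.1, h2.2, h3.1, h3.2, h.η_nonneg]

lemma abs_kern_sub_mainF_le (h : NearPair τ η y z) :
    |kern τ y z - mainF τ y z| ≤ 60 * (η * wlog τ y z) := by
  have h1 := h.abs_ringF_sub_mainF_le
  have h2 := h.abs_mainF_le
  have h3 := h.symm.hgt_sub_one
  have h4 := h.abs_sqrt_sub_one_le
  have h5 := h.symm.hgt_le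
  have h5' := h.symm.hgt_ge
  have h6 := h.sqrt_le
  have h6' := h.sqrt_ge
  have hm := h.one_le_wlog
  have hη := h.η_nonneg
  set s := √(hgt τ y * hgt τ z)
  set u := hgt τ z
  set m := wlog τ y z
  have e : kern τ y z - mainF τ y z = u * s * (ringF (rho τ y z) - mainF τ y z)
      + (u * (s - 1) + (u - 1)) * mainF τ y z := by rw [kern]; ring
  rw [e]
  refine (abs_add_le _ _).trans ?_
  rw [abs_mul, abs_mul (_ + _)]
  have h7 : |u * s| ≤ 25 / 16 := by
    rw [abs_of_nonneg (by positivity)]; nlinarith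
  have h8 : |u * (s - 1) + (u - 1)| ≤ 4 * η := by
    refine (abs_add_le _ _).trans ?_
    rw [abs_mul, abs_of_nonneg (show 0 ≤ u by linarith)]
    nlinarith [abs_nonneg (s - 1)]
  have h9 := mul_le_mul h7 h1 (abs_nonneg _) (by norm_num)
  have h10 := mul_le_mul h8 h2 (abs_nonneg _) (by positivity)
  nlinarith [mul_nonneg hη (show 0 ≤ m by linarith)]

lemma abs_kern_sub_le (h : NearPair τ η y z) :
    |kern τ y z - ((1 + τ * y.re / 2 + 3 / 2 * (τ * z.re)) * mainF τ y z
      + (τ * y.re + τ * z.re) / (4 * π))| ≤ 300 * (η ^ 2 * wlog τ y z) := by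
  have h1 := h.abs_ringF_sub_le
  have h2 := h.abs_mainF_le
  have h3 := h.symm.abs_re_le
  have h3' := h.abs_re_le
  have h4 := h.abs_sqrt_sub_le
  have h4' := h.abs_sqrt_sub_one_le
  have h5 := h.symm.hgt_le
  have h5' := h.symm.hgt_ge
  have h6 := h.sqrt_le
  have h6' := h.sqrt_ge
  have hm := h.one_le_wlog
  have hη := h.η_nonneg
  have hη4 := h.η_le
  set s := √(hgt τ y * hgt τ z)
  set a := τ * y.re
  set b := τ * z.re
  set X := mainF τ y z
  set m := wlog τ y z
  have hu : hgt τ z = 1 + b := rfl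
  have e : kern τ y z - ((1 + a / 2 + 3 / 2 * b) * X + (a + b) / (4 * π))
      = (1 + b) * s * (ringF (rho τ y z) - (X + (a + b) / (4 * π)))
      + ((1 + b) * (s - 1 - (a + b) / 2) + b * ((a + b) / 2)) * X
      + ((s - 1) + b * s) * ((a + b) / (4 * π)) := by
    rw [show kern τ y z = hgt τ z * s * ringF (rho τ y z) from rfl, hu]; ring
  rw [e]
  rw [hu] at h5 h5'
  refine (abs_add_le _ _).trans (add_le_add_left (abs_add_le _ _) _ |>.trans ?_)
  rw [abs_mul ((1 + b) * s), abs_mul (_ + _) X, abs_mul (s - 1 + b * s)]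
  have hab : |(a + b) / (4 * π)| ≤ η := by
    rw [abs_div, abs_of_pos (show 0 < 4 * π by positivity), div_le_iff₀ (by positivity)]
    have := abs_add_le a b
    nlinarith [pi_gt_three]
  have hab2 : |(a + b) / 2| ≤ η := by
    rw [abs_div, abs_of_pos (show (0 : ℝ) < 2 by positivity), div_le_iff₀ (by positivity)]
    have := abs_add_le a b
    linarith
  have h7 : |(1 + b) * s| ≤ 25 / 16 := by
    rw [abs_of_nonneg (by positivity)]; nlinarith
  have h8 : |(1 + b) * (s - 1 - (a + b) / 2) + b * ((a + b) / 2)| ≤ 4 * η ^ 2 := by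
    refine (abs_add_le _ _).trans ?_
    rw [abs_mul, abs_mul b, abs_of_nonneg (show 0 ≤ 1 + b by linarith)]
    nlinarith [abs_nonneg (s - 1 - (a + b) / 2), abs_nonneg b, abs_nonneg ((a + b) / 2),
      mul_le_mul h3 hab2 (abs_nonneg _) hη]
  have h8' : |(s - 1) + b * s| ≤ 4 * η := by
    refine (abs_add_le _ _).trans ?_
    rw [abs_mul, abs_of_nonneg (show 0 ≤ s by linarith)]
    nlinarith [abs_nonneg b]
  have h9 := mul_le_mul h7 h1 (abs_nonneg _) (by norm_num)
  have h10 := mul_le_mul h8 h2 (abs_nonneg _) (by positivity)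
  have h11 := mul_le_mul h8' hab (abs_nonneg _) (by positivity)
  have h12 : η ^ 2 ≤ η ^ 2 * m := le_mul_of_one_le_right (sq_nonneg η) hm
  linarith [sq_nonneg η]

lemma abs_kern_le (h : NearPair τ η y z) : |kern τ y z| ≤ 16 * wlog τ y z := by
  have h1 := h.abs_kern_sub_mainF_le
  have h2 := h.abs_mainF_le
  have h3 := abs_add_le (kern τ y z - mainF τ y z) (mainF τ y z)
  rw [sub_add_cancel] at h3
  have h6 := h.one_le_wlog
  nlinarith [mul_le_mul_of_nonneg_right h.η_le (show 0 ≤ wlog τ y z by linarith)]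

lemma norm_kernGrad_add_le (h : NearPair τ η y z) :
    ‖kernGrad τ y z + (1 / (2 * π) : ℝ) * (y - z)⁻¹‖
      ≤ 60 * (η / ‖y - z‖ + τ * wlog τ y z) := by
  have h1 := h.abs_ringP_add_le'
  have h0 := h.abs_ringP_add_le
  have hr := h.rho_le'
  have h2 := h.abs_ringF_le
  have h3 := h.symm.hgt_sub_one
  have h4 := h.abs_sqrt_sub_one_le
  have h5 := h.symm.hgt_le
  have h5' := h.symm.hgt_ge
  have k5 := h.hgt_ge
  have h6 := h.sqrt_le
  have h6' := h.sqrt_ge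
  have hm := h.one_le_wlog
  have hη := h.η_nonneg
  have hη4 := h.η_le
  have hτ := h.τ_pos
  have hY := h.norm_sub_pos
  have hτY := h.mul_norm_sub_le
  set s := √(hgt τ y * hgt τ z)
  set u := hgt τ z
  set u' := hgt τ y
  set m := wlog τ y z
  set p := ringP (rho τ y z) + 1 / (4 * π) with hp
  set F := ringF (rho τ y z)
  have e : kernGrad τ y z + (1 / (2 * π) : ℝ) * (y - z)⁻¹
      = ((u * s * (τ / (2 * u') * F) - u * s * ((p - 1 / (4 * π)) * (τ / u')) : ℝ) : ℂ)
        + ((u * s * (p * 2) - 1 / (2 * π) * (u * s - 1) : ℝ) : ℂ) * (y - z)⁻¹ := by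
    rw [show kernGrad τ y z = ((u * s : ℝ) : ℂ) * ((τ / (2 * u') * F : ℝ)
      + (ringP (rho τ y z) : ℂ) * (2 * (y - z)⁻¹ - ((τ / u' : ℝ) : ℂ))) from rfl,
      show ringP (rho τ y z) = p - 1 / (4 * π) by rw [hp]; ring]
    push_cast; ring
  rw [e]
  refine (norm_add_le _ _).trans ?_
  rw [norm_mul, norm_inv, Complex.norm_real, Complex.norm_real, norm_eq_abs, norm_eq_abs]
  have h7 : |u * s| ≤ 25 / 16 := by
    rw [abs_of_nonneg (by positivity)]; nlinarith
  have h8 : |u * s - 1| ≤ 4 * η := by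
    rw [show u * s - 1 = u * (s - 1) + (u - 1) by ring]
    refine (abs_add_le _ _).trans ?_
    rw [abs_mul, abs_of_nonneg (show 0 ≤ u by linarith)]
    nlinarith [abs_nonneg (s - 1)]
  have hpi : 1 / (4 * π) ≤ 1 / 12 := by
    rw [show 1 / (4 * π) = 1 / 4 * (1 / π) by ring]; linarith [inv_pi_le]
  have hpi0 : 0 ≤ 1 / (4 * π) := by positivity
  have hpi2 : 1 / (2 * π) = 2 * (1 / (4 * π)) := by ring
  have hu' : τ / u' ≤ 4 / 3 * τ := by
    rw [div_le_iff₀ (by linarith)]; nlinarith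
  have hu0 : 0 ≤ τ / u' := by positivity
  have hp4 : |p| ≤ 4 * m := by
    have : η ^ 2 * m ≤ 1 / 16 * m := mul_le_mul_of_nonneg_right (by nlinarith) (by linarith)
    linarith
  have hY1 : 0 ≤ τ * ‖y - z‖ := by positivity
  have hp5 : |p| ≤ 8 * (τ * ‖y - z‖ * m) := by
    have q1 : rho τ y z ≤ τ * ‖y - z‖ := by nlinarith
    nlinarith [mul_le_mul_of_nonneg_right q1 (show 0 ≤ m by linarith)]
  have b1 : |u * s * (τ / (2 * u') * F) - u * s * ((p - 1 / (4 * π)) * (τ / u'))|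
      ≤ 20 * (τ * m) := by
    rw [show u * s * (τ / (2 * u') * F) - u * s * ((p - 1 / (4 * π)) * (τ / u'))
      = u * s * (τ / u' * (F / 2 - p + 1 / (4 * π))) by ring, abs_mul, abs_mul (τ / u'),
      abs_of_nonneg hu0]
    have c1 : |F / 2 - p + 1 / (4 * π)| ≤ 8 * m := by
      have a1 := abs_le.1 h2
      have a2 := abs_le.1 hp4
      rw [abs_le]; constructor <;> linarith [a1.1, a1.2, a2.1, a2.2]
    have c2 := mul_le_mul hu' c1 (abs_nonneg _) (by positivity)
    have c3 := mul_le_mul h7 c2 (by positivity) (by norm_num)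
    nlinarith [mul_pos hτ (show 0 < m by linarith)]
  have b2 : |u * s * (p * 2) - 1 / (2 * π) * (u * s - 1)| ≤ 25 * (τ * ‖y - z‖ * m) + η := by
    refine (abs_sub _ _).trans ?_
    rw [abs_mul, abs_mul p, abs_mul (1 / (2 * π)), hpi2,
      abs_of_nonneg (show (0 : ℝ) ≤ 2 * (1 / (4 * π)) by positivity),
      abs_of_nonneg (show (0 : ℝ) ≤ 2 by norm_num)]
    have c1 := mul_le_mul h7 (mul_le_mul_of_nonneg_right hp5 (show (0 : ℝ) ≤ 2 by norm_num))
      (by positivity) (by norm_num)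
    have c2 : 2 * (1 / (4 * π)) * |u * s - 1| ≤ 2 * (1 / 12) * (4 * η) :=
      mul_le_mul (by linarith) h8 (abs_nonneg _) (by norm_num)
    have : 0 ≤ τ * ‖y - z‖ * m := by positivity
    linarith
  have b3 := mul_le_mul_of_nonneg_right b2 (inv_nonneg.2 hY.le)
  have b4 : (25 * (τ * ‖y - z‖ * m) + η) * ‖y - z‖⁻¹ = 25 * (τ * m) + η / ‖y - z‖ := by
    field_simp
  have b5 : 0 ≤ η / ‖y - z‖ := by positivity
  have b6 : 0 ≤ τ * m := by positivity
  linarith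

set_option maxHeartbeats 1000000 in
/-- The dilation derivative of the kernel. -/
lemma abs_dilation_le (h : NearPair τ η y z) :
    |(kernGrad τ y z * y).re + (kernGrad τ z y * z).re + 1 / (2 * π)|
      ≤ 105 * (η * wlog τ y z) := by
  have h0 := h.abs_ringP_add_le
  have h2 := h.abs_ringF_le
  have h4 := h.abs_sqrt_sub_one_le
  have h5 := h.symm.hgt_le
  have h5' := h.symm.hgt_ge
  have k5 := h.hgt_ge
  have k5' := h.hgt_le
  have h6 := h.sqrt_le
  have h6' := h.sqrt_ge
  have hm := h.one_le_wlog
  have hη := h.η_nonneg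
  have hη4 := h.η_le
  have hτ := h.τ_pos
  have hY := h.norm_sub_pos
  have hA := h.abs_re_le
  have hB := h.symm.abs_re_le
  set s := √(hgt τ y * hgt τ z) with hs
  set p := ringP (rho τ y z) + 1 / (4 * π) with hp
  set F := ringF (rho τ y z) with hF
  set m := wlog τ y z
  have hsy : √(hgt τ z * hgt τ y) = s := by rw [mul_comm]
  have hρ : rho τ z y = rho τ y z := by rw [rho, rho, norm_sub_rev, mul_comm (hgt τ z)]
  set E : ℝ := τ * ((z.re * y - y.re * z) * (y - z)⁻¹).re with hE
  set X : ℝ := hgt τ z * (τ * y.re) / hgt τ y + hgt τ y * (τ * z.re) / hgt τ z with hX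
  have hYne : y - z ≠ 0 := sub_ne_zero.2 h.ne
  have hE2 : |E| ≤ 2 * η := by
    rw [hE, abs_mul, abs_of_pos hτ]
    have q1 := Complex.abs_re_le_norm ((z.re * y - y.re * z) * (y - z)⁻¹)
    have q2 : (z.re * y - y.re * z) * (y - z)⁻¹ = z.re - ((y - z).re : ℂ) * (z * (y - z)⁻¹) := by
      field_simp
      simp only [Complex.sub_re]
      push_cast
      ring
    have q3 : ‖(z.re * y - y.re * z) * (y - z)⁻¹‖ ≤ 2 * ‖z‖ := by
      rw [q2]
      refine (norm_sub_le _ _).trans ?_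
      rw [norm_mul, norm_mul, norm_inv, Complex.norm_real, Complex.norm_real, norm_eq_abs,
        norm_eq_abs]
      have r1 := Complex.abs_re_le_norm z
      have r2 := Complex.abs_re_le_norm (y - z)
      have r3 : |(y - z).re| * (‖z‖ * ‖y - z‖⁻¹) ≤ ‖y - z‖ * (‖z‖ * ‖y - z‖⁻¹) :=
        mul_le_mul_of_nonneg_right r2 (by positivity)
      rw [show ‖y - z‖ * (‖z‖ * ‖y - z‖⁻¹) = ‖z‖ by field_simp] at r3
      linarith
    have := mul_le_mul_of_nonneg_left (q1.trans q3) hτ.le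
    linarith [h.right]
  have hX2 : |X| ≤ 4 * η := by
    have r1 : |hgt τ z * (τ * y.re) / hgt τ y| ≤ 5 / 3 * η := by
      rw [abs_div, abs_mul, abs_of_pos (show 0 < hgt τ y by linarith),
        abs_of_pos (show 0 < hgt τ z by linarith), div_le_iff₀ (by linarith)]
      have := mul_le_mul h5 hA (abs_nonneg _) (by norm_num)
      nlinarith
    have r2 : |hgt τ y * (τ * z.re) / hgt τ z| ≤ 5 / 3 * η := by
      rw [abs_div, abs_mul, abs_of_pos (show 0 < hgt τ y by linarith),
        abs_of_pos (show 0 < hgt τ z by linarith), div_le_iff₀ (by linarith)]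
      have := mul_le_mul k5' hB (abs_nonneg _) (by norm_num)
      nlinarith
    have := abs_add_le (hgt τ z * (τ * y.re) / hgt τ y) (hgt τ y * (τ * z.re) / hgt τ z)
    linarith
  have e : (kernGrad τ y z * y).re + (kernGrad τ z y * z).re + 1 / (2 * π)
      = s * X * (F / 2 - p + 1 / (4 * π)) + 2 * p * (s * (1 + E))
        - 1 / (2 * π) * (s * (1 + E) - 1) := by
    have hP : ringP (rho τ y z) = p - 1 / (4 * π) := by rw [hp]; ring
    have c1 : (kernGrad τ y z * y).re = hgt τ z * s * (τ / (2 * hgt τ y) * F * y.re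
        + (p - 1 / (4 * π)) * (2 * (y * (y - z)⁻¹).re - τ / hgt τ y * y.re)) := by
      rw [kernGrad, ← hs, ← hF, hP, mul_assoc, Complex.re_ofReal_mul]
      congr 1
      rw [show ((τ / (2 * hgt τ y) * F : ℝ) + ((p - 1 / (4 * π) : ℝ) : ℂ)
        * (2 * (y - z)⁻¹ - ((τ / hgt τ y : ℝ) : ℂ))) * y
        = ((τ / (2 * hgt τ y) * F : ℝ) : ℂ) * y + ((p - 1 / (4 * π) : ℝ) : ℂ)
        * (((2 : ℝ) : ℂ) * (y * (y - z)⁻¹) - ((τ / hgt τ y : ℝ) : ℂ) * y) by push_cast; ring]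
      simp only [Complex.add_re, Complex.re_ofReal_mul, Complex.sub_re]
    have c2 : (kernGrad τ z y * z).re = hgt τ y * s * (τ / (2 * hgt τ z) * F * z.re
        + (p - 1 / (4 * π)) * (-2 * (z * (y - z)⁻¹).re - τ / hgt τ z * z.re)) := by
      rw [kernGrad, hsy, hρ, ← hF, hP, mul_assoc, Complex.re_ofReal_mul]
      congr 1
      rw [show ((τ / (2 * hgt τ z) * F : ℝ) + ((p - 1 / (4 * π) : ℝ) : ℂ)
        * (2 * (z - y)⁻¹ - ((τ / hgt τ z : ℝ) : ℂ))) * z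
        = ((τ / (2 * hgt τ z) * F : ℝ) : ℂ) * z + ((p - 1 / (4 * π) : ℝ) : ℂ)
        * (((-2 : ℝ) : ℂ) * (z * (y - z)⁻¹) - ((τ / hgt τ z : ℝ) : ℂ) * z) by
          rw [← neg_sub y z, inv_neg]; push_cast; ring]
      simp only [Complex.add_re, Complex.re_ofReal_mul, Complex.sub_re]
    have c3 : hgt τ z * (y * (y - z)⁻¹).re - hgt τ y * (z * (y - z)⁻¹).re = 1 + E := by
      rw [hE, ← Complex.re_ofReal_mul, ← Complex.re_ofReal_mul, ← Complex.re_ofReal_mul,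
        ← Complex.sub_re, ← Complex.one_re, ← Complex.add_re]
      congr 1
      simp only [hgt]
      field_simp
      push_cast
      ring
    have hne : hgt τ y ≠ 0 := by linarith
    have hne' : hgt τ z ≠ 0 := by linarith
    rw [c1, c2, ← c3, hX]
    ring
  rw [e]
  have hpi : 1 / (4 * π) ≤ 1 / 12 := by
    rw [show 1 / (4 * π) = 1 / 4 * (1 / π) by ring]; linarith [inv_pi_le]
  have hpi0 : 0 ≤ 1 / (4 * π) := by positivity
  have hpi2 : 1 / (2 * π) = 2 * (1 / (4 * π)) := by ring
  have hp4 : |p| ≤ 4 * m := by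
    have : η ^ 2 * m ≤ 1 / 16 * m := mul_le_mul_of_nonneg_right (by nlinarith) (by linarith)
    linarith
  have hp5 : |p| ≤ 16 * (η * m) := by
    have : 0 ≤ η * m := by positivity
    nlinarith
  have hE' := abs_le.1 hE2
  have h4' := abs_le.1 h4
  have d1 : |s * X * (F / 2 - p + 1 / (4 * π))| ≤ 40 * (η * m) := by
    rw [abs_mul, abs_mul, abs_of_nonneg (show 0 ≤ s by linarith)]
    have c1 : |F / 2 - p + 1 / (4 * π)| ≤ 8 * m := by
      have a1 := abs_le.1 h2
      have a2 := abs_le.1 hp4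
      rw [abs_le]; constructor <;> linarith [a1.1, a1.2, a2.1, a2.2]
    have c2 := mul_le_mul h6 hX2 (abs_nonneg _) (by norm_num)
    have c3 := mul_le_mul c2 c1 (abs_nonneg _) (by positivity)
    linarith
  have d2 : |s * (1 + E)| ≤ 2 := by
    rw [abs_mul, abs_of_nonneg (show 0 ≤ s by linarith),
      abs_of_nonneg (show 0 ≤ 1 + E by linarith [hE'.1])]
    nlinarith [hE'.1, hE'.2]
  have d3 : |s * (1 + E) - 1| ≤ 5 * η := by
    rw [show s * (1 + E) - 1 = (s - 1) + s * E by ring]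
    refine (abs_add_le _ _).trans ?_
    rw [abs_mul, abs_of_nonneg (show 0 ≤ s by linarith)]
    nlinarith [abs_nonneg E]
  have d4 : |2 * p * (s * (1 + E))| ≤ 2 * (16 * (η * m)) * 2 := by
    rw [abs_mul, abs_mul, abs_of_nonneg (show (0 : ℝ) ≤ 2 by norm_num)]
    gcongr
  have d5 : |1 / (2 * π) * (s * (1 + E) - 1)| ≤ 2 * (1 / 12) * (5 * η) := by
    rw [hpi2, abs_mul, abs_of_nonneg (by positivity)]
    gcongr
  have d6 : η ≤ η * m := le_mul_of_one_le_right hη hm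
  have d7 := abs_sub (s * X * (F / 2 - p + 1 / (4 * π)) + 2 * p * (s * (1 + E)))
    (1 / (2 * π) * (s * (1 + E) - 1))
  have d8 := abs_add_le (s * X * (F / 2 - p + 1 / (4 * π))) (2 * p * (s * (1 + E)))
  have d9 : 0 ≤ η * m := by positivity
  have hfin : 40 * (η * m) + 2 * (16 * (η * m)) * 2 + 2 * (1 / 12) * (5 * η) ≤ 105 * (η * m) := by
    linarith
  linarith

set_option maxHeartbeats 1000000 in
/-- The axial translation derivative of the kernel. -/
lemma abs_translation_le (h : NearPair τ η y z) :
    |(kernGrad τ y z + kernGrad τ z y).re - τ * ((1 + (τ * y.re + τ * z.re) / 2) *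
      (mainF τ y z + 1 / (2 * π) * (1 + (y - z).re ^ 2 / ‖y - z‖ ^ 2))
        + (τ * y.re + τ * z.re) / (4 * π))| ≤ 1000 * (τ * (η ^ 2 * wlog τ y z)) := by
  have h0 := h.abs_ringP_add_le
  have h1 := h.abs_ringF_sub_le
  have hX := h.abs_mainF_le
  have h2 := h.abs_ringF_le
  have h4 := h.abs_sqrt_sub_le
  have h4' := h.abs_sqrt_sub_one_le
  have h5' := h.symm.hgt_ge
  have k5 := h.hgt_ge
  have h6 := h.sqrt_le
  have h6' := h.sqrt_ge
  have hm := h.one_le_wlog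
  have hη := h.η_nonneg
  have hη4 := h.η_le
  have hτ := h.τ_pos
  have hY := h.norm_sub_pos
  have hA := h.abs_re_le
  have hB := h.symm.abs_re_le
  have hρ0 := h.rho_pos
  have hρ8 := h.rho_le
  set s := √(hgt τ y * hgt τ z) with hs
  set p := ringP (rho τ y z) + 1 / (4 * π) with hp
  set F := ringF (rho τ y z) with hF
  set m := wlog τ y z
  set M := mainF τ y z
  have hsy : √(hgt τ z * hgt τ y) = s := by rw [mul_comm]
  have hρ : rho τ z y = rho τ y z := by rw [rho, rho, norm_sub_rev, mul_comm (hgt τ z)]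
  set q := (y - z).re ^ 2 / ‖y - z‖ ^ 2 with hq
  have hq1 : q ≤ 1 := by
    rw [hq, div_le_one (by positivity), ← sq_abs (y - z).re]
    exact pow_le_pow_left₀ (abs_nonneg _) (Complex.abs_re_le_norm _) 2
  have hq0 : 0 ≤ q := by positivity
  set ξ := rho τ y z * q with hξ
  have hξ0 : 0 ≤ ξ := by positivity
  have hξ8 : ξ ≤ 8 * η ^ 2 := by nlinarith
  have hne : hgt τ y ≠ 0 := by linarith
  have hne' : hgt τ z ≠ 0 := by linarith
  have hinv : ((y - z)⁻¹).re = (y - z).re / ‖y - z‖ ^ 2 := by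
    rw [Complex.inv_re, Complex.normSq_eq_norm_sq]
  set a := τ * y.re with ha
  set b := τ * z.re with hb
  have hre : (y - z).re = y.re - z.re := rfl
  have e : (kernGrad τ y z + kernGrad τ z y).re
      = τ * (s * ((2 + ξ) * (F / 2 - p + 1 / (4 * π)) - 2 * (p - 1 / (4 * π)) * q)) := by
    have hP : ringP (rho τ y z) = p - 1 / (4 * π) := by rw [hp]; ring
    have c1 : (kernGrad τ y z).re = hgt τ z * s * (τ / (2 * hgt τ y) * F
        + (p - 1 / (4 * π)) * (2 * ((y - z).re / ‖y - z‖ ^ 2) - τ / hgt τ y)) := by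
      rw [kernGrad, ← hs, ← hF, hP, Complex.re_ofReal_mul, Complex.add_re, Complex.ofReal_re,
        Complex.re_ofReal_mul, Complex.sub_re, Complex.ofReal_re, ← hinv,
        show (2 : ℂ) = ((2 : ℝ) : ℂ) by norm_num, Complex.re_ofReal_mul]
    have c2 : (kernGrad τ z y).re = hgt τ y * s * (τ / (2 * hgt τ z) * F
        + (p - 1 / (4 * π)) * (2 * (-((y - z).re / ‖y - z‖ ^ 2)) - τ / hgt τ z)) := by
      rw [kernGrad, hsy, hρ, ← hF, hP, Complex.re_ofReal_mul, Complex.add_re, Complex.ofReal_re,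
        Complex.re_ofReal_mul, Complex.sub_re, Complex.ofReal_re, ← hinv,
        show (2 : ℂ) = ((2 : ℝ) : ℂ) by norm_num, Complex.re_ofReal_mul, ← neg_sub y z, inv_neg,
        Complex.neg_re]
    have c3 : hgt τ z - hgt τ y = -(τ * (y - z).re) := by simp only [hgt, hre]; ring
    have c4 : ξ * (hgt τ y * hgt τ z) = (hgt τ z - hgt τ y) ^ 2 := by
      rw [c3, hξ, hq, rho]
      field_simp
    have c5 : (hgt τ z - hgt τ y) * ((y - z).re / ‖y - z‖ ^ 2) = -τ * q := by
      rw [c3, hq]; ring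
    have c6 : hgt τ z / hgt τ y + hgt τ y / hgt τ z = 2 + ξ := by
      rw [show ξ = (hgt τ z - hgt τ y) ^ 2 / (hgt τ y * hgt τ z) by
        rw [← c4, mul_div_cancel_right₀ _ (mul_ne_zero hne hne')] ]
      field_simp
      ring
    rw [Complex.add_re, c1, c2, ← c6]
    linear_combination 2 * s * (p - 1 / (4 * π)) * c5
  have e2 : (kernGrad τ y z + kernGrad τ z y).re - τ * ((1 + (a + b) / 2) *
      (M + 1 / (2 * π) * (1 + q)) + (a + b) / (4 * π))
      = τ * (s * (F - (M + (a + b) / (4 * π))) + (s - 1 - (a + b) / 2) *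
        (M + 1 / (2 * π) * (1 + q)) + (s - 1) * ((a + b) / (4 * π))
        + s * (ξ * (F / 2 - p + 1 / (4 * π)) - 2 * p * (1 + q))) := by
    rw [e]; ring
  rw [e2, abs_mul, abs_of_pos hτ]
  rw [show 1000 * (τ * (η ^ 2 * m)) = τ * (1000 * (η ^ 2 * m)) by ring]
  refine mul_le_mul_of_nonneg_left ?_ hτ.le
  have hpi : 1 / (4 * π) ≤ 1 / 12 := by
    rw [show 1 / (4 * π) = 1 / 4 * (1 / π) by ring]; linarith [inv_pi_le]
  have hpi0 : 0 ≤ 1 / (4 * π) := by positivity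
  have hpi2 : 1 / (2 * π) = 2 * (1 / (4 * π)) := by ring
  have hp4 : |p| ≤ 4 * m := by
    have : η ^ 2 * m ≤ 1 / 16 * m := mul_le_mul_of_nonneg_right (by nlinarith) (by linarith)
    linarith
  have c1 : |F / 2 - p + 1 / (4 * π)| ≤ 8 * m := by
    have a1 := abs_le.1 h2
    have a2 := abs_le.1 hp4
    rw [abs_le]; constructor <;> linarith [a1.1, a1.2, a2.1, a2.2]
  have hab : |(a + b) / (4 * π)| ≤ η := by
    rw [abs_div, abs_of_pos (show 0 < 4 * π by positivity), div_le_iff₀ (by positivity)]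
    have := abs_add_le a b
    nlinarith [pi_gt_three]
  have c2 : |M + 1 / (2 * π) * (1 + q)| ≤ 2 * m := by
    have a1 := abs_le.1 hX
    have : 1 / (2 * π) * (1 + q) ≤ 1 := by rw [hpi2]; nlinarith
    have : 0 ≤ 1 / (2 * π) * (1 + q) := by positivity
    rw [abs_le]; constructor <;> linarith [a1.1, a1.2]
  have hηm : η ^ 2 ≤ η ^ 2 * m := le_mul_of_one_le_right (sq_nonneg η) hm
  have d1 : |s * (F - (M + (a + b) / (4 * π)))| ≤ 5 / 4 * (70 * (η ^ 2 * m)) := by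
    rw [abs_mul, abs_of_nonneg (show 0 ≤ s by linarith)]; gcongr
  have d2 : |(s - 1 - (a + b) / 2) * (M + 1 / (2 * π) * (1 + q))| ≤ 2 * η ^ 2 * (2 * m) := by
    rw [abs_mul]; gcongr
  have d3 : |(s - 1) * ((a + b) / (4 * π))| ≤ 2 * η * η := by
    rw [abs_mul]; gcongr
  have d4 : |s * (ξ * (F / 2 - p + 1 / (4 * π)) - 2 * p * (1 + q))|
      ≤ 5 / 4 * (8 * η ^ 2 * (8 * m) + 2 * (64 * (η ^ 2 * m)) * 2) := by
    rw [abs_mul, abs_of_nonneg (show 0 ≤ s by linarith)]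
    have : |ξ * (F / 2 - p + 1 / (4 * π)) - 2 * p * (1 + q)|
        ≤ 8 * η ^ 2 * (8 * m) + 2 * (64 * (η ^ 2 * m)) * 2 := by
      refine (abs_sub _ _).trans ?_
      rw [abs_mul, abs_mul (2 * p), abs_mul 2, abs_of_nonneg hξ0,
        abs_of_nonneg (show (0 : ℝ) ≤ 2 by norm_num), abs_of_nonneg (show 0 ≤ 1 + q by linarith)]
      gcongr
      linarith
    gcongr
  have f1 := abs_add_le (s * (F - (M + (a + b) / (4 * π))) + (s - 1 - (a + b) / 2) *
        (M + 1 / (2 * π) * (1 + q)) + (s - 1) * ((a + b) / (4 * π)))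
        (s * (ξ * (F / 2 - p + 1 / (4 * π)) - 2 * p * (1 + q)))
  have f2 := abs_add_three (s * (F - (M + (a + b) / (4 * π)))) ((s - 1 - (a + b) / 2) *
        (M + 1 / (2 * π) * (1 + q))) ((s - 1) * ((a + b) / (4 * π)))
  nlinarith

end NearPair

lemma measurable_ringF : Measurable ringF := by
  have h : StronglyMeasurable (Function.uncurry fun (ρ θ : ℝ) => cos θ / √(ρ + 2 - 2 * cos θ)) :=
    Measurable.stronglyMeasurable (by unfold Function.uncurry; fun_prop)
  have h2 : Measurable fun ρ : ℝ => ∫ θ in (-π)..π, cos θ / √(ρ + 2 - 2 * cos θ) := by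
    simp_rw [intervalIntegral.integral_of_le (show -π ≤ π by linarith [pi_pos])]
    exact (h.integral_prod_right (ν := volume.restrict (Set.Ioc (-π) π))).measurable
  exact h2.const_mul _

lemma measurable_ringP : Measurable ringP :=
  (measurable_id.mul (measurable_deriv ringR)).const_add _

@[fun_prop]
lemma measurable_hgt (τ : ℝ) : Measurable (hgt τ) := by
  unfold hgt; exact (Complex.measurable_re.const_mul τ).const_add 1

lemma measurable_rho (τ : ℝ) : Measurable fun p : ℂ × ℂ => rho τ p.1 p.2 := by
  unfold rho; fun_prop

lemma measurable_kern (τ : ℝ) : Measurable fun p : ℂ × ℂ => kern τ p.1 p.2 := by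
  have h1 := measurable_ringF.comp (measurable_rho τ)
  have h2 : Measurable fun p : ℂ × ℂ => hgt τ p.2 * √(hgt τ p.1 * hgt τ p.2) := by fun_prop
  exact h2.mul h1

lemma measurable_kernGrad (τ : ℝ) : Measurable fun p : ℂ × ℂ => kernGrad τ p.1 p.2 := by
  have h1 : Measurable fun p : ℂ × ℂ => ringF (rho τ p.1 p.2) :=
    measurable_ringF.comp (measurable_rho τ)
  have h2 : Measurable fun p : ℂ × ℂ => ringP (rho τ p.1 p.2) :=
    measurable_ringP.comp (measurable_rho τ)
  unfold kernGrad
  fun_prop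

lemma measurable_wlog (τ : ℝ) : Measurable fun p : ℂ × ℂ => wlog τ p.1 p.2 := by
  unfold wlog
  refine Measurable.const_add ?_ _
  exact (measurable_log.comp (by fun_prop)).abs

/-- `ringR` with its continuous value at `0`. -/
def ringR0 (ρ : ℝ) : ℝ := if ρ = 0 then 0 else ringR ρ

/-- The kernel `kern` with its logarithmic singularity removed. -/
def kernReg (τ : ℝ) (y z : ℂ) : ℝ := hgt τ z * √(hgt τ y * hgt τ z) *
  (1 / (4 * π) * (ringB - 2 * log τ + log (hgt τ y) + log (hgt τ z)) + ringR0 (rho τ y z))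

lemma NearPair.kern_eq {τ η : ℝ} {y z : ℂ} (h : NearPair τ η y z) :
    kern τ y z = kernReg τ y z
      - hgt τ z * √(hgt τ y * hgt τ z) / (2 * π) * log ‖y - z‖ := by
  rw [kern, kernReg, ringR0, if_neg h.rho_pos.ne', ringF_eq h.rho_pos, h.log_rho]
  field_simp
  ring

lemma hasFDerivAt_hgt (τ : ℝ) (y : ℂ) : HasFDerivAt (hgt τ) (reMul τ) y := by
  have h := ((Complex.reCLM.hasFDerivAt (x := y)).const_mul τ).const_add 1
  refine h.congr_fderiv ?_
  ext v; simp

lemma hasFDerivAt_sqrt_hgt {τ : ℝ} {y z : ℂ} (hy : 0 < hgt τ y) (hz : 0 < hgt τ z) :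
    HasFDerivAt (fun y => hgt τ z * √(hgt τ y * hgt τ z))
      (reMul ((hgt τ z * √(hgt τ y * hgt τ z) * (τ / (2 * hgt τ y)) : ℝ) : ℂ)) y := by
  have h := (((hasFDerivAt_hgt τ y).mul_const (hgt τ z)).sqrt (by positivity)).const_mul (hgt τ z)
  refine h.congr_fderiv ?_
  ext v
  have e := Real.mul_self_sqrt (mul_pos hy hz).le
  have hs : √(hgt τ y * hgt τ z) ≠ 0 := by positivity
  simp only [reMul_apply, smul_apply, smul_eq_mul, Complex.re_ofReal_mul]
  field_simp
  rw [mul_comm (hgt τ z) (hgt τ y), sq, e]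

lemma hasFDerivAt_log_hgt {τ : ℝ} {y : ℂ} (hy : 0 < hgt τ y) :
    HasFDerivAt (fun y => log (hgt τ y)) (reMul ((τ / hgt τ y : ℝ) : ℂ)) y := by
  refine ((hasFDerivAt_hgt τ y).log hy.ne').congr_fderiv ?_
  ext v
  simp only [reMul_apply, smul_apply, smul_eq_mul, Complex.re_ofReal_mul]
  ring

lemma hasFDerivAt_rho {τ : ℝ} {y z : ℂ} (hy : 0 < hgt τ y) (hz : 0 < hgt τ z) (hne : y ≠ z) :
    HasFDerivAt (fun y => rho τ y z)
      (reMul ((rho τ y z : ℂ) * (2 * (y - z)⁻¹ - ((τ / hgt τ y : ℝ) : ℂ)))) y := by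
  have h := ((hasFDerivAt_normSq_sub z y).const_mul (τ ^ 2)).mul
    ((hasDerivAt_inv (mul_pos hy hz).ne').comp_hasFDerivAt y
      ((hasFDerivAt_hgt τ y).mul_const (hgt τ z)))
  refine h.congr_fderiv ?_
  have hn : ‖y - z‖ ^ 2 ≠ 0 := by simpa using sub_ne_zero.2 hne
  ext v
  rw [Complex.inv_def, Complex.normSq_eq_norm_sq]
  simp only [reMul_apply, smul_apply, smul_eq_mul, add_apply, mul_assoc, Complex.re_ofReal_mul,
    Function.comp_apply]
  rw [show (2 * ((starRingEnd ℂ) (y - z) * ((‖y - z‖ ^ 2)⁻¹ : ℝ)) - ((τ / hgt τ y : ℝ) : ℂ)) * v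
    = ((2 * (‖y - z‖ ^ 2)⁻¹ : ℝ) : ℂ) * ((starRingEnd ℂ) (y - z) * v) - ((τ / hgt τ y : ℝ) : ℂ) * v
    by push_cast; ring, show (2 : ℂ) * ((starRingEnd ℂ) (y - z) * v)
      = ((2 : ℝ) : ℂ) * ((starRingEnd ℂ) (y - z) * v) by push_cast; ring]
  simp only [Complex.sub_re, Complex.re_ofReal_mul]
  have hn' : ‖y - z‖ ≠ 0 := by simpa using sub_ne_zero.2 hne
  rw [rho]
  field_simp
  ring

/-- The gradient of `kernReg` off the diagonal. -/
def kernRegGrad (τ : ℝ) (y z : ℂ) : ℂ := ((hgt τ z * √(hgt τ y * hgt τ z) : ℝ) : ℂ) *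
  (((τ / (2 * hgt τ y) * (1 / (4 * π) * (ringB - 2 * log τ + log (hgt τ y) + log (hgt τ z))
      + ringR0 (rho τ y z)) + 1 / (4 * π) * (τ / hgt τ y) : ℝ) : ℂ)
    + ((rho τ y z * deriv ringR (rho τ y z) : ℝ) : ℂ) *
      (2 * (y - z)⁻¹ - ((τ / hgt τ y : ℝ) : ℂ)))

lemma NearPair.hasFDerivAt_kernReg {τ η : ℝ} {y z : ℂ} (h : NearPair τ η y z) :
    HasFDerivAt (fun y => kernReg τ y z) (reMul (kernRegGrad τ y z)) y := by
  have hy : 0 < hgt τ y := by linarith [h.hgt_ge]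
  have hz : 0 < hgt τ z := by linarith [h.symm.hgt_ge]
  have hR : HasDerivAt ringR0 (deriv ringR (rho τ y z)) (rho τ y z) := by
    refine (hasDerivAt_ringR h.rho_pos).congr_of_eventuallyEq ?_
    filter_upwards [isOpen_ne.mem_nhds h.rho_pos.ne'] with s hs
    rw [ringR0, if_neg hs]
  have h1 := hR.comp_hasFDerivAt y (hasFDerivAt_rho hy hz h.ne)
  have h2 := (((hasFDerivAt_log_hgt hy).const_add (ringB - 2 * log τ)).add_const
    (log (hgt τ z))).const_mul (1 / (4 * π))
  have h3 := (hasFDerivAt_sqrt_hgt hy hz).mul (h2.add h1)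
  refine h3.congr_fderiv ?_
  ext v
  simp only [kernRegGrad, reMul_apply, smul_apply, smul_eq_mul, add_apply, mul_assoc,
    Complex.re_ofReal_mul, add_mul, Complex.add_re, Pi.add_apply, Function.comp_apply]
  simp only [← mul_assoc]
  simp only [mul_assoc]
  ring

lemma NearPair.kernRegGrad_eq {τ η : ℝ} {y z : ℂ} (h : NearPair τ η y z) :
    kernRegGrad τ y z = kernGrad τ y z
      + ((hgt τ z * √(hgt τ y * hgt τ z) / (2 * π) * (τ / (2 * hgt τ y)) * log ‖y - z‖ : ℝ) : ℂ)
      + ((hgt τ z * √(hgt τ y * hgt τ z) / (2 * π) : ℝ) : ℂ) * (y - z)⁻¹ := by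
  rw [kernGrad, kernRegGrad, ringR0, if_neg h.rho_pos.ne', ringF_eq h.rho_pos, h.log_rho, ringP]
  push_cast
  have := Complex.ofReal_ne_zero.2 pi_ne_zero
  field_simp
  ring

lemma mul_one_add_abs_log_le {ρ t : ℝ} (h0 : 0 < ρ) (h1 : ρ ≤ 1) (ht : 0 < t) :
    ρ * (1 + |log ρ|) ≤ (1 + 1 / t) * ρ ^ (1 - t) := by
  have h2 := (abs_log_mul_self_rpow_lt ρ t h0 h1 ht).le
  rw [abs_mul, abs_of_pos (rpow_pos_of_pos h0 t)] at h2
  have h3 : ρ = ρ ^ t * ρ ^ (1 - t) := by rw [← rpow_add h0]; simp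
  have h4 : ρ ^ t ≤ 1 := rpow_le_one h0.le h1 ht.le
  have h5 := rpow_pos_of_pos h0 (1 - t)
  calc ρ * (1 + |log ρ|) = (ρ ^ t + |log ρ| * ρ ^ t) * ρ ^ (1 - t) := by
        nth_rewrite 1 [h3]; ring
    _ ≤ (1 + 1 / t) * ρ ^ (1 - t) := by gcongr

lemma NearPair.sqrt_rho_le {τ η : ℝ} {y z : ℂ} (h : NearPair τ η y z) :
    √(rho τ y z) ≤ 4 / 3 * (τ * ‖y - z‖) := by
  have h1 := h.hgt_ge
  have h2 := h.symm.hgt_ge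
  have h3 := h.τ_pos
  apply sqrt_le_iff.2 ⟨by positivity, ?_⟩
  rw [rho, div_le_iff₀ (by positivity)]
  have h4 : 9 / 16 ≤ hgt τ y * hgt τ z := by nlinarith
  have h5 : 0 ≤ τ ^ 2 * ‖y - z‖ ^ 2 := by positivity
  nlinarith

lemma NearPair.norm_kernRegGrad_le {τ η : ℝ} {y z : ℂ} (h : NearPair τ η y z) :
    ‖kernRegGrad τ y z‖ ≤ 60 * -log τ := by
  have hτ := h.τ_pos
  have hl := h.one_le
  have hy := h.hgt_ge
  have hy' := h.hgt_le
  have hz := h.symm.hgt_ge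
  have hz' := h.symm.hgt_le
  have hY := h.norm_sub_pos
  have hτ1 : τ ≤ 1 := by
    by_contra h'
    have := log_pos (not_le.1 h'); linarith
  have hq : |hgt τ z * √(hgt τ y * hgt τ z)| ≤ 2 := by
    rw [abs_of_nonneg (by positivity)]
    have : √(hgt τ y * hgt τ z) ≤ 5 / 4 := sqrt_le_iff.2 ⟨by norm_num, by nlinarith⟩
    nlinarith [sqrt_nonneg (hgt τ y * hgt τ z)]
  have hα : |τ / hgt τ y| ≤ 4 / 3 := by
    rw [abs_of_nonneg (by positivity), div_le_iff₀ (by linarith)]; linarith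
  have hα2 : |τ / (2 * hgt τ y)| ≤ 1 := by
    rw [abs_of_nonneg (by positivity), div_le_iff₀ (by linarith)]; linarith
  have hπ : |1 / (4 * π)| ≤ 1 / 12 := by
    rw [abs_of_pos (by positivity)]
    exact one_div_le_one_div_of_le (by norm_num) (by linarith [pi_gt_three])
  have hl1 := abs_le.1 (h.abs_log_hgt_le)
  have hl2 := abs_le.1 (h.symm.abs_log_hgt_le)
  have hη := h.η_le
  have hη0 := h.η_nonneg
  have hB := ringB_mem
  have hs : |ringB - 2 * log τ + log (hgt τ y) + log (hgt τ z)| ≤ 6 * -log τ := by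
    rw [abs_le]; constructor <;> linarith [hl1.1, hl1.2, hl2.1, hl2.2, hB.1, hB.2]
  have hρ := h.rho_pos
  have hρ1 := h.rho_le_one
  have hm := mul_one_add_abs_log_le hρ hρ1 (t := 1) (by norm_num)
  have hm2 := mul_one_add_abs_log_le hρ hρ1 (t := 1 / 2) (by norm_num)
  rw [show (1 : ℝ) - 1 / 2 = 1 / 2 by norm_num, ← sqrt_eq_rpow] at hm2
  norm_num at hm
  have hr0 : |ringR0 (rho τ y z)| ≤ 4 := by
    rw [ringR0, if_neg hρ.ne']
    linarith [abs_ringR_le hρ hρ1]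
  have hd : |rho τ y z * deriv ringR (rho τ y z)| ≤ 8 * (τ * ‖y - z‖) := by
    rw [abs_mul, abs_of_pos hρ]
    have := mul_le_mul_of_nonneg_left (abs_deriv_ringR_le hρ hρ1) hρ.le
    have := h.sqrt_rho_le
    linarith
  have hτY : τ * ‖y - z‖ ≤ 1 / 2 := by linarith [h.mul_norm_sub_le]
  rw [kernRegGrad, norm_mul, Complex.norm_real, Real.norm_eq_abs]
  have e1 : ‖((τ / (2 * hgt τ y) * (1 / (4 * π) * (ringB - 2 * log τ + log (hgt τ y) +
      log (hgt τ z)) + ringR0 (rho τ y z)) + 1 / (4 * π) * (τ / hgt τ y) : ℝ) : ℂ)‖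
      ≤ 1 * (1 / 12 * (6 * -log τ) + 4) + 1 / 12 * (4 / 3) := by
    rw [Complex.norm_real, Real.norm_eq_abs]
    refine (abs_add_le _ _).trans ?_
    rw [abs_mul (τ / (2 * hgt τ y)), abs_mul (1 / (4 * π)) (τ / hgt τ y)]
    have := abs_add_le (1 / (4 * π) * (ringB - 2 * log τ + log (hgt τ y) +
      log (hgt τ z))) (ringR0 (rho τ y z))
    rw [abs_mul (1 / (4 * π))] at this
    have h7 : |1 / (4 * π)| * |ringB - 2 * log τ + log (hgt τ y) + log (hgt τ z)|
      ≤ 1 / 12 * (6 * -log τ) := by gcongr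
    have h8 : |1 / (4 * π)| * |τ / hgt τ y| ≤ 1 / 12 * (4 / 3) := by gcongr
    have h9 := mul_le_mul hα2 (this.trans (add_le_add h7 hr0)) (abs_nonneg _) zero_le_one
    linarith
  have e2 : ‖((rho τ y z * deriv ringR (rho τ y z) : ℝ) : ℂ) *
      (2 * (y - z)⁻¹ - ((τ / hgt τ y : ℝ) : ℂ))‖ ≤ 22 := by
    rw [norm_mul, Complex.norm_real, Real.norm_eq_abs]
    have h6 : ‖2 * (y - z)⁻¹ - ((τ / hgt τ y : ℝ) : ℂ)‖ ≤ 2 * ‖y - z‖⁻¹ + 4 / 3 := by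
      refine (norm_sub_le _ _).trans ?_
      rw [Complex.norm_real, Real.norm_eq_abs]
      simp only [norm_mul, norm_inv, Complex.norm_ofNat]
      linarith
    calc _ ≤ 8 * (τ * ‖y - z‖) * (2 * ‖y - z‖⁻¹ + 4 / 3) := by gcongr
      _ = 16 * τ * (‖y - z‖ * ‖y - z‖⁻¹) + 32 / 3 * (τ * ‖y - z‖) := by ring
      _ ≤ 22 := by rw [mul_inv_cancel₀ hY.ne']; linarith
  have e3 := (norm_add_le _ _).trans (add_le_add e1 e2)
  have := mul_le_mul hq e3 (norm_nonneg _) (by norm_num)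
  refine this.trans ?_
  linarith

lemma rho_self (τ : ℝ) (z : ℂ) : rho τ z z = 0 := by simp [rho]

lemma abs_re_le_of_norm_le {τ η : ℝ} (hτ : 0 < τ) {z : ℂ} (h : τ * ‖z‖ ≤ η) : |τ * z.re| ≤ η := by
  rw [abs_mul, abs_of_pos hτ]
  exact (mul_le_mul_of_nonneg_left (Complex.abs_re_le_norm z) hτ.le).trans h

lemma norm_kernRegGrad_self_le {τ : ℝ} {z : ℂ} (hτ : 0 < τ) (hl : 1 ≤ -log τ)
    (hz : τ * ‖z‖ ≤ 1 / 4) : ‖kernRegGrad τ z z‖ ≤ 60 * -log τ := by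
  have h1 := abs_le.1 (abs_re_le_of_norm_le hτ hz)
  have h2 : 3 / 4 ≤ hgt τ z := by rw [hgt]; linarith [h1.1]
  have h3 : hgt τ z ≤ 5 / 4 := by rw [hgt]; linarith [h1.2]
  have hτ1 : τ ≤ 1 := by
    by_contra h'
    have := log_pos (not_le.1 h'); linarith
  have h4 : |log (hgt τ z)| ≤ 1 := by
    rw [abs_le]
    have a1 := log_le_sub_one_of_pos (show 0 < hgt τ z by linarith)
    have a2 := one_sub_inv_le_log_of_pos (show 0 < hgt τ z by linarith)
    have a3 : (hgt τ z)⁻¹ ≤ 4 / 3 := inv_le_of_inv_le₀ (by norm_num) (by norm_num; linarith)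
    constructor <;> linarith
  have h5 := abs_le.1 h4
  have hB := ringB_mem
  have hs : |ringB - 2 * log τ + log (hgt τ z) + log (hgt τ z)| ≤ 6 * -log τ := by
    rw [abs_le]; constructor <;> linarith [hB.1, hB.2, h5.1, h5.2]
  have hπ : |1 / (4 * π)| ≤ 1 / 12 := by
    rw [abs_of_pos (by positivity)]
    exact one_div_le_one_div_of_le (by norm_num) (by linarith [pi_gt_three])
  have hα : |τ / hgt τ z| ≤ 4 / 3 := by
    rw [abs_of_nonneg (by positivity), div_le_iff₀ (by linarith)]; linarith
  have e : kernRegGrad τ z z = ((hgt τ z ^ 2 * (1 / (4 * π)) * (τ / hgt τ z) *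
      (1 / 2 * (ringB - 2 * log τ + log (hgt τ z) + log (hgt τ z)) + 1) : ℝ) : ℂ) := by
    rw [kernRegGrad, rho_self, ringR0, if_pos rfl, sqrt_mul_self (by linarith)]
    have : hgt τ z ≠ 0 := by linarith
    push_cast
    have : (hgt τ z : ℂ) ≠ 0 := by exact_mod_cast this
    field_simp
    ring
  rw [e, Complex.norm_real, Real.norm_eq_abs, abs_mul, abs_mul, abs_mul, abs_of_nonneg (sq_nonneg _)]
  have h6 : hgt τ z ^ 2 ≤ 2 := by nlinarith
  have h7 : |1 / 2 * (ringB - 2 * log τ + log (hgt τ z) + log (hgt τ z)) + 1| ≤ 4 * -log τ := by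
    refine (abs_add_le _ _).trans ?_
    rw [abs_mul, abs_one, abs_of_pos (by norm_num : (0 : ℝ) < 1 / 2)]; linarith
  calc _ ≤ 2 * (1 / 12) * (4 / 3) * (4 * -log τ) := by gcongr
    _ ≤ _ := by linarith

lemma hasFDerivAt_kernReg_self {τ : ℝ} {z : ℂ} (hτ : 0 < τ) (hl : 1 ≤ -log τ)
    (hz : τ * ‖z‖ < 1 / 4) : HasFDerivAt (fun y => kernReg τ y z) (reMul (kernRegGrad τ z z)) z := by
  have h1 := abs_le.1 (abs_re_le_of_norm_le hτ hz.le)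
  have h2 : 0 < hgt τ z := by rw [hgt]; linarith [h1.1]
  have hR : HasFDerivAt (fun y => ringR0 (rho τ y z)) (reMul 0) z := by
    apply hasFDerivAt_of_remainder (C := 10 * (4 / 3 * τ) ^ (3 / 2 : ℝ))
    have : ∀ᶠ h : ℂ in 𝓝 0, τ * ‖z + h‖ < 1 / 4 := by
      have hc : Continuous fun h : ℂ => τ * ‖z + h‖ := by fun_prop
      exact hc.continuousAt.eventually (Iio_mem_nhds (by simpa using hz))
    filter_upwards [this] with h hh
    rw [rho_self, ringR0, ringR0, if_pos rfl]
    split_ifs with h0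
    · simp; positivity
    · have hn : NearPair τ (1 / 4) (z + h) z := ⟨hτ, hl, le_rfl, hh.le, hz.le, by
        rintro e; exact h0 (by rw [e, rho_self])⟩
      have h3 := abs_ringR_le hn.rho_pos hn.rho_le_one
      have h4 := mul_one_add_abs_log_le hn.rho_pos hn.rho_le_one (t := 1 / 4) (by norm_num)
      have h5 := hn.sqrt_rho_le
      rw [add_sub_cancel_left] at h5
      have h6 : rho τ (z + h) z ^ (1 - 1 / 4 : ℝ) ≤ (4 / 3 * τ) ^ (3 / 2 : ℝ) * ‖h‖ ^ (3 / 2 : ℝ) := by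
        rw [← mul_rpow (by positivity) (norm_nonneg _)]
        calc _ = √(rho τ (z + h) z) ^ (3 / 2 : ℝ) := by
              rw [sqrt_eq_rpow, ← rpow_mul hn.rho_pos.le]; norm_num
          _ ≤ _ := by
              apply rpow_le_rpow (sqrt_nonneg _) _ (by norm_num); linarith
      simp only [sub_zero, reMul_apply, zero_mul, Complex.zero_re]
      norm_num at h4
      norm_num at h6
      linarith
  have h3 := (((hasFDerivAt_log_hgt h2).const_add (ringB - 2 * log τ)).add_const
    (log (hgt τ z))).const_mul (1 / (4 * π))
  refine ((hasFDerivAt_sqrt_hgt h2 h2).mul (h3.add hR)).congr_fderiv ?_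
  ext v
  simp only [kernRegGrad, reMul_apply, smul_apply, smul_eq_mul, add_apply, mul_assoc,
    Complex.re_ofReal_mul, Pi.add_apply, rho_self, zero_mul, Complex.ofReal_zero, add_zero,
    Complex.zero_re]
  ring

lemma kernReg_lipschitz {τ : ℝ} {y y' z : ℂ} (hτ : 0 < τ) (hl : 1 ≤ -log τ)
    (hz : τ * ‖z‖ < 1 / 4) (hy : τ * ‖y‖ < 1 / 4) (hy' : τ * ‖y'‖ < 1 / 4) :
    |kernReg τ y z - kernReg τ y' z| ≤ 60 * -log τ * ‖y - y'‖ := by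
  have hm : ∀ w : ℂ, w ∈ Metric.ball (0 : ℂ) (1 / 4 / τ) ↔ τ * ‖w‖ < 1 / 4 := fun w => by
    rw [mem_ball_zero_iff, lt_div_iff₀ hτ, mul_comm]
  refine (convex_ball (0 : ℂ) (1 / 4 / τ)).norm_image_sub_le_of_norm_hasFDerivWithin_le
    (f := fun y => kernReg τ y z) (f' := fun y => reMul (kernRegGrad τ y z))
    (fun w hw => ?_) (fun w hw => ?_) ((hm y').2 hy') ((hm y).2 hy)
  · rw [hm] at hw
    by_cases e : w = z
    · subst e; exact (hasFDerivAt_kernReg_self hτ hl hz).hasFDerivWithinAt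
    · exact (NearPair.hasFDerivAt_kernReg (η := 1 / 4)
        ⟨hτ, hl, le_rfl, hw.le, hz.le, e⟩).hasFDerivWithinAt
  · rw [hm] at hw
    refine (norm_reMul_le _).trans ?_
    by_cases e : w = z
    · subst e; exact norm_kernRegGrad_self_le hτ hl hz.le
    · exact NearPair.norm_kernRegGrad_le (η := 1 / 4) ⟨hτ, hl, le_rfl, hw.le, hz.le, e⟩

/-- Measurable sets in the region where the kernel expansions hold. -/
structure IsRegion (τ : ℝ) (B : Set ℂ) : Prop where
  τ_pos : 0 < τ
  one_le : 1 ≤ -log τ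
  measurableSet : MeasurableSet B
  le : ∀ z ∈ B, τ * ‖z‖ ≤ 1 / 8

/-- The potential of a cross-section. -/
def spot (τ : ℝ) (B : Set ℂ) (y : ℂ) : ℝ := ∫ z in B, kern τ y z

/-- The gradient of `spot`. -/
def spotGrad (τ : ℝ) (B : Set ℂ) (y : ℂ) : ℂ := ∫ z in B, kernGrad τ y z

lemma ae_ne (y : ℂ) (B : Set ℂ) : ∀ᵐ z ∂volume.restrict B, y ≠ z := by
  filter_upwards [ae_restrict_of_ae (measure_eq_zero_iff_ae_notMem.1
    (measure_singleton (μ := volume) y))] with z hz e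
  exact hz e.symm

lemma continuous_reMul : Continuous reMul :=
  continuous_const.clm_comp (ContinuousLinearMap.mul ℝ ℂ).continuous

/-- The weight of the logarithmic part of `kern`. -/
def logWeight (τ : ℝ) (B : Set ℂ) : ℂ → ℝ :=
  B.indicator fun z => hgt τ z * √(hgt τ z) / (2 * π)

namespace IsRegion
variable {τ : ℝ} {B : Set ℂ}

lemma norm_le (h : IsRegion τ B) : ∀ z ∈ B, ‖z‖ ≤ 1 / 8 / τ := fun z hz => by
  rw [le_div_iff₀ h.τ_pos, mul_comm]; exact h.le z hz

lemma volume_lt_top (h : IsRegion τ B) : volume B < ⊤ :=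
  (measure_mono fun z hz => mem_closedBall_zero_iff.2 (h.norm_le z hz)).trans_lt
    measure_closedBall_lt_top

lemma isFiniteMeasure (h : IsRegion τ B) : IsFiniteMeasure (volume.restrict B) :=
  ⟨by simpa using h.volume_lt_top⟩

lemma nearPair (h : IsRegion τ B) {y : ℂ} (hy : τ * ‖y‖ ≤ 1 / 4) {z : ℂ} (hz : z ∈ B)
    (hne : y ≠ z) : NearPair τ (1 / 4) y z :=
  ⟨h.τ_pos, h.one_le, le_rfl, hy, (h.le z hz).trans (by norm_num), hne⟩

lemma ae_nearPair (h : IsRegion τ B) {y : ℂ} (hy : τ * ‖y‖ ≤ 1 / 4) :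
    ∀ᵐ z ∂volume.restrict B, NearPair τ (1 / 4) y z := by
  filter_upwards [ae_ne y B, ae_restrict_mem h.measurableSet] with z h1 h2
  exact h.nearPair hy h2 h1

lemma integrableOn_log (h : IsRegion τ B) (y : ℂ) :
    IntegrableOn (fun z => log ‖y - z‖) B := by
  rw [← integrable_indicator_iff h.measurableSet]
  refine ((isDensity_ind h.measurableSet h.norm_le).integrable_log y).congr
    (Eventually.of_forall fun z => ?_)
  by_cases hz : z ∈ B <;> simp [ind, hz]

lemma integrableOn_inv (h : IsRegion τ B) (y : ℂ) : IntegrableOn (fun z => (y - z)⁻¹) B := by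
  rw [← integrable_indicator_iff h.measurableSet]
  refine ((isDensity_ind h.measurableSet h.norm_le).integrable_inv y).congr
    (Eventually.of_forall fun z => ?_)
  by_cases hz : z ∈ B <;> simp [ind, hz]

lemma integrableOn_const (h : IsRegion τ B) (c : ℝ) : IntegrableOn (fun _ : ℂ => c) B :=
  MeasureTheory.integrableOn_const h.volume_lt_top.ne

lemma integrableOn_wlog (h : IsRegion τ B) (y : ℂ) : IntegrableOn (fun z => wlog τ y z) B :=
  (h.integrableOn_const _).add (h.integrableOn_log y).abs

lemma integrableOn_kern (h : IsRegion τ B) {y : ℂ} (hy : τ * ‖y‖ ≤ 1 / 4) :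
    IntegrableOn (kern τ y) B := by
  refine ((h.integrableOn_wlog y).const_mul 16).mono'
    ((measurable_kern τ).comp measurable_prodMk_left).aestronglyMeasurable ?_
  filter_upwards [h.ae_nearPair hy] with z hz
  exact hz.abs_kern_le

lemma integrableOn_kernGrad (h : IsRegion τ B) {y : ℂ} (hy : τ * ‖y‖ ≤ 1 / 4) :
    IntegrableOn (kernGrad τ y) B := by
  refine Integrable.mono' (((h.integrableOn_wlog y).const_mul (60 * τ)).add
    ((h.integrableOn_inv y).norm.const_mul 16))
    ((measurable_kernGrad τ).comp measurable_prodMk_left).aestronglyMeasurable ?_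
  filter_upwards [h.ae_nearPair hy] with z hz
  have h1 := hz.norm_kernGrad_add_le
  have h2 := norm_sub_le (kernGrad τ y z + (1 / (2 * π) : ℝ) * (y - z)⁻¹)
    ((1 / (2 * π) : ℝ) * (y - z)⁻¹)
  rw [add_sub_cancel_right, norm_mul, Complex.norm_real, Real.norm_eq_abs,
    abs_of_pos (by positivity)] at h2
  have h3 : 1 / (2 * π) ≤ 1 := by
    rw [div_le_one (by positivity)]; linarith [pi_gt_three]
  have h4 : 1 / (2 * π) * ‖(y - z)⁻¹‖ ≤ 1 * ‖(y - z)⁻¹‖ := by gcongr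
  rw [div_eq_mul_inv _ ‖y - z‖, ← norm_inv] at h1
  simp only [Pi.add_apply]
  linarith

lemma integral_logWeight_mul (h : IsRegion τ B) (g : ℂ → ℝ) :
    ∫ z in B, logWeight τ B z * g z = ∫ z, logWeight τ B z * g z := by
  rw [← integral_indicator h.measurableSet]
  congr 1 with z
  by_cases hz : z ∈ B <;> simp [logWeight, hz]

lemma integral_logWeight_mul' (h : IsRegion τ B) (g : ℂ → ℂ) :
    ∫ z in B, (logWeight τ B z : ℂ) * g z = ∫ z, (logWeight τ B z : ℂ) * g z := by
  rw [← integral_indicator h.measurableSet]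
  congr 1 with z
  by_cases hz : z ∈ B <;> simp [logWeight, hz]

lemma kernRegGrad_ae_eq (h : IsRegion τ B) {y : ℂ} (hy : τ * ‖y‖ ≤ 1 / 4) :
    ∀ᵐ z ∂volume.restrict B, kernRegGrad τ y z = kernGrad τ y z
      + ((√(hgt τ y) * (τ / (2 * hgt τ y)) * (logWeight τ B z * log ‖y - z‖) : ℝ) : ℂ)
      + (√(hgt τ y) : ℝ) * ((logWeight τ B z : ℂ) * (y - z)⁻¹) := by
  filter_upwards [h.ae_nearPair hy, ae_restrict_mem h.measurableSet] with z hz hB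
  rw [hz.kernRegGrad_eq, logWeight, Set.indicator_of_mem hB, sqrt_mul (by linarith [hz.hgt_ge])]
  push_cast
  ring

lemma isDensity_logWeight (h : IsRegion τ B) : IsDensity (logWeight τ B) 2 (1 / 8 / τ) where
  measurable := Measurable.indicator (by fun_prop) h.measurableSet
  pos := two_pos
  bound z := by
    by_cases hz : z ∈ B
    · have h1 := abs_le.1 (abs_re_le_of_norm_le h.τ_pos (h.le z hz))
      rw [logWeight, Set.indicator_of_mem hz]
      have h2 : 0 ≤ hgt τ z := by rw [hgt]; linarith [h1.1]
      have h3 : hgt τ z ≤ 9 / 8 := by rw [hgt]; linarith [h1.2]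
      have h4 : √(hgt τ z) ≤ 9 / 8 := sqrt_le_iff.2 ⟨by norm_num, by linarith⟩
      rw [abs_of_nonneg (by positivity), div_le_iff₀ (by positivity)]
      nlinarith [sqrt_nonneg (hgt τ z), pi_gt_three]
    · rw [logWeight, Set.indicator_of_notMem hz]; norm_num
  supp z hz := Set.indicator_of_notMem (fun hB => absurd (h.norm_le z hB) (not_le.2 hz)) _

lemma hasFDerivAt_integral_kernReg (h : IsRegion τ B) {y : ℂ} (hy : τ * ‖y‖ < 1 / 4) :
    Integrable (fun z => reMul (kernRegGrad τ y z)) (volume.restrict B) ∧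
      HasFDerivAt (fun y => ∫ z in B, kernReg τ y z) (∫ z in B, reMul (kernRegGrad τ y z)) y := by
  have hfin := h.isFiniteMeasure
  have hV : {y : ℂ | τ * ‖y‖ < 1 / 4} ∈ 𝓝 y :=
    (isOpen_lt (by fun_prop) continuous_const).mem_nhds hy
  have hd := h.isDensity_logWeight
  have key : ∀ y : ℂ, τ * ‖y‖ ≤ 1 / 4 → kernReg τ y =ᵐ[volume.restrict B] fun z => kern τ y z +
      √(hgt τ y) * (logWeight τ B z * log ‖y - z‖) := fun y hy => by
    filter_upwards [h.ae_nearPair hy, ae_restrict_mem h.measurableSet] with z hz hB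
    rw [hz.kern_eq, logWeight, Set.indicator_of_mem hB, sqrt_mul (by linarith [hz.hgt_ge])]
    ring
  have hint : ∀ y : ℂ, τ * ‖y‖ ≤ 1 / 4 → Integrable (kernReg τ y) (volume.restrict B) :=
    fun y hy => ((h.integrableOn_kern hy).add
      (((hd.integrable_log y).const_mul _).integrableOn)).congr (key y hy).symm
  have hgrad : AEStronglyMeasurable (fun z => kernRegGrad τ y z) (volume.restrict B) := by
    have m1 : Measurable fun z => kernGrad τ y z :=
      (measurable_kernGrad τ).comp measurable_prodMk_left
    have m2 := hd.measurable
    have m3 : Measurable fun z : ℂ => log ‖y - z‖ := measurable_log.comp (by fun_prop)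
    refine AEStronglyMeasurable.congr (Measurable.aestronglyMeasurable ?_)
      (EventuallyEq.symm (h.kernRegGrad_ae_eq hy.le))
    fun_prop
  refine hasFDerivAt_integral_of_dominated_loc_of_lip' (bound := fun _ => 60 * -log τ) hV
    (fun x hx => (hint x hx.le).aestronglyMeasurable) (hint y hy.le)
    (continuous_reMul.comp_aestronglyMeasurable hgrad) ?_ (integrable_const _) ?_
  · filter_upwards [ae_restrict_mem h.measurableSet] with z hB x hx
    exact kernReg_lipschitz h.τ_pos h.one_le ((h.le z hB).trans_lt (by norm_num)) hx hy
  · filter_upwards [h.ae_nearPair hy.le] with z hz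
    exact hz.hasFDerivAt_kernReg

lemma hasFDerivAt_spot (h : IsRegion τ B) {y : ℂ} (hy : τ * ‖y‖ < 1 / 4) :
    HasFDerivAt (spot τ B) (reMul (spotGrad τ B y)) y := by
  have hd := h.isDensity_logWeight
  obtain ⟨i1, h1⟩ := h.hasFDerivAt_integral_kernReg hy
  have hV : {y : ℂ | τ * ‖y‖ < 1 / 4} ∈ 𝓝 y :=
    (isOpen_lt (by fun_prop) continuous_const).mem_nhds hy
  have hre := abs_le.1 (abs_re_le_of_norm_le h.τ_pos hy.le)
  have hy0 : 0 < hgt τ y := by rw [hgt]; linarith [hre.1]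
  have h2 := (hasFDerivAt_sqrt_hgt (z := 0) hy0 (by simp [hgt])).mul (hasFDerivAt_logPot hd y)
  refine ((h1.sub h2).congr_of_eventuallyEq ?_).congr_fderiv ?_
  · filter_upwards [hV] with x hx
    have e : ∫ z in B, kernReg τ x z = ∫ z in B, (kern τ x z +
        √(hgt τ x) * (logWeight τ B z * log ‖x - z‖)) := by
      refine integral_congr_ae ?_
      filter_upwards [h.ae_nearPair hx.le, ae_restrict_mem h.measurableSet] with z hz hB
      rw [hz.kern_eq, logWeight, Set.indicator_of_mem hB, sqrt_mul (by linarith [hz.hgt_ge])]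
      ring
    rw [integral_add (h.integrableOn_kern hx.le) ((hd.integrable_log x).const_mul _).integrableOn,
      integral_const_mul, integral_logWeight_mul h] at e
    simp only [Pi.sub_apply, Pi.mul_apply, e, spot, logPot]
    simp [hgt]
  · have e2 : ∫ z in B, kernRegGrad τ y z = spotGrad τ B y
        + ((√(hgt τ y) * (τ / (2 * hgt τ y)) * logPot (logWeight τ B) y : ℝ) : ℂ)
        + (√(hgt τ y) : ℝ) * cauPot (logWeight τ B) y := by
      rw [integral_congr_ae (h.kernRegGrad_ae_eq hy.le), integral_add, integral_add,
        integral_complex_ofReal, integral_const_mul, integral_const_mul, integral_logWeight_mul h,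
        integral_logWeight_mul' h]
      · rfl
      · exact h.integrableOn_kernGrad hy.le
      · exact (((hd.integrable_log y).const_mul _).integrableOn).ofReal
      · exact (h.integrableOn_kernGrad hy.le).add
          (((hd.integrable_log y).const_mul _).integrableOn).ofReal
      · exact ((hd.integrable_inv y).const_mul _).integrableOn
    have e3 : Integrable (kernRegGrad τ y) (volume.restrict B) := by
      refine Integrable.congr ?_ (EventuallyEq.symm (h.kernRegGrad_ae_eq hy.le))
      exact ((h.integrableOn_kernGrad hy.le).add
          (((hd.integrable_log y).const_mul _).integrableOn).ofReal).add
        ((hd.integrable_inv y).const_mul _).integrableOn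
    ext v
    have e4 : (∫ z in B, reMul (kernRegGrad τ y z)) v = ((∫ z in B, kernRegGrad τ y z) * v).re := by
      rw [ContinuousLinearMap.integral_apply i1, ← integral_mul_const]
      exact integral_re (𝕜 := ℂ) (e3.mul_const v)
    simp only [sub_apply, e4, e2, add_apply, smul_apply, reMul_apply, smul_eq_mul, add_mul,
      Complex.add_re, mul_assoc, Complex.re_ofReal_mul]
    simp [hgt]
    ring
end IsRegion

lemma IsDensity.integrable_prod {f g : ℂ → ℝ} {M R M' R' : ℝ} (hf : IsDensity f M R)
    (hg : IsDensity g M' R') {a : ℝ} (ha : 0 ≤ a) (ha2 : a < 2) :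
    Integrable (fun p : ℂ × ℂ => f p.1 * g p.2 * ‖p.1 - p.2‖ ^ (-a)) (volume.prod volume) := by
  have hm : Measurable fun p : ℂ × ℂ => f p.1 * g p.2 * ‖p.1 - p.2‖ ^ (-a) := by
    have := hf.measurable
    have := hg.measurable
    fun_prop
  obtain ⟨C, hC, hb⟩ := hg.exists_pow_le ha ha2
  rw [integrable_prod_iff hm.aestronglyMeasurable]
  have e : ∀ y z : ℂ, ‖f y * g z * ‖y - z‖ ^ (-a)‖ = |f y| * (|g z| * ‖y - z‖ ^ (-a)) := fun y z => by
    rw [Real.norm_eq_abs, abs_mul, abs_mul, abs_of_nonneg (rpow_nonneg (norm_nonneg _) _), mul_assoc]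
  refine ⟨Eventually.of_forall fun y => ?_, ?_⟩
  · refine ((hg.integrable_pow ha ha2 y).const_mul |f y|).mono'
      (hm.comp measurable_prodMk_left).aestronglyMeasurable (Eventually.of_forall fun z => (e y z).le)
  · refine (hf.integrable.abs.mul_const C).mono'
      (hm.stronglyMeasurable.norm.integral_prod_right (ν := volume)).aestronglyMeasurable
      (Eventually.of_forall fun y => ?_)
    rw [Real.norm_of_nonneg (integral_nonneg fun _ => norm_nonneg _)]
    simp_rw [e]
    rw [integral_const_mul]
    exact mul_le_mul_of_nonneg_left (hb y) (abs_nonneg _)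

/-- A bounded superlevel set of a differentiable function with gradient `G`. -/
structure IsLevelSet (h : ℂ → ℝ) (G : ℂ → ℂ) (B : Set ℂ) (R M : ℝ) : Prop where
  R_pos : 0 < R
  deriv : ∀ y, ‖y‖ < 2 * R → HasFDerivAt h (reMul (G y)) y
  mem_iff : ∀ y, ‖y‖ < 2 * R → (y ∈ B ↔ 0 < h y)
  norm_le : ∀ y ∈ B, ‖y‖ ≤ R
  bound : ∀ y ∈ B, ‖G y‖ ≤ M
  measurable : Measurable G
  measurable_fun : Measurable h

/-- A regularized positive part of `h`. -/
def smoothPos (h : ℂ → ℝ) (B : Set ℂ) (δ : ℝ) : ℂ → ℝ := B.indicator fun y => h y ^ 2 / (h y + δ)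

/-- The gradient of `smoothPos`. -/
def smoothGrad (h : ℂ → ℝ) (G : ℂ → ℂ) (B : Set ℂ) (δ : ℝ) : ℂ → ℂ :=
  B.indicator fun y => ((1 - δ ^ 2 / (h y + δ) ^ 2 : ℝ) : ℂ) * G y

namespace IsLevelSet
variable {h : ℂ → ℝ} {G : ℂ → ℂ} {B : Set ℂ} {R M δ : ℝ}

lemma norm_lt (H : IsLevelSet h G B R M) : ∀ y ∈ B, ‖y‖ < 2 * R := fun y hy => by
  linarith [H.norm_le y hy, H.R_pos]

lemma pos (H : IsLevelSet h G B R M) {y : ℂ} (hy : y ∈ B) : 0 < h y :=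
  (H.mem_iff y (H.norm_lt y hy)).1 hy

lemma isOpen (H : IsLevelSet h G B R M) : IsOpen B := by
  rw [isOpen_iff_mem_nhds]
  intro y hy
  filter_upwards [(isOpen_lt continuous_norm continuous_const).mem_nhds (H.norm_lt y hy),
    (H.deriv y (H.norm_lt y hy)).continuousAt.eventually (Ioi_mem_nhds (H.pos hy))] with x hx hx'
  exact (H.mem_iff x hx).2 hx'

lemma measurableSet (H : IsLevelSet h G B R M) : MeasurableSet B := H.isOpen.measurableSet

lemma isDensity (H : IsLevelSet h G B R M) : IsDensity (ind B) 1 R :=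
  isDensity_ind H.measurableSet H.norm_le

lemma volume_lt_top (H : IsLevelSet h G B R M) : volume B < ⊤ :=
  (measure_mono fun z hz => mem_closedBall_zero_iff.2 (H.norm_le z hz)).trans_lt
    measure_closedBall_lt_top

lemma continuousOn (H : IsLevelSet h G B R M) : ContinuousOn h (Metric.ball 0 (2 * R)) :=
  fun y hy => (H.deriv y (by simpa using hy)).continuousAt.continuousWithinAt

lemma exists_le (H : IsLevelSet h G B R M) : ∃ C, 0 < C ∧ ∀ y ∈ B, h y ≤ C := by
  obtain ⟨C, hC⟩ := (isCompact_closedBall (0 : ℂ) R).exists_bound_of_continuousOn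
    (H.continuousOn.mono (Metric.closedBall_subset_ball (by linarith [H.R_pos])))
  exact ⟨|C| + 1, by positivity, fun y hy => by
    have := hC y (by simpa using H.norm_le y hy)
    linarith [le_abs_self (h y), le_abs_self C, Real.norm_eq_abs (h y)]⟩

lemma integrableOn (H : IsLevelSet h G B R M) : IntegrableOn h B := by
  obtain ⟨C, hC, hb⟩ := H.exists_le
  refine Measure.integrableOn_of_bounded (M := C) H.volume_lt_top.ne
    H.measurable_fun.aestronglyMeasurable ?_
  filter_upwards [ae_restrict_mem H.measurableSet] with y hy
  rw [Real.norm_eq_abs, abs_of_pos (H.pos hy)]; exact hb y hy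

lemma integrableOn_grad (H : IsLevelSet h G B R M) : IntegrableOn G B := by
  refine Measure.integrableOn_of_bounded (M := M) H.volume_lt_top.ne
    H.measurable.aestronglyMeasurable ?_
  filter_upwards [ae_restrict_mem H.measurableSet] with y hy using H.bound y hy

lemma hasFDerivAt_smoothPos (H : IsLevelSet h G B R M) (hδ : 0 < δ) (y : ℂ) :
    HasFDerivAt (smoothPos h B δ) (reMul (smoothGrad h G B δ y)) y := by
  by_cases hy : y ∈ B
  · have hp := H.pos hy
    have hd := H.deriv y (H.norm_lt y hy)
    have h1 : HasDerivAt (fun s : ℝ => s ^ 2 / (s + δ)) (1 - δ ^ 2 / (h y + δ) ^ 2) (h y) := by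
      refine (((hasDerivAt_id (h y)).pow 2).div ((hasDerivAt_id (h y)).add_const δ)
        (by simp; linarith)).congr_deriv ?_
      have : h y + δ ≠ 0 := by linarith
      simp
      field_simp
      ring
    refine ((h1.comp_hasFDerivAt y hd).congr_of_eventuallyEq ?_).congr_fderiv ?_
    · filter_upwards [H.isOpen.mem_nhds hy] with x hx
      rw [smoothPos, Set.indicator_of_mem hx]; rfl
    · ext v
      rw [smoothGrad, Set.indicator_of_mem hy]
      simp only [smul_apply, reMul_apply, smul_eq_mul, mul_assoc, Complex.re_ofReal_mul]
  · rw [smoothGrad, Set.indicator_of_notMem hy]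
    have h0 : reMul 0 = 0 := by ext v; simp
    rw [h0]
    by_cases hn : ‖y‖ < 2 * R
    · have hy0 : h y ≤ 0 := not_lt.1 fun h' => hy ((H.mem_iff y hn).2 h')
      have h1 := (H.deriv y hn).isBigO_sub
      have h2 : smoothPos h B δ =O[𝓝 y] fun x => ‖h x - h y‖ ^ 2 := by
        refine Asymptotics.IsBigO.of_bound (1 / δ) (Eventually.of_forall fun x => ?_)
        by_cases hx : x ∈ B
        · have hp := H.pos hx
          rw [smoothPos, Set.indicator_of_mem hx, Real.norm_of_nonneg (by positivity), norm_pow,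
            norm_norm, Real.norm_of_nonneg (by linarith), div_le_iff₀ (by linarith)]
          have h3 : h x ^ 2 ≤ (h x - h y) ^ 2 := by nlinarith
          calc h x ^ 2 ≤ (h x - h y) ^ 2 := h3
            _ = 1 / δ * (h x - h y) ^ 2 * δ := by field_simp
            _ ≤ 1 / δ * (h x - h y) ^ 2 * (h x + δ) := by gcongr; linarith
        · rw [smoothPos, Set.indicator_of_notMem hx]; simp; positivity
      exact (h2.trans (h1.norm_norm.pow 2)).hasFDerivAt (by norm_num)
    · refine (hasFDerivAt_const (0 : ℝ) y).congr_of_eventuallyEq ?_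
      have : y ∈ {x : ℂ | R < ‖x‖} := by
        have := H.R_pos; simp only [Set.mem_ofPred_eq]; linarith
      filter_upwards [(isOpen_lt continuous_const continuous_norm).mem_nhds this] with x hx
      exact Set.indicator_of_notMem (fun hB => absurd (H.norm_le x hB) (not_le.2 hx)) _

lemma smoothPos_eq_zero (H : IsLevelSet h G B R M) {y : ℂ} (hy : R < ‖y‖) :
    smoothPos h B δ y = 0 :=
  Set.indicator_of_notMem (fun hB => absurd (H.norm_le y hB) (not_le.2 hy)) _

lemma smoothGrad_eq_zero (H : IsLevelSet h G B R M) {y : ℂ} (hy : R < ‖y‖) :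
    smoothGrad h G B δ y = 0 :=
  Set.indicator_of_notMem (fun hB => absurd (H.norm_le y hB) (not_le.2 hy)) _

lemma factor_mem (H : IsLevelSet h G B R M) (hδ : 0 < δ) {y : ℂ} (hy : y ∈ B) :
    0 ≤ 1 - δ ^ 2 / (h y + δ) ^ 2 ∧ 1 - δ ^ 2 / (h y + δ) ^ 2 ≤ 1 := by
  have hp := H.pos hy
  have h1 : δ ^ 2 / (h y + δ) ^ 2 ≤ 1 := by
    rw [div_le_one (by positivity)]; gcongr; linarith
  have h2 : 0 ≤ δ ^ 2 / (h y + δ) ^ 2 := by positivity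
  constructor <;> linarith

lemma norm_smoothGrad_le (H : IsLevelSet h G B R M) (hδ : 0 < δ) (y : ℂ) :
    ‖smoothGrad h G B δ y‖ ≤ |M| * ind B y := by
  by_cases hy : y ∈ B
  · rw [smoothGrad, ind, Set.indicator_of_mem hy, Set.indicator_of_mem hy, norm_mul,
      Complex.norm_real, Real.norm_of_nonneg (H.factor_mem hδ hy).1, mul_one]
    have := mul_le_mul (H.factor_mem hδ hy).2 (H.bound y hy) (norm_nonneg _) zero_le_one
    linarith [le_abs_self M]
  · simp [smoothGrad, ind, hy]

lemma continuous_smoothPos (H : IsLevelSet h G B R M) (hδ : 0 < δ) :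
    Continuous (smoothPos h B δ) :=
  continuous_iff_continuousAt.2 fun y => (H.hasFDerivAt_smoothPos hδ y).continuousAt

lemma measurable_smoothGrad (H : IsLevelSet h G B R M) : Measurable (smoothGrad h G B δ) := by
  have h1 := H.measurable
  have h2 := H.measurable_fun
  exact Measurable.indicator (by fun_prop) H.measurableSet

lemma smoothPos_mem (H : IsLevelSet h G B R M) (hδ : 0 < δ) (y : ℂ) :
    0 ≤ smoothPos h B δ y ∧ smoothPos h B δ y ≤ B.indicator h y := by
  by_cases hy : y ∈ B
  · have hp := H.pos hy
    rw [smoothPos, Set.indicator_of_mem hy, Set.indicator_of_mem hy]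
    refine ⟨by positivity, ?_⟩
    rw [div_le_iff₀ (by linarith)]
    nlinarith
  · simp [smoothPos, hy]

lemma integrable_indicator (H : IsLevelSet h G B R M) : Integrable (B.indicator h) :=
  (integrable_indicator_iff H.measurableSet).2 H.integrableOn

lemma integrable_smoothPos (H : IsLevelSet h G B R M) (hδ : 0 < δ) :
    Integrable (smoothPos h B δ) := by
  refine H.integrable_indicator.mono' (H.continuous_smoothPos hδ).aestronglyMeasurable
    (Eventually.of_forall fun y => ?_)
  rw [Real.norm_of_nonneg (H.smoothPos_mem hδ y).1]; exact (H.smoothPos_mem hδ y).2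

lemma tendsto_smoothPos (H : IsLevelSet h G B R M) (E : Set ℂ) :
    Tendsto (fun n : ℕ => ∫ y in E, smoothPos h B (1 / ((n : ℝ) + 1)) y) atTop
      (𝓝 (∫ y in E, B.indicator h y)) := by
  refine tendsto_integral_of_dominated_convergence (B.indicator h)
    (fun n => (H.continuous_smoothPos (by positivity)).aestronglyMeasurable)
    H.integrable_indicator.integrableOn (fun n => Eventually.of_forall fun y => ?_)
    (Eventually.of_forall fun y => ?_)
  · have := H.smoothPos_mem (δ := 1 / ((n : ℝ) + 1)) (by positivity) y
    rw [Real.norm_of_nonneg this.1]; exact this.2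
  · by_cases hy : y ∈ B
    · have hp := H.pos hy
      simp only [smoothPos, Set.indicator_of_mem hy]
      have := (tendsto_const_nhds (x := h y ^ 2)).div
        ((tendsto_const_nhds (x := h y)).add tendsto_one_div_add_atTop_nhds_zero_nat) (by simpa using hp.ne')
      rw [add_zero, pow_two, mul_div_assoc, div_self hp.ne', mul_one] at this
      refine this.congr fun n => ?_
      simp [pow_two]
    · simp [smoothPos, hy]

lemma integrable_mul_smoothGrad (H : IsLevelSet h G B R M) (hδ : 0 < δ) {φ : ℂ → ℂ}
    (hm : Measurable φ) (hφ : IntegrableOn φ B) :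
    Integrable fun y => φ y * smoothGrad h G B δ y := by
  refine (((integrable_indicator_iff H.measurableSet).2 hφ).norm.mul_const |M|).mono'
    (hm.mul H.measurable_smoothGrad).aestronglyMeasurable (Eventually.of_forall fun y => ?_)
  have := H.norm_smoothGrad_le hδ y
  by_cases hy : y ∈ B
  · rw [ind, Set.indicator_of_mem hy, mul_one] at this
    rw [norm_mul, Set.indicator_of_mem hy]
    exact mul_le_mul_of_nonneg_left this (norm_nonneg _)
  · simp [smoothGrad, hy]

lemma tendsto_smoothGrad (H : IsLevelSet h G B R M) {φ : ℂ → ℂ}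
    (hm : Measurable φ) (hφ : IntegrableOn φ B) :
    Tendsto (fun n : ℕ => ∫ y, (φ y * smoothGrad h G B (1 / ((n : ℝ) + 1)) y).re) atTop
      (𝓝 (∫ y in B, (φ y * G y).re)) := by
  rw [← integral_indicator H.measurableSet]
  refine tendsto_integral_of_dominated_convergence (fun y => ‖B.indicator φ y‖ * |M|)
    (fun n => (Complex.measurable_re.comp (hm.mul H.measurable_smoothGrad)).aestronglyMeasurable)
    (((integrable_indicator_iff H.measurableSet).2 hφ).norm.mul_const |M|)
    (fun n => Eventually.of_forall fun y => ?_)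
    (Eventually.of_forall fun y => ?_)
  · have := H.norm_smoothGrad_le (δ := 1 / ((n : ℝ) + 1)) (by positivity) y
    by_cases hy : y ∈ B
    · rw [ind, Set.indicator_of_mem hy, mul_one] at this
      rw [Set.indicator_of_mem hy]
      exact (Complex.abs_re_le_norm _).trans ((norm_mul _ _).trans_le
        (mul_le_mul_of_nonneg_left this (norm_nonneg _)))
    · simp [smoothGrad, hy]
  · by_cases hy : y ∈ B
    · have hp := H.pos hy
      simp only [smoothGrad, Set.indicator_of_mem hy]
      have h0 := tendsto_one_div_add_atTop_nhds_zero_nat (𝕜 := ℝ)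
      have h1 := (tendsto_const_nhds (x := (1 : ℝ)) (f := atTop)).sub ((h0.pow 2).div
        (((tendsto_const_nhds (x := h y)).add h0).pow 2) (by simpa using hp.ne'))
      have h2 := h1.mul_const ((φ y * G y).re)
      simp only [ne_eq, OfNat.ofNat_ne_zero, not_false_eq_true, zero_pow, zero_div, sub_zero,
        one_mul] at h2
      refine h2.congr fun n => ?_
      rw [mul_left_comm, Complex.re_ofReal_mul]
      rfl
    · simp [smoothGrad, hy]

/-- Integration by parts against an affine function. -/
lemma integral_grad (H : IsLevelSet h G B R M) {f : ℂ → ℝ} {L : ℂ →L[ℝ] ℝ}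
    (hf : ∀ y, HasFDerivAt f L y) (v : ℂ) :
    ∫ y in B, f y * (G y * v).re = -(L v * ∫ y in B, h y) := by
  have hfc : Continuous f := continuous_iff_continuousAt.2 fun y => (hf y).continuousAt
  have hfi : IntegrableOn f B := (hfc.continuousOn.integrableOn_compact
    (isCompact_closedBall (0 : ℂ) R)).mono_set fun y hy => by simpa using H.norm_le y hy
  have hφm : Measurable fun y => (f y : ℂ) * v := by
    have := hfc.measurable
    fun_prop
  have hφ : IntegrableOn (fun y => (f y : ℂ) * v) B := hfi.ofReal.mul_const v
  have key : ∀ n : ℕ, ∫ y, ((f y : ℂ) * v * smoothGrad h G B (1 / ((n : ℝ) + 1)) y).re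
      = -(L v * ∫ y in Set.univ, smoothPos h B (1 / ((n : ℝ) + 1)) y) := by
    intro n
    have hδ : (0 : ℝ) < 1 / ((n : ℝ) + 1) := by positivity
    have e : ∀ y, ((f y : ℂ) * v * smoothGrad h G B (1 / ((n : ℝ) + 1)) y).re
        = ContinuousLinearMap.mul ℝ ℝ (f y) (reMul (smoothGrad h G B (1 / ((n : ℝ) + 1)) y) v) := by
      intro y
      rw [mul_assoc, Complex.re_ofReal_mul, ContinuousLinearMap.mul_apply', reMul_apply, mul_comm v]
    rw [integral_congr_ae (Eventually.of_forall e),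
      integral_bilinear_hasFDerivAt_right_eq_neg_left_of_integrable (f' := fun _ => L) ?_ ?_ ?_ (fun y _ => hf y)
        (fun y _ => H.hasFDerivAt_smoothPos hδ y), setIntegral_univ, ← integral_const_mul]
    · rfl
    · exact (H.integrable_smoothPos hδ).const_mul (L v)
    · exact ((H.integrable_mul_smoothGrad hδ hφm hφ).re).congr (Eventually.of_forall e)
    · refine (integrable_indicator_iff H.measurableSet).2 ?_ |>.congr (f := B.indicator fun y =>
        f y * smoothPos h B (1 / ((n : ℝ) + 1)) y) (Eventually.of_forall fun y => ?_)
      · exact (((hfc.mul (H.continuous_smoothPos hδ)).continuousOn).integrableOn_compact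
          (isCompact_closedBall (0 : ℂ) R)).mono_set fun y hy => by simpa using H.norm_le y hy
      · by_cases hy : y ∈ B <;> simp [smoothPos, hy]
  have h1 := H.tendsto_smoothGrad hφm hφ
  have h2 := ((H.tendsto_smoothPos Set.univ).const_mul (L v)).neg
  rw [setIntegral_univ, integral_indicator H.measurableSet] at h2
  simp_rw [key] at h1
  rw [← tendsto_nhds_unique h1 h2]
  refine integral_congr_ae (Eventually.of_forall fun y => ?_)
  simp only [mul_assoc, Complex.re_ofReal_mul, mul_comm v]

lemma integral_re_grad (H : IsLevelSet h G B R M) : ∫ y in B, (G y).re = 0 := by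
  have := H.integral_grad (f := fun _ => 1) (L := 0) (fun y => hasFDerivAt_const _ _) 1
  simpa using this

lemma integral_dilation (H : IsLevelSet h G B R M) :
    ∫ y in B, (y * G y).re = -(2 * ∫ y in B, h y) := by
  have h1 := H.integral_grad (f := Complex.reCLM) (L := Complex.reCLM)
    (fun y => Complex.reCLM.hasFDerivAt) 1
  have h2 := H.integral_grad (f := Complex.imCLM) (L := Complex.imCLM)
    (fun y => Complex.imCLM.hasFDerivAt) Complex.I
  have hi : ∀ f : ℂ →L[ℝ] ℝ, ∀ v : ℂ, IntegrableOn (fun y => f y * (G y * v).re) B := by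
    intro f v
    have hb : IntegrableOn (fun y => ‖f‖ * R * ‖v‖ * ‖G y‖) B := H.integrableOn_grad.norm.const_mul _
    refine hb.mono' ?_ ?_
    · have := H.measurable
      have := f.continuous.measurable
      exact Measurable.aestronglyMeasurable (by fun_prop)
    · filter_upwards [ae_restrict_mem H.measurableSet] with y hy
      rw [norm_mul, mul_assoc (‖f‖ * R), mul_comm ‖v‖]
      refine mul_le_mul ((f.le_opNorm y).trans (by gcongr; exact H.norm_le y hy))
        ((Complex.abs_re_le_norm _).trans (norm_mul _ _).le) (norm_nonneg _)
        (mul_nonneg (norm_nonneg _) H.R_pos.le)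
  have e : ∀ y, (y * G y).re = Complex.reCLM y * (G y * 1).re + Complex.imCLM y * (G y * Complex.I).re := by
    intro y
    simp
    ring
  rw [integral_congr_ae (Eventually.of_forall e), integral_add (hi _ _) (hi _ _), h1, h2]
  simp
  ring

/-- `smoothPos` is the Newtonian potential of its Laplacian, in weak form. -/
lemma integral_inv_mul_smoothGrad (H : IsLevelSet h G B R M) (hδ : 0 < δ) (z : ℂ) :
    ∫ y, ((starRingEnd ℂ) (y - z)⁻¹ * smoothGrad h G B δ y).re = -(2 * π * smoothPos h B δ z) := by
  set g := smoothGrad h G B δ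
  have hgm : Measurable g := H.measurable_smoothGrad
  set F : ℂ → ℝ := fun w => ((starRingEnd ℂ) w⁻¹ * g (z + w)).re
  have hFm : Measurable F := by
    have : Measurable fun w : ℂ => (starRingEnd ℂ) w⁻¹ :=
      Complex.continuous_conj.measurable.comp measurable_inv
    exact Complex.measurable_re.comp (this.mul (hgm.comp (measurable_const_add z)))
  have hinv : Measurable fun y : ℂ => (starRingEnd ℂ) (y - z)⁻¹ :=
    Complex.continuous_conj.measurable.comp (measurable_inv.comp (measurable_id.sub_const z))
  have hi0 : IntegrableOn (fun y : ℂ => (starRingEnd ℂ) (y - z)⁻¹) B := by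
    refine Integrable.mono' (g := fun y => ‖y - z‖ ^ (-(1 : ℝ))) ?_ hinv.aestronglyMeasurable
      (Eventually.of_forall fun y => ?_)
    · refine (integrable_indicator_iff H.measurableSet).1 ?_
      refine (H.isDensity.integrable_pow zero_le_one one_lt_two z).congr
        (Eventually.of_forall fun y => ?_)
      by_cases hy : y ∈ B <;> simp [ind, hy, norm_sub_rev]
    · rw [RCLike.norm_conj, norm_inv, rpow_neg_one]
  have hF : Integrable F := by
    refine ((H.integrable_mul_smoothGrad hδ hinv hi0).re.comp_add_left z).congr
      (Eventually.of_forall fun w => ?_)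
    simp [F, g]
  have e1 : ∫ y, ((starRingEnd ℂ) (y - z)⁻¹ * g y).re = ∫ w, F w := by
    rw [← integral_add_left_eq_self _ z]
    refine integral_congr_ae (Eventually.of_forall fun w => ?_)
    simp [F]
  rw [e1, integral_polar' hFm.stronglyMeasurable hF]
  have key : ∀ θ : ℝ, ∫ s in Set.Ioi (0 : ℝ), s • F (circleMap 0 s θ) = -smoothPos h B δ z := by
    intro θ
    set u : ℂ := Complex.exp (θ * Complex.I)
    have hu : ‖u‖ = 1 := Complex.norm_exp_ofReal_mul_I θ
    have hc : ∀ s : ℝ, circleMap 0 s θ = s * u := fun s => by simp [circleMap, u]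
    have hd : ∀ s : ℝ, HasDerivAt (fun s : ℝ => smoothPos h B δ (z + s * u)) ((u * g (z + s * u)).re) s := by
      intro s
      have h1 : HasDerivAt (fun s : ℝ => z + s * u) u s := by
        simpa using ((Complex.ofRealCLM.hasDerivAt (x := s)).mul_const u).const_add z
      refine ((H.hasFDerivAt_smoothPos hδ (z + s * u)).comp_hasDerivAt s h1).congr_deriv ?_
      rw [reMul_apply, mul_comm]
    have hbig : ∀ s : ℝ, R + ‖z‖ < s → R < ‖z + s * u‖ := by
      intro s hs
      have h1 := norm_sub_le (z + s * u) z
      rw [add_sub_cancel_left, norm_mul, hu, mul_one, Complex.norm_real, Real.norm_eq_abs] at h1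
      linarith [le_abs_self s]
    have h2 := integral_Ioi_of_hasDerivAt_of_tendsto' (a := 0) (m := 0) (fun s _ => hd s) ?_ ?_
    · simp only [Complex.ofReal_zero, zero_mul, add_zero, zero_sub] at h2
      rw [← h2]
      refine setIntegral_congr_fun measurableSet_Ioi fun s hs => ?_
      have hs' : (0 : ℝ) < s := hs
      have h3 : ((starRingEnd ℂ) u)⁻¹ = u := by rw [← Complex.inv_eq_conj hu, inv_inv]
      simp only [F, hc, mul_inv, map_mul, map_inv₀, h3, Complex.conj_ofReal, smul_eq_mul, mul_assoc]
      rw [← Complex.ofReal_inv, Complex.re_ofReal_mul]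
      rw [← mul_assoc, mul_inv_cancel₀ hs'.ne', one_mul]
    · refine Integrable.mono' (g := (Set.Ioc 0 (R + ‖z‖)).indicator fun _ => |M|) ?_ ?_ ?_
      · exact ((integrable_indicator_iff measurableSet_Ioc).2
          (integrableOn_const (by simp))).integrableOn
      · have : Measurable fun s : ℝ => (u * g (z + s * u)).re := by fun_prop
        exact this.aestronglyMeasurable
      · filter_upwards [ae_restrict_mem measurableSet_Ioi] with s hs
        by_cases hsR : s ≤ R + ‖z‖
        · rw [Set.indicator_of_mem (show s ∈ Set.Ioc 0 (R + ‖z‖) from ⟨hs, hsR⟩)]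
          refine (Complex.abs_re_le_norm _).trans ?_
          rw [norm_mul, hu, one_mul]
          refine (H.norm_smoothGrad_le hδ _).trans ?_
          rw [ind]
          by_cases hy : z + s * u ∈ B <;> simp [hy]
        · rw [show g (z + s * u) = 0 from H.smoothGrad_eq_zero (hbig s (not_le.1 hsR))]
          simp [hsR]
    · refine tendsto_const_nhds.congr' ?_
      filter_upwards [eventually_gt_atTop (R + ‖z‖)] with s hs
      exact (H.smoothPos_eq_zero (hbig s hs)).symm
  simp_rw [key]
  rw [setIntegral_const, Real.volume_real_Ioo_of_le (by linarith [pi_pos]), smul_eq_mul]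
  ring

lemma integral_cauPot_smoothGrad (H : IsLevelSet h G B R M) (hδ : 0 < δ) {E : Set ℂ} {R' : ℝ}
    (hE : IsDensity (ind E) 1 R') (hEm : MeasurableSet E) :
    ∫ y, ((starRingEnd ℂ) (cauPot (ind E) y) * smoothGrad h G B δ y).re
      = -(2 * π * ∫ z in E, smoothPos h B δ z) := by
  set g := smoothGrad h G B δ
  have hgm : Measurable g := H.measurable_smoothGrad
  have hEm' := hE.measurable
  set K : ℂ × ℂ → ℂ := fun p => (starRingEnd ℂ) ((ind E p.2 : ℂ) * (p.1 - p.2)⁻¹) * g p.1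
  have hKm : Measurable K := by
    have : Measurable fun p : ℂ × ℂ => (ind E p.2 : ℂ) * (p.1 - p.2)⁻¹ := by fun_prop
    exact (Complex.continuous_conj.measurable.comp this).mul (hgm.comp measurable_fst)
  have hK : Integrable K (volume.prod volume) := by
    refine ((H.isDensity.integrable_prod hE zero_le_one one_lt_two).const_mul |M|).mono'
      hKm.aestronglyMeasurable (Eventually.of_forall fun p => ?_)
    have h1 := H.norm_smoothGrad_le hδ p.1
    have h0 : 0 ≤ ind E p.2 := Set.indicator_nonneg (fun _ _ => zero_le_one) _
    simp only [K, norm_mul, RCLike.norm_conj, norm_inv, Complex.norm_real, rpow_neg_one,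
      Real.norm_of_nonneg h0]
    calc ind E p.2 * ‖p.1 - p.2‖⁻¹ * ‖g p.1‖ ≤ ind E p.2 * ‖p.1 - p.2‖⁻¹ * (|M| * ind B p.1) := by
          gcongr
      _ = _ := by ring
  have hswap := integral_integral_swap (f := fun y z => (K (y, z)).re) hK.re
  have eL : ∀ y, ∫ z, (K (y, z)).re = ((starRingEnd ℂ) (cauPot (ind E) y) * g y).re := by
    intro y
    have h1 : Integrable fun z => K (y, z) :=
      (Complex.conjCLE.toContinuousLinearMap.integrable_comp (hE.integrable_inv y)).mul_const (g y)
    have h2 : ∫ z, (K (y, z)).re = (∫ z, K (y, z)).re := integral_re h1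
    have h3 : ∫ z, K (y, z) = (∫ z, (starRingEnd ℂ) ((ind E z : ℂ) * (y - z)⁻¹)) * g y :=
      integral_mul_const (g y) fun z => (starRingEnd ℂ) ((ind E z : ℂ) * (y - z)⁻¹)
    rw [h2, h3, integral_conj]
    rfl
  have eR : ∀ z, ∫ y, (K (y, z)).re = ind E z * -(2 * π * smoothPos h B δ z) := by
    intro z
    rw [← H.integral_inv_mul_smoothGrad hδ z, ← integral_const_mul]
    refine integral_congr_ae (Eventually.of_forall fun y => ?_)
    simp only [K, map_mul, Complex.conj_ofReal, mul_assoc, Complex.re_ofReal_mul]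
    rfl
  simp_rw [eL, eR] at hswap
  rw [hswap, ← integral_const_mul, ← integral_neg, ← integral_indicator hEm]
  refine integral_congr_ae (Eventually.of_forall fun z => ?_)
  by_cases hz : z ∈ E <;> simp [ind, hz]

/-- The energy identity. -/
lemma integral_cauPot_grad (H : IsLevelSet h G B R M) {E : Set ℂ} {R' : ℝ}
    (hE : IsDensity (ind E) 1 R') (hEm : MeasurableSet E) :
    ∫ y in B, ((starRingEnd ℂ) (cauPot (ind E) y) * G y).re
      = -(2 * π * ∫ z in E, B.indicator h z) := by
  have hc : Continuous fun y => (starRingEnd ℂ) (cauPot (ind E) y) :=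
    Complex.continuous_conj.comp (continuous_cauPot hE)
  refine tendsto_nhds_unique (H.tendsto_smoothGrad hc.measurable
    ((hc.continuousOn.integrableOn_compact (isCompact_closedBall (0 : ℂ) R)).mono_set
      fun y hy => by simpa using H.norm_le y hy)) ?_
  simp_rw [H.integral_cauPot_smoothGrad (one_div_pos.2 (Nat.cast_add_one_pos _)) hE hEm]
  exact ((H.tendsto_smoothPos E).const_mul (2 * π)).neg

end IsLevelSet

lemma setIntegral_pow_le {B : Set ℂ} (hB : MeasurableSet B) {R : ℝ} (hR : ∀ z ∈ B, ‖z‖ ≤ R)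
    {a m : ℝ} (ha : 0 ≤ a) (ha2 : a < 2) (hm : 0 < m) (hBm : volume.real B ≤ m) (y : ℂ) :
    IntegrableOn (fun z => ‖y - z‖ ^ (-a)) B ∧
      ∫ z in B, ‖y - z‖ ^ (-a) ≤ (2 * π / (2 - a) + 1) * m ^ (1 - a / 2) := by
  have hd := isDensity_ind hB hR
  have e1 : ∀ z, |ind B z| = ind B z := fun z =>
    abs_of_nonneg (Set.indicator_nonneg (fun _ _ => zero_le_one) _)
  have e2 : ∀ z, |ind B z| * ‖y - z‖ ^ (-a) = B.indicator (fun z => ‖y - z‖ ^ (-a)) z := by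
    intro z
    rw [e1]
    by_cases hz : z ∈ B <;> simp [ind, hz]
  constructor
  · rw [← integrable_indicator_iff hB]
    exact (hd.integrable_pow ha ha2 y).congr (Eventually.of_forall e2)
  · rw [← integral_indicator hB, ← integral_congr_ae (Eventually.of_forall e2)]
    refine integral_abs_mul_pow_le hd.integrable hd.bound ha ha2 hm ?_ y
    simp_rw [e1]
    rw [ind, integral_indicator hB]
    simpa using hBm

lemma sqrt_pi_le : √π ≤ 1.8 := by
  rw [sqrt_le_left (by norm_num)]; nlinarith [pi_lt_d2]

/-- The Newtonian potential of the uniform density on `B`. -/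
def newt (B : Set ℂ) (y : ℂ) : ℝ := -(1 / (2 * π)) * logPot (ind B) y

/-- The gradient of `newt`. -/
def newtGrad (B : Set ℂ) (y : ℂ) : ℂ := -(1 / (2 * π) : ℝ) * cauPot (ind B) y

/-- The function whose positivity set is the cross-section. -/
def lev (τ ω m : ℝ) (B : Set ℂ) (y : ℂ) : ℝ := spot τ B y - ω / 2 * hgt τ y ^ 2 - m

/-- The gradient of `lev`. -/
def levGrad (τ ω : ℝ) (B : Set ℂ) (y : ℂ) : ℂ := spotGrad τ B y - (ω * τ * hgt τ y : ℝ)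

namespace IsRegion
variable {τ η : ℝ} {B : Set ℂ} {y : ℂ}

lemma integrableOn_pow (h : IsRegion τ B) {a : ℝ} (ha : 0 ≤ a) (ha2 : a < 2) (y : ℂ) :
    IntegrableOn (fun z => ‖y - z‖ ^ (-a)) B := by
  have h0 : volume.real B ≤ volume.real B + 1 := by linarith
  have h1 : 0 < volume.real B + 1 := by positivity
  exact (setIntegral_pow_le h.measurableSet h.norm_le ha ha2 h1 h0 y).1

lemma integral_inv_le (h : IsRegion τ B) (hB : volume.real B = π) (y : ℂ) :
    ∫ z in B, ‖y - z‖⁻¹ ≤ 16 := by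
  have h1 := (setIntegral_pow_le h.measurableSet h.norm_le zero_le_one one_lt_two pi_pos hB.le y).2
  simp only [rpow_neg_one] at h1
  refine h1.trans ?_
  rw [show (1 : ℝ) - 1 / 2 = 1 / 2 by norm_num, ← sqrt_eq_rpow]
  have h2 := sqrt_pi_le
  nlinarith [pi_lt_d2, pi_pos, sqrt_nonneg π]

lemma integral_pow_three_halves_le (h : IsRegion τ B) (hB : volume.real B = π) (y : ℂ) :
    ∫ z in B, ‖y - z‖ ^ (-(3 / 2) : ℝ) ≤ 20 := by
  have h1 := (setIntegral_pow_le h.measurableSet h.norm_le (a := 3 / 2) (by norm_num)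
    (by norm_num) pi_pos hB.le y).2
  refine h1.trans ?_
  have h2 : π ^ (1 - 3 / 2 / 2 : ℝ) ≤ 1.4 := by
    rw [show (1 - 3 / 2 / 2 : ℝ) = 1 / 2 * (1 / 2) by norm_num, rpow_mul pi_pos.le, ← sqrt_eq_rpow,
      ← sqrt_eq_rpow, sqrt_le_left (by norm_num)]
    exact sqrt_pi_le.trans (by norm_num)
  have h3 : 2 * π / (2 - 3 / 2) + 1 = 4 * π + 1 := by ring
  rw [h3]
  have := rpow_nonneg pi_pos.le (1 - 3 / 2 / 2)
  nlinarith [pi_lt_d2, pi_pos]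

lemma abs_log_le (h : IsRegion τ B) (hy : τ * ‖y‖ ≤ 1 / 4) {z : ℂ} (hz : z ∈ B) (hne : y ≠ z) :
    |log ‖y - z‖| ≤ ‖y - z‖ ^ (-(3 / 2) : ℝ) + -log τ := by
  have hn := h.nearPair hy hz hne
  have h0 := hn.norm_sub_pos
  have h1 : 0 ≤ ‖y - z‖ ^ (-(3 / 2) : ℝ) := rpow_nonneg h0.le _
  have h2 := neg_log_le_rpow h0
  have h3 : log (τ * ‖y - z‖) ≤ 0 := log_nonpos (mul_nonneg h.τ_pos.le h0.le) (by
    have := hn.mul_norm_sub_le; linarith)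
  rw [log_mul h.τ_pos.ne' h0.ne'] at h3
  have := h.one_le
  rw [abs_le]
  constructor <;> linarith

lemma integral_wlog_le (h : IsRegion τ B) (hB : volume.real B = π) (hy : τ * ‖y‖ ≤ 1 / 4) :
    ∫ z in B, wlog τ y z ≤ 30 * -log τ := by
  have h1 : ∫ z in B, wlog τ y z ≤ ∫ z in B, (‖y - z‖ ^ (-(3 / 2) : ℝ) + 2 * -log τ) := by
    refine setIntegral_mono_ae_restrict (h.integrableOn_wlog y)
      ((h.integrableOn_pow (by norm_num) (by norm_num) y).add (h.integrableOn_const _)) ?_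
    filter_upwards [ae_ne y B, ae_restrict_mem h.measurableSet] with z hne hz
    have := h.abs_log_le hy hz hne
    rw [wlog]; linarith
  refine h1.trans ?_
  rw [integral_add (h.integrableOn_pow (by norm_num) (by norm_num) y) (h.integrableOn_const _),
    setIntegral_const, hB, smul_eq_mul]
  have := h.integral_pow_three_halves_le hB y
  nlinarith [h.one_le, pi_lt_d2]

/-- Integrated expansion of the kernel to leading order. -/
lemma abs_spot_sub_le (h : IsRegion τ B) (hB : volume.real B = π) (hη : η ≤ 1 / 4)
    (hBη : ∀ z ∈ B, τ * ‖z‖ ≤ η) (hy : τ * ‖y‖ ≤ η) :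
    |spot τ B y - ((-log τ + ringB / 2) / 2 + newt B y)| ≤ 1800 * (η * -log τ) := by
  have i1 := h.integrableOn_kern (hy.trans hη)
  have i2 : IntegrableOn (mainF τ y) B :=
    ((h.integrableOn_const _).sub (h.integrableOn_log y)).const_mul _
  have hη0 : 0 ≤ η := (mul_nonneg h.τ_pos.le (norm_nonneg _)).trans hy
  have e : (-log τ + ringB / 2) / 2 + newt B y = ∫ z in B, mainF τ y z := by
    simp only [mainF]
    rw [integral_const_mul, integral_sub (h.integrableOn_const _) (h.integrableOn_log y),
      setIntegral_const, hB, newt, logPot_ind h.measurableSet, smul_eq_mul]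
    field_simp
    ring
  rw [e, spot, ← integral_sub i1 i2]
  calc |∫ z in B, (kern τ y z - mainF τ y z)| ≤ ∫ z in B, |kern τ y z - mainF τ y z| :=
        abs_integral_le_integral_abs
    _ ≤ ∫ z in B, 60 * η * wlog τ y z := by
        refine setIntegral_mono_ae_restrict (i1.sub i2).abs ((h.integrableOn_wlog y).const_mul _) ?_
        filter_upwards [ae_ne y B, ae_restrict_mem h.measurableSet] with z hne hz
        have := NearPair.abs_kern_sub_mainF_le ⟨h.τ_pos, h.one_le, hη, hy, hBη z hz, hne⟩
        rwa [mul_assoc]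
    _ ≤ _ := by
        rw [integral_const_mul]
        have := mul_le_mul_of_nonneg_left (h.integral_wlog_le hB (hy.trans hη))
          (show 0 ≤ 60 * η by positivity)
        linarith

lemma norm_spotGrad_sub_le (h : IsRegion τ B) (hB : volume.real B = π) (hη : η ≤ 1 / 4)
    (hBη : ∀ z ∈ B, τ * ‖z‖ ≤ η) (hy : τ * ‖y‖ ≤ η) :
    ‖spotGrad τ B y - newtGrad B y‖ ≤ 1800 * (η + τ * -log τ) := by
  have i1 := h.integrableOn_kernGrad (hy.trans hη)
  have i2 : IntegrableOn (fun z => ((1 / (2 * π) : ℝ) : ℂ) * (y - z)⁻¹) B :=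
    (h.integrableOn_inv y).const_mul _
  have hη0 : 0 ≤ η := (mul_nonneg h.τ_pos.le (norm_nonneg _)).trans hy
  have e : spotGrad τ B y - newtGrad B y
      = ∫ z in B, (kernGrad τ y z + (1 / (2 * π) : ℝ) * (y - z)⁻¹) := by
    rw [integral_add i1 i2, integral_const_mul, newtGrad, cauPot_ind h.measurableSet, spotGrad]
    push_cast
    ring
  have i3 : IntegrableOn (fun z => ‖y - z‖⁻¹) B := by
    have := (h.integrableOn_inv y).norm
    simp only [norm_inv] at this
    exact this
  rw [e]
  calc _ ≤ ∫ z in B, ‖kernGrad τ y z + (1 / (2 * π) : ℝ) * (y - z)⁻¹‖ :=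
        norm_integral_le_integral_norm _
    _ ≤ ∫ z in B, (60 * η * ‖y - z‖⁻¹ + 60 * τ * wlog τ y z) := by
        refine setIntegral_mono_ae_restrict (i1.add i2).norm
          ((i3.const_mul _).add ((h.integrableOn_wlog y).const_mul _)) ?_
        filter_upwards [ae_ne y B, ae_restrict_mem h.measurableSet] with z hne hz
        refine (NearPair.norm_kernGrad_add_le
          ⟨h.τ_pos, h.one_le, hη, hy, hBη z hz, hne⟩).trans_eq ?_
        ring
    _ ≤ _ := by
        rw [integral_add (i3.const_mul _) ((h.integrableOn_wlog y).const_mul _),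
          integral_const_mul, integral_const_mul]
        have h1 := mul_le_mul_of_nonneg_left (h.integral_wlog_le hB (hy.trans hη))
          (show 0 ≤ 60 * τ by linarith [h.τ_pos])
        have h2 := mul_le_mul_of_nonneg_left (h.integral_inv_le hB y)
          (show 0 ≤ 60 * η by positivity)
        linarith

lemma norm_newtGrad_le (h : IsRegion τ B) (hB : volume.real B = π) (y : ℂ) :
    ‖newtGrad B y‖ ≤ 3 := by
  have h1 : ‖cauPot (ind B) y‖ ≤ 16 := by
    rw [cauPot_ind h.measurableSet]
    refine (norm_integral_le_integral_norm _).trans ?_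
    simp only [norm_inv]
    exact h.integral_inv_le hB y
  rw [newtGrad, norm_mul, norm_neg, Complex.norm_real, Real.norm_of_nonneg (by positivity),
    one_div_mul_eq_div, div_le_iff₀ (by positivity)]
  nlinarith [pi_gt_d2]

lemma kern_le (h : IsRegion τ B) (hy : τ * ‖y‖ ≤ 1 / 4) {z : ℂ} (hz : z ∈ B) (hne : y ≠ z) :
    kern τ y z ≤ 2 * -log (τ * ‖y - z‖) + 20 := by
  have hn := h.nearPair hy hz hne
  have h0 := hn.norm_sub_pos
  have hρ := hn.rho_pos
  have hρ1 := hn.rho_le_one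
  have hl := hn.log_rho
  have hτ := h.τ_pos
  have hg1 : log (hgt τ y) ≤ 1 / 4 := (log_le_sub_one_of_pos (by linarith [hn.hgt_ge])).trans (by
    linarith [hn.hgt_le])
  have hg2 : log (hgt τ z) ≤ 1 / 4 := (log_le_sub_one_of_pos (by linarith [hn.symm.hgt_ge])).trans (by
    linarith [hn.symm.hgt_le])
  have h3 : log (τ * ‖y - z‖) ≤ 0 := log_nonpos (by positivity) (by
    have := hn.mul_norm_sub_le; linarith)
  rw [log_mul hτ.ne' h0.ne'] at h3 ⊢
  have hR := (abs_le.1 (abs_ringR_le hρ hρ1)).2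
  have hρl : rho τ y z * |log (rho τ y z)| ≤ 1 := by
    rw [abs_of_nonpos (log_nonpos hρ.le hρ1)]
    have := log_le_sub_one_of_pos (inv_pos.2 hρ)
    rw [log_inv] at this
    have h5 := mul_le_mul_of_nonneg_left this hρ.le
    rw [mul_sub, mul_inv_cancel₀ hρ.ne'] at h5
    linarith
  have hB := ringB_mem
  have hF : ringF (rho τ y z) ≤ 1 * (-(log τ + log ‖y - z‖)) + 5 := by
    rw [ringF_eq hρ, hl]
    have hp : 1 / (4 * π) ≤ 1 / 12 := by gcongr; linarith [pi_gt_three]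
    have hp0 : 0 < 1 / (4 * π) := by positivity
    have hX : -(2 * log τ + 2 * log ‖y - z‖ - log (hgt τ y) - log (hgt τ z)) + ringB
        ≤ 2 * -(log τ + log ‖y - z‖) + 2 := by linarith [hB.2]
    have := mul_le_mul_of_nonneg_left hX hp0.le
    nlinarith
  have hc0 : 0 ≤ hgt τ z * √(hgt τ y * hgt τ z) :=
    mul_nonneg (by linarith [hn.symm.hgt_ge]) (sqrt_nonneg _)
  have hc : hgt τ z * √(hgt τ y * hgt τ z) ≤ 25 / 16 := by
    have : √(hgt τ y * hgt τ z) ≤ 5 / 4 := by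
      rw [sqrt_le_left (by norm_num)]
      nlinarith [hn.hgt_le, hn.symm.hgt_le, hn.hgt_ge, hn.symm.hgt_ge]
    nlinarith [hn.symm.hgt_le, hn.symm.hgt_ge, sqrt_nonneg (hgt τ y * hgt τ z)]
  rw [kern]
  have := mul_le_mul_of_nonneg_left hF hc0
  nlinarith

lemma measurable_spot : Measurable (spot τ B) :=
  ((measurable_kern τ).stronglyMeasurable.integral_prod_right (ν := volume.restrict B)).measurable

lemma measurable_spotGrad : Measurable (spotGrad τ B) :=
  ((measurable_kernGrad τ).stronglyMeasurable.integral_prod_right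
    (ν := volume.restrict B)).measurable

end IsRegion

/-- A rescaled vortex core. -/
structure IsCore (τ ω m : ℝ) (B : Set ℂ) : Prop extends IsRegion τ B where
  ω_pos : 0 < ω
  m_nonneg : 0 ≤ m
  volume_eq : volume.real B = π
  centroid : ∫ z in B, z = 0
  preconnected : IsPreconnected B
  mem_iff : ∀ y, τ * ‖y‖ < 1 / 4 → (y ∈ B ↔ 0 < lev τ ω m B y)

namespace IsCore
variable {τ ω m η : ℝ} {B : Set ℂ} {y : ℂ}

lemma hasFDerivAt_lev (h : IsRegion τ B) (hy : τ * ‖y‖ < 1 / 4) :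
    HasFDerivAt (lev τ ω m B) (reMul (levGrad τ ω B y)) y := by
  have h1 := (((hasFDerivAt_hgt τ y).pow 2).const_mul (ω / 2))
  refine (((h.hasFDerivAt_spot hy).sub h1).sub_const m).congr_fderiv ?_
  ext v
  simp [levGrad, sub_mul, reMul_apply]
  ring

lemma norm_levGrad_sub_le (h : IsCore τ ω m B) (hη : η ≤ 1 / 4)
    (hBη : ∀ z ∈ B, τ * ‖z‖ ≤ η) (hy : τ * ‖y‖ ≤ η) :
    ‖levGrad τ ω B y - newtGrad B y‖ ≤ 1800 * (η + τ * -log τ) + 2 * (ω * τ) := by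
  have h1 := h.norm_spotGrad_sub_le h.volume_eq hη hBη hy
  have h2 : |hgt τ y| ≤ 2 := by
    have := abs_le.1 (abs_re_le_of_norm_le h.τ_pos (hy.trans hη))
    rw [hgt, abs_le]; constructor <;> linarith
  have h3 : ‖((ω * τ * hgt τ y : ℝ) : ℂ)‖ ≤ 2 * (ω * τ) := by
    have := h.ω_pos
    have := h.τ_pos
    rw [Complex.norm_real, Real.norm_eq_abs, abs_mul, abs_of_pos (show 0 < ω * τ by positivity)]
    nlinarith [mul_pos h.ω_pos h.τ_pos]
  have e : levGrad τ ω B y - newtGrad B y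
      = (spotGrad τ B y - newtGrad B y) - ((ω * τ * hgt τ y : ℝ) : ℂ) := by rw [levGrad]; ring
  rw [e]
  exact (norm_sub_le _ _).trans (by linarith)

lemma exists_isLevelSet (h : IsCore τ ω m B) :
    ∃ M, IsLevelSet (lev τ ω m B) (levGrad τ ω B) B (1 / 8 / τ) M := by
  have hτ := h.τ_pos
  have e : ∀ y : ℂ, ‖y‖ < 2 * (1 / 8 / τ) → τ * ‖y‖ < 1 / 4 := fun y hy => by
    rw [show 2 * (1 / 8 / τ) = 1 / 4 / τ by ring, lt_div_iff₀ hτ] at hy; linarith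
  refine ⟨1800 * (1 / 4 + τ * -log τ) + 2 * (ω * τ) + 3, by positivity, fun y hy =>
    hasFDerivAt_lev h.toIsRegion (e y hy), fun y hy => h.mem_iff y (e y hy), h.norm_le, ?_, ?_, ?_⟩
  · intro y hy
    have h1 := h.norm_levGrad_sub_le le_rfl (fun z hz => (h.le z hz).trans (by norm_num))
      ((h.le y hy).trans (by norm_num))
    have h2 := h.norm_newtGrad_le h.volume_eq y
    have h3 := norm_add_le (levGrad τ ω B y - newtGrad B y) (newtGrad B y)
    rw [sub_add_cancel] at h3
    linarith
  · have := IsRegion.measurable_spotGrad (τ := τ) (B := B)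
    have := measurable_hgt τ
    unfold levGrad
    fun_prop
  · have := IsRegion.measurable_spot (τ := τ) (B := B)
    have := measurable_hgt τ
    unfold lev
    fun_prop

lemma exists_shell {B : Set ℂ} (hBm : MeasurableSet B) (hB : volume.real B = π)
    (hc : IsPreconnected B) {p q : ℂ} (hp : p ∈ B) (hq : q ∈ B) {N : ℕ} (hN : 0 < N) :
    ∃ A ⊆ B, MeasurableSet A ∧ volume.real A ≤ π / N ∧
      ∃ y ∈ B, ∀ z ∈ B \ A, ‖p - q‖ / (2 * N) ≤ ‖y - z‖ := by
  have hfin : volume B ≠ ⊤ := fun h => by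
    rw [measureReal_def, h] at hB; simp at hB; exact pi_pos.ne hB
  set d := ‖p - q‖ / N
  have hN' : (0 : ℝ) < N := by exact_mod_cast hN
  have hd : 0 ≤ d := by positivity
  set A : ℕ → Set ℂ := fun k => B ∩ {z | (k : ℝ) * d ≤ ‖z - p‖ ∧ ‖z - p‖ < (k + 1) * d}
  have hnm : Measurable fun z : ℂ => ‖z - p‖ := by fun_prop
  have hAm : ∀ k, MeasurableSet (A k) := fun k => hBm.inter
    (hnm (measurableSet_Ico (a := (k : ℝ) * d) (b := (k + 1) * d)))
  have hdisj : (↑(Finset.range N) : Set ℕ).PairwiseDisjoint A := by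
    intro i _ j _ hij
    refine Set.disjoint_left.2 fun z hzi hzj => hij ?_
    have h1 : (i : ℝ) * d < (j + 1) * d := hzi.2.1.trans_lt hzj.2.2
    have h2 : (j : ℝ) * d < (i + 1) * d := hzj.2.1.trans_lt hzi.2.2
    have h3 := lt_of_mul_lt_mul_right h1 hd
    have h4 := lt_of_mul_lt_mul_right h2 hd
    norm_cast at h3 h4
    lia
  have hsum : ∑ k ∈ Finset.range N, volume.real (A k) ≤ ∑ k ∈ Finset.range N, π / N := by
    rw [← measureReal_biUnion_finset hdisj (fun k _ => hAm k)
      (fun k _ => measure_ne_top_of_subset Set.inter_subset_left hfin)]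
    rw [Finset.sum_const, Finset.card_range, nsmul_eq_mul, mul_div_cancel₀ _ hN'.ne', ← hB]
    exact measureReal_mono (Set.iUnion₂_subset fun _ _ => Set.inter_subset_left) hfin
  obtain ⟨k, hk, hkA⟩ := Finset.exists_le_of_sum_le (Finset.nonempty_range_iff.2 hN.ne') hsum
  refine ⟨A k, Set.inter_subset_left, hAm k, hkA, ?_⟩
  have hk1 : (k : ℝ) + 1 ≤ N := by exact_mod_cast Finset.mem_range.1 hk
  have hdN : ‖p - q‖ = N * d := by simp only [d]; field_simp
  obtain ⟨y, hy, hyk⟩ := hc.intermediate_value hp hq (f := fun z => ‖z - p‖) (by fun_prop)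
    (show ((k : ℝ) + 1 / 2) * d ∈ _ by
      simp only [sub_self, norm_zero, Set.mem_Icc]
      rw [norm_sub_rev q p, hdN]
      exact ⟨by positivity, by gcongr; linarith⟩)
  refine ⟨y, hy, fun z hz => ?_⟩
  have e : ‖p - q‖ / (2 * N) = d / 2 := by simp only [d]; ring
  have h1 := norm_sub_norm_le (y - p) (z - p)
  have h2 := norm_sub_norm_le (z - p) (y - p)
  rw [sub_sub_sub_cancel_right] at h1 h2
  rw [norm_sub_rev z y] at h2
  simp only at hyk
  rw [hyk] at h1 h2
  rw [e]
  by_contra! hlt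
  exact hz.2 ⟨hz.1, by nlinarith, by nlinarith⟩

lemma exists_log_dist_ge {c₀ : ℝ} (hc₀ : 0 < c₀) :
    ∃ C c : ℝ, 0 < C ∧ 0 < c ∧ ∀ τ ω m : ℝ, ∀ B : Set ℂ, IsCore τ ω m B → c₀ * -log τ ≤ ω →
      ∀ p ∈ B, ∀ q ∈ B, p ≠ q → c * -log τ - C ≤ -log (τ * ‖p - q‖) := by
  obtain ⟨N, hN⟩ := exists_nat_gt (16 * π / c₀)
  have hN0 : (0 : ℝ) < N := lt_trans (by positivity) hN
  have hN1 : (1 : ℝ) ≤ N := by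
    have : 0 < N := by exact_mod_cast hN0
    exact_mod_cast this
  refine ⟨20 + log (2 * N), c₀ / (8 * π), by have := log_nonneg (show 1 ≤ 2 * (N : ℝ) by linarith); linarith, by positivity, ?_⟩
  intro τ ω m B h hω p hp q hq hpq
  obtain ⟨A, hAB, hAm, hA, y, hy, hyA⟩ := exists_shell h.measurableSet h.volume_eq h.preconnected
    hp hq (show 0 < N by exact_mod_cast hN0)
  have hτ := h.τ_pos
  have hl := h.one_le
  have hd : 0 < ‖p - q‖ := norm_pos_iff.2 (sub_ne_zero.2 hpq)
  have hy8 := h.le y hy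
  have hy4 : τ * ‖y‖ ≤ 1 / 4 := hy8.trans (by norm_num)
  set P := -log (τ * (‖p - q‖ / (2 * N))) with hP
  have hP' : P = -log (τ * ‖p - q‖) + log (2 * N) := by
    rw [hP, ← mul_div_assoc, log_div (by positivity) (by positivity)]; ring
  have hP0 : 0 ≤ P := by
    have h1 : τ * ‖p - q‖ ≤ 1 := by
      have := norm_sub_le p q
      have := h.le p hp
      have := h.le q hq
      nlinarith
    have := log_nonpos (by positivity) h1
    have := log_nonneg (show 1 ≤ 2 * (N : ℝ) by linarith)
    linarith
  have hlow : 3 / 8 * (c₀ * -log τ) ≤ spot τ B y := by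
    have h1 := (h.mem_iff y (hy8.trans_lt (by norm_num))).1 hy
    have h2 := abs_le.1 (abs_re_le_of_norm_le hτ hy8)
    have h3 : 3 / 4 ≤ hgt τ y ^ 2 := by rw [hgt]; nlinarith
    have h4 := h.m_nonneg
    have h5 := h.ω_pos
    rw [lev] at h1
    nlinarith
  have hpt : ∀ z ∈ B, y ≠ z → kern τ y z
      ≤ 2 * (P + A.indicator (fun _ => -log τ) z + ‖y - z‖ ^ (-(3 / 2) : ℝ)) + 20 := by
    intro z hz hne
    have h1 := h.kern_le hy4 hz hne
    have h0 : 0 < ‖y - z‖ := norm_pos_iff.2 (sub_ne_zero.2 hne)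
    have h2 : 0 ≤ ‖y - z‖ ^ (-(3 / 2) : ℝ) := rpow_nonneg h0.le _
    by_cases hzA : z ∈ A
    · rw [Set.indicator_of_mem hzA]
      have := neg_log_le_rpow h0
      rw [log_mul hτ.ne' h0.ne'] at h1
      linarith
    · rw [Set.indicator_of_notMem hzA]
      have := log_le_log (by positivity) (mul_le_mul_of_nonneg_left (hyA z ⟨hz, hzA⟩) hτ.le)
      linarith
  have i1 : IntegrableOn (fun z => P + A.indicator (fun _ => -log τ) z) B :=
    (h.integrableOn_const _).add ((integrable_indicator_iff hAm).2
      ((h.integrableOn_const _).mono_set hAB)).integrableOn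
  have i2 := h.integrableOn_pow (a := 3 / 2) (by norm_num) (by norm_num) y
  have hup : spot τ B y ≤ 2 * (π * P + π / N * -log τ + 20) + 20 * π := by
    calc spot τ B y ≤ ∫ z in B, (2 * (P + A.indicator (fun _ => -log τ) z
          + ‖y - z‖ ^ (-(3 / 2) : ℝ)) + 20) := by
          refine setIntegral_mono_ae_restrict (h.integrableOn_kern hy4)
            (((i1.add i2).const_mul 2).add (h.integrableOn_const _)) ?_
          filter_upwards [ae_ne y B, ae_restrict_mem h.measurableSet] with z hne hz
          exact hpt z hz hne
      _ ≤ _ := by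
          have i3 : IntegrableOn (fun z => 2 * (P + A.indicator (fun _ => -log τ) z
            + ‖y - z‖ ^ (-(3 / 2) : ℝ))) B := (i1.add i2).const_mul 2
          rw [integral_add i3 (h.integrableOn_const _), integral_const_mul,
            integral_add i1 i2, integral_add (h.integrableOn_const _)
            ((integrable_indicator_iff hAm).2
              ((h.integrableOn_const _).mono_set hAB)).integrableOn,
            setIntegral_indicator hAm, setIntegral_const, setIntegral_const, setIntegral_const,
            h.volume_eq, Set.inter_eq_self_of_subset_right hAB]
          simp only [smul_eq_mul]
          have := h.integral_pow_three_halves_le h.volume_eq y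
          have := mul_le_mul_of_nonneg_right hA (show 0 ≤ -log τ by linarith)
          linarith
  have hN2 : π / N ≤ c₀ / 16 := by
    rw [div_lt_iff₀ hc₀] at hN
    rw [div_le_div_iff₀ hN0 (by norm_num)]; linarith
  have h3 := mul_le_mul_of_nonneg_right hN2 (show 0 ≤ -log τ by linarith)
  have h4 : c₀ / 4 * -log τ ≤ 2 * π * (P + 20) := by
    nlinarith [pi_gt_three]
  have h5 : c₀ / (8 * π) * -log τ ≤ P + 20 := by
    rw [div_mul_eq_mul_div, div_le_iff₀ (by positivity)]
    linarith
  linarith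

lemma exists_norm_le {c₀ : ℝ} (hc₀ : 0 < c₀) :
    ∃ C c : ℝ, 0 < C ∧ 0 < c ∧ ∀ τ ω m : ℝ, ∀ B : Set ℂ, IsCore τ ω m B → c₀ * -log τ ≤ ω →
      ∀ y ∈ B, τ * ‖y‖ ≤ C * exp (-(c * -log τ)) := by
  obtain ⟨C, c, hC, hc, H⟩ := exists_log_dist_ge hc₀
  refine ⟨exp C, c, exp_pos _, hc, fun τ ω m B h hω y hy => ?_⟩
  have hτ := h.τ_pos
  set K := exp C * exp (-(c * -log τ))
  have h1 : ∀ z ∈ B, ‖y - z‖ ≤ K / τ := by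
    intro z hz
    rw [le_div_iff₀ hτ, mul_comm]
    rcases eq_or_ne y z with rfl | hne
    · simp; positivity
    · have h0 : 0 < ‖y - z‖ := norm_pos_iff.2 (sub_ne_zero.2 hne)
      have := H τ ω m B h hω y hy z hz hne
      rw [← exp_log (show 0 < τ * ‖y - z‖ by positivity), show K = exp (C + -(c * -log τ)) from
        (exp_add _ _).symm]
      exact exp_le_exp.2 (by linarith)
  have hid : IntegrableOn (fun z : ℂ => z) B :=
    (continuous_id.continuousOn.integrableOn_compact (isCompact_closedBall (0 : ℂ) (1 / 8 / τ))).mono_set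
      fun z hz => by simpa using h.norm_le z hz
  have hiy : IntegrableOn (fun _ : ℂ => y) B := MeasureTheory.integrableOn_const h.volume_lt_top.ne
  have h2 : ∫ z in B, (y - z) = π * y := by
    rw [integral_sub hiy hid, h.centroid,
      setIntegral_const, h.volume_eq]
    simp
  have h3 := norm_setIntegral_le_of_norm_le_const h.volume_lt_top h1
  rw [h2, h.volume_eq, norm_mul, Complex.norm_real, Real.norm_of_nonneg pi_pos.le] at h3
  have h4 : ‖y‖ ≤ K / τ := le_of_mul_le_mul_left (by linarith) pi_pos
  rw [le_div_iff₀ hτ] at h4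
  linarith

/-- Cores have small diameter compared with their distance to the axis. -/
lemma exists_radius {c₀ δ : ℝ} (hc₀ : 0 < c₀) (hδ : 0 < δ) :
    ∃ Λ : ℝ, ∀ τ ω m : ℝ, ∀ B : Set ℂ, IsCore τ ω m B → c₀ * -log τ ≤ ω → Λ ≤ -log τ →
      ∃ R η : ℝ, 0 < R ∧ (∀ z ∈ B, ‖z‖ ≤ R) ∧ τ * (R + 8) ≤ η ∧ η < 1 / 4 ∧ η * -log τ ≤ δ := by
  obtain ⟨C, c, hC, hc, H⟩ := exists_norm_le hc₀
  have t1 : Tendsto (fun x : ℝ => (C * exp (-(c * x)) + 8 * exp (-x)) * x) atTop (𝓝 0) := by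
    have h1 := (tendsto_rpow_mul_exp_neg_mul_atTop_nhds_zero 1 c hc).const_mul C
    have h2 := (tendsto_rpow_mul_exp_neg_mul_atTop_nhds_zero 1 1 one_pos).const_mul 8
    have h3 := h1.add h2
    simp only [mul_zero, add_zero] at h3
    refine h3.congr fun x => ?_
    rw [rpow_one]; ring_nf
  obtain ⟨Λ, hΛ⟩ := eventually_atTop.1
    (t1.eventually (gt_mem_nhds (show 0 < min δ (1 / 8) by positivity)))
  refine ⟨Λ, fun τ ω m B h hω hl => ?_⟩
  have hτ := h.τ_pos
  have h1 := hΛ _ hl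
  rw [lt_min_iff] at h1
  have e : exp (- -log τ) = τ := by rw [neg_neg, exp_log hτ]
  rw [e] at h1
  have hp := exp_pos (-(c * -log τ))
  refine ⟨C * exp (-(c * -log τ)) / τ, C * exp (-(c * -log τ)) + 8 * τ, by positivity, ?_, ?_, ?_,
    h1.1.le⟩
  · intro z hz
    rw [le_div_iff₀ hτ, mul_comm]; exact H τ ω m B h hω z hz
  · rw [mul_add, mul_div_cancel₀ _ hτ.ne']; linarith
  · have := h.one_le
    have h0 : 0 < C * exp (-(c * -log τ)) + 8 * τ := by positivity
    nlinarith [h1.2]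

end IsCore

lemma differentiableOn_cauPot_ind {E : Set ℂ} (hE : MeasurableSet E) (hfin : volume E < ⊤)
    {c : ℂ} {r : ℝ} (hd : ∀ z ∈ E, r ≤ ‖z - c‖) :
    DifferentiableOn ℂ (cauPot (ind E)) (Metric.ball c r) := by
  intro y hy
  have hy : ‖y - c‖ < r := by simpa [dist_eq_norm] using hy
  set d := (r - ‖y - c‖) / 2 with hdd
  have hd0 : 0 < d := by rw [hdd]; linarith
  have hfinite : IsFiniteMeasure (volume.restrict E) := ⟨by simpa using hfin⟩
  have hfar : ∀ z ∈ E, ∀ x ∈ Metric.ball y d, d ≤ ‖x - z‖ := by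
    intro z hz x hx
    have hx : ‖x - y‖ < d := by simpa [dist_eq_norm] using hx
    have h1 := hd z hz
    have h2 : ‖z - c‖ ≤ ‖x - z‖ + ‖x - y‖ + ‖y - c‖ := by
      have := norm_add₃_le (a := z - x) (b := x - y) (c := y - c)
      rw [norm_sub_rev z x] at this
      rwa [show z - x + (x - y) + (y - c) = z - c by ring] at this
    linarith
  have hne : ∀ z ∈ E, ∀ x ∈ Metric.ball y d, x - z ≠ 0 := fun z hz x hx =>
    norm_pos_iff.1 (hd0.trans_le (hfar z hz x hx))
  have hb : ∀ z ∈ E, ∀ x ∈ Metric.ball y d, ‖(x - z)⁻¹‖ ≤ d⁻¹ := fun z hz x hx => by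
    rw [norm_inv]; exact inv_anti₀ hd0 (hfar z hz x hx)
  have key := (hasDerivAt_integral_of_dominated_loc_of_deriv_le (𝕜 := ℂ) (μ := volume.restrict E)
    (F := fun x z => (x - z)⁻¹) (F' := fun x z => -1 / (x - z) ^ 2) (x₀ := y)
    (s := Metric.ball y d) (bound := fun _ => (d⁻¹) ^ 2)
    (Metric.ball_mem_nhds y hd0)
    (Eventually.of_forall fun x => (by fun_prop : Measurable fun z : ℂ => (x - z)⁻¹).aestronglyMeasurable)
    ?_ (by fun_prop : Measurable fun z : ℂ => -1 / (y - z) ^ 2).aestronglyMeasurable ?_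
    (integrable_const _) ?_).2
  · refine DifferentiableAt.differentiableWithinAt ?_
    have : cauPot (ind E) = fun x => ∫ z in E, (x - z)⁻¹ := by
      funext x; exact cauPot_ind hE x
    rw [this]
    exact key.differentiableAt
  · refine Integrable.mono' (integrable_const d⁻¹)
      (by fun_prop : Measurable fun z : ℂ => (y - z)⁻¹).aestronglyMeasurable ?_
    exact (ae_restrict_iff' hE).2 (Eventually.of_forall fun z hz =>
      hb z hz y (Metric.mem_ball_self hd0))
  · refine (ae_restrict_iff' hE).2 (Eventually.of_forall fun z hz x hx => ?_)
    have := hb z hz x hx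
    rw [norm_inv] at this
    rw [norm_div, norm_pow, norm_neg, norm_one, one_div, ← inv_pow]
    gcongr
  · refine (ae_restrict_iff' hE).2 (Eventually.of_forall fun z hz x hx => ?_)
    exact ((hasDerivAt_id x).sub_const z).inv (hne z hz x hx)

/-- Mean value obstruction: a real part of a holomorphic function plus a strictly convex radial
term has no maximum at the centre of a disc. -/
lemma exists_re_add_gt {g : ℂ → ℂ} {c : ℂ} {r k : ℝ} (hr : 0 < r) (hk : 0 < k)
    (hg : DifferentiableOn ℂ g (Metric.ball c r)) :
    ∃ y ∈ Metric.ball c r, (g c).re < (g y).re + k * ‖y - c‖ ^ 2 := by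
  by_contra! hcon
  have h2 : |r / 2| = r / 2 := abs_of_pos (by linarith)
  have hsub : Metric.closedBall c (r / 2) ⊆ Metric.ball c r :=
    Metric.closedBall_subset_ball (by linarith)
  have hd : DiffContOnCl ℂ g (Metric.ball c |r / 2|) := by
    rw [h2]
    refine DifferentiableOn.diffContOnCl ?_
    rw [closure_ball c (by linarith)]
    exact hg.mono hsub
  have hc : ContinuousOn g (Metric.closedBall c (r / 2)) := (hg.mono hsub).continuousOn
  have hsph : Metric.sphere c |r / 2| ⊆ Metric.closedBall c (r / 2) := by
    rw [h2]; exact Metric.sphere_subset_closedBall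
  have hci : CircleIntegrable g c (r / 2) := (hc.mono hsph).circleIntegrable'
  have hav := hd.circleAverage
  have hre : Real.circleAverage (fun z => (g z).re) c (r / 2) = (g c).re := by
    rw [← hav]
    have := Complex.reCLM.circleAverage_comp_comm hci
    simpa [Function.comp_def] using this
  have hle : Real.circleAverage (fun z => (g z).re) c (r / 2) ≤ (g c).re - k * (r / 2) ^ 2 := by
    refine Real.circleAverage_mono_on_of_le_circle ?_ ?_
    · exact ((Complex.continuous_re.comp_continuousOn (hc.mono hsph))).circleIntegrable'
    · intro x hx
      have h3 := hcon x (hsub (hsph hx))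
      have h4 : ‖x - c‖ = r / 2 := by rw [h2] at hx; simpa [dist_eq_norm] using hx
      rw [h4] at h3
      linarith
  nlinarith [mul_pos hk (by positivity : 0 < (r / 2) ^ 2)]

lemma ind_eq_add_of_subset {B D : Set ℂ} (h : D ⊆ B) (z : ℂ) :
    ind B z = ind (B \ D) z + ind D z := by
  by_cases h1 : z ∈ D
  · simp [ind, h1, h h1]
  · by_cases h2 : z ∈ B <;> simp [ind, h1, h2]

lemma newt_eq_add_of_subset {B D : Set ℂ} {M R M' R' : ℝ} (h : D ⊆ B)
    (h1 : IsDensity (ind (B \ D)) M R) (h2 : IsDensity (ind D) M' R') (y : ℂ) :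
    newt B y = newt (B \ D) y + newt D y := by
  simp only [newt, logPot]
  rw [← mul_add, ← integral_add (h1.integrable_log y) (h2.integrable_log y)]
  congr 2 with z
  rw [ind_eq_add_of_subset h z]; ring

lemma newtGrad_eq_add_of_subset {B D : Set ℂ} {M R M' R' : ℝ} (h : D ⊆ B)
    (h1 : IsDensity (ind (B \ D)) M R) (h2 : IsDensity (ind D) M' R') (y : ℂ) :
    newtGrad B y = newtGrad (B \ D) y + newtGrad D y := by
  simp only [newtGrad, cauPot]
  rw [← mul_add, ← integral_add (h1.integrable_inv y) (h2.integrable_inv y)]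
  congr 2 with z
  rw [ind_eq_add_of_subset h z]; push_cast; ring

lemma hasFDerivAt_newt {B : Set ℂ} {M R : ℝ} (h : IsDensity (ind B) M R) (y : ℂ) :
    HasFDerivAt (newt B) (reMul (newtGrad B y)) y := by
  refine ((hasFDerivAt_logPot h y).const_mul (-(1 / (2 * π)))).congr_fderiv ?_
  ext v; simp [newtGrad, mul_assoc]

lemma continuous_newt {B : Set ℂ} {M R : ℝ} (h : IsDensity (ind B) M R) : Continuous (newt B) :=
  (continuous_logPot h).const_mul _

lemma continuous_newtGrad {B : Set ℂ} {M R : ℝ} (h : IsDensity (ind B) M R) :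
    Continuous (newtGrad B) := (continuous_cauPot h).const_mul _

lemma newt_ball_inside {c y : ℂ} {r : ℝ} (h : ‖y - c‖ ≤ r) :
    newt (Metric.ball c r) y = -(r ^ 2 * log r / 2) + (r ^ 2 - ‖y - c‖ ^ 2) / 4 := by
  rw [newt, logPot_ball_inside h]; field_simp; ring

lemma newt_ball_outside {c y : ℂ} {r : ℝ} (hr : 0 ≤ r) (h : r ≤ ‖y - c‖) :
    newt (Metric.ball c r) y = -(r ^ 2 * log ‖y - c‖ / 2) := by
  rw [newt, logPot_ball_outside hr h]; field_simp

lemma newtGrad_ball_inside {c y : ℂ} {r : ℝ} (h : ‖y - c‖ < r) :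
    newtGrad (Metric.ball c r) y = -((starRingEnd ℂ) (y - c) / 2) := by
  rw [newtGrad, cauPot_ball_inside h]
  have : (π : ℂ) ≠ 0 := by exact_mod_cast pi_ne_zero
  push_cast; field_simp

/-- `|∇w|² + w` is subharmonic inside a patch, hence strictly convex perturbations of it have no
interior maximum. -/
lemma exists_gt_of_isOpen {B : Set ℂ} {R k : ℝ} (hB : IsOpen B) (hR : ∀ z ∈ B, ‖z‖ ≤ R)
    (hk : 0 < k) {z₀ : ℂ} (hz : z₀ ∈ B) : ∃ y ∈ B,
    ‖newtGrad B z₀‖ ^ 2 + newt B z₀ + k * ‖z₀‖ ^ 2 < ‖newtGrad B y‖ ^ 2 + newt B y + k * ‖y‖ ^ 2 := by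
  obtain ⟨r, hr, hsub⟩ := Metric.isOpen_iff.1 hB z₀ hz
  set D := Metric.ball z₀ r with hD
  have hEm : MeasurableSet (B \ D) := hB.measurableSet.diff Metric.isOpen_ball.measurableSet
  have dE : IsDensity (ind (B \ D)) 1 R := isDensity_ind hEm fun z hz => hR z hz.1
  have dD := isDensity_ball z₀ r
  have hfin : volume (B \ D) < ⊤ := by
    refine (measure_mono (t := Metric.closedBall 0 R) fun z hz => ?_).trans_lt
      measure_closedBall_lt_top
    simpa using hR z hz.1
  have hF : DifferentiableOn ℂ (newtGrad (B \ D)) D := by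
    refine (differentiableOn_cauPot_ind hEm hfin fun z hz => ?_).const_mul _
    have := hz.2
    rw [hD, Metric.mem_ball, dist_eq_norm, not_lt] at this
    exact this
  obtain ⟨Φ, hΦ⟩ := hF.isExactOn_ball
  set v := newt (B \ D) with hv
  set F := newtGrad (B \ D) with hFd
  have hconst : ∀ y ∈ D, v y - (Φ y).re = v z₀ - (Φ z₀).re := by
    intro y hy
    have hderiv : ∀ x ∈ D, HasFDerivAt (fun x => v x - (Φ x).re) (0 : ℂ →L[ℝ] ℝ) x := by
      intro x hx
      have h1 := hasFDerivAt_newt dE x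
      have h2 : HasFDerivAt Φ _ x := (hΦ x hx).hasFDerivAt.restrictScalars ℝ
      have h3 := Complex.reCLM.hasFDerivAt.comp x h2
      refine (h1.sub h3).congr_fderiv ?_
      ext
      simp only [← hFd, sub_apply, ContinuousLinearMap.comp_apply]
      simp; ring
    refine IsOpen.is_const_of_fderiv_eq_zero (𝕜 := ℝ) (f := fun x => v x - (Φ x).re)
      (s := D) Metric.isOpen_ball (convex_ball z₀ r).isPreconnected
      (fun x hx => (hderiv x hx).differentiableAt.differentiableWithinAt)
      (fun x hx => (hderiv x hx).fderiv) hy (Metric.mem_ball_self hr)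
  have hg : DifferentiableOn ℂ (fun y => 2 * (starRingEnd ℂ) (F z₀) * F y - F y * (y - z₀) + Φ y
      + 2 * k * (starRingEnd ℂ) z₀ * (y - z₀)) D := by
    have hΦd : DifferentiableOn ℂ Φ D := fun x hx =>
      (hΦ x hx).differentiableAt.differentiableWithinAt
    fun_prop
  obtain ⟨y, hy, hlt⟩ := exists_re_add_gt hr hk hg
  refine ⟨y, hsub hy, ?_⟩
  have hyn : ‖y - z₀‖ < r := by simpa [dist_eq_norm] using hy
  rw [newt_eq_add_of_subset hsub dE dD, newt_eq_add_of_subset hsub dE dD y,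
    newtGrad_eq_add_of_subset hsub dE dD, newtGrad_eq_add_of_subset hsub dE dD y,
    newtGrad_ball_inside hyn, newtGrad_ball_inside (by simpa using hr),
    newt_ball_inside hyn.le, newt_ball_inside (by simpa using hr.le), ← hv, ← hFd]
  have hc := hconst y hy
  obtain ⟨ζ, rfl⟩ : ∃ ζ, y = z₀ + ζ := ⟨y - z₀, by ring⟩
  simp only [← Complex.normSq_eq_norm_sq, Complex.normSq_apply, sub_self, map_zero, zero_div,
    neg_zero, add_zero, add_sub_cancel_left, Complex.add_re, Complex.add_im, Complex.sub_re,
    Complex.mul_re, Complex.mul_im, Complex.conj_re, Complex.conj_im,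
    Complex.neg_re, Complex.neg_im, Complex.ofReal_re, Complex.ofReal_im, Complex.re_ofNat,
    Complex.im_ofNat, Complex.div_ofNat_re, Complex.div_ofNat_im, Complex.zero_re,
    Complex.zero_im] at hlt hc ⊢
  nlinarith [sq_nonneg ((F (z₀ + ζ)).re - (F z₀).re), sq_nonneg ((F (z₀ + ζ)).im - (F z₀).im)]

lemma norm_newtGrad_le_three {B : Set ℂ} {R : ℝ} (hB : MeasurableSet B) (hR : ∀ z ∈ B, ‖z‖ ≤ R)
    (hv : volume.real B = π) (y : ℂ) : ‖newtGrad B y‖ ≤ 3 := by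
  have h0 : 0 < 1 / (8 * (|R| + 1)) := by positivity
  have hτ : 0 < min (1 / (8 * (|R| + 1))) (exp (-1)) := lt_min h0 (exp_pos _)
  refine IsRegion.norm_newtGrad_le (τ := min (1 / (8 * (|R| + 1))) (exp (-1)))
    ⟨hτ, ?_, hB, fun z hz => ?_⟩ hv y
  · have := log_le_log hτ (min_le_right _ _)
    rw [log_exp] at this
    linarith
  · calc _ ≤ 1 / (8 * (|R| + 1)) * (|R| + 1) := by
          refine mul_le_mul (min_le_left _ _) ?_ (norm_nonneg _) h0.le
          linarith [hR z hz, le_abs_self R]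
      _ = 1 / 8 := by field_simp

/-- A unit-strength patch that is the positivity set of a function close, up to a constant, to its
own Newtonian potential. -/
structure IsNearPatch (h : ℂ → ℝ) (G : ℂ → ℂ) (B : Set ℂ) (R M R' δ c : ℝ) : Prop extends
    IsLevelSet h G B R M where
  volume_eq : volume.real B = π
  centroid : ∫ z in B, z = 0
  preconnected : IsPreconnected B
  radius_pos : 0 < R'
  radius_lt : R' + 8 < 2 * R
  norm_le' : ∀ y ∈ B, ‖y‖ ≤ R'
  δ_pos : 0 < δ
  δ_le : δ ≤ 1 / 224
  grad_le : ∀ y, ‖y‖ ≤ R' + 8 → ‖G y - newtGrad B y‖ ≤ δ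
  near : ∀ y, ‖y‖ ≤ R' + 8 → |h y - (newt B y + c)| ≤ δ
  energy : π / 8 - δ ≤ ∫ y in B, h y

namespace IsNearPatch
variable {h : ℂ → ℝ} {G : ℂ → ℂ} {B : Set ℂ} {R M R' δ c : ℝ}

lemma isOpen' (H : IsNearPatch h G B R M R' δ c) : IsOpen B := H.toIsLevelSet.isOpen
lemma isMeas (H : IsNearPatch h G B R M R' δ c) : MeasurableSet B := H.toIsLevelSet.measurableSet
lemma dens (H : IsNearPatch h G B R M R' δ c) : IsDensity (ind B) 1 R' :=
  isDensity_ind H.isMeas H.norm_le'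

lemma norm_newtGrad_le (H : IsNearPatch h G B R M R' δ c) (y : ℂ) : ‖newtGrad B y‖ ≤ 3 :=
  norm_newtGrad_le_three H.isMeas H.norm_le' H.volume_eq y

lemma integral_newtGrad_mul (H : IsNearPatch h G B R M R' δ c) :
    ∫ y in B, ((starRingEnd ℂ) (newtGrad B y) * G y).re = ∫ y in B, h y := by
  have h1 := H.toIsLevelSet.integral_cauPot_grad H.dens H.isMeas
  have h2 : ∀ y, ((starRingEnd ℂ) (newtGrad B y) * G y).re
      = -(1 / (2 * π)) * ((starRingEnd ℂ) (cauPot (ind B) y) * G y).re := by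
    intro y
    rw [newtGrad, map_mul, map_neg, Complex.conj_ofReal, ← Complex.ofReal_neg, mul_assoc,
      Complex.re_ofReal_mul]
  simp_rw [h2]
  rw [integral_const_mul, h1, setIntegral_congr_fun H.isMeas (g := h)]
  · field_simp
  · intro z hz; simp [hz]

lemma exists_energy_ge (H : IsNearPatch h G B R M R' δ c) :
    ∃ y ∈ B, 1 / 4 - 4 * δ ≤ ‖newtGrad B y‖ ^ 2 + h y := by
  have hc := continuous_newtGrad H.dens
  have hδ := H.δ_pos
  have hfin : volume B ≠ ⊤ := H.toIsLevelSet.volume_lt_top.ne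
  have hne : volume B ≠ 0 := by
    intro h0
    have := H.volume_eq
    simp [Measure.real, h0] at this
    exact pi_ne_zero this.symm
  have i1 : IntegrableOn (fun y => ‖newtGrad B y‖ ^ 2) B := by
    refine Measure.integrableOn_of_bounded (M := 9) hfin (by fun_prop) ?_
    refine Eventually.of_forall fun y => ?_
    rw [norm_pow, norm_norm]
    nlinarith [H.norm_newtGrad_le y, norm_nonneg (newtGrad B y)]
  have i2 : IntegrableOn h B := H.toIsLevelSet.integrableOn
  have i3 : IntegrableOn (fun y => ‖newtGrad B y‖ ^ 2 + h y) B := i1.add i2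
  obtain ⟨y, hy, hle⟩ := exists_setAverage_le hne hfin i3
  refine ⟨y, hy, ?_⟩
  rw [setAverage_eq, H.volume_eq, smul_eq_mul, integral_add i1 i2] at hle
  have hm : Measurable (newtGrad B) := hc.measurable
  have hG := H.toIsLevelSet.measurable
  have i4 : IntegrableOn (fun y => ((starRingEnd ℂ) (newtGrad B y) * G y).re) B := by
    refine Measure.integrableOn_of_bounded (M := 3 * M) hfin
      (Complex.measurable_re.comp
        ((Complex.continuous_conj.measurable.comp hm).mul hG)).aestronglyMeasurable ?_
    refine (ae_restrict_iff' H.isMeas).2 (Eventually.of_forall fun y hy => ?_)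
    refine (Complex.abs_re_le_norm _).trans ?_
    rw [norm_mul, RCLike.norm_conj]
    exact mul_le_mul (H.norm_newtGrad_le y) (H.bound y hy) (norm_nonneg _) (by norm_num)
  have hlow : (∫ y in B, h y) - 3 * δ * π ≤ ∫ y in B, ‖newtGrad B y‖ ^ 2 := by
    rw [← H.integral_newtGrad_mul]
    have i5 : IntegrableOn (fun _ : ℂ => 3 * δ) B := integrableOn_const hfin
    have e5 : ∫ _ in B, 3 * δ = 3 * δ * π := by
      rw [setIntegral_const, H.volume_eq, smul_eq_mul]; ring
    rw [← e5, ← integral_sub i4 i5]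
    refine setIntegral_mono_on (i4.sub i5) i1 H.isMeas fun y hy => ?_
    have h1 := H.grad_le y (by linarith [H.norm_le' y hy])
    have h2 : ((starRingEnd ℂ) (newtGrad B y) * (G y - newtGrad B y)).re ≤ 3 * δ := by
      refine (Complex.re_le_norm _).trans ?_
      rw [norm_mul, RCLike.norm_conj]
      exact mul_le_mul (H.norm_newtGrad_le y) h1 (norm_nonneg _) (by norm_num)
    have h3 : ((starRingEnd ℂ) (newtGrad B y) * newtGrad B y).re = ‖newtGrad B y‖ ^ 2 := by
      rw [← Complex.normSq_eq_norm_sq, Complex.normSq_apply, Complex.mul_re, Complex.conj_re,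
        Complex.conj_im]; ring
    rw [mul_sub, Complex.sub_re, h3] at h2
    linarith
  have h4 := H.energy
  have h5 : π * (1 / 4 - 4 * δ) ≤ (∫ y in B, ‖newtGrad B y‖ ^ 2) + ∫ y in B, h y := by
    nlinarith [pi_gt_d2]
  have h6 : 1 / 4 - 4 * δ ≤ π⁻¹ * ((∫ y in B, ‖newtGrad B y‖ ^ 2) + ∫ y in B, h y) := by
    rw [le_inv_mul_iff₀ pi_pos]; exact h5
  linarith

lemma exists_boundary_point (H : IsNearPatch h G B R M R' δ c) :
    ∃ z, ‖z‖ ≤ R' ∧ h z = 0 ∧ 1 / 2 - 14 * δ ≤ ‖newtGrad B z‖ := by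
  have hδ := H.δ_pos
  have hR := H.radius_pos
  set k := δ / R' ^ 2 with hk
  have hk0 : 0 < k := by positivity
  have hcl : closure B ⊆ Metric.closedBall 0 R' :=
    closure_minimal (fun z hz => by simpa using H.norm_le' z hz) Metric.isClosed_closedBall
  have hcomp : IsCompact (closure B) :=
    (isCompact_closedBall (0 : ℂ) R').of_isClosed_subset isClosed_closure hcl
  obtain ⟨y, hy, hyQ⟩ := H.exists_energy_ge
  have hcont : Continuous fun y => ‖newtGrad B y‖ ^ 2 + newt B y + k * ‖y‖ ^ 2 := by
    have := continuous_newtGrad H.dens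
    have := continuous_newt H.dens
    fun_prop
  obtain ⟨z, hz, hmax⟩ := hcomp.exists_isMaxOn ⟨y, subset_closure hy⟩ hcont.continuousOn
  have hzB : z ∉ B := by
    intro hzB
    obtain ⟨x, hx, hlt⟩ := exists_gt_of_isOpen H.isOpen' H.norm_le' hk0 hzB
    exact absurd (hmax (subset_closure hx)) (not_le.2 hlt)
  have hzR : ‖z‖ ≤ R' := by simpa using hcl hz
  have hzlt : ‖z‖ < 2 * R := by linarith [H.radius_lt]
  have hz0 : h z = 0 := by
    refine le_antisymm (not_lt.1 fun h0 => hzB ((H.mem_iff z hzlt).2 h0)) ?_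
    have hcz : ContinuousWithinAt h B z := (H.deriv z hzlt).continuousAt.continuousWithinAt
    have : (𝓝[B] z).NeBot := mem_closure_iff_nhdsWithin_neBot.1 hz
    exact ge_of_tendsto hcz (eventually_nhdsWithin_of_forall fun x hx => (H.toIsLevelSet.pos hx).le)
  refine ⟨z, hzR, hz0, ?_⟩
  have h1 := hmax (subset_closure hy)
  simp only [Set.mem_ofPred_eq] at h1
  have h2 := abs_le.1 (H.near y (by linarith [H.norm_le' y hy]))
  have h3 := abs_le.1 (H.near z (by linarith))
  have h4 : k * ‖z‖ ^ 2 ≤ δ := by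
    rw [hk, div_mul_eq_mul_div, div_le_iff₀ (by positivity)]
    gcongr
  have h5 : 0 ≤ k * ‖y‖ ^ 2 := by positivity
  have h6 : 1 / 4 - 7 * δ ≤ ‖newtGrad B z‖ ^ 2 := by linarith
  by_contra! hlt
  have hn := norm_nonneg (newtGrad B z)
  nlinarith [H.δ_le]

end IsNearPatch

lemma cauPot_ball_outside_of_le {c y : ℂ} {r : ℝ} (hr : 0 < r) (h : r ≤ ‖y - c‖) :
    cauPot (ind (Metric.ball c r)) y = π * r ^ 2 * (y - c)⁻¹ := by
  have hyc : y - c ≠ 0 := norm_pos_iff.1 (hr.trans_le h)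
  have h1 : Tendsto (fun t : ℝ => c + t * (y - c)) (𝓝[>] 1) (𝓝 y) := by
    have : ContinuousAt (fun t : ℝ => c + t * (y - c)) 1 := by fun_prop
    have h2 := this.tendsto
    simp only [Complex.ofReal_one, one_mul, add_sub_cancel] at h2
    exact h2.mono_left nhdsWithin_le_nhds
  have h2 := ((continuous_cauPot (isDensity_ball c r)).tendsto y).comp h1
  have h3 : Tendsto (fun x : ℂ => (π : ℂ) * r ^ 2 * (x - c)⁻¹) (𝓝 y) (𝓝 (π * r ^ 2 * (y - c)⁻¹)) := by
    refine Tendsto.const_mul _ (Tendsto.inv₀ (by exact tendsto_id.sub_const c) hyc)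
  refine tendsto_nhds_unique h2 ((h3.comp h1).congr' ?_)
  filter_upwards [self_mem_nhdsWithin] with t ht
  have ht : 1 < t := ht
  simp only [Function.comp_apply]
  refine (cauPot_ball_outside hr.le ?_).symm
  rw [add_sub_cancel_left, norm_mul, Complex.norm_real, Real.norm_of_nonneg (by linarith)]
  nlinarith

lemma volume_real_ball (c : ℂ) {r : ℝ} (hr : 0 ≤ r) :
    volume.real (Metric.ball c r) = π * r ^ 2 := by
  rw [Measure.real, Complex.volume_ball]
  simp [ENNReal.toReal_ofReal hr]; ring

lemma ind_sub_abs (B D : Set ℂ) (z : ℂ) :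
    |ind B z - ind D z| = ind (B \ D) z + ind (D \ B) z := by
  by_cases h1 : z ∈ B <;> by_cases h2 : z ∈ D <;> simp [ind, h1, h2]

lemma isDensity_ind_sub {B D : Set ℂ} {R R' : ℝ} (hB : MeasurableSet B) (hD : MeasurableSet D)
    (h1 : ∀ z ∈ B, ‖z‖ ≤ R) (h2 : ∀ z ∈ D, ‖z‖ ≤ R') :
    IsDensity (fun z => ind B z - ind D z) 1 (max R R') where
  measurable := (isDensity_ind hB h1).measurable.sub (isDensity_ind hD h2).measurable
  pos := one_pos
  bound z := by by_cases h1 : z ∈ B <;> by_cases h2 : z ∈ D <;> simp [ind, h1, h2]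
  supp z hz := by
    have e1 : z ∉ B := fun h => (not_le.2 ((le_max_left R R').trans_lt hz)) (h1 z h)
    have e2 : z ∉ D := fun h => (not_le.2 ((le_max_right R R').trans_lt hz)) (h2 z h)
    simp [ind, e1, e2]

lemma cauPot_ind_sub {B D : Set ℂ} {M R M' R' : ℝ} (h1 : IsDensity (ind B) M R)
    (h2 : IsDensity (ind D) M' R') (y : ℂ) :
    cauPot (fun z => ind B z - ind D z) y = cauPot (ind B) y - cauPot (ind D) y := by
  rw [cauPot, cauPot, cauPot, ← integral_sub (h1.integrable_inv y) (h2.integrable_inv y)]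
  congr 1 with z; push_cast; ring

lemma logPot_ind_sub {B D : Set ℂ} {M R M' R' : ℝ} (h1 : IsDensity (ind B) M R)
    (h2 : IsDensity (ind D) M' R') (y : ℂ) :
    logPot (fun z => ind B z - ind D z) y = logPot (ind B) y - logPot (ind D) y := by
  rw [logPot, logPot, logPot, ← integral_sub (h1.integrable_log y) (h2.integrable_log y)]
  congr 1 with z; ring

lemma integral_ind {B : Set ℂ} (hB : MeasurableSet B) : ∫ z, ind B z = volume.real B := by
  rw [ind, integral_indicator hB]; simp

lemma volume_real_diff_comm {B D : Set ℂ} (hB : MeasurableSet B) (hD : MeasurableSet D)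
    (h1 : volume B ≠ ⊤) (h2 : volume D ≠ ⊤) (h : volume.real B = volume.real D) :
    volume.real (B \ D) = volume.real (D \ B) := by
  have e1 := measureReal_inter_add_sdiff (μ := volume) (s := B) hD h1
  have e2 := measureReal_inter_add_sdiff (μ := volume) (s := D) hB h2
  rw [Set.inter_comm] at e2
  linarith

/-- Newtonian gradients of two sets of equal area differ by the square root of the overlap defect. -/
lemma norm_newtGrad_sub_le {B D : Set ℂ} {R R' m : ℝ} (hB : MeasurableSet B) (hD : MeasurableSet D)
    (h1 : ∀ z ∈ B, ‖z‖ ≤ R) (h2 : ∀ z ∈ D, ‖z‖ ≤ R') (hfB : volume B ≠ ⊤) (hfD : volume D ≠ ⊤)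
    (h : volume.real B = volume.real D) (hm : 0 < m) (hBD : volume.real (D \ B) ≤ m) (y : ℂ) :
    ‖newtGrad B y - newtGrad D y‖ ≤ 2 * √(2 * m) := by
  have hf := isDensity_ind_sub hB hD h1 h2
  have dB := isDensity_ind hB h1
  have dD := isDensity_ind hD h2
  have hint : ∫ z, |ind B z - ind D z| ≤ 2 * m := by
    have i1 : Integrable (ind (B \ D)) := (isDensity_ind (hB.diff hD) fun z hz => h1 z hz.1).integrable
    have i2 : Integrable (ind (D \ B)) := (isDensity_ind (hD.diff hB) fun z hz => h2 z hz.1).integrable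
    simp_rw [ind_sub_abs]
    rw [integral_add i1 i2, integral_ind (hB.diff hD), integral_ind (hD.diff hB),
      volume_real_diff_comm hB hD hfB hfD h]
    linarith
  have key := integral_abs_mul_pow_le hf.integrable hf.bound zero_le_one one_lt_two
    (by positivity : 0 < 2 * m) hint y
  rw [show (1 : ℝ) - 1 / 2 = 1 / 2 by norm_num, ← sqrt_eq_rpow] at key
  have h3 : ‖cauPot (fun z => ind B z - ind D z) y‖ ≤ (2 * π + 1) * √(2 * m) := by
    refine (norm_integral_le_integral_norm _).trans (le_trans (le_of_eq ?_) (key.trans (le_of_eq ?_)))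
    · congr 1 with z
      rw [norm_mul, norm_inv, Complex.norm_real, norm_eq_abs, rpow_neg_one]
    · norm_num
  rw [newtGrad, newtGrad, ← mul_sub, ← cauPot_ind_sub dB dD, norm_mul, norm_neg, Complex.norm_real,
    Real.norm_of_nonneg (by positivity), one_div_mul_eq_div, div_le_iff₀ (by positivity)]
  nlinarith [pi_gt_d2, sqrt_nonneg (2 * m)]

/-- A quantitative form of the fact that a thin set near the boundary is small. -/
lemma volume_real_le_of_integral_le {E : Set ℂ} {c : ℂ} {K s : ℝ} (hE : MeasurableSet E)
    (hsub : E ⊆ Metric.ball c 1) (hs : 0 < s) (hs1 : s ≤ 1)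
    (hK : ∫ z in E, (1 - ‖z - c‖ ^ 2) ≤ K) : volume.real E ≤ K / s + π * s := by
  set r := √(1 - s) with hr
  have hr2 : r ^ 2 = 1 - s := sq_sqrt (by linarith)
  have hr0 : 0 ≤ r := sqrt_nonneg _
  have hr1 : r ≤ 1 := by nlinarith
  have hbr : Metric.ball c r ⊆ Metric.ball c 1 := Metric.ball_subset_ball hr1
  set A := Metric.ball c 1 \ Metric.ball c r with hA
  have hAm : MeasurableSet A := Metric.isOpen_ball.measurableSet.diff Metric.isOpen_ball.measurableSet
  have hAv : volume.real A = π * s := by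
    rw [hA, measureReal_sdiff hbr Metric.isOpen_ball.measurableSet measure_ball_lt_top.ne, volume_real_ball c zero_le_one,
      volume_real_ball c hr0, hr2]; ring
  have hEfin : volume E ≠ ⊤ := ((measure_mono hsub).trans_lt measure_ball_lt_top).ne
  have i0 : IntegrableOn (fun z => 1 - ‖z - c‖ ^ 2) E :=
    ((by fun_prop : Continuous fun z : ℂ => 1 - ‖z - c‖ ^ 2).continuousOn.integrableOn_compact
      (isCompact_closedBall c 1)).mono_set (hsub.trans Metric.ball_subset_closedBall)
  have i1 : IntegrableOn (fun z => (1 - ‖z - c‖ ^ 2) / s) E := i0.div_const s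
  have hAi : Integrable (A.indicator fun _ => (1 : ℝ)) := by
    rw [integrable_indicator_iff hAm]
    exact integrableOn_const ((measure_mono Set.sdiff_subset).trans_lt measure_ball_lt_top).ne
  have i2 : IntegrableOn (A.indicator fun _ => (1 : ℝ)) E := hAi.integrableOn
  calc volume.real E = ∫ _ in E, (1 : ℝ) := by simp
    _ ≤ ∫ z in E, ((1 - ‖z - c‖ ^ 2) / s + A.indicator (fun _ => (1 : ℝ)) z) := by
        refine setIntegral_mono_on (integrableOn_const hEfin) (i1.add i2) hE fun z hz => ?_
        have hz1 : ‖z - c‖ < 1 := by simpa [dist_eq_norm] using hsub hz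
        by_cases hzr : ‖z - c‖ < r
        · have : s ≤ 1 - ‖z - c‖ ^ 2 := by nlinarith [norm_nonneg (z - c)]
          have h3 : 1 ≤ (1 - ‖z - c‖ ^ 2) / s := (one_le_div hs).2 this
          have h4 : 0 ≤ A.indicator (fun _ => (1 : ℝ)) z :=
            Set.indicator_nonneg (fun _ _ => zero_le_one) _
          linarith
        · have hzA : z ∈ A := ⟨hsub hz, by simpa [dist_eq_norm] using hzr⟩
          rw [Set.indicator_of_mem hzA]
          have : 0 ≤ (1 - ‖z - c‖ ^ 2) / s := by
            apply div_nonneg _ hs.le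
            nlinarith [norm_nonneg (z - c)]
          linarith
    _ = (∫ z in E, (1 - ‖z - c‖ ^ 2)) / s + ∫ z in E, A.indicator (fun _ => (1 : ℝ)) z := by
        rw [integral_add i1 i2, integral_div]
    _ ≤ K / s + π * s := by
        gcongr
        rw [← hAv, ← integral_indicator_one hAm]
        exact setIntegral_le_integral hAi
          (Eventually.of_forall fun z => Set.indicator_nonneg (fun _ _ => zero_le_one) _)

namespace IsNearPatch
variable {h : ℂ → ℝ} {G : ℂ → ℂ} {B : Set ℂ} {R M R' δ c : ℝ}

/-- The patch nearly fills a unit disc whose boundary passes through a zero of `h`. -/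
lemma exists_disc (H : IsNearPatch h G B R M R' δ c) :
    ∃ z₀ c₀, ‖z₀‖ ≤ R' ∧ h z₀ = 0 ∧ ‖z₀ - c₀‖ = 1 ∧
      volume.real (Metric.ball c₀ 1 \ B) ≤ 2 * π * √(224 * δ) := by
  obtain ⟨z₀, hz₀, hz0, hq⟩ := H.exists_boundary_point
  have hδ := H.δ_pos
  have hδ1 := H.δ_le
  set q := newtGrad B z₀ with hqd
  have hqn : 0 < ‖q‖ := by linarith
  set s : ℂ := (starRingEnd ℂ) q / ‖q‖ with hs
  have hqc : (‖q‖ : ℂ) ≠ 0 := by exact_mod_cast hqn.ne'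
  have hsn : ‖s‖ = 1 := by
    rw [hs, norm_div, RCLike.norm_conj, Complex.norm_real, norm_norm, div_self hqn.ne']
  have hs0 : s ≠ 0 := norm_pos_iff.1 (by rw [hsn]; exact one_pos)
  have hsq : s * q = ‖q‖ := by
    rw [hs, div_mul_eq_mul_div, mul_comm, Complex.mul_conj, Complex.normSq_eq_norm_sq]
    push_cast; field_simp
  refine ⟨z₀, z₀ + s, hz₀, hz0, by simpa using hsn, ?_⟩
  set D := Metric.ball (z₀ + s) 1 with hD
  have hDm : MeasurableSet D := Metric.isOpen_ball.measurableSet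
  have hDn : ∀ z ∈ D, ‖z‖ ≤ ‖z₀ + s‖ + 1 := by
    intro z hz
    have : ‖z - (z₀ + s)‖ < 1 := by simpa [hD, dist_eq_norm] using hz
    have := norm_le_norm_add_norm_sub' z (z₀ + s)
    linarith
  have dB := H.dens
  have dD := isDensity_ind hDm hDn
  have hf := isDensity_ind_sub H.isMeas hDm H.norm_le' hDn
  set f : ℂ → ℝ := fun z => ind B z - ind D z with hfd
  have hfin : volume B ≠ ⊤ := H.toIsLevelSet.volume_lt_top.ne
  have hvD : volume.real D = π := by rw [hD, volume_real_ball _ zero_le_one]; ring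
  have hf0 : ∫ z, f z = 0 := by
    rw [hfd, integral_sub dB.integrable dD.integrable, integral_ind H.isMeas, integral_ind hDm, hvD,
      H.volume_eq, sub_self]
  have hcau : (cauPot f z₀ * (-s)).re = 2 * π * ‖q‖ - π := by
    have e1 : cauPot (ind B) z₀ = -(2 * π) * q := by
      rw [hqd, newtGrad]
      have : (π : ℂ) ≠ 0 := by exact_mod_cast pi_ne_zero
      push_cast; field_simp
    have e2 : cauPot (ind D) z₀ = π * (-s)⁻¹ := by
      rw [hD, cauPot_ball_outside_of_le one_pos (by simp [hsn])]
      simp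
    rw [hfd, cauPot_ind_sub dB dD, e1, e2]
    have : (-(2 * π) * q - π * (-s)⁻¹) * (-s) = ((2 * π * ‖q‖ - π : ℝ) : ℂ) := by
      push_cast
      rw [← hsq]; field_simp; ring
    rw [this, Complex.ofReal_re]
  have hJ : ∀ z, z ≠ z₀ → ((-s) / (z₀ - z)).re - 1 / 2
      = (1 - ‖z - (z₀ + s)‖ ^ 2) / (2 * ‖z - z₀‖ ^ 2) := by
    intro z hz
    obtain ⟨w, rfl⟩ : ∃ w, z = z₀ + w := ⟨z - z₀, by ring⟩
    have hw : w ≠ 0 := by simpa using hz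
    have hw2 : w.re ^ 2 + w.im ^ 2 ≠ 0 := by
      have := (Complex.normSq_pos.2 hw).ne'
      rwa [Complex.normSq_apply, ← sq, ← sq] at this
    have hs2 : s.re * s.re + s.im * s.im = 1 := by
      rw [← Complex.normSq_apply, Complex.normSq_eq_norm_sq, hsn, one_pow]
    rw [show (-s) / (z₀ - (z₀ + w)) = s / w by rw [sub_add_cancel_left, neg_div_neg_eq],
      show z₀ + w - (z₀ + s) = w - s by ring, add_sub_cancel_left, ← Complex.normSq_eq_norm_sq,
      ← Complex.normSq_eq_norm_sq, Complex.div_re, Complex.normSq_apply, Complex.normSq_apply,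
      Complex.sub_re, Complex.sub_im]
    field_simp
    linear_combination hs2
  have hint : Integrable fun z => f z * (((-s) / (z₀ - z)).re - 1 / 2) := by
    have i1 : Integrable fun z => f z * ((-s) / (z₀ - z)).re := by
      refine (((hf.integrable_inv z₀).mul_const (-s)).re).congr (Eventually.of_forall fun z => ?_)
      simp only [RCLike.re_eq_complex_re]
      rw [mul_assoc, Complex.re_ofReal_mul, div_eq_mul_inv, mul_comm (-s)]
    refine (i1.sub (hf.integrable.mul_const (1 / 2))).congr (Eventually.of_forall fun z => ?_)
    simp only [Pi.sub_apply]; ring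
  have hval : ∫ z, f z * (((-s) / (z₀ - z)).re - 1 / 2) = 2 * π * ‖q‖ - π := by
    rw [← hcau, cauPot_mul_re hf]
    have i1 : Integrable fun z => f z * ((-s) / (z₀ - z)).re := by
      refine (hint.add (hf.integrable.mul_const (1 / 2))).congr (Eventually.of_forall fun z => ?_)
      simp only [Pi.add_apply]; ring
    have i2 : Integrable fun z => f z * (1 / 2) := hf.integrable.mul_const _
    have e3 : ∫ z, f z * (1 / 2) = 0 := by rw [integral_mul_const, hf0, zero_mul]
    rw [← sub_zero (∫ z, f z * ((-s) / (z₀ - z)).re), ← e3, ← integral_sub i1 i2]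
    congr 1 with z; ring
  have hE : MeasurableSet (D \ B) := hDm.diff H.isMeas
  have hcont : Continuous fun z : ℂ => 1 - ‖z - (z₀ + s)‖ ^ 2 := by fun_prop
  have hi8 : IntegrableOn (fun z => (1 - ‖z - (z₀ + s)‖ ^ 2) / 8) (D \ B) :=
    ((hcont.continuousOn.integrableOn_compact (isCompact_closedBall (z₀ + s) 1)).mono_set
      (Set.sdiff_subset.trans Metric.ball_subset_closedBall)).div_const 8
  have hae : ∀ᵐ z : ℂ, z ≠ z₀ := by
    rw [ae_iff]; simp
  have hkey : ∫ z in D \ B, (1 - ‖z - (z₀ + s)‖ ^ 2) / 8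
      ≤ ∫ z, -(f z * (((-s) / (z₀ - z)).re - 1 / 2)) := by
    rw [← integral_indicator hE]
    refine integral_mono_ae ((integrable_indicator_iff hE).2 hi8) hint.neg ?_
    filter_upwards [hae] with z hz
    have hzp : 0 < ‖z - z₀‖ := norm_pos_iff.2 (sub_ne_zero.2 hz)
    rw [hJ z hz]
    by_cases hzD : z ∈ D
    · have hzn : ‖z - (z₀ + s)‖ < 1 := by simpa [hD, dist_eq_norm] using hzD
      by_cases hzB : z ∈ B
      · rw [Set.indicator_of_notMem fun h => h.2 hzB]
        simp [hfd, ind, hzD, hzB]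
      · rw [Set.indicator_of_mem (show z ∈ D \ B from ⟨hzD, hzB⟩)]
        have e4 : f z = -1 := by simp [hfd, ind, hzD, hzB]
        rw [e4, neg_one_mul, neg_neg]
        have h5 : ‖z - z₀‖ ≤ 2 := by
          have := norm_add_le (z - (z₀ + s)) s
          rw [show z - (z₀ + s) + s = z - z₀ by ring, hsn] at this
          linarith
        refine div_le_div_of_nonneg_left ?_ (by positivity) (by nlinarith)
        nlinarith [norm_nonneg (z - (z₀ + s))]
    · rw [Set.indicator_of_notMem fun h => hzD h.1]
      have hzn : 1 ≤ ‖z - (z₀ + s)‖ := by simpa [hD, dist_eq_norm] using hzD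
      have e4 : 0 ≤ f z := by
        by_cases hzB : z ∈ B <;> simp [hfd, ind, hzD, hzB]
      rw [← mul_neg, ← neg_div]
      refine mul_nonneg e4 (div_nonneg ?_ (by positivity))
      nlinarith
  rw [integral_neg, hval, integral_div] at hkey
  have hK : ∫ z in D \ B, (1 - ‖z - (z₀ + s)‖ ^ 2) ≤ π * (224 * δ) := by
    nlinarith [pi_pos]
  have h224 : 0 < 224 * δ := by positivity
  have hsq2 := sq_sqrt h224.le
  have hsp := sqrt_pos.2 h224
  have := volume_real_le_of_integral_le hE Set.sdiff_subset hsp (by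
    rw [sqrt_le_one]; linarith) hK
  refine this.trans (le_of_eq ?_)
  rw [← hsq2, sqrt_sq hsp.le]; field_simp; ring

end IsNearPatch

lemma integral_ball_sub_center (c : ℂ) {r : ℝ} : ∫ z in Metric.ball c r, (z - c) = 0 := by
  have h1 := (Measure.measurePreserving_sub_left (volume : Measure ℂ) (2 * c))
  have h2 := h1.setIntegral_preimage_emb (Homeomorph.subLeft (2 * c)).measurableEmbedding
    (fun z => z - c) (Metric.ball c r)
  have h3 : (fun x => 2 * c - x) ⁻¹' Metric.ball c r = Metric.ball c r := by
    ext x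
    simp only [Set.mem_preimage, Metric.mem_ball, dist_eq_norm]
    rw [← norm_neg, show -(2 * c - x - c) = x - c by ring]
  rw [h3] at h2
  have h4 : ∀ x, 2 * c - x - c = -(x - c) := fun x => by ring
  simp only [h4] at h2
  rw [integral_neg] at h2
  linear_combination (-1 / 2 : ℂ) * h2

lemma IsPreconnected.norm_lt_of_forall_ne {B : Set ℂ} (hB : IsPreconnected B) {c : ℂ} {r : ℝ}
    (hc : ∃ z ∈ B, ‖z - c‖ < r) (hne : ∀ z ∈ B, ‖z - c‖ ≠ r) : ∀ z ∈ B, ‖z - c‖ < r := by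
  obtain ⟨b, hb, hbr⟩ := hc
  intro z hz
  by_contra! h
  obtain ⟨x, hx, hxr⟩ := hB.intermediate_value hb hz
    (f := fun z => ‖z - c‖) (by fun_prop) ⟨hbr.le, h⟩
  exact hne x hx hxr

/-- A set trapped between two concentric discs and with centroid `0` has its centre near `0`. -/
lemma norm_center_le {B : Set ℂ} {c : ℂ} {t : ℝ} (hB : MeasurableSet B) (hv : volume.real B = π)
    (h0 : ∫ z in B, z = 0) (ht1 : t ≤ 1) (hin : Metric.ball c (1 - t) ⊆ B)
    (hout : ∀ z ∈ B, ‖z - c‖ < 1 + t) : ‖c‖ ≤ 4 * t := by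
  set D := Metric.ball c (1 - t) with hD
  have hDm : MeasurableSet D := Metric.isOpen_ball.measurableSet
  have hvD : volume.real D = π * (1 - t) ^ 2 := volume_real_ball c (by linarith)
  have hfin : volume B ≠ ⊤ := by
    refine ((measure_mono (t := Metric.ball c (1 + t)) fun z hz => ?_).trans_lt
      measure_ball_lt_top).ne
    simpa [dist_eq_norm] using hout z hz
  have hvE : volume.real (B \ D) = π - π * (1 - t) ^ 2 := by
    rw [measureReal_sdiff hin hDm hfin, hv, hvD]
  have ib : IntegrableOn (fun z => z - c) B := by
    refine Measure.integrableOn_of_bounded (M := 1 + t) hfin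
      (by fun_prop : Measurable fun z : ℂ => z - c).aestronglyMeasurable ?_
    exact (ae_restrict_iff' hB).2 (Eventually.of_forall fun z hz => (hout z hz).le)
  have ib2 : IntegrableOn (fun z : ℂ => z) B := by
    refine (ib.add (integrableOn_const (C := c) hfin)).congr (Eventually.of_forall fun z => ?_)
    simp
  have e1 : ∫ z in B, (z - c) = -(π * c) := by
    rw [integral_sub ib2 (integrableOn_const hfin), h0, setIntegral_const, hv]
    simp
  have e2 : ∫ z in B, (z - c) = ∫ z in B \ D, (z - c) := by
    have := setIntegral_sdiff hDm ib hin
    rw [integral_ball_sub_center, sub_zero] at this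
    exact this.symm
  have e3 : ‖∫ z in B \ D, (z - c)‖ ≤ 2 * volume.real (B \ D) := by
    refine norm_setIntegral_le_of_norm_le_const
      ((measure_mono Set.sdiff_subset).trans_lt hfin.lt_top) fun z hz => ?_
    linarith [hout z hz.1]
  rw [← e2, e1, norm_neg, norm_mul, Complex.norm_real, Real.norm_of_nonneg pi_pos.le, hvE] at e3
  have : π * ‖c‖ ≤ π * (4 * t) := by
    nlinarith [mul_nonneg pi_pos.le (sq_nonneg t)]
  exact le_of_mul_le_mul_left this pi_pos

namespace IsNearPatch
variable {h : ℂ → ℝ} {G : ℂ → ℂ} {B : Set ℂ} {R M R' δ c : ℝ}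

lemma near_disc (H : IsNearPatch h G B R M R' δ c) {m t : ℝ} (hm : m = 2 * π * √(224 * δ))
    (ht : t = 13 * (δ + 2 * √(2 * m))) (ht1 : t ≤ 1 / 2) :
    Metric.ball 0 (1 - 5 * t) ⊆ B ∧ ∀ z ∈ B, ‖z‖ ≤ 1 + 5 * t := by
  obtain ⟨z₀, c₀, hz₀, hz0, hzc, hvol⟩ := H.exists_disc
  have hδ := H.δ_pos
  have hm0 : 0 < m := by rw [hm]; positivity
  rw [← hm] at hvol
  set D := Metric.ball c₀ 1 with hD
  have hDm : MeasurableSet D := Metric.isOpen_ball.measurableSet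
  have hc0 : ‖c₀‖ ≤ R' + 1 := by
    have := norm_le_norm_add_norm_sub' c₀ z₀
    rw [norm_sub_rev, hzc] at this
    linarith
  have hDn : ∀ z ∈ D, ‖z‖ ≤ ‖c₀‖ + 1 := by
    intro z hz
    have : ‖z - c₀‖ < 1 := by simpa [hD, dist_eq_norm] using hz
    have := norm_le_norm_add_norm_sub' z c₀
    linarith
  have dD := isDensity_ind hDm hDn
  have hvD : volume.real D = π := by rw [hD, volume_real_ball _ zero_le_one]; ring
  set δ₁ := δ + 2 * √(2 * m) with hδ₁
  have hδ10 : 0 < δ₁ := by positivity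
  have hball : ∀ y ∈ Metric.closedBall c₀ 2, ‖y‖ ≤ R' + 3 := by
    intro y hy
    have h1 : ‖y - c₀‖ ≤ 2 := by simpa [dist_eq_norm] using hy
    have := norm_le_norm_add_norm_sub' y c₀
    linarith
  have hlip : ∀ y ∈ Metric.closedBall c₀ 2, |h y - newt D y| ≤ 3 * δ₁ := by
    intro y hy
    have hz₀m : z₀ ∈ Metric.closedBall c₀ 2 := by simp [dist_eq_norm, hzc]
    have hd : ∀ x ∈ Metric.closedBall c₀ 2, HasFDerivWithinAt (fun x => h x - newt D x)
        (reMul (G x) - reMul (newtGrad D x)) (Metric.closedBall c₀ 2) x := fun x hx =>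
      ((H.deriv x (by linarith [hball x hx, H.radius_lt])).sub
        (hasFDerivAt_newt dD x)).hasFDerivWithinAt
    have hb : ∀ x ∈ Metric.closedBall c₀ 2, ‖reMul (G x) - reMul (newtGrad D x)‖ ≤ δ₁ := by
      intro x hx
      have e1 : reMul (G x) - reMul (newtGrad D x) = reMul (G x - newtGrad D x) := by
        ext v; simp [sub_mul]
      rw [e1]
      refine (norm_reMul_le _).trans ?_
      have h1 := H.grad_le x (by linarith [hball x hx])
      have h2 := norm_newtGrad_sub_le H.isMeas hDm H.norm_le' hDn
        H.toIsLevelSet.volume_lt_top.ne measure_ball_lt_top.ne (H.volume_eq.trans hvD.symm) hm0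
        hvol x
      have := norm_add_le (G x - newtGrad B x) (newtGrad B x - newtGrad D x)
      rw [sub_add_sub_cancel] at this
      linarith
    have key := (convex_closedBall c₀ 2).norm_image_sub_le_of_norm_hasFDerivWithin_le hd hb hz₀m hy
    have hN : newt D z₀ = 0 := by
      rw [hD, newt_ball_outside zero_le_one hzc.ge, hzc]; simp
    rw [hz0, hN, sub_zero, sub_zero, norm_eq_abs] at key
    refine key.trans ?_
    have h1 : ‖y - c₀‖ ≤ 2 := by simpa [dist_eq_norm] using hy
    have h3 : ‖y - z₀‖ ≤ 3 := by
      have := norm_sub_le (y - c₀) (z₀ - c₀)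
      rw [sub_sub_sub_cancel_right, hzc] at this
      linarith
    rw [mul_comm]
    gcongr
  have ht0 : 0 < t := by rw [ht]; positivity
  have hlt : ∀ y ∈ Metric.closedBall c₀ 2, ‖y‖ < 2 * R := fun y hy => by
    linarith [hball y hy, H.radius_lt]
  have hin : Metric.ball c₀ (1 - t) ⊆ B := by
    intro y hy
    have hy1 : ‖y - c₀‖ < 1 - t := by simpa [dist_eq_norm] using hy
    have hy2 : y ∈ Metric.closedBall c₀ 2 := by
      rw [Metric.mem_closedBall, dist_eq_norm]; linarith
    rw [H.mem_iff y (hlt y hy2)]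
    have h1 := abs_le.1 (hlip y hy2)
    rw [hD, newt_ball_inside (by linarith)] at h1
    have h2 : t / 4 ≤ (1 - ‖y - c₀‖ ^ 2) / 4 := by nlinarith [norm_nonneg (y - c₀)]
    simp only [one_pow, log_one, mul_zero, zero_div, neg_zero, zero_add] at h1
    linarith
  have hout : ∀ z ∈ B, ‖z - c₀‖ < 1 + t := by
    refine IsPreconnected.norm_lt_of_forall_ne H.preconnected ⟨c₀, hin ?_, ?_⟩ fun z hz hzt => ?_
    · simp; linarith
    · simp; linarith
    have hy2 : z ∈ Metric.closedBall c₀ 2 := by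
      rw [Metric.mem_closedBall, dist_eq_norm]; linarith
    have h1 := abs_le.1 (hlip z hy2)
    rw [hD, newt_ball_outside zero_le_one (by linarith), hzt] at h1
    have h2 := H.toIsLevelSet.pos hz
    have h3 : t / 2 ≤ log (1 + t) := by
      have := one_sub_inv_le_log_of_pos (by linarith : 0 < 1 + t)
      refine le_trans ?_ this
      rw [← one_div, le_sub_iff_add_le, ← le_sub_iff_add_le', div_le_iff₀ (by linarith)]
      nlinarith
    linarith
  have hc := norm_center_le H.isMeas H.volume_eq H.centroid (by linarith) hin hout
  refine ⟨fun z hz => hin ?_, fun z hz => ?_⟩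
  · have hz : ‖z‖ < 1 - 5 * t := by simpa using hz
    rw [Metric.mem_ball, dist_eq_norm]
    linarith [norm_sub_le z c₀]
  · have := norm_le_norm_add_norm_sub' z c₀
    linarith [hout z hz]

end IsNearPatch

/-- Compactness-free stability of the disc: near solutions are near discs. -/
theorem exists_near_disc {t₀ : ℝ} (ht₀ : 0 < t₀) : ∃ δ, 0 < δ ∧ δ ≤ 1 / 224 ∧
    ∀ (h : ℂ → ℝ) (G : ℂ → ℂ) (B : Set ℂ) (R M R' c : ℝ), IsNearPatch h G B R M R' δ c →
      Metric.ball 0 (1 - t₀) ⊆ B ∧ ∀ z ∈ B, ‖z‖ ≤ 1 + t₀ := by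
  have hT : Tendsto (fun δ : ℝ => 13 * (δ + 2 * √(2 * (2 * π * √(224 * δ))))) (𝓝[>] 0) (𝓝 0) := by
    have : Continuous fun δ : ℝ => 13 * (δ + 2 * √(2 * (2 * π * √(224 * δ)))) := by fun_prop
    have h2 := this.tendsto 0
    simp only [mul_zero, sqrt_zero, add_zero] at h2
    exact h2.mono_left nhdsWithin_le_nhds
  have h1 := hT.eventually (gt_mem_nhds (by positivity : 0 < min (1 / 2) (t₀ / 5)))
  have h2 : ∀ᶠ δ : ℝ in 𝓝[>] 0, δ ≤ 1 / 224 :=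
    (eventually_le_nhds (by norm_num)).filter_mono nhdsWithin_le_nhds
  obtain ⟨δ, h1, h2, h3⟩ := (h1.and (h2.and self_mem_nhdsWithin)).exists
  refine ⟨δ, h3, h2, fun h G B R M R' c H => ?_⟩
  have h4 := h1.le.trans (min_le_left _ _)
  have h5 := h1.le.trans (min_le_right _ _)
  obtain ⟨h6, h7⟩ := H.near_disc rfl rfl h4
  refine ⟨(Metric.ball_subset_ball ?_).trans h6, fun z hz => (h7 z hz).trans ?_⟩ <;> linarith

/-- Lebesgue measure on pairs of points of `B`. -/
def pairMeasure (B : Set ℂ) : Measure (ℂ × ℂ) := (volume.restrict B).prod (volume.restrict B)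

namespace IsRegion
variable {τ η : ℝ} {B : Set ℂ}

lemma isFiniteMeasure_pair (h : IsRegion τ B) : IsFiniteMeasure (pairMeasure B) := by
  have := h.isFiniteMeasure
  unfold pairMeasure
  infer_instance

lemma ae_pair (h : IsRegion τ B) :
    ∀ᵐ p ∂pairMeasure B, p.1 ∈ B ∧ p.2 ∈ B ∧ p.1 ≠ p.2 := by
  have := h.isFiniteMeasure
  have hd : ∀ᵐ p ∂pairMeasure B, p.1 ≠ p.2 := by
    have hm : MeasurableSet {p : ℂ × ℂ | p.1 ≠ p.2} := measurableSet_diagonal.compl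
    rw [pairMeasure, Measure.ae_prod_iff_ae_ae hm]
    exact Eventually.of_forall fun y => ae_ne y B
  have hB : ∀ᵐ p ∂pairMeasure B, p ∈ B ×ˢ B := by
    rw [pairMeasure, Measure.prod_restrict]
    exact ae_restrict_mem (h.measurableSet.prod h.measurableSet)
  filter_upwards [hd, hB] with p h1 h2
  exact ⟨h2.1, h2.2, h1⟩

lemma integrable_pair_pow (h : IsRegion τ B) {a : ℝ} (ha : 0 ≤ a) (ha2 : a < 2) :
    Integrable (fun p : ℂ × ℂ => ‖p.1 - p.2‖ ^ (-a)) (pairMeasure B) := by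
  have hB := isDensity_ind h.measurableSet h.norm_le
  have h1 := hB.integrable_prod hB ha ha2
  have e : (fun p : ℂ × ℂ => ind B p.1 * ind B p.2 * ‖p.1 - p.2‖ ^ (-a))
      = (B ×ˢ B).indicator fun p => ‖p.1 - p.2‖ ^ (-a) := by
    ext p
    by_cases h1 : p.1 ∈ B <;> by_cases h2 : p.2 ∈ B <;> simp [ind, Set.indicator, h1, h2]
  rw [e, integrable_indicator_iff (h.measurableSet.prod h.measurableSet)] at h1
  rwa [pairMeasure, Measure.prod_restrict]

lemma norm_pair_le (h : IsRegion τ B) {y z : ℂ} (hy : y ∈ B) (hz : z ∈ B) :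
    ‖y - z‖ ≤ 1 / 4 / τ := by
  have h1 := h.norm_le y hy
  have h2 := h.norm_le z hz
  have h3 := norm_sub_le y z
  have e : 1 / 4 / τ = 1 / 8 / τ + 1 / 8 / τ := by ring
  linarith

lemma integrable_pair_wlog (h : IsRegion τ B) :
    Integrable (fun p : ℂ × ℂ => wlog τ p.1 p.2) (pairMeasure B) := by
  have := h.isFiniteMeasure_pair
  have h1 : Integrable (fun p : ℂ × ℂ => (-log τ + 1 / 4 / τ) + ‖p.1 - p.2‖ ^ (-(3 / 2) : ℝ))
      (pairMeasure B) := (integrable_const _).add (h.integrable_pair_pow (by norm_num) (by norm_num))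
  refine h1.mono' (measurable_wlog τ).aestronglyMeasurable ?_
  filter_upwards [h.ae_pair] with p hp
  have h2 := h.norm_pair_le hp.1 hp.2.1
  have h3 := abs_log_le_rpow (norm_nonneg (p.1 - p.2))
  have := h.one_le
  rw [Real.norm_eq_abs, abs_of_nonneg (by rw [wlog]; positivity), wlog]
  linarith

lemma integrable_pair_kernGrad (h : IsRegion τ B) :
    Integrable (fun p : ℂ × ℂ => kernGrad τ p.1 p.2) (pairMeasure B) := by
  have h1 := (h.integrable_pair_pow zero_le_one one_lt_two).const_mul 16
  have h2 := h.integrable_pair_wlog.const_mul (60 * τ)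
  refine (h1.add h2).mono' (measurable_kernGrad τ).aestronglyMeasurable ?_
  filter_upwards [h.ae_pair] with p hp
  have hn := h.nearPair ((h.le _ hp.1).trans (by norm_num)) hp.2.1 hp.2.2
  have h3 := hn.norm_kernGrad_add_le
  have h4 := norm_sub_le (kernGrad τ p.1 p.2 + (1 / (2 * π) : ℝ) * (p.1 - p.2)⁻¹)
    ((1 / (2 * π) : ℝ) * (p.1 - p.2)⁻¹)
  rw [add_sub_cancel_right] at h4
  have h5 : ‖((1 / (2 * π) : ℝ) : ℂ) * (p.1 - p.2)⁻¹‖ ≤ ‖p.1 - p.2‖⁻¹ := by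
    rw [norm_mul, norm_inv, Complex.norm_real, Real.norm_of_nonneg (by positivity)]
    have : 1 / (2 * π) ≤ 1 := by
      rw [div_le_one (by positivity)]; linarith [pi_gt_three]
    have := inv_nonneg.2 (norm_nonneg (p.1 - p.2))
    nlinarith
  rw [Pi.add_apply, rpow_neg_one]
  have e : 1 / 4 / ‖p.1 - p.2‖ = 1 / 4 * ‖p.1 - p.2‖⁻¹ := by rw [div_eq_mul_inv]
  rw [e] at h3
  linarith

lemma integral_pair_wlog_le (h : IsRegion τ B) (hB : volume.real B = π) :
    ∫ p, wlog τ p.1 p.2 ∂pairMeasure B ≤ 30 * -log τ * π := by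
  have := h.isFiniteMeasure
  have hi := h.integrable_pair_wlog
  unfold pairMeasure at hi ⊢
  rw [integral_prod _ hi]
  calc _ ≤ ∫ y in B, 30 * -log τ := by
        refine setIntegral_mono_on hi.integral_prod_left (integrable_const _) h.measurableSet ?_
        exact fun y hy => h.integral_wlog_le hB ((h.le y hy).trans (by norm_num))
    _ = _ := by simp [hB]; ring

lemma abs_integral_pair_sub_le (h : IsRegion τ B) (hB : volume.real B = π) {F A : ℂ × ℂ → ℝ}
    {K : ℝ} (hK : 0 ≤ K) (hF : Integrable F (pairMeasure B)) (hA : Integrable A (pairMeasure B))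
    (hFA : ∀ y ∈ B, ∀ z ∈ B, y ≠ z → |F (y, z) - A (y, z)| ≤ K * wlog τ y z) :
    |∫ p, F p ∂pairMeasure B - ∫ p, A p ∂pairMeasure B| ≤ K * (30 * -log τ * π) := by
  rw [← integral_sub hF hA]
  refine abs_integral_le_integral_abs.trans ?_
  refine (integral_mono_ae (hF.sub hA).abs (h.integrable_pair_wlog.const_mul K) ?_).trans ?_
  · filter_upwards [h.ae_pair] with p hp using hFA p.1 hp.1 p.2 hp.2.1 hp.2.2
  · rw [integral_const_mul]
    exact mul_le_mul_of_nonneg_left (h.integral_pair_wlog_le hB) hK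

lemma integrable_pair_kernGrad_mul (h : IsRegion τ B) {φ : ℂ → ℂ} (hφ : Measurable φ) {K : ℝ}
    (hK : ∀ y ∈ B, ‖φ y‖ ≤ K) :
    Integrable (fun p : ℂ × ℂ => (kernGrad τ p.1 p.2 * φ p.1).re) (pairMeasure B) := by
  have h1 : Integrable (fun p : ℂ × ℂ => kernGrad τ p.1 p.2 * φ p.1) (pairMeasure B) := by
    refine h.integrable_pair_kernGrad.mul_bdd (c := K)
      (hφ.comp measurable_fst).aestronglyMeasurable ?_
    filter_upwards [h.ae_pair] with p hp using hK _ hp.1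
  exact h1.re

lemma integrable_pair_symm (h : IsRegion τ B) {F : ℂ × ℂ → ℝ} (hF : Integrable F (pairMeasure B)) :
    Integrable (fun p : ℂ × ℂ => F (p.2, p.1)) (pairMeasure B) := by
  have := h.isFiniteMeasure
  exact hF.swap

lemma integral_spotGrad_mul (h : IsRegion τ B) {φ : ℂ → ℂ} (hφ : Measurable φ) {K : ℝ}
    (hK : ∀ y ∈ B, ‖φ y‖ ≤ K) :
    ∫ y in B, (spotGrad τ B y * φ y).re = 1 / 2 * ∫ p, ((kernGrad τ p.1 p.2 * φ p.1).re
      + (kernGrad τ p.2 p.1 * φ p.2).re) ∂pairMeasure B := by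
  have := h.isFiniteMeasure
  have h1 := h.integrable_pair_kernGrad_mul hφ hK
  have h2 := h.integrable_pair_symm h1
  simp only at h2
  rw [integral_add h1 h2]
  have e : ∫ p, (kernGrad τ p.2 p.1 * φ p.2).re ∂pairMeasure B
      = ∫ p, (kernGrad τ p.1 p.2 * φ p.1).re ∂pairMeasure B :=
    integral_prod_swap (μ := volume.restrict B) (ν := volume.restrict B)
      (fun p : ℂ × ℂ => (kernGrad τ p.1 p.2 * φ p.1).re)
  rw [e]
  have e2 : ∫ p, (kernGrad τ p.1 p.2 * φ p.1).re ∂pairMeasure B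
      = ∫ y in B, (spotGrad τ B y * φ y).re := by
    unfold pairMeasure at h1 ⊢
    rw [integral_prod _ h1]
    refine setIntegral_congr_fun h.measurableSet fun y hy => ?_
    simp only
    have hi := h.integrableOn_kernGrad ((h.le y hy).trans (by norm_num : (1 : ℝ) / 8 ≤ 1 / 4))
    rw [spotGrad, ← integral_mul_const]
    exact integral_re (hi.mul_const (φ y))
  rw [e2]
  ring

/-- The virial of the self-interaction of a region. -/
lemma abs_integral_dilation_le (h : IsRegion τ B) (hB : volume.real B = π) (hη : η ≤ 1 / 4)
    (hBη : ∀ z ∈ B, τ * ‖z‖ ≤ η) :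
    |(∫ y in B, (spotGrad τ B y * y).re) + π / 4| ≤ 5000 * (η * -log τ) := by
  have := h.isFiniteMeasure
  have := h.isFiniteMeasure_pair
  have hη0 : 0 ≤ η := by
    by_contra! h0
    have : B = ∅ := Set.eq_empty_of_forall_notMem fun z hz =>
      absurd (hBη z hz) (not_le.2 (h0.trans_le (mul_nonneg h.τ_pos.le (norm_nonneg z))))
    rw [this] at hB
    simp at hB
    exact pi_pos.ne hB
  have hl := h.one_le
  have e0 := h.integral_spotGrad_mul measurable_id h.norm_le
  simp only [id] at e0
  rw [e0]
  have h1 := h.integrable_pair_kernGrad_mul measurable_id h.norm_le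
  have h2 := h.integrable_pair_symm h1
  have h3 := h.abs_integral_pair_sub_le hB (A := fun _ => -(1 / (2 * π)))
    (mul_nonneg (by norm_num : (0 : ℝ) ≤ 105) hη0)
    (h1.add h2) (integrable_const _) (fun y hy z hz hne => by
      have hn : NearPair τ η y z := ⟨h.τ_pos, h.one_le, hη, hBη y hy, hBη z hz, hne⟩
      have := hn.abs_dilation_le
      simp only [Pi.add_apply, id, sub_neg_eq_add]
      linarith)
  have e : ∫ _, -(1 / (2 * π)) ∂pairMeasure B = -(π / 2) := by
    rw [integral_const, pairMeasure, measureReal_def, ← Set.univ_prod_univ, Measure.prod_prod,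
      ENNReal.toReal_mul, Measure.restrict_apply_univ, ← measureReal_def, hB, smul_eq_mul]
    field_simp
  rw [e] at h3
  simp only [Pi.add_apply, id] at h3 ⊢
  rw [abs_le] at h3 ⊢
  have hπ := pi_lt_d2
  have : 0 ≤ η * -log τ := mul_nonneg hη0 (by linarith)
  constructor <;> nlinarith [h3.1, h3.2]

end IsRegion

namespace IsCore
variable {τ ω m η : ℝ} {B : Set ℂ}

lemma integral_re (h : IsCore τ ω m B) : ∫ z in B, z.re = 0 := by
  have := h.isFiniteMeasure
  have hi : IntegrableOn (fun z : ℂ => z) B := by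
    refine (integrable_const (1 / 8 / τ)).mono' (by fun_prop) ?_
    filter_upwards [ae_restrict_mem h.measurableSet] with z hz using h.norm_le z hz
  have e := _root_.integral_re hi
  rw [h.centroid] at e
  simpa using e

lemma le_integral_lev (h : IsCore τ ω m B) (hη : η ≤ 1 / 4) (hBη : ∀ z ∈ B, τ * ‖z‖ ≤ η) :
    π / 8 - 2500 * (η * -log τ) ≤ ∫ y in B, lev τ ω m B y := by
  have := h.isFiniteMeasure
  obtain ⟨M, H⟩ := h.exists_isLevelSet
  have h1 := H.integral_dilation
  have h2 := abs_le.1 (h.abs_integral_dilation_le h.volume_eq hη hBη)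
  have hb : ∀ {f : ℂ → ℝ}, Continuous f → IntegrableOn f B := fun {f} hf =>
    (hf.continuousOn.integrableOn_compact (isCompact_closedBall 0 (1 / 8 / τ))).mono_set
      fun z hz => mem_closedBall_zero_iff.2 (h.norm_le z hz)
  have i1 : IntegrableOn (fun y : ℂ => ω * τ * y.re) B := hb (by fun_prop)
  have i2 : IntegrableOn (fun y : ℂ => ω * τ ^ 2 * y.re ^ 2) B := hb (by fun_prop)
  have i3 : IntegrableOn (fun y : ℂ => ω * τ * y.re + ω * τ ^ 2 * y.re ^ 2) B := i1.add i2
  have i4 : IntegrableOn (fun y : ℂ => (y * levGrad τ ω B y).re) B := by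
    have : IntegrableOn (fun y : ℂ => levGrad τ ω B y * y) B := by
      refine H.integrableOn_grad.mul_bdd (c := 1 / 8 / τ) (by fun_prop) ?_
      filter_upwards [ae_restrict_mem h.measurableSet] with z hz using h.norm_le z hz
    simp_rw [mul_comm _ (levGrad _ _ _ _)]
    exact this.re
  have e : ∀ y : ℂ, (spotGrad τ B y * y).re
      = (y * levGrad τ ω B y).re + (ω * τ * y.re + ω * τ ^ 2 * y.re ^ 2) := fun y => by
    rw [levGrad, hgt]
    simp
    ring
  simp_rw [e] at h2
  rw [integral_add i4 i3, integral_add i1 i2, integral_const_mul, h.integral_re, h1] at h2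
  have h3 : 0 ≤ ∫ y in B, ω * τ ^ 2 * y.re ^ 2 := integral_nonneg fun y => by
    have := h.ω_pos
    simp only [Pi.zero_apply]
    positivity
  linarith [h2.2]

/-- The cross-section of a thin ring is close to a disc. -/
lemma exists_near_disc {c₀ C₀ t₀ : ℝ} (hc₀ : 0 < c₀) (hC₀ : 0 < C₀) (ht₀ : 0 < t₀) :
    ∃ Λ : ℝ, ∀ τ ω m : ℝ, ∀ B : Set ℂ, IsCore τ ω m B → c₀ * -log τ ≤ ω → ω ≤ C₀ * -log τ →
      Λ ≤ -log τ → Metric.ball 0 (1 - t₀) ⊆ B ∧ ∀ z ∈ B, ‖z‖ ≤ 1 + t₀ := by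
  obtain ⟨δ, hδ, hδ', H⟩ := VortexRing.exists_near_disc ht₀
  obtain ⟨Λ, hΛ⟩ := exists_radius hc₀ (δ := δ / (4000 + 2 * C₀)) (by positivity)
  refine ⟨Λ, fun τ ω m B h hω hω' hl => ?_⟩
  obtain ⟨R', η, hR', hBR, hη, hη4, hηl⟩ := hΛ τ ω m B h hω hl
  obtain ⟨M, hM⟩ := h.exists_isLevelSet
  have hτ := h.τ_pos
  have hlam := h.one_le
  have hω0 := h.ω_pos
  rw [le_div_iff₀ (by positivity)] at hηl
  set X := η * -log τ with hX
  have hτη : 8 * τ ≤ η := by nlinarith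
  have hη0 : 0 < η := by linarith
  have hηX : η ≤ X := by nlinarith
  have hτX : 8 * (τ * -log τ) ≤ X := by nlinarith
  have hτω : 8 * (ω * τ) ≤ C₀ * X := by nlinarith [mul_le_mul_of_nonneg_right hω' hτ.le]
  have hX0 : 0 < X := by linarith
  have hy' : ∀ y : ℂ, ‖y‖ ≤ R' + 8 → τ * ‖y‖ ≤ η := fun y hy =>
    (mul_le_mul_of_nonneg_left hy hτ.le).trans hη
  have hBη : ∀ z ∈ B, τ * ‖z‖ ≤ η := fun z hz => hy' z (by linarith [hBR z hz])
  have hC : 0 < C₀ * X := mul_pos hC₀ hX0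
  refine H (lev τ ω m B) (levGrad τ ω B) B (1 / 8 / τ) M R'
    ((-log τ + ringB / 2) / 2 - ω / 2 - m) ⟨hM, h.volume_eq, h.centroid, h.preconnected, hR', ?_,
      hBR, hδ, hδ', fun y hy => ?_, fun y hy => ?_, ?_⟩
  · rw [show 2 * (1 / 8 / τ) = 1 / 4 / τ by ring, lt_div_iff₀ hτ]; linarith
  · refine (h.norm_levGrad_sub_le hη4.le hBη (hy' y hy)).trans ?_
    linarith
  · have h1 := abs_le.1 (h.abs_spot_sub_le h.volume_eq hη4.le hBη (hy' y hy))
    have h2 := abs_le.1 (abs_re_le_of_norm_le hτ (hy' y hy))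
    have e : lev τ ω m B y - (newt B y + ((-log τ + ringB / 2) / 2 - ω / 2 - m))
        = (spot τ B y - ((-log τ + ringB / 2) / 2 + newt B y))
          - ω * (τ * y.re) * (1 + τ * y.re / 2) := by
      rw [lev, hgt]; ring
    have h3 : |ω * (τ * y.re) * (1 + τ * y.re / 2)| ≤ C₀ * X * (9 / 8) := by
      have h4 : ω * η ≤ C₀ * X := by nlinarith [mul_le_mul_of_nonneg_right hω' hη0.le]
      rw [abs_mul, abs_mul, abs_of_pos hω0]
      have h5 : |1 + τ * y.re / 2| ≤ 9 / 8 := by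
        rw [abs_le]; constructor <;> linarith [h2.1, h2.2]
      have h6 : ω * |τ * y.re| ≤ C₀ * X :=
        (mul_le_mul_of_nonneg_left (abs_le.2 h2) hω0.le).trans h4
      exact mul_le_mul h6 h5 (abs_nonneg _) hC.le
    have h4 := abs_le.1 h3
    rw [e, abs_le]
    constructor <;> linarith [h1.1, h1.2, h4.1, h4.2]
  · have := h.le_integral_lev hη4.le hBη
    linarith

end IsCore

/-- The set `B` lies between the discs of radii `1 - b` and `1 + a`. -/
structure IsNearDisc (B : Set ℂ) (a b : ℝ) : Prop where
  a_pos : 0 < a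
  b_pos : 0 < b
  a_le : a ≤ 1 / 2
  b_le : b ≤ 1 / 2
  ball_subset : Metric.ball 0 (1 - b) ⊆ B
  norm_le : ∀ z ∈ B, ‖z‖ ≤ 1 + a

/-- The closed annulus of radii `1 - b` and `1 + a`. -/
def annulus (a b : ℝ) : Set ℂ := {z | 1 - b ≤ ‖z‖ ∧ ‖z‖ ≤ 1 + a}

lemma measurableSet_annulus (a b : ℝ) : MeasurableSet (annulus a b) :=
  measurable_norm (measurableSet_Icc (a := 1 - b) (b := 1 + a))

lemma abs_log_le_inv_add {s : ℝ} (hs : 0 ≤ s) : |log s| ≤ s⁻¹ + s := by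
  rcases hs.eq_or_lt with rfl | hs
  · simp
  have h1 := one_sub_inv_le_log_of_pos hs
  have h2 := log_le_sub_one_of_pos hs
  have : 0 < s⁻¹ := by positivity
  rw [abs_le]; constructor <;> linarith

namespace IsNearDisc
variable {B : Set ℂ} {a b : ℝ}

lemma norm_le_two (H : IsNearDisc B a b) : ∀ z ∈ B, ‖z‖ ≤ 2 := fun z hz => by
  linarith [H.norm_le z hz, H.a_le]

lemma mem_annulus (H : IsNearDisc B a b) {z : ℂ} (hz : ind B z ≠ ind (Metric.ball 0 1) z) :
    z ∈ annulus a b := by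
  have ha := H.a_pos
  have hb := H.b_pos
  by_contra hn
  rw [annulus, Set.mem_ofPred_eq, not_and_or, not_le, not_le] at hn
  rcases hn with h | h
  · refine hz ?_
    rw [ind, Set.indicator_of_mem (H.ball_subset (mem_ball_zero_iff.2 h)), ind,
      Set.indicator_of_mem (mem_ball_zero_iff.2 (by linarith))]
  · refine hz ?_
    rw [ind, Set.indicator_of_notMem (fun hz => absurd (H.norm_le z hz) (not_le.2 h)), ind,
      Set.indicator_of_notMem (fun hz => absurd (mem_ball_zero_iff.1 hz) (by linarith))]

lemma abs_ind_sub_le (H : IsNearDisc B a b) (z : ℂ) :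
    |ind B z - ind (Metric.ball 0 1) z| ≤ ind (annulus a b) z := by
  by_cases hz : ind B z = ind (Metric.ball 0 1) z
  · rw [hz, sub_self, abs_zero]
    exact Set.indicator_nonneg (fun _ _ => zero_le_one) z
  · have h1 : ind (annulus a b) z = 1 := Set.indicator_of_mem (H.mem_annulus hz) _
    rw [h1, abs_le]
    by_cases h2 : z ∈ B <;> by_cases h3 : z ∈ Metric.ball (0 : ℂ) 1 <;> simp [ind, Set.indicator, h2, h3]

lemma isDensity_annulus (H : IsNearDisc B a b) : IsDensity (ind (annulus a b)) 1 2 :=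
  isDensity_ind (measurableSet_annulus a b) fun z hz => by linarith [hz.2, H.a_le]

lemma volume_annulus_le (H : IsNearDisc B a b) : volume.real (annulus a b) ≤ 8 * (a + b) := by
  have ha := H.a_pos
  have hb := H.b_pos
  have ha' := H.a_le
  have hb' := H.b_le
  have e : annulus a b = Metric.closedBall 0 (1 + a) \ Metric.ball 0 (1 - b) := by
    ext z
    simp [annulus, and_comm]
  have hsub : Metric.ball (0 : ℂ) (1 - b) ⊆ Metric.closedBall 0 (1 + a) :=
    (Metric.ball_subset_ball (by linarith)).trans Metric.ball_subset_closedBall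
  have hv : volume.real (Metric.closedBall (0 : ℂ) (1 + a)) = π * (1 + a) ^ 2 := by
    rw [Measure.real, Complex.volume_closedBall]
    simp [ENNReal.toReal_ofReal (show 0 ≤ 1 + a by linarith)]; ring
  rw [e, measureReal_sdiff hsub Metric.isOpen_ball.measurableSet measure_closedBall_lt_top.ne, hv,
    volume_real_ball _ (by linarith)]
  have h2 : (1 + a) ^ 2 - (1 - b) ^ 2 ≤ 5 / 2 * (a + b) := by nlinarith
  nlinarith [pi_lt_d2, pi_pos]

end IsNearDisc

lemma isRegion_unit_ball : IsRegion (exp (-10)) (Metric.ball 0 1) where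
  τ_pos := exp_pos _
  one_le := by rw [log_exp]; norm_num
  measurableSet := Metric.isOpen_ball.measurableSet
  le z hz := by
    have h1 := (mem_ball_zero_iff.1 hz).le
    have h2 : exp (-10) ≤ 1 / 8 := by
      have h3 := add_one_le_exp (10 : ℝ)
      rw [exp_neg, inv_le_comm₀ (exp_pos _) (by norm_num)]
      linarith
    nlinarith [exp_pos (-10 : ℝ), norm_nonneg z]

lemma integral_pair_eq {B : Set ℂ} (hB : MeasurableSet B) (q : ℂ × ℂ → ℝ) :
    ∫ p, q p ∂pairMeasure B = ∫ p, ind B p.1 * ind B p.2 * q p ∂(volume.prod volume) := by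
  rw [pairMeasure, Measure.prod_restrict, ← integral_indicator (hB.prod hB)]
  congr 1 with p
  by_cases h1 : p.1 ∈ B <;> by_cases h2 : p.2 ∈ B <;> simp [ind, Set.indicator, h1, h2]

/-- Replacing a nearly circular set by the unit disc in a double integral. -/
lemma exists_abs_integral_pair_sub_disc_le : ∃ C : ℝ, 0 < C ∧ ∀ (B : Set ℂ) (a b K : ℝ)
    (q : ℂ × ℂ → ℝ), MeasurableSet B → IsNearDisc B a b → Measurable q → 0 ≤ K →
    (∀ y z : ℂ, ‖y‖ ≤ 2 → ‖z‖ ≤ 2 → |q (y, z)| ≤ K * (1 + ‖y - z‖⁻¹)) →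
    |∫ p, q p ∂pairMeasure B - ∫ p, q p ∂pairMeasure (Metric.ball 0 1)| ≤ C * K * (a + b) := by
  set U : Set ℂ := Metric.closedBall 0 2 with hU
  have dU : IsDensity (ind U) 1 2 := isDensity_ind Metric.isClosed_closedBall.measurableSet
    fun z hz => mem_closedBall_zero_iff.1 hz
  obtain ⟨C, hC, hCb⟩ := dU.exists_pow_le zero_le_one one_lt_two
  have hUv : 0 ≤ volume.real U := measureReal_nonneg
  refine ⟨16 * (volume.real U + C), by positivity, fun B a b K q hB H hq hK hqK => ?_⟩
  have hD : MeasurableSet (Metric.ball (0 : ℂ) 1) := Metric.isOpen_ball.measurableSet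
  have hiU : ∀ {z : ℂ}, ‖z‖ ≤ 2 → ind U z = 1 := fun hz =>
    Set.indicator_of_mem (mem_closedBall_zero_iff.2 hz) _
  have dN := H.isDensity_annulus
  have hn : ∀ (S : Set ℂ) (z : ℂ), 0 ≤ ind S z ∧ ind S z ≤ 1 := fun S z => by
    by_cases hz : z ∈ S <;> simp [ind, hz]
  have hw : ∀ {f g : ℂ → ℝ}, IsDensity f 1 2 → IsDensity g 1 2 → Integrable
      (fun p : ℂ × ℂ => f p.1 * g p.2 * (1 + ‖p.1 - p.2‖⁻¹)) (volume.prod volume) := by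
    intro f g hf hg
    have h0 := hf.integrable_prod hg le_rfl two_pos
    have h1 := hf.integrable_prod hg zero_le_one one_lt_two
    refine (h0.add h1).congr (Eventually.of_forall fun p => ?_)
    simp only [Pi.add_apply, neg_zero, rpow_zero, rpow_neg_one]
    ring
  have hqi : ∀ {S : Set ℂ}, MeasurableSet S → (∀ z ∈ S, ‖z‖ ≤ 2) → Integrable
      (fun p : ℂ × ℂ => ind S p.1 * ind S p.2 * q p) (volume.prod volume) := by
    intro S hS hS2
    have d := isDensity_ind hS hS2
    have hm := d.measurable
    refine ((hw d d).const_mul K).mono' (by fun_prop) (Eventually.of_forall fun p => ?_)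
    by_cases h1 : p.1 ∈ S <;> by_cases h2 : p.2 ∈ S <;> simp [ind, Set.indicator, h1, h2]
    exact hqK p.1 p.2 (hS2 _ h1) (hS2 _ h2)
  have iB := hqi hB H.norm_le_two
  have iD := hqi hD fun z hz => ((mem_ball_zero_iff.1 hz).trans one_lt_two).le
  rw [integral_pair_eq hB, integral_pair_eq hD, ← integral_sub iB iD]
  refine abs_integral_le_integral_abs.trans ?_
  have w1 := hw dN dU
  have w2 := hw dU dN
  have hpt : ∀ p : ℂ × ℂ, |ind B p.1 * ind B p.2 * q p
      - ind (Metric.ball 0 1) p.1 * ind (Metric.ball 0 1) p.2 * q p|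
      ≤ K * (ind (annulus a b) p.1 * ind U p.2 * (1 + ‖p.1 - p.2‖⁻¹)
        + ind U p.1 * ind (annulus a b) p.2 * (1 + ‖p.1 - p.2‖⁻¹)) := by
    intro p
    by_cases hp : ‖p.1‖ ≤ 2 ∧ ‖p.2‖ ≤ 2
    · rw [hiU hp.1, hiU hp.2, ← sub_mul, abs_mul]
      have h1 := H.abs_ind_sub_le p.1
      have h2 := H.abs_ind_sub_le p.2
      have h3 := hqK p.1 p.2 hp.1 hp.2
      have e : ind B p.1 * ind B p.2 - ind (Metric.ball 0 1) p.1 * ind (Metric.ball 0 1) p.2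
          = (ind B p.1 - ind (Metric.ball 0 1) p.1) * ind B p.2
            + ind (Metric.ball 0 1) p.1 * (ind B p.2 - ind (Metric.ball 0 1) p.2) := by ring
      have h4 : |ind B p.1 * ind B p.2 - ind (Metric.ball 0 1) p.1 * ind (Metric.ball 0 1) p.2|
          ≤ ind (annulus a b) p.1 + ind (annulus a b) p.2 := by
        rw [e]
        refine (abs_add_le _ _).trans ?_
        rw [abs_mul, abs_mul, abs_of_nonneg (hn B p.2).1, abs_of_nonneg (hn (Metric.ball 0 1) p.1).1]
        have := abs_nonneg (ind B p.1 - ind (Metric.ball 0 1) p.1)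
        have := abs_nonneg (ind B p.2 - ind (Metric.ball 0 1) p.2)
        nlinarith [hn B p.2, hn (Metric.ball 0 1) p.1]
      have h5 := mul_le_mul h4 h3 (abs_nonneg _) (by linarith [(hn (annulus a b) p.1).1, (hn (annulus a b) p.2).1])
      linarith
    · have hz : ∀ S : Set ℂ, (∀ z ∈ S, ‖z‖ ≤ 2) → ind S p.1 * ind S p.2 = 0 := by
        intro S hS
        rw [not_and_or] at hp
        rcases hp with h | h
        · rw [ind, Set.indicator_of_notMem (fun h' => h (hS _ h')), zero_mul]
        · rw [ind, Set.indicator_of_notMem (a := p.2) (fun h' => h (hS _ h')), mul_zero]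
      rw [hz B H.norm_le_two, hz _ fun z hz => ((mem_ball_zero_iff.1 hz).trans one_lt_two).le]
      have := (hn (annulus a b) p.1).1
      have := (hn (annulus a b) p.2).1
      have := (hn U p.1).1
      have := (hn U p.2).1
      simp only [zero_mul, sub_self, abs_zero]
      positivity
  refine (integral_mono (iB.sub iD).abs ((w1.add w2).const_mul K) hpt).trans ?_
  rw [integral_const_mul]
  have e1 : ∫ p : ℂ × ℂ, ind (annulus a b) p.1 * ind U p.2 * (1 + ‖p.1 - p.2‖⁻¹) ∂(volume.prod volume)
      ≤ (volume.real U + C) * (8 * (a + b)) := by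
    rw [integral_prod _ w1]
    have hin : ∀ y, ∫ z, ind (annulus a b) y * ind U z * (1 + ‖y - z‖⁻¹)
        ≤ ind (annulus a b) y * (volume.real U + C) := by
      intro y
      have i1 := dU.integrable
      have i2 := dU.integrable_pow zero_le_one one_lt_two y
      have h1 := hCb y
      have e : ∀ z, ind (annulus a b) y * ind U z * (1 + ‖y - z‖⁻¹)
          = ind (annulus a b) y * (ind U z + |ind U z| * ‖y - z‖ ^ (-1 : ℝ)) := fun z => by
        rw [abs_of_nonneg (hn U z).1, rpow_neg_one]; ring
      simp_rw [e]
      rw [integral_const_mul, integral_add i1 i2, integral_ind Metric.isClosed_closedBall.measurableSet]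
      exact mul_le_mul_of_nonneg_left (by linarith) (hn _ y).1
    refine (integral_mono w1.integral_prod_left (dN.integrable.mul_const _) hin).trans ?_
    rw [integral_mul_const, integral_ind (measurableSet_annulus a b), mul_comm]
    exact mul_le_mul_of_nonneg_left H.volume_annulus_le (by positivity)
  have e2 : ∫ p : ℂ × ℂ, ind U p.1 * ind (annulus a b) p.2 * (1 + ‖p.1 - p.2‖⁻¹) ∂(volume.prod volume)
      = ∫ p : ℂ × ℂ, ind (annulus a b) p.1 * ind U p.2 * (1 + ‖p.1 - p.2‖⁻¹) ∂(volume.prod volume) := by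
    rw [← integral_prod_swap]
    congr 1 with p
    simp only [Prod.fst_swap, Prod.snd_swap]
    rw [norm_sub_rev]; ring
  rw [integral_add' w1 w2, e2]
  have := mul_le_mul_of_nonneg_left e1 hK
  linarith

lemma integral_ball_normSq : ∫ z in Metric.ball (0 : ℂ) 1, ‖z‖ ^ 2 = π / 2 := by
  have hi : IntegrableOn (fun z : ℂ => ‖z‖ ^ 2) (Metric.ball 0 1) :=
    ((by fun_prop : Continuous fun z : ℂ => ‖z‖ ^ 2).continuousOn.integrableOn_compact
      (isCompact_closedBall 0 1)).mono_set Metric.ball_subset_closedBall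
  rw [integral_ball_eq_circleAverage (by fun_prop : Continuous fun z : ℂ => ‖z‖ ^ 2).stronglyMeasurable hi,
    ← integral_Ioc_eq_integral_Ioo, ← intervalIntegral.integral_of_le zero_le_one]
  have e : ∀ s : ℝ, (2 * π * s) • circleAverage (fun z : ℂ => ‖z‖ ^ 2) 0 s = 2 * π * s ^ 3 := by
    intro s
    have : circleAverage (fun z : ℂ => ‖z‖ ^ 2) 0 s = s ^ 2 := by
      rw [circleAverage_congr_sphere (f₂ := fun _ => s ^ 2), circleAverage_const]
      intro z hz
      have : ‖z‖ = |s| := by simpa using hz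
      simp [this]
    rw [this, smul_eq_mul]; ring
  simp_rw [e]
  rw [intervalIntegral.integral_const_mul, integral_pow]
  norm_num
  ring

lemma integrable_pair_disc {q : ℂ × ℂ → ℝ} (hq : Measurable q) {K : ℝ}
    {B : Set ℂ} {τ : ℝ} (hB : IsRegion τ B) (hB2 : ∀ z ∈ B, ‖z‖ ≤ 2)
    (hqK : ∀ y z : ℂ, ‖y‖ ≤ 2 → ‖z‖ ≤ 2 → |q (y, z)| ≤ K * (1 + ‖y - z‖⁻¹)) :
    Integrable q (pairMeasure B) := by
  have := hB.isFiniteMeasure_pair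
  have h1 := (hB.integrable_pair_pow zero_le_one one_lt_two)
  refine (((integrable_const (1 : ℝ)).add h1).const_mul K).mono' hq.aestronglyMeasurable ?_
  filter_upwards [hB.ae_pair] with p hp
  have := hqK p.1 p.2 (hB2 _ hp.1) (hB2 _ hp.2.1)
  simpa [rpow_neg_one] using this

lemma integral_pair_disc_log :
    ∫ p : ℂ × ℂ, log ‖p.1 - p.2‖ ∂pairMeasure (Metric.ball 0 1) = -(π ^ 2 / 4) := by
  have hD : MeasurableSet (Metric.ball (0 : ℂ) 1) := Metric.isOpen_ball.measurableSet
  have := isRegion_unit_ball.isFiniteMeasure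
  have hi : Integrable (fun p : ℂ × ℂ => log ‖p.1 - p.2‖) (pairMeasure (Metric.ball 0 1)) := by
    refine integrable_pair_disc (K := 4) (by fun_prop) isRegion_unit_ball
      (fun z hz => ((mem_ball_zero_iff.1 hz).trans one_lt_two).le) fun y z hy hz => ?_
    have h1 := abs_log_le_inv_add (norm_nonneg (y - z))
    have h2 := norm_sub_le y z
    have h3 := inv_nonneg.2 (norm_nonneg (y - z))
    simp only
    linarith
  unfold pairMeasure at hi ⊢
  rw [integral_prod _ hi]
  have e : ∀ y ∈ Metric.ball (0 : ℂ) 1, ∫ z in Metric.ball (0 : ℂ) 1, log ‖y - z‖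
      = π / 2 * ‖y‖ ^ 2 - π / 2 := by
    intro y hy
    rw [← logPot_ind hD, logPot_ball_inside (by simpa using (mem_ball_zero_iff.1 hy).le)]
    simp
    ring
  have hc : IntegrableOn (fun z : ℂ => π / 2 * ‖z‖ ^ 2) (Metric.ball 0 1) :=
    ((by fun_prop : Continuous fun z : ℂ => π / 2 * ‖z‖ ^ 2).continuousOn.integrableOn_compact
      (isCompact_closedBall 0 1)).mono_set Metric.ball_subset_closedBall
  rw [setIntegral_congr_fun hD e, integral_sub hc (integrable_const _), integral_const_mul,
    integral_ball_normSq]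
  simp [volume_real_ball]
  ring

/-- The pair measure of the disc is invariant under rotations. -/
lemma integral_pair_disc_rotation (u : Circle) (q : ℂ × ℂ → ℝ) :
    ∫ p, q (u * p.1, u * p.2) ∂pairMeasure (Metric.ball 0 1)
      = ∫ p, q p ∂pairMeasure (Metric.ball 0 1) := by
  have := isRegion_unit_ball.isFiniteMeasure
  have h1 : MeasurePreserving (rotation u) (volume.restrict (Metric.ball (0 : ℂ) 1))
      (volume.restrict (Metric.ball 0 1)) := by
    have h := (rotation u).measurePreserving.restrict_preimage
      (Metric.isOpen_ball.measurableSet : MeasurableSet (Metric.ball (0 : ℂ) 1))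
    have e : (rotation u) ⁻¹' Metric.ball (0 : ℂ) 1 = Metric.ball 0 1 := by
      ext z
      rw [Set.mem_preimage, mem_ball_zero_iff, mem_ball_zero_iff, LinearIsometryEquiv.norm_map]
    rwa [e] at h
  have h2 := h1.prod h1
  have hme : MeasurableEmbedding (Prod.map (rotation u) (rotation u)) := by
    have hr : MeasurableEmbedding (rotation u) := (rotation u).toHomeomorph.measurableEmbedding
    exact hr.prodMap hr
  exact h2.integral_comp hme q

/-- The angular part of the translation identity. -/
def angular (p : ℂ × ℂ) : ℝ := (p.1 - p.2).re ^ 2 / ‖p.1 - p.2‖ ^ 2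

lemma measurable_angular : Measurable angular := by
  unfold angular
  have := Complex.measurable_re.comp (measurable_fst.sub measurable_snd : Measurable fun p : ℂ × ℂ => p.1 - p.2)
  exact (this.pow_const 2).div (by fun_prop)

lemma angular_nonneg (p : ℂ × ℂ) : 0 ≤ angular p := by unfold angular; positivity

lemma angular_le_one (p : ℂ × ℂ) : angular p ≤ 1 := by
  unfold angular
  refine div_le_one_of_le₀ ?_ (by positivity)
  rw [Complex.sq_norm, Complex.normSq_apply]
  nlinarith [mul_self_nonneg (p.1 - p.2).im]

lemma integral_pair_disc_angular :
    ∫ p, angular p ∂pairMeasure (Metric.ball 0 1) = π ^ 2 / 2 := by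
  have := isRegion_unit_ball.isFiniteMeasure_pair
  have hi : Integrable angular (pairMeasure (Metric.ball 0 1)) :=
    (integrable_const (1 : ℝ)).mono' measurable_angular.aestronglyMeasurable
      (Eventually.of_forall fun p => by
        rw [Real.norm_of_nonneg (angular_nonneg p)]; exact angular_le_one p)
  set u : Circle := ⟨Complex.I, by simp [Submonoid.unitSphere]⟩ with hu
  have h1 := integral_pair_disc_rotation u angular
  have h2 : ∫ p, (1 - angular p) ∂pairMeasure (Metric.ball 0 1)
      = ∫ p, angular (u * p.1, u * p.2) ∂pairMeasure (Metric.ball 0 1) := by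
    refine integral_congr_ae ?_
    filter_upwards [isRegion_unit_ball.ae_pair] with p hp
    have h3 : ‖p.1 - p.2‖ ^ 2 ≠ 0 := by
      have := norm_pos_iff.2 (sub_ne_zero.2 hp.2.2); positivity
    rw [angular, angular]
    have e : ((u : ℂ) * p.1 - u * p.2) = Complex.I * (p.1 - p.2) := by rw [hu]; simp; ring
    simp only [e, norm_mul, Complex.norm_I, one_mul]
    rw [eq_div_iff h3, sub_mul, div_mul_cancel₀ _ h3, Complex.sq_norm, Complex.normSq_apply]
    simp
    ring
  rw [integral_sub (integrable_const _) hi, h1] at h2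
  have e1 : ∫ _, (1 : ℝ) ∂pairMeasure (Metric.ball (0 : ℂ) 1) = π ^ 2 := by
    rw [integral_const, pairMeasure, measureReal_def, ← Set.univ_prod_univ, Measure.prod_prod,
      ENNReal.toReal_mul, Measure.restrict_apply_univ, ← measureReal_def,
      volume_real_ball _ zero_le_one, smul_eq_mul]
    ring
  rw [e1] at h2
  linarith

/-- The non-constant part of the translation identity. -/
def drift (τ : ℝ) (p : ℂ × ℂ) : ℝ :=
  (1 + τ * (p.1.re + p.2.re) / 2) * (-log ‖p.1 - p.2‖ + angular p)

lemma measurable_drift (τ : ℝ) : Measurable (drift τ) := by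
  unfold drift
  have := measurable_angular
  have h1 : Measurable fun p : ℂ × ℂ => p.1.re := Complex.measurable_re.comp measurable_fst
  have h2 : Measurable fun p : ℂ × ℂ => p.2.re := Complex.measurable_re.comp measurable_snd
  fun_prop

lemma abs_drift_le {τ : ℝ} (hτ : 0 < τ) (hτ' : τ ≤ 1 / 4) {y z : ℂ} (hy : ‖y‖ ≤ 2) (hz : ‖z‖ ≤ 2) :
    |drift τ (y, z)| ≤ 10 * (1 + ‖y - z‖⁻¹) := by
  have h1 := abs_log_le_inv_add (norm_nonneg (y - z))
  have h2 := norm_sub_le y z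
  have h3 := inv_nonneg.2 (norm_nonneg (y - z))
  have h4 := abs_le.1 (Complex.abs_re_le_norm y)
  have h5 := abs_le.1 (Complex.abs_re_le_norm z)
  have h6 : |1 + τ * (y.re + z.re) / 2| ≤ 2 := by
    rw [abs_le]; constructor <;> nlinarith
  have h7 : |-log ‖y - z‖ + angular (y, z)| ≤ 5 * (1 + ‖y - z‖⁻¹) := by
    have h8 := abs_le.1 h1
    have := angular_nonneg (y, z)
    have := angular_le_one (y, z)
    rw [abs_le]; constructor <;> linarith [h8.1, h8.2]
  rw [drift, abs_mul]
  calc _ ≤ 2 * (5 * (1 + ‖y - z‖⁻¹)) := mul_le_mul h6 h7 (abs_nonneg _) (by norm_num)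
    _ = _ := by ring

lemma integral_pair_disc_drift {τ : ℝ} (hτ : 0 < τ) (hτ' : τ ≤ 1 / 4) :
    ∫ p, drift τ p ∂pairMeasure (Metric.ball 0 1) = 3 * π ^ 2 / 4 := by
  have hD2 : ∀ z ∈ Metric.ball (0 : ℂ) 1, ‖z‖ ≤ 2 :=
    fun z hz => ((mem_ball_zero_iff.1 hz).trans one_lt_two).le
  have hi : Integrable (drift τ) (pairMeasure (Metric.ball 0 1)) :=
    integrable_pair_disc (measurable_drift τ) isRegion_unit_ball hD2
      fun y z hy hz => abs_drift_le hτ hτ' hy hz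
  have := isRegion_unit_ball.isFiniteMeasure_pair
  have ia : Integrable angular (pairMeasure (Metric.ball 0 1)) :=
    (integrable_const (1 : ℝ)).mono' measurable_angular.aestronglyMeasurable
      (Eventually.of_forall fun p => by
        rw [Real.norm_of_nonneg (angular_nonneg p)]; exact angular_le_one p)
  have il : Integrable (fun p : ℂ × ℂ => log ‖p.1 - p.2‖) (pairMeasure (Metric.ball 0 1)) := by
    refine integrable_pair_disc (K := 4) (by fun_prop) isRegion_unit_ball
      hD2 fun y z hy hz => ?_
    have h1 := abs_log_le_inv_add (norm_nonneg (y - z))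
    have h2 := norm_sub_le y z
    have h3 := inv_nonneg.2 (norm_nonneg (y - z))
    simp only
    linarith
  set u : Circle := ⟨-1, by simp [Submonoid.unitSphere]⟩ with hu
  have h1 := integral_pair_disc_rotation u (drift τ)
  have il' : Integrable (fun p : ℂ × ℂ => -log ‖p.1 - p.2‖) (pairMeasure (Metric.ball 0 1)) := il.neg
  have hi' : Integrable (fun p : ℂ × ℂ => drift τ (u * p.1, u * p.2)) (pairMeasure (Metric.ball 0 1)) := by
    have e : ∀ p : ℂ × ℂ, drift τ (u * p.1, u * p.2)
        = -drift τ p + 2 * (-log ‖p.1 - p.2‖ + angular p) := by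
      intro p
      have e1 : ((u : ℂ) * p.1 - u * p.2) = -(p.1 - p.2) := by rw [hu]; simp; ring
      simp only [drift, angular, e1, norm_neg]
      simp [hu]
      ring
    simp_rw [e]
    exact hi.neg.add ((il'.add ia).const_mul 2)
  have h2 : ∫ p : ℂ × ℂ, (drift τ p + drift τ (u * p.1, u * p.2)) ∂pairMeasure (Metric.ball 0 1)
      = ∫ p : ℂ × ℂ, 2 * (-log ‖p.1 - p.2‖ + angular p) ∂pairMeasure (Metric.ball 0 1) := by
    congr 1 with p
    have e1 : ((u : ℂ) * p.1 - u * p.2) = -(p.1 - p.2) := by rw [hu]; simp; ring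
    simp only [drift, angular, e1, norm_neg]
    simp [hu]
    ring
  rw [integral_add hi hi', h1, integral_const_mul, integral_add il' ia, integral_pair_disc_angular] at h2
  have e3 : ∫ p : ℂ × ℂ, -log ‖p.1 - p.2‖ ∂pairMeasure (Metric.ball 0 1) = π ^ 2 / 4 := by
    rw [integral_neg, integral_pair_disc_log]; ring
  rw [e3] at h2
  linarith

namespace IsCore
variable {τ ω m : ℝ} {B : Set ℂ}

lemma integral_pair_re (h : IsCore τ ω m B) :
    ∫ p : ℂ × ℂ, (p.1.re + p.2.re) ∂pairMeasure B = 0 := by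
  have := h.isFiniteMeasure
  have i1 : Integrable (fun z : ℂ => z.re) (volume.restrict B) := by
    refine (integrable_const (1 / 8 / τ)).mono' Complex.measurable_re.aestronglyMeasurable ?_
    filter_upwards [ae_restrict_mem h.measurableSet] with z hz
      using (Complex.abs_re_le_norm z).trans (h.norm_le z hz)
  have a1 : Integrable (fun p : ℂ × ℂ => p.1.re) (pairMeasure B) := i1.comp_fst _
  have a2 : Integrable (fun p : ℂ × ℂ => p.2.re) (pairMeasure B) := i1.comp_snd _
  rw [integral_add a1 a2]
  unfold pairMeasure at a1 a2 ⊢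
  rw [integral_prod _ a1, integral_prod _ a2]
  simp [h.integral_re, integral_const_mul]

lemma integral_re_spotGrad (h : IsCore τ ω m B) :
    ∫ y in B, (spotGrad τ B y).re = ω * τ * π := by
  have := h.isFiniteMeasure
  obtain ⟨M, H⟩ := h.exists_isLevelSet
  have h1 := H.integral_re_grad
  have i1 : IntegrableOn (fun y : ℂ => (levGrad τ ω B y).re) B := H.integrableOn_grad.re
  have i2 : IntegrableOn (fun z : ℂ => z.re) B := by
    refine (integrable_const (1 / 8 / τ)).mono' Complex.measurable_re.aestronglyMeasurable ?_
    filter_upwards [ae_restrict_mem h.measurableSet] with z hz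
      using (Complex.abs_re_le_norm z).trans (h.norm_le z hz)
  have e : ∀ y : ℂ, (spotGrad τ B y).re = (levGrad τ ω B y).re + (ω * τ + ω * τ ^ 2 * y.re) :=
    fun y => by
      rw [levGrad, hgt, Complex.sub_re, Complex.ofReal_re]; ring
  have i3 : IntegrableOn (fun z : ℂ => ω * τ + ω * τ ^ 2 * z.re) B :=
    (integrable_const _).add (i2.const_mul _)
  simp_rw [e]
  rw [integral_add i1 i3, integral_add (integrable_const _) (i2.const_mul _),
    integral_const_mul (ω * τ ^ 2), h.integral_re, h1]
  simp [h.volume_eq]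
  ring

/-- The speed of a nearly circular vortex ring. -/
lemma exists_abs_speed_sub_le : ∃ C : ℝ, 0 < C ∧ ∀ (τ ω m : ℝ) (B : Set ℂ) (a b : ℝ),
    IsCore τ ω m B → IsNearDisc B a b → τ ≤ 1 / 8 →
    |ω - 1 / 4 * (-log τ + log 8 - 1 / 4)| ≤ C * (a + b + τ ^ 2 * -log τ) := by
  obtain ⟨C, hC, H⟩ := exists_abs_integral_pair_sub_disc_le
  refine ⟨C + 60000, by positivity, fun τ ω m B a b h hN hτ8 => ?_⟩
  have hτ := h.τ_pos
  have hl := h.one_le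
  have hfin := h.isFiniteMeasure_pair
  have hη : 2 * τ ≤ 1 / 4 := by linarith
  have hBη : ∀ z ∈ B, τ * ‖z‖ ≤ 2 * τ := fun z hz => by nlinarith [hN.norm_le_two z hz]
  set P : ℝ := (-log τ + ringB / 2 + 1) with hP
  set A : ℂ × ℂ → ℝ := fun p => τ / (2 * π) * (P + (P + 1) / 2 * τ * (p.1.re + p.2.re) + drift τ p) with hA
  have hφ : ∀ y ∈ B, ‖(1 : ℂ)‖ ≤ 1 := fun _ _ => by simp
  have e0 := h.integral_spotGrad_mul (φ := fun _ => 1) measurable_const hφ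
  have i1 := h.integrable_pair_kernGrad_mul (φ := fun _ => 1) measurable_const hφ
  have i2 := h.integrable_pair_symm i1
  simp only [mul_one] at e0 i1 i2
  rw [h.integral_re_spotGrad] at e0
  have dr : Integrable (drift τ) (pairMeasure B) :=
    integrable_pair_disc (measurable_drift τ) h.toIsRegion hN.norm_le_two
      fun y z hy hz => abs_drift_le hτ (by linarith) hy hz
  have lin : Integrable (fun p : ℂ × ℂ => (P + 1) / 2 * τ * (p.1.re + p.2.re)) (pairMeasure B) := by
    refine (integrable_const (|(P + 1) / 2 * τ| * (1 / 8 / τ + 1 / 8 / τ))).mono' ?_ ?_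
    · exact (((Complex.measurable_re.comp measurable_fst).add
        (Complex.measurable_re.comp measurable_snd)).const_mul _).aestronglyMeasurable
    · filter_upwards [h.ae_pair] with p hp
      rw [Real.norm_eq_abs, abs_mul]
      refine mul_le_mul_of_nonneg_left ((abs_add_le _ _).trans (add_le_add ?_ ?_)) (abs_nonneg _)
      · exact (Complex.abs_re_le_norm _).trans (h.norm_le _ hp.1)
      · exact (Complex.abs_re_le_norm _).trans (h.norm_le _ hp.2.1)
  have clin : Integrable (fun p : ℂ × ℂ => P + (P + 1) / 2 * τ * (p.1.re + p.2.re)) (pairMeasure B) :=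
    (integrable_const P).add lin
  have iA : Integrable A (pairMeasure B) := (clin.add dr).const_mul _
  have h3 := h.abs_integral_pair_sub_le h.volume_eq (A := A) (K := 1000 * (τ * (2 * τ) ^ 2))
    (by positivity) (i1.add i2) iA (fun y hy z hz hne => by
      have hn : NearPair τ (2 * τ) y z := ⟨hτ, hl, hη, hBη y hy, hBη z hz, hne⟩
      have h1 := hn.abs_translation_le
      have eA : A (y, z) = τ * ((1 + (τ * y.re + τ * z.re) / 2) *
          (mainF τ y z + 1 / (2 * π) * (1 + (y - z).re ^ 2 / ‖y - z‖ ^ 2))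
          + (τ * y.re + τ * z.re) / (4 * π)) := by
        simp only [hA, hP, drift, angular, mainF]
        field_simp
        ring
      rw [eA]
      simp only [Pi.add_apply]
      rw [Complex.add_re] at h1
      linarith)
  have h4 := H B a b 10 (drift τ) h.measurableSet hN (measurable_drift τ) (by norm_num)
    (fun y z hy hz => abs_drift_le hτ (by linarith) hy hz)
  rw [integral_pair_disc_drift hτ (by linarith)] at h4
  have eA : ∫ p, A p ∂pairMeasure B = τ / (2 * π) * (P * π ^ 2 + ∫ p, drift τ p ∂pairMeasure B) := by
    rw [hA, integral_const_mul, integral_add clin dr, integral_add (integrable_const _) lin,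
      integral_const_mul, h.integral_pair_re, integral_const, pairMeasure, measureReal_def,
      ← Set.univ_prod_univ, Measure.prod_prod, ENNReal.toReal_mul, Measure.restrict_apply_univ,
      ← measureReal_def, h.volume_eq, smul_eq_mul]
    ring
  set I := ∫ p, drift τ p ∂pairMeasure B
  simp only [Pi.add_apply] at h3
  rw [eA] at h3
  set J := ∫ p : ℂ × ℂ, ((kernGrad τ p.1 p.2).re + (kernGrad τ p.2 p.1).re) ∂pairMeasure B
  have hJ : J = 2 * (ω * τ * π) := by linarith
  rw [hJ] at h3
  have h5 : |4 * π * ω - (P * π + I / π)| ≤ 240000 * π * (τ ^ 2 * -log τ) := by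
    have e : 4 * π * ω - (P * π + I / π)
        = 2 / τ * (2 * (ω * τ * π) - τ / (2 * π) * (P * π ^ 2 + I)) := by
      field_simp
      ring
    rw [e, abs_mul, abs_of_pos (by positivity : (0 : ℝ) < 2 / τ)]
    calc _ ≤ 2 / τ * (1000 * (τ * (2 * τ) ^ 2) * (30 * -log τ * π)) := by gcongr
      _ = _ := by field_simp; ring
  have h6 : |I / π - 3 * π / 4| ≤ 10 * C * (a + b) / π := by
    have e : I / π - 3 * π / 4 = (I - 3 * π ^ 2 / 4) / π := by field_simp
    rw [e, abs_div, abs_of_pos pi_pos]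
    gcongr
    linarith
  have hlog : log 64 = 2 * log 8 := by
    rw [show (64 : ℝ) = 8 ^ 2 by norm_num, log_pow]; norm_num
  have e : ω - 1 / 4 * (-log τ + log 8 - 1 / 4)
      = (1 / (4 * π)) * ((4 * π * ω - (P * π + I / π)) + (I / π - 3 * π / 4)) := by
    rw [hP, ringB, hlog]
    field_simp
    ring
  rw [e, abs_mul, abs_of_pos (by positivity)]
  have h7 := (abs_add_le (4 * π * ω - (P * π + I / π)) (I / π - 3 * π / 4)).trans (add_le_add h5 h6)
  have ht : 0 ≤ a + b := by linarith [hN.a_pos, hN.b_pos]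
  have hlam : 0 ≤ τ ^ 2 * -log τ := mul_nonneg (sq_nonneg _) (by linarith)
  have h9 : 1 / (4 * π) * (10 * C * (a + b) / π) ≤ C * (a + b) := by
    have : 1 / (4 * π) * (10 * C * (a + b) / π) = C * (a + b) * (10 / (4 * π ^ 2)) := by
      field_simp
    rw [this]
    refine mul_le_of_le_one_right (by positivity) ?_
    rw [div_le_one (by positivity)]
    nlinarith [pi_gt_three]
  calc _ ≤ 1 / (4 * π) * (240000 * π * (τ ^ 2 * -log τ) + 10 * C * (a + b) / π) := by gcongr
    _ = 60000 * (τ ^ 2 * -log τ) + 1 / (4 * π) * (10 * C * (a + b) / π) := by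
      field_simp; ring
    _ ≤ _ := by nlinarith

end IsCore

lemma abs_logPot_sub_le {f : ℂ → ℝ} {M R K : ℝ} (hf : IsDensity f M R)
    (hK : ∀ y, ‖cauPot f y‖ ≤ K) (y y' : ℂ) : |logPot f y - logPot f y'| ≤ K * ‖y - y'‖ := by
  have := Convex.norm_image_sub_le_of_norm_hasFDerivWithin_le (f := logPot f)
    (f' := fun y => reMul (cauPot f y)) (s := Set.univ) (C := K) (x := y') (y := y)
    (fun z _ => (hasFDerivAt_logPot hf z).hasFDerivWithinAt)
    (fun z _ => (norm_reMul_le _).trans (hK z)) convex_univ trivial trivial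
  simpa using this

lemma IsDensity.exists_lipschitz {f : ℂ → ℝ} {M R : ℝ} (hf : IsDensity f M R) :
    ∃ K, 0 < K ∧ ∀ y y', |logPot f y - logPot f y'| ≤ K * ‖y - y'‖ := by
  obtain ⟨K, hK, h⟩ := hf.exists_pow_le zero_le_one one_lt_two
  refine ⟨K, hK, abs_logPot_sub_le hf fun y => ?_⟩
  refine (norm_integral_le_integral_norm _).trans (le_trans (le_of_eq ?_) (h y))
  congr 1 with z
  rw [norm_mul, norm_inv, Complex.norm_real, norm_eq_abs, rpow_neg_one]

namespace IsNearDisc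
variable {B : Set ℂ} {a b : ℝ}

lemma integral_annulus_inv_le (H : IsNearDisc B a b) (y : ℂ) :
    ∫ z, ind (annulus a b) z * ‖y - z‖⁻¹ ≤ 21 * √(a + b) := by
  have ha := H.a_pos
  have hb := H.b_pos
  have hd := H.isDensity_annulus
  have h0 : ∀ z, 0 ≤ ind (annulus a b) z := Set.indicator_nonneg fun _ _ => zero_le_one
  have hint : ∫ z, |ind (annulus a b) z| ≤ 8 * (a + b) := by
    simp_rw [abs_of_nonneg (h0 _)]
    rw [integral_ind (measurableSet_annulus a b)]
    exact H.volume_annulus_le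
  have key := integral_abs_mul_pow_le hd.integrable hd.bound zero_le_one one_lt_two
    (by positivity) hint y
  simp_rw [abs_of_nonneg (h0 _), rpow_neg_one] at key
  rw [show (1 : ℝ) - 1 / 2 = 1 / 2 by norm_num, ← sqrt_eq_rpow, sqrt_mul (by norm_num)] at key
  have h8 : √8 ≤ 2.829 := by
    rw [sqrt_le_left (by norm_num)]; norm_num
  have hs := sqrt_nonneg (a + b)
  refine key.trans ?_
  have : (2 * π / (2 - 1) + 1) * √8 ≤ 21 := by
    nlinarith [pi_lt_d2, pi_pos, sqrt_nonneg (8 : ℝ)]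
  calc _ = ((2 * π / (2 - 1) + 1) * √8) * √(a + b) := by ring
    _ ≤ _ := by gcongr

lemma integral_annulus_log_le (H : IsNearDisc B a b) {y : ℂ} (hy : ‖y‖ ≤ 2) :
    ∫ z, ind (annulus a b) z * |log ‖y - z‖| ≤ 60 * √(a + b) := by
  have ha := H.a_pos
  have hb := H.b_pos
  have ha' := H.a_le
  have hb' := H.b_le
  have hd := H.isDensity_annulus
  have h0 : ∀ z, 0 ≤ ind (annulus a b) z := Set.indicator_nonneg fun _ _ => zero_le_one
  have i1 : Integrable fun z => ind (annulus a b) z * ‖y - z‖⁻¹ := by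
    have := hd.integrable_pow zero_le_one one_lt_two y
    simpa only [abs_of_nonneg (h0 _), rpow_neg_one] using this
  have i2 : Integrable fun z => 4 * ind (annulus a b) z := hd.integrable.const_mul 4
  have hle : ∀ z, ind (annulus a b) z * |log ‖y - z‖|
      ≤ ind (annulus a b) z * ‖y - z‖⁻¹ + 4 * ind (annulus a b) z := fun z => by
    by_cases hz : z ∈ annulus a b
    · have e : ind (annulus a b) z = 1 := Set.indicator_of_mem hz _
      rw [e]
      have h1 := abs_log_le_inv_add (norm_nonneg (y - z))
      have h2 := norm_sub_le y z
      linarith [hz.2]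
    · have e : ind (annulus a b) z = 0 := Set.indicator_of_notMem hz _
      simp [e]
  have h3 : ∫ z, ind (annulus a b) z * |log ‖y - z‖|
      ≤ ∫ z, (ind (annulus a b) z * ‖y - z‖⁻¹ + 4 * ind (annulus a b) z) :=
    integral_mono_of_nonneg (Eventually.of_forall fun z => mul_nonneg (h0 z) (abs_nonneg _))
      (i1.add i2) (Eventually.of_forall hle)
  rw [integral_add i1 i2, integral_const_mul, integral_ind (measurableSet_annulus a b)] at h3
  have h4 := H.integral_annulus_inv_le y
  have h5 := H.volume_annulus_le
  have h6 : a + b ≤ √(a + b) := by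
    rw [le_sqrt (by linarith) (by linarith)]
    nlinarith
  linarith

/-- Bounds for the potential of a density carried by a thin annulus. -/
lemma abs_logPot_le (H : IsNearDisc B a b) {f : ℂ → ℝ} {M : ℝ}
    (h : ∀ z, |f z| ≤ M * ind (annulus a b) z) (hM : 0 ≤ M) {y : ℂ} (hy : ‖y‖ ≤ 2) :
    |logPot f y| ≤ 60 * M * √(a + b) := by
  have hd := H.isDensity_annulus
  have h0 : ∀ z, 0 ≤ ind (annulus a b) z := Set.indicator_nonneg fun _ _ => zero_le_one
  have i1 : Integrable fun z => ind (annulus a b) z * |log ‖y - z‖| := by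
    refine (hd.integrable_log y).abs.congr (Eventually.of_forall fun z => ?_)
    simp only [abs_mul]
    rw [abs_of_nonneg (h0 z)]
  refine (abs_integral_le_integral_abs).trans ?_
  have h2 : ∫ z, |f z * log ‖y - z‖| ≤ ∫ z, M * (ind (annulus a b) z * |log ‖y - z‖|) :=
    integral_mono_of_nonneg (Eventually.of_forall fun z => abs_nonneg _) (i1.const_mul M)
      (Eventually.of_forall fun z => by
        simp only [abs_mul]
        rw [← mul_assoc]
        exact mul_le_mul_of_nonneg_right (h z) (abs_nonneg _))
  rw [integral_const_mul] at h2
  nlinarith [H.integral_annulus_log_le hy]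

lemma norm_cauPot_le (H : IsNearDisc B a b) {f : ℂ → ℝ}
    (h : ∀ z, |f z| ≤ ind (annulus a b) z) (y : ℂ) :
    ‖cauPot f y‖ ≤ 21 * √(a + b) := by
  have hd := H.isDensity_annulus
  have h0 : ∀ z, 0 ≤ ind (annulus a b) z := Set.indicator_nonneg fun _ _ => zero_le_one
  have i1 : Integrable fun z => ind (annulus a b) z * ‖y - z‖⁻¹ := by
    have := hd.integrable_pow zero_le_one one_lt_two y
    simpa only [abs_of_nonneg (h0 _), rpow_neg_one] using this
  refine (norm_integral_le_integral_norm _).trans (le_trans ?_ (H.integral_annulus_inv_le y))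
  refine integral_mono_of_nonneg (Eventually.of_forall fun z => norm_nonneg _) i1
      (Eventually.of_forall fun z => ?_)
  simp only [norm_mul, norm_inv, Complex.norm_real, norm_eq_abs]
  exact mul_le_mul_of_nonneg_right (h z) (by positivity)

end IsNearDisc

lemma circleAverage_re_mul_log {y : ℂ} (hy : ‖y‖ = 1) {s : ℝ} (hs : 0 < s) (hs1 : s < 1) :
    circleAverage (fun z => z.re * log ‖y - z‖) 0 s = -(s ^ 2 / 2 * y.re) := by
  have hy0 : y ≠ 0 := by rintro rfl; simp at hy
  set g : ℂ → ℂ := fun z => Complex.log (1 - z / y) with hg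
  have hslit : ∀ z ∈ Metric.ball (0 : ℂ) 1, 1 - z / y ∈ Complex.slitPlane := fun z hz => by
    rw [mem_ball_zero_iff] at hz
    refine Complex.ball_one_subset_slitPlane ?_
    rw [mem_ball_iff_norm]
    simpa [hy] using hz
  have hgd : ∀ z ∈ Metric.ball (0 : ℂ) 1, HasDerivAt g (-(1 / y) / (1 - z / y)) z := fun z hz =>
    HasDerivAt.clog (((hasDerivAt_id z).div_const y).const_sub 1) (hslit z hz)
  have hgD : DifferentiableOn ℂ g (Metric.ball 0 1) := fun z hz =>
    (hgd z hz).differentiableAt.differentiableWithinAt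
  have hg0 : g 0 = 0 := by simp [hg]
  have hds : DifferentiableOn ℂ (dslope g 0) (Metric.ball 0 1) :=
    (Complex.differentiableOn_dslope (Metric.ball_mem_nhds 0 one_pos)).2 hgD
  set G : ℂ → ℂ := fun z => 1 / 2 * (z * g z) + (s : ℂ) ^ 2 / 2 * dslope g 0 z with hG
  have hGD : DifferentiableOn ℂ G (Metric.ball 0 1) := by
    rw [hG]
    exact ((differentiableOn_id.mul hgD).const_mul _).add (hds.const_mul _)
  have hsub : Metric.closedBall (0 : ℂ) |s| ⊆ Metric.ball 0 1 :=
    Metric.closedBall_subset_ball (by rwa [abs_of_pos hs])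
  have hav : circleAverage G 0 s = G 0 :=
    DiffContOnCl.circleAverage (DifferentiableOn.diffContOnCl_ball hGD hsub)
  have hci : CircleIntegrable G 0 s :=
    ((hGD.continuousOn).mono (Metric.sphere_subset_closedBall.trans
      ((abs_of_pos hs) ▸ hsub))).circleIntegrable hs.le
  have hre := ContinuousLinearMap.circleAverage_comp_comm Complex.reCLM hci
  rw [hav] at hre
  have hG0 : (G 0).re = -(s ^ 2 / 2 * y.re) := by
    have e : dslope g 0 0 = -(1 / y) := by
      rw [dslope_same, (hgd 0 (Metric.mem_ball_self one_pos)).deriv]; simp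
    have e2 : (1 / y).re = y.re := by
      rw [one_div, Complex.inv_re, Complex.normSq_eq_norm_sq, hy]; simp
    have e3 : ((s : ℂ) ^ 2 / 2) = ((s ^ 2 / 2 : ℝ) : ℂ) := by push_cast; ring
    rw [hG]
    simp only [zero_mul, mul_zero, zero_add]
    rw [e, e3, Complex.re_ofReal_mul, Complex.neg_re, e2]
    ring
  rw [Complex.reCLM_apply, hG0] at hre
  rw [← hre]
  refine circleAverage_congr_sphere fun z hz => ?_
  rw [abs_of_pos hs, mem_sphere_zero_iff_norm] at hz
  have hz0 : z ≠ 0 := by rintro rfl; simp at hz; linarith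
  have hzb : z ∈ Metric.ball (0 : ℂ) 1 := mem_ball_zero_iff.2 (hz ▸ hs1)
  have e1 : log ‖y - z‖ = (g z).re := by
    rw [hg, Complex.log_re]
    congr 1
    rw [show y - z = y * (1 - z / y) by field_simp, norm_mul, hy, one_mul]
  have e2 : dslope g 0 z = g z / z := by
    rw [dslope_of_ne _ hz0, slope_def_field, hg0]; simp
  have e3 : (s : ℂ) ^ 2 = z * (starRingEnd ℂ) z := by
    rw [Complex.mul_conj, Complex.normSq_eq_norm_sq, hz]; push_cast; ring
  have e4 : G z = ((z.re : ℝ) : ℂ) * g z := by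
    rw [hG]
    simp only
    rw [e2, e3, Complex.re_eq_add_conj]
    field_simp
  simp only [Function.comp, Complex.reCLM_apply]
  rw [e4, Complex.re_ofReal_mul, e1]

/-- The density `x₁` on the unit disc. -/
lemma isDensity_re {B : Set ℂ} (hB : MeasurableSet B) (h : ∀ z ∈ B, ‖z‖ ≤ 2) :
    IsDensity (fun z => ind B z * z.re) 2 2 where
  measurable := (isDensity_ind hB h).measurable.mul Complex.measurable_re
  pos := two_pos
  bound z := by
    by_cases hz : z ∈ B
    · have : |z.re| ≤ 2 := (Complex.abs_re_le_norm z).trans (h z hz)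
      simpa [ind, hz] using this
    · simp [ind, hz]
  supp z hz := by
    rw [(isDensity_ind hB h).supp z hz, zero_mul]

lemma logPot_re_eq {B : Set ℂ} (hB : MeasurableSet B) (y : ℂ) :
    logPot (fun z => ind B z * z.re) y = ∫ z in B, z.re * log ‖y - z‖ := by
  rw [logPot, ← integral_indicator hB]
  congr 1 with z
  by_cases hz : z ∈ B <;> simp [ind, hz]

lemma logPot_re_ball {y : ℂ} (hy : ‖y‖ = 1) :
    logPot (fun z => ind (Metric.ball 0 1) z * z.re) y = -(π / 4 * y.re) := by
  have hd := isDensity_re (B := Metric.ball 0 1) Metric.isOpen_ball.measurableSet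
    fun z hz => by linarith [mem_ball_zero_iff.1 hz]
  have hi : IntegrableOn (fun z : ℂ => z.re * log ‖y - z‖) (Metric.ball 0 1) := by
    rw [← integrable_indicator_iff Metric.isOpen_ball.measurableSet]
    refine (hd.integrable_log y).congr (Eventually.of_forall fun z => ?_)
    by_cases hz : z ∈ Metric.ball (0 : ℂ) 1
    · simp only [ind, Set.indicator_of_mem hz, one_mul]
    · simp only [ind, Set.indicator_of_notMem hz, zero_mul]
  rw [logPot_re_eq Metric.isOpen_ball.measurableSet,
    integral_ball_eq_circleAverage (Measurable.stronglyMeasurable (by fun_prop)) hi]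
  have e : ∫ s in Set.Ioo (0 : ℝ) 1, (2 * π * s) • circleAverage (fun z => z.re * log ‖y - z‖) 0 s
      = ∫ s in Set.Ioo (0 : ℝ) 1, -(π * y.re) * s ^ 3 := by
    refine setIntegral_congr_fun measurableSet_Ioo fun s hs => ?_
    simp only [smul_eq_mul]
    rw [circleAverage_re_mul_log hy hs.1 hs.2]
    ring
  rw [e, integral_const_mul, ← integral_Ioc_eq_integral_Ioo,
    ← intervalIntegral.integral_of_le zero_le_one, integral_pow]
  norm_num
  ring

/-- The first moment potential of the disc near the unit circle. -/
lemma exists_abs_logPot_re_ball_le : ∃ K : ℝ, 0 < K ∧ ∀ y u : ℂ, ‖u‖ = 1 →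
    |logPot (fun z => ind (Metric.ball 0 1) z * z.re) y + π / 4 * u.re| ≤ K * ‖y - u‖ := by
  obtain ⟨K, hK, h⟩ := (isDensity_re (B := Metric.ball 0 1) Metric.isOpen_ball.measurableSet
    fun z hz => by linarith [mem_ball_zero_iff.1 hz]).exists_lipschitz
  refine ⟨K, hK, fun y u hu => ?_⟩
  have := h y u
  rwa [logPot_re_ball hu, sub_neg_eq_add] at this

/-- The logarithmic kernel, corrected by terms orthogonal to the admissible perturbations. -/
def posKer (t : ℝ) (u z : ℂ) : ℝ :=
  (log 2 / 2 + t) - (log ‖u - z‖ + 1 / 2 * ((starRingEnd ℂ) u * z).re)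

lemma posKer_nonneg {t : ℝ} {u z : ℂ} (hu : ‖u‖ = 1) (hz : ‖z‖ ^ 2 ≤ 1 + 4 * t) (hne : u ≠ z) :
    0 ≤ posKer t u z := by
  have h0 : 0 < ‖u - z‖ := norm_pos_iff.2 (sub_ne_zero.2 hne)
  have h1 : log (‖u - z‖ ^ 2 / 2) ≤ ‖u - z‖ ^ 2 / 2 - 1 := log_le_sub_one_of_pos (by positivity)
  rw [log_div (by positivity) (by norm_num), log_pow] at h1
  have h2 : ‖u - z‖ ^ 2 = 1 + ‖z‖ ^ 2 - 2 * ((starRingEnd ℂ) u * z).re := by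
    rw [← Complex.normSq_eq_norm_sq, Complex.normSq_sub, Complex.normSq_eq_norm_sq,
      Complex.normSq_eq_norm_sq, hu]
    simp [Complex.mul_re]
  rw [posKer]
  push_cast at h1
  linarith

lemma integral_posKer {E : Set ℂ} {t : ℝ} {R : ℝ} (hE : MeasurableSet E) (hR : ∀ z ∈ E, ‖z‖ ≤ R)
    (h0 : ∫ z in E, z = 0) (u : ℂ) :
    Integrable (fun z => ind E z * posKer t u z) ∧ ∫ z, ind E z * posKer t u z
      = (log 2 / 2 + t) * volume.real E - logPot (ind E) u := by
  have hd := isDensity_ind hE hR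
  have i1 : Integrable fun z => (log 2 / 2 + t) * ind E z := hd.integrable.const_mul _
  have i2 : Integrable fun z => ind E z * log ‖u - z‖ := hd.integrable_log u
  have hsub : E ⊆ Metric.closedBall 0 R := fun z hz => by simpa using hR z hz
  have j3 : IntegrableOn (fun z : ℂ => z) E :=
    (continuous_id.continuousOn.integrableOn_compact (isCompact_closedBall 0 R)).mono_set hsub
  have j4 : IntegrableOn (fun z : ℂ => reMul ((starRingEnd ℂ) u) z) E :=
    (reMul ((starRingEnd ℂ) u)).integrable_comp j3
  have e4 : ∫ z in E, reMul ((starRingEnd ℂ) u) z = 0 := by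
    rw [ContinuousLinearMap.integral_comp_comm _ j3, h0, map_zero]
  have k4 : ∀ z, ind E z * ((starRingEnd ℂ) u * z).re
      = E.indicator (fun z => reMul ((starRingEnd ℂ) u) z) z := fun z => by
    by_cases hz : z ∈ E <;> simp [ind, hz]
  have i4 : Integrable fun z => 1 / 2 * (ind E z * ((starRingEnd ℂ) u * z).re) := by
    simp_rw [k4]
    exact ((integrable_indicator_iff hE).2 j4).const_mul _
  have i5 : Integrable fun z => ind E z * log ‖u - z‖
      + 1 / 2 * (ind E z * ((starRingEnd ℂ) u * z).re) := i2.add i4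
  have e : (fun z => ind E z * posKer t u z) = fun z => (log 2 / 2 + t) * ind E z
      - (ind E z * log ‖u - z‖ + 1 / 2 * (ind E z * ((starRingEnd ℂ) u * z).re)) := by
    ext z; rw [posKer]; ring
  rw [e]
  refine ⟨i1.sub i5, ?_⟩
  rw [integral_sub i1 i5, integral_add i2 i4, integral_const_mul, integral_const_mul, integral_ind hE]
  simp_rw [k4]
  rw [integral_indicator hE, e4, logPot]
  ring

namespace IsNearDisc
variable {B : Set ℂ} {a b : ℝ}

lemma newt_unit_le (H : IsNearDisc B a b) (hB : MeasurableSet B) (hv : volume.real B = π)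
    (h0 : ∫ z in B, z = 0) {u : ℂ} (hu : ‖u‖ = 1) :
    2 * newt B u ≤ log 2 * a + 3 * (a + b) ^ 2 ∧ -(log 2 * b + 3 * (a + b) ^ 2) ≤ 2 * newt B u := by
  have ha := H.a_pos
  have hb := H.b_pos
  have ha' := H.a_le
  have hb' := H.b_le
  have hcen : ∀ r : ℝ, ∫ z in Metric.ball (0 : ℂ) r, z = 0 := fun r => by
    simpa using integral_ball_sub_center (0 : ℂ) (r := r)
  obtain ⟨iB, eB⟩ := integral_posKer (t := a + b) hB H.norm_le h0 u
  have hcl : ∀ r : ℝ, ∀ z ∈ Metric.ball (0 : ℂ) r, ‖z‖ ≤ r := fun r z hz =>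
    (mem_ball_zero_iff.1 hz).le
  obtain ⟨iE, eE⟩ := integral_posKer (t := a + b) (E := Metric.ball 0 (1 + a))
    Metric.isOpen_ball.measurableSet (hcl _) (hcen _) u
  obtain ⟨iF, eF⟩ := integral_posKer (t := a + b) (E := Metric.ball 0 (1 - b))
    Metric.isOpen_ball.measurableSet (hcl _) (hcen _) u
  have hne : ∀ᵐ z : ℂ, u ≠ z := by
    have : ({u} : Set ℂ)ᶜ ∈ ae (volume : Measure ℂ) := by
      rw [mem_ae_iff, compl_compl]; simp
    filter_upwards [this] with z hz h using hz (by simp [h])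
  have hsph : ∀ᵐ z : ℂ, ‖z‖ ≠ 1 + a := by
    have : (Metric.sphere (0 : ℂ) (1 + a))ᶜ ∈ ae (volume : Measure ℂ) := by
      rw [mem_ae_iff, compl_compl]; exact Measure.addHaar_sphere _ _ _
    filter_upwards [this] with z hz h using hz (by simpa using h)
  have h1 : ∫ z, ind B z * posKer (a + b) u z
      ≤ ∫ z, ind (Metric.ball 0 (1 + a)) z * posKer (a + b) u z := by
    refine integral_mono_ae iB iE ?_
    filter_upwards [hne, hsph] with z hz hz2
    by_cases hzB : z ∈ B
    · have : z ∈ Metric.ball (0 : ℂ) (1 + a) :=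
        mem_ball_zero_iff.2 (lt_of_le_of_ne (H.norm_le z hzB) hz2)
      simp [ind, hzB, this]
    · by_cases hzE : z ∈ Metric.ball (0 : ℂ) (1 + a)
      · have hz3 := mem_ball_zero_iff.1 hzE
        have := posKer_nonneg (t := a + b) hu (by nlinarith [norm_nonneg z]) hz
        simpa [ind, hzB, Set.indicator_of_mem hzE] using this
      · simp [ind, hzB, Set.indicator_of_notMem hzE]
  have h2 : ∫ z, ind (Metric.ball 0 (1 - b)) z * posKer (a + b) u z
      ≤ ∫ z, ind B z * posKer (a + b) u z := by
    refine integral_mono_ae iF iB ?_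
    filter_upwards [hne] with z hz
    by_cases hzF : z ∈ Metric.ball (0 : ℂ) (1 - b)
    · simp only [ind, Set.indicator_of_mem hzF, Set.indicator_of_mem (H.ball_subset hzF), le_refl]
    · by_cases hzB : z ∈ B
      · have hz3 := H.norm_le z hzB
        have := posKer_nonneg (t := a + b) hu (by nlinarith [norm_nonneg z]) hz
        simpa [ind, hzB, Set.indicator_of_notMem hzF] using this
      · simp [ind, hzB, Set.indicator_of_notMem hzF]
  rw [eB, eE, volume_real_ball _ (by linarith), hv,
    logPot_ball_inside (by rw [sub_zero, hu]; linarith), sub_zero, hu] at h1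
  rw [eB, eF, volume_real_ball _ (by linarith), hv,
    logPot_ball_outside (by linarith) (by rw [sub_zero, hu]; linarith), sub_zero, hu, log_one] at h2
  have hN : logPot (ind B) u = -(π * (2 * newt B u)) := by
    rw [newt]; field_simp
  rw [hN] at h1 h2
  have hlog : a * (1 + a) ≤ (1 + a) ^ 2 * log (1 + a) := by
    have := one_sub_inv_le_log_of_pos (by linarith : 0 < 1 + a)
    have e : 1 - (1 + a)⁻¹ = a / (1 + a) := by
      have : (1 + a) ≠ 0 := by linarith
      field_simp; ring
    rw [e, div_le_iff₀ (by linarith)] at this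
    nlinarith
  have l2 : 0 < log 2 := log_pos (by norm_num)
  have l2' : log 2 < 1 := by linarith [log_two_lt_d9]
  constructor
  · have h3 : 2 * newt B u ≤ (log 2 / 2 + (a + b)) * (2 * a + a ^ 2) - a * (1 + a)
        + 1 / 2 * (2 * a + a ^ 2) := by
      refine le_of_mul_le_mul_left ?_ pi_pos
      nlinarith [pi_pos]
    nlinarith [mul_pos ha hb]
  · have h3 : -((log 2 / 2 + (a + b)) * (2 * b - b ^ 2)) ≤ 2 * newt B u := by
      refine le_of_mul_le_mul_left ?_ pi_pos
      nlinarith [pi_pos]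
    nlinarith [mul_pos ha hb]

end IsNearDisc

/-- The leading constant in the expansion of the level function. -/
def levConst (τ ω m : ℝ) : ℝ := (-log τ + ringB / 2) / 2 - ω / 2 - m

lemma IsRegion.abs_spot_sub_expansion {τ : ℝ} {B : Set ℂ} (h : IsRegion τ B)
    (hB : volume.real B = π) (h0 : ∫ z in B, z.re = 0) (h2 : ∀ z ∈ B, ‖z‖ ≤ 2) (hτ8 : τ ≤ 1 / 8)
    {y : ℂ} (hy : ‖y‖ ≤ 2) :
    |spot τ B y - ((1 + τ * y.re / 2) * ((-log τ + ringB / 2) / 2 + newt B y)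
      - 3 * τ / (4 * π) * logPot (fun z => ind B z * z.re) y + τ * y.re / 4)|
      ≤ 36000 * (τ ^ 2 * -log τ) := by
  have hτ := h.τ_pos
  have hl := h.one_le
  have hη : 2 * τ ≤ 1 / 4 := by linarith
  have hyη : τ * ‖y‖ ≤ 2 * τ := by nlinarith
  have i1 := h.integrableOn_kern (hyη.trans hη)
  have i2 : IntegrableOn (mainF τ y) B :=
    ((h.integrableOn_const _).sub (h.integrableOn_log y)).const_mul _
  have i3 : IntegrableOn (fun z : ℂ => z.re) B :=
    (Complex.continuous_re.continuousOn.integrableOn_compact (isCompact_closedBall 0 2)).mono_set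
      fun z hz => by simpa using h2 z hz
  have i4 : IntegrableOn (fun z : ℂ => z.re * log ‖y - z‖) B := by
    refine ((h.integrableOn_log y).norm.const_mul 2).mono' (by fun_prop) ?_
    filter_upwards [ae_restrict_mem h.measurableSet] with z hz
    rw [norm_mul]
    exact mul_le_mul_of_nonneg_right ((Complex.abs_re_le_norm z).trans (h2 z hz)) (norm_nonneg _)
  have e0 : (-log τ + ringB / 2) / 2 + newt B y = ∫ z in B, mainF τ y z := by
    simp only [mainF]
    rw [integral_const_mul, integral_sub (h.integrableOn_const _) (h.integrableOn_log y),
      setIntegral_const, hB, newt, logPot_ind h.measurableSet, smul_eq_mul]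
    field_simp
    ring
  have j1 : IntegrableOn (fun z => (1 + τ * y.re / 2) * mainF τ y z) B := i2.const_mul _
  have j2 : IntegrableOn (fun z : ℂ => (3 * τ / (4 * π) * (-log τ + ringB / 2) + τ / (4 * π)) * z.re) B :=
    i3.const_mul _
  have j3 : IntegrableOn (fun z : ℂ => 3 * τ / (4 * π) * (z.re * log ‖y - z‖)) B := i4.const_mul _
  have j4 : IntegrableOn (fun _ : ℂ => τ * y.re / (4 * π)) B := h.integrableOn_const _
  have j23 : IntegrableOn (fun z : ℂ => (3 * τ / (4 * π) * (-log τ + ringB / 2) + τ / (4 * π)) * z.re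
      - 3 * τ / (4 * π) * (z.re * log ‖y - z‖)) B := j2.sub j3
  have j234 : IntegrableOn (fun z : ℂ => (3 * τ / (4 * π) * (-log τ + ringB / 2) + τ / (4 * π)) * z.re
      - 3 * τ / (4 * π) * (z.re * log ‖y - z‖) + τ * y.re / (4 * π)) B := j23.add j4
  have hq : (fun z => (1 + τ * y.re / 2 + 3 / 2 * (τ * z.re)) * mainF τ y z
      + (τ * y.re + τ * z.re) / (4 * π)) = fun z => (1 + τ * y.re / 2) * mainF τ y z
      + ((3 * τ / (4 * π) * (-log τ + ringB / 2) + τ / (4 * π)) * z.re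
      - 3 * τ / (4 * π) * (z.re * log ‖y - z‖) + τ * y.re / (4 * π)) := by
    ext z
    rw [mainF]
    field_simp
    ring
  have jq : IntegrableOn (fun z => (1 + τ * y.re / 2 + 3 / 2 * (τ * z.re)) * mainF τ y z
      + (τ * y.re + τ * z.re) / (4 * π)) B := by
    rw [hq]; exact j1.add j234
  have e : (1 + τ * y.re / 2) * ((-log τ + ringB / 2) / 2 + newt B y)
      - 3 * τ / (4 * π) * logPot (fun z => ind B z * z.re) y + τ * y.re / 4
      = ∫ z in B, ((1 + τ * y.re / 2 + 3 / 2 * (τ * z.re)) * mainF τ y z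
      + (τ * y.re + τ * z.re) / (4 * π)) := by
    rw [hq, integral_add j1 j234, integral_add j23 j4, integral_sub j2 j3,
      integral_const_mul (1 + τ * y.re / 2), ← e0,
      integral_const_mul (3 * τ / (4 * π) * (-log τ + ringB / 2) + τ / (4 * π)), h0,
      integral_const_mul (3 * τ / (4 * π)), logPot_re_eq h.measurableSet, setIntegral_const, hB,
      smul_eq_mul]
    field_simp
    ring
  rw [e, spot, ← integral_sub i1 jq]
  refine abs_integral_le_integral_abs.trans ?_
  calc _ ≤ ∫ z in B, 1200 * τ ^ 2 * wlog τ y z := by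
        refine setIntegral_mono_ae_restrict (i1.sub jq).abs ((h.integrableOn_wlog y).const_mul _) ?_
        filter_upwards [ae_ne y B, ae_restrict_mem h.measurableSet] with z hne hz
        have := NearPair.abs_kern_sub_le (η := 2 * τ)
          ⟨hτ, hl, hη, hyη, by nlinarith [h2 z hz], hne⟩
        calc _ ≤ _ := this
          _ = _ := by ring
    _ ≤ _ := by
        rw [integral_const_mul]
        have := mul_le_mul_of_nonneg_left (h.integral_wlog_le hB (hyη.trans hη))
          (show 0 ≤ 1200 * τ ^ 2 by positivity)
        linarith

lemma abs_newt_ball_le {y : ℂ} {t : ℝ} (h : |‖y‖ - 1| ≤ t) :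
    |newt (Metric.ball 0 1) y| ≤ t := by
  rw [abs_le] at h
  rcases le_total ‖y‖ 1 with h1 | h1
  · rw [newt_ball_inside (by simpa using h1), sub_zero, log_one, abs_le]
    constructor <;> nlinarith [norm_nonneg y]
  · rw [newt_ball_outside zero_le_one (by simpa using h1), sub_zero, abs_le]
    have := log_nonneg h1
    have := log_le_sub_one_of_pos (by linarith : 0 < ‖y‖)
    constructor <;> linarith

namespace IsNearDisc
variable {B : Set ℂ} {a b : ℝ}

lemma abs_norm_sub_one_le (H : IsNearDisc B a b) {y : ℂ} (hy : y ∈ annulus a b) :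
    |‖y‖ - 1| ≤ a + b := by
  rw [abs_le]
  constructor <;> linarith [hy.1, hy.2, H.a_pos, H.b_pos]

lemma isDensity_sub (H : IsNearDisc B a b) (hB : MeasurableSet B) :
    IsDensity (fun z => ind B z - ind (Metric.ball 0 1) z) 1 (max 2 1) :=
  isDensity_ind_sub hB Metric.isOpen_ball.measurableSet H.norm_le_two
    fun _ hz => (mem_ball_zero_iff.1 hz).le

lemma newt_sub_eq (H : IsNearDisc B a b) (hB : MeasurableSet B) (y : ℂ) :
    newt B y - newt (Metric.ball 0 1) y
      = -(1 / (2 * π)) * logPot (fun z => ind B z - ind (Metric.ball 0 1) z) y := by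
  rw [logPot_ind_sub (isDensity_ind hB H.norm_le_two) (isDensity_ball 0 1), newt, newt]
  ring

lemma abs_newt_sub_le (H : IsNearDisc B a b) (hB : MeasurableSet B) {y : ℂ} (hy : ‖y‖ ≤ 2) :
    |newt B y - newt (Metric.ball 0 1) y| ≤ 10 * √(a + b) := by
  have := H.abs_logPot_le (M := 1) (fun z => by rw [one_mul]; exact H.abs_ind_sub_le z) zero_le_one hy
  rw [H.newt_sub_eq hB, abs_mul, abs_neg, abs_of_pos (by positivity), one_div_mul_eq_div,
    div_le_iff₀ (by positivity)]
  nlinarith [pi_gt_three, sqrt_nonneg (a + b)]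

lemma abs_newt_sub_sub_le (H : IsNearDisc B a b) (hB : MeasurableSet B) (y u : ℂ) :
    |(newt B y - newt (Metric.ball 0 1) y) - (newt B u - newt (Metric.ball 0 1) u)|
      ≤ 4 * √(a + b) * ‖y - u‖ := by
  have := abs_logPot_sub_le (H.isDensity_sub hB) (H.norm_cauPot_le H.abs_ind_sub_le) y u
  rw [H.newt_sub_eq hB, H.newt_sub_eq hB, ← mul_sub, abs_mul, abs_neg, abs_of_pos (by positivity),
    one_div_mul_eq_div, div_le_iff₀ (by positivity)]
  have h2 : 0 ≤ √(a + b) * ‖y - u‖ := by positivity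
  nlinarith [pi_gt_three]

lemma exists_abs_logPot_re_le : ∃ K : ℝ, 0 < K ∧ ∀ (B : Set ℂ) (a b : ℝ), IsNearDisc B a b →
    MeasurableSet B → ∀ y ∈ annulus a b, ∀ u : ℂ, ‖u‖ = 1 → ‖y - u‖ ≤ a + b →
    |logPot (fun z => ind B z * z.re) y + π / 4 * y.re| ≤ K * √(a + b) := by
  obtain ⟨K, hK, h⟩ := exists_abs_logPot_re_ball_le
  refine ⟨K + 121, by positivity, fun B a b H hB y hy u hu hyu => ?_⟩
  have ha := H.a_pos
  have hb := H.b_pos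
  have ha' := H.a_le
  have hb' := H.b_le
  have hs : a + b ≤ √(a + b) := by
    rw [le_sqrt (by linarith) (by linarith)]
    nlinarith
  have hy2 : ‖y‖ ≤ 2 := by linarith [hy.2]
  have h1 := isDensity_re hB H.norm_le_two
  have h2 := isDensity_re (B := Metric.ball 0 1) Metric.isOpen_ball.measurableSet
    fun z hz => by linarith [mem_ball_zero_iff.1 hz]
  have h3 := H.abs_logPot_le (f := fun z => ind B z * z.re - ind (Metric.ball 0 1) z * z.re) (M := 2)
    (fun z => by
      have e := H.abs_ind_sub_le z
      by_cases hz : z ∈ annulus a b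
      · have : |z.re| ≤ 2 := (Complex.abs_re_le_norm z).trans (by linarith [hz.2])
        rw [← sub_mul, abs_mul, mul_comm]
        gcongr
      · have e0 : ind (annulus a b) z = 0 := Set.indicator_of_notMem hz _
        rw [e0] at e ⊢
        rw [← sub_mul, abs_mul, le_antisymm e (abs_nonneg _)]
        simp) two_pos.le hy2
  have e : logPot (fun z => ind B z * z.re - ind (Metric.ball 0 1) z * z.re) y
      = logPot (fun z => ind B z * z.re) y - logPot (fun z => ind (Metric.ball 0 1) z * z.re) y := by
    simp only [logPot, sub_mul]
    exact integral_sub (h1.integrable_log y) (h2.integrable_log y)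
  rw [e] at h3
  have h4 := h y u hu
  have h5 : |y.re - u.re| ≤ a + b := by
    rw [← Complex.sub_re]; exact (Complex.abs_re_le_norm _).trans hyu
  have h6 : |π / 4 * (y.re - u.re)| ≤ a + b := by
    rw [abs_mul, abs_of_pos (by positivity)]
    nlinarith [pi_lt_four, abs_nonneg (y.re - u.re)]
  have h7 : K * ‖y - u‖ ≤ K * √(a + b) := by gcongr; linarith
  rw [abs_le] at h3 h4 h6 ⊢
  constructor <;> nlinarith

end IsNearDisc

lemma abs_six_terms_le (p q r v w x : ℝ) :
    |p - q + r - v - w + x| ≤ |p| + |q| + |r| + |v| + |w| + |x| := by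
  have h1 := abs_add_le (p - q + r - v - w) x
  have h2 := abs_sub (p - q + r - v) w
  have h3 := abs_sub (p - q + r) v
  have h4 := abs_add_le (p - q) r
  have h5 := abs_sub p q
  linarith

lemma sum_error_le {C₀ C₁ K P Q S : ℝ} (hC₀ : 0 ≤ C₀) (hC₁ : 0 ≤ C₁) (hK : 0 ≤ K) (hP : 0 ≤ P)
    (hQ : 0 ≤ Q) (hS : 0 ≤ S) : 36000 * Q + (2 * C₁ * P + 2 * C₁ * Q) + 11 * P + K * P
      + 2 * C₀ * Q + 4 * S ≤ (36000 + 2 * C₀ + 4 * C₁ + K + 11 + 4) * (P + Q + S) := by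
  have h1 : 0 ≤ (36000 + 2 * C₀ + 2 * C₁ + 4) * P + (2 * C₁ + K + 15) * Q
      + (36000 + 2 * C₀ + 4 * C₁ + K + 11) * S := by positivity
  linarith

set_option maxHeartbeats 1000000 in
/-- The level function near the boundary of a nearly circular core. -/
lemma IsCore.exists_abs_lev_sub_le (C₀ : ℝ) (hC₀ : 0 < C₀) :
    ∃ C : ℝ, 0 < C ∧ ∀ (τ ω m : ℝ) (B : Set ℂ) (a b : ℝ), IsCore τ ω m B → IsNearDisc B a b →
    τ ≤ 1 / 8 → ω ≤ C₀ * -log τ → ∀ y ∈ annulus a b, ∀ u : ℂ, ‖u‖ = 1 → ‖y - u‖ ≤ a + b →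
    |lev τ ω m B y - (levConst τ ω m + newt (Metric.ball 0 1) y + newt B u)|
      ≤ C * (τ * √(a + b) + τ ^ 2 * -log τ + (a + b) * √(a + b)) := by
  obtain ⟨C₁, hC₁, hsp⟩ := exists_abs_speed_sub_le
  obtain ⟨K, hK, hre⟩ := IsNearDisc.exists_abs_logPot_re_le
  refine ⟨36000 + 2 * C₀ + 4 * C₁ + K + 11 + 4, by positivity, fun τ ω m B a b h H hτ8 hω y hy u hu hyu => ?_⟩
  have hτ := h.τ_pos
  have hl := h.one_le
  have hB := h.measurableSet
  have ha := H.a_pos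
  have hb := H.b_pos
  have ha' := H.a_le
  have hb' := H.b_le
  have hs : a + b ≤ √(a + b) := by
    rw [le_sqrt (by linarith) (by linarith)]
    nlinarith
  have hy2 : ‖y‖ ≤ 2 := by linarith [hy.2]
  set s := √(a + b) with hsdef
  have hs0 : 0 ≤ s := sqrt_nonneg _
  have hyre : |y.re| ≤ 2 := (Complex.abs_re_le_norm y).trans hy2
  have h1 := h.abs_spot_sub_expansion h.volume_eq h.integral_re H.norm_le_two hτ8 hy2
  have h2 := hsp τ ω m B a b h H hτ8
  have h3 := hre B a b H hB y hy u hu hyu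
  have h4 := H.abs_newt_sub_le hB hy2
  have h5 := abs_newt_ball_le (H.abs_norm_sub_one_le hy)
  have h6 := H.abs_newt_sub_sub_le hB y u
  have hu0 : newt (Metric.ball 0 1) u = 0 := by
    rw [newt_ball_outside zero_le_one (by simp [hu]), sub_zero, hu]; simp
  rw [hu0, sub_zero] at h6
  have h7 : 4 * s * ‖y - u‖ ≤ 4 * ((a + b) * s) := by nlinarith
  have hN : |newt B y| ≤ 11 * s := by
    rw [abs_le] at h4 h5 ⊢
    constructor <;> linarith
  have hlog : log 64 = 2 * log 8 := by
    rw [show (64 : ℝ) = 8 ^ 2 by norm_num, log_pow]; norm_num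
  set T := logPot (fun z => ind B z * z.re) y with hT
  set X := (1 + τ * y.re / 2) * ((-log τ + ringB / 2) / 2 + newt B y)
      - 3 * τ / (4 * π) * T + τ * y.re / 4 with hX
  have e : lev τ ω m B y - (levConst τ ω m + newt (Metric.ball 0 1) y + newt B u)
      = (spot τ B y - X) - τ * y.re * (ω - 1 / 4 * (-log τ + log 8 - 1 / 4))
        + τ * y.re / 2 * newt B y - 3 * τ / (4 * π) * (T + π / 4 * y.re)
        - ω / 2 * τ ^ 2 * y.re ^ 2
        + (newt B y - newt (Metric.ball 0 1) y - newt B u) := by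
    rw [lev, hX, levConst, hgt, ringB, hlog]
    field_simp
    ring
  have hlam : 0 ≤ τ ^ 2 * -log τ := mul_nonneg (sq_nonneg _) (by linarith)
  have b1 : |τ * y.re * (ω - 1 / 4 * (-log τ + log 8 - 1 / 4))|
      ≤ 2 * C₁ * (τ * s) + 2 * C₁ * (τ ^ 2 * -log τ) := by
    rw [abs_mul, abs_mul, abs_of_pos hτ]
    calc _ ≤ τ * 2 * (C₁ * (a + b + τ ^ 2 * -log τ)) := by gcongr
      _ ≤ τ * 2 * (C₁ * (s + τ ^ 2 * -log τ)) := by gcongr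
      _ = 2 * C₁ * (τ * s) + 2 * C₁ * (τ * (τ ^ 2 * -log τ)) := by ring
      _ ≤ _ := by
        have : τ * (τ ^ 2 * -log τ) ≤ τ ^ 2 * -log τ := mul_le_of_le_one_left hlam (by linarith)
        nlinarith
  have b2 : |τ * y.re / 2 * newt B y| ≤ 11 * (τ * s) := by
    rw [abs_mul, abs_div, abs_mul, abs_of_pos hτ, abs_of_pos (two_pos : (0 : ℝ) < 2)]
    calc _ ≤ τ * 2 / 2 * (11 * s) := by gcongr
      _ = _ := by ring
  have b3 : |3 * τ / (4 * π) * (T + π / 4 * y.re)| ≤ K * (τ * s) := by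
    rw [abs_mul, abs_of_pos (by positivity)]
    calc _ ≤ τ * (K * s) := by
          gcongr
          rw [div_le_iff₀ (by positivity)]
          linarith [mul_lt_mul_of_pos_left pi_gt_three hτ]
      _ = _ := by ring
  have b4 : |ω / 2 * τ ^ 2 * y.re ^ 2| ≤ 2 * C₀ * (τ ^ 2 * -log τ) := by
    have hω0 := h.ω_pos
    rw [abs_of_nonneg (by positivity)]
    have : y.re ^ 2 ≤ 4 := by rw [← sq_abs]; nlinarith [abs_nonneg y.re]
    calc _ ≤ (C₀ * -log τ) / 2 * τ ^ 2 * 4 := by gcongr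
      _ = _ := by ring
  have hts : 0 ≤ τ * s := by positivity
  have hsl : 0 ≤ (a + b) * s := by positivity
  rw [e]
  refine (abs_six_terms_le _ _ _ _ _ _).trans ?_
  have h8 := h6.trans h7
  refine le_trans ?_ (sum_error_le hC₀.le hC₁.le hK.le hts hlam hsl)
  exact add_le_add (add_le_add (add_le_add (add_le_add (add_le_add h1 b1) b2) b3) b4) h8

lemma abs_newt_ball_add_le {y : ℂ} :
    |newt (Metric.ball 0 1) y + (‖y‖ - 1) / 2| ≤ (‖y‖ - 1) ^ 2 / 2 := by
  rcases le_total ‖y‖ 1 with h1 | h1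
  · rw [newt_ball_inside (by simpa using h1), sub_zero, log_one, abs_le]
    constructor <;> nlinarith [sq_nonneg (‖y‖ - 1)]
  · rw [newt_ball_outside zero_le_one (by simpa using h1), sub_zero, abs_le]
    have h0 : 0 < ‖y‖ := by linarith
    have h2 := log_le_sub_one_of_pos h0
    have h3 := one_sub_inv_le_log_of_pos h0
    have h4 : (‖y‖ - 1) - (‖y‖ - 1) ^ 2 ≤ 1 - ‖y‖⁻¹ := by
      have e : 1 - ‖y‖⁻¹ = (‖y‖ - 1) / ‖y‖ := by field_simp
      rw [e, le_div_iff₀ h0]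
      nlinarith [mul_nonneg (sub_nonneg.2 h1) (sq_nonneg (‖y‖ - 1))]
    constructor <;> nlinarith [sq_nonneg (‖y‖ - 1)]

lemma exists_unit_near {y : ℂ} (hy : y ≠ 0) : ∃ u : ℂ, ‖u‖ = 1 ∧ ‖y - u‖ = |‖y‖ - 1| := by
  have h : 0 < ‖y‖ := norm_pos_iff.2 hy
  have e : y - y / (‖y‖ : ℂ) = ((‖y‖ - 1 : ℝ) : ℂ) * (y / (‖y‖ : ℂ)) := by
    have : (‖y‖ : ℂ) ≠ 0 := by exact_mod_cast h.ne'
    push_cast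
    field_simp
  have hu : ‖y / (‖y‖ : ℂ)‖ = 1 := by
    rw [norm_div, Complex.norm_real, norm_norm, div_self h.ne']
  refine ⟨y / ‖y‖, hu, ?_⟩
  rw [e, norm_mul, hu, mul_one, Complex.norm_real, norm_eq_abs]

namespace IsCore
variable {τ ω m : ℝ} {B : Set ℂ}

lemma mul_norm_lt (h : IsCore τ ω m B) (hτ8 : τ ≤ 1 / 10) {y : ℂ} (hy : ‖y‖ ≤ 2) : τ * ‖y‖ < 1 / 4 := by
  have := h.τ_pos
  nlinarith [norm_nonneg y]

/-- One step of the improvement of the roundness of the core. -/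
lemma exists_isNearDisc_step {a b E : ℝ} (h : IsCore τ ω m B) (hτ8 : τ ≤ 1 / 10)
    (H : IsNearDisc B a b)
    (hE : ∀ y ∈ annulus a b, ∀ u : ℂ, ‖u‖ = 1 → ‖y - u‖ ≤ a + b →
      |lev τ ω m B y - (levConst τ ω m + newt (Metric.ball 0 1) y + newt B u)| ≤ E)
    {q : ℝ} (hq : 0 < q)
    (hs : log 2 * (a + b) + 2 * (4 * (a + b) ^ 2 + 2 * E) + 2 * q ≤ 1 / 2) :
    ∃ a' b', IsNearDisc B a' b' ∧
      a' + b' = log 2 * (a + b) + 2 * (4 * (a + b) ^ 2 + 2 * E) + 2 * q := by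
  have ha := H.a_pos
  have hb := H.b_pos
  have ha' := H.a_le
  have hb' := H.b_le
  have hfin := h.volume_lt_top
  set M := 4 * (a + b) ^ 2 + 2 * E with hM
  set s₁ := 2 * levConst τ ω m + log 2 * a + M with hs₁
  set s₂ := 2 * levConst τ ω m - log 2 * b - M with hs₂
  have key : ∀ y ∈ annulus a b, 2 * lev τ ω m B y ≤ s₁ - (‖y‖ - 1) ∧
      s₂ - (‖y‖ - 1) ≤ 2 * lev τ ω m B y := fun y hy => by
    have hy0 : y ≠ 0 := by
      rintro rfl
      have := hy.1
      rw [norm_zero] at this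
      linarith
    obtain ⟨u, hu, hyu⟩ := exists_unit_near hy0
    have h1 := H.abs_norm_sub_one_le hy
    have h2 := hE y hy u hu (hyu ▸ h1)
    have h3 := H.newt_unit_le h.measurableSet h.volume_eq h.centroid hu
    have h4 := abs_newt_ball_add_le (y := y)
    have h5 : (‖y‖ - 1) ^ 2 ≤ (a + b) ^ 2 := sq_le_sq' (abs_le.1 h1).1 (abs_le.1 h1).2
    rw [abs_le] at h2 h4
    constructor <;> linarith
  have hout : ∀ y ∈ B, 1 - b ≤ ‖y‖ → ‖y‖ - 1 ≤ s₁ := fun y hy hyb => by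
    have h1 := (key y ⟨hyb, H.norm_le y hy⟩).1
    have h2 := (h.mem_iff y (h.mul_norm_lt hτ8 (H.norm_le_two y hy))).1 hy
    linarith
  have hin : ∀ y, ‖y‖ ≤ 1 + a → ‖y‖ - 1 < s₂ → y ∈ B := fun y hya hys => by
    rcases lt_or_ge ‖y‖ (1 - b) with hyb | hyb
    · exact H.ball_subset (mem_ball_zero_iff.2 hyb)
    · have h1 := (key y ⟨hyb, hya⟩).2
      exact (h.mem_iff y (h.mul_norm_lt hτ8 (by linarith))).2 (by linarith)
  have hs₁0 : 0 ≤ s₁ := by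
    by_contra! hneg
    set r := max (1 - b) (1 + s₁) with hr
    have hr1 : r < 1 := max_lt (by linarith) (by linarith)
    have hr0 : 0 < r := lt_of_lt_of_le (by linarith) (le_max_left _ _)
    have hsub : B ⊆ Metric.ball 0 ((1 + r) / 2) := fun y hy => by
      rw [mem_ball_zero_iff]
      have : ‖y‖ ≤ r := by
        rcases lt_or_ge ‖y‖ (1 - b) with hyb | hyb
        · exact hyb.le.trans (le_max_left _ _)
        · exact (by linarith [hout y hy hyb] : ‖y‖ ≤ 1 + s₁).trans (le_max_right _ _)
      linarith
    have := measureReal_mono hsub (μ := volume) measure_ball_lt_top.ne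
    rw [h.volume_eq, volume_real_ball _ (by linarith)] at this
    have h1 : ((1 + r) / 2) ^ 2 < 1 := by nlinarith
    nlinarith [pi_pos]
  have hs₂0 : s₂ ≤ 0 := by
    by_contra! hpos
    set r := min a s₂ with hr
    have hr0 : 0 < r := lt_min ha hpos
    have hsub : Metric.ball 0 (1 + r) ⊆ B := fun y hy => by
      rw [mem_ball_zero_iff] at hy
      exact hin y (by linarith [min_le_left a s₂]) (by linarith [min_le_right a s₂])
    have := measureReal_mono hsub (μ := volume) hfin.ne
    rw [h.volume_eq, volume_real_ball _ (by linarith)] at this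
    have h1 : 1 < (1 + r) ^ 2 := by nlinarith
    nlinarith [pi_pos]
  have esum : (s₁ + q) + (q - s₂) = log 2 * (a + b) + 2 * M + 2 * q := by
    rw [hs₁, hs₂]; ring
  refine ⟨s₁ + q, q - s₂, ⟨by linarith, by linarith, by linarith, by linarith, fun y hy => ?_,
    fun z hz => ?_⟩, esum⟩
  · rw [mem_ball_zero_iff] at hy
    exact hin y (by linarith) (by linarith)
  · rcases lt_or_ge ‖z‖ (1 - b) with hyb | hyb
    · linarith
    · linarith [hout z hz hyb]

lemma exists_isNearDisc (c₀ C₀ : ℝ) (hc₀ : 0 < c₀) (hC₀ : 0 < C₀) :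
    ∃ Λ C : ℝ, 0 < C ∧ ∀ (τ ω m : ℝ) (B : Set ℂ), IsCore τ ω m B →
      c₀ * -log τ ≤ ω → ω ≤ C₀ * -log τ → Λ ≤ -log τ →
      τ ≤ 1 / 10 ∧ ∃ a b, IsNearDisc B a b ∧ a + b ≤ C * (τ ^ 2 * -log τ) := by
  obtain ⟨C, hC, hlev⟩ := exists_abs_lev_sub_le C₀ hC₀
  set t₀ : ℝ := min (1 / 80) (1 / (80 * C) ^ 2) with ht₀
  have ht₀0 : 0 < t₀ := lt_min (by norm_num) (by positivity)
  obtain ⟨Λ, hΛ⟩ := IsCore.exists_near_disc hc₀ hC₀ (half_pos ht₀0)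
  set K : ℝ := 2 + 4 * C + 80 * C ^ 2 with hK
  have hK0 : 0 < K := by positivity
  refine ⟨max Λ (max (log 10) (10 * K / t₀)), 10 * K + 1, by positivity,
    fun τ ω m B h hω1 hω2 hl => ?_⟩
  have hτ := h.τ_pos
  have hl1 := h.one_le
  have hτ10 : τ ≤ 1 / 10 := by
    have : log 10 ≤ -log τ := ((le_max_left _ _).trans (le_max_right _ _)).trans hl
    rw [← log_inv, log_le_log_iff (by norm_num) (by positivity)] at this
    rw [le_div_iff₀ (by norm_num)]
    rwa [le_inv_comm₀ (by norm_num) hτ, inv_eq_one_div, le_div_iff₀ (by norm_num)] at this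
  set Q := τ ^ 2 * -log τ with hQ
  have hQ0 : 0 < Q := by positivity
  have hQt : K * Q ≤ t₀ / 10 := by
    have h1 : 10 * K / t₀ ≤ -log τ := ((le_max_right _ _).trans (le_max_right _ _)).trans hl
    rw [div_le_iff₀ ht₀0] at h1
    have h2 : τ * -log τ ≤ 1 := by
      have := log_le_sub_one_of_pos (inv_pos.2 hτ)
      rw [log_inv] at this
      calc τ * -log τ ≤ τ * τ⁻¹ := by gcongr; linarith
        _ = 1 := mul_inv_cancel₀ hτ.ne'
    have h3 : Q * -log τ ≤ 1 := by
      have : Q * -log τ = (τ * -log τ) ^ 2 := by rw [hQ]; ring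
      rw [this]
      exact pow_le_one₀ (by positivity) h2
    have h4 : Q * (10 * K) ≤ Q * (-log τ * t₀) := by gcongr
    nlinarith
  refine ⟨hτ10, ?_⟩
  have hstart := hΛ τ ω m B h hω1 hω2 ((le_max_left _ _).trans hl)
  have ht80 : t₀ ≤ 1 / 80 := min_le_left _ _
  have htC : t₀ ≤ 1 / (80 * C) ^ 2 := min_le_right _ _
  have hit : ∀ n : ℕ, ∃ a b, IsNearDisc B a b ∧ a + b ≤ t₀ ∧ a + b ≤ (9 / 10) ^ n * t₀ + 10 * K * Q := by
    intro n
    induction n with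
    | zero =>
      refine ⟨t₀ / 2, t₀ / 2, ⟨by positivity, by positivity, by linarith, by linarith, hstart.1,
        hstart.2⟩, by linarith, ?_⟩
      have : 0 ≤ 10 * K * Q := by positivity
      linarith
    | succ n ih =>
      obtain ⟨a, b, H, h1, h2⟩ := ih
      have ht : 0 < a + b := add_pos H.a_pos H.b_pos
      set s := √(a + b) with hs
      have hs0 : 0 ≤ s := sqrt_nonneg _
      have hss : s ^ 2 = a + b := sq_sqrt ht.le
      have hsC : 80 * C * s ≤ 1 := by
        have h3 : s ≤ 1 / (80 * C) := by
          rw [hs]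
          refine sqrt_le_iff.2 ⟨by positivity, (h1.trans htC).trans (le_of_eq (by rw [one_div_pow]))⟩
        rwa [le_div_iff₀ (by positivity), mul_comm] at h3
      have hτQ : τ ^ 2 ≤ Q := le_mul_of_one_le_right (sq_nonneg _) hl1
      have e1 : 4 * C * (τ * s) ≤ (a + b) / 20 + 80 * C ^ 2 * Q := by
        have h3 : 80 * C ^ 2 * τ ^ 2 ≤ 80 * C ^ 2 * Q := by gcongr
        nlinarith [sq_nonneg (s - 40 * C * τ), sq_nonneg (C * τ)]
      have e2 : 4 * C * ((a + b) * s) ≤ (a + b) / 20 := by nlinarith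
      have hl2 : log 2 < 0.7 := by linarith [log_two_lt_d9]
      have e3 : log 2 * (a + b) ≤ 0.7 * (a + b) := by gcongr
      have e4 : 8 * (a + b) ^ 2 ≤ (a + b) / 10 := by nlinarith
      have e5 : log 2 * (a + b) + 2 * (4 * (a + b) ^ 2 + 2 * (C * (τ * s + Q + (a + b) * s))) + 2 * Q
          ≤ 9 / 10 * (a + b) + K * Q := by
        rw [hK]
        linarith
      obtain ⟨a', b', H', e⟩ := h.exists_isNearDisc_step hτ10 H
        (hlev τ ω m B a b h H (by linarith) hω2) hQ0 (by linarith)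
      refine ⟨a', b', H', by linarith, ?_⟩
      rw [pow_succ]
      linarith
  obtain ⟨n, hn⟩ := exists_pow_lt_of_lt_one (y := (9 / 10 : ℝ)) (div_pos hQ0 ht₀0) (by norm_num)
  obtain ⟨a, b, H, -, h2⟩ := hit n
  refine ⟨a, b, H, ?_⟩
  rw [lt_div_iff₀ ht₀0] at hn
  linarith

end IsCore

namespace IsCore
variable {τ ω m : ℝ} {B : Set ℂ}

/-- Points of the core where the potential exceeds its value at the centroid. -/
lemma norm_le_of_spot_le {a b : ℝ} (h : IsCore τ ω m B) (hτ10 : τ ≤ 1 / 10) (H : IsNearDisc B a b)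
    {p : ℂ} (hp : p ∈ B) (hs : spot τ B 0 ≤ spot τ B p) :
    ‖p‖ ≤ 86400 * (τ * -log τ) + 64 * √(a + b) := by
  have hτ := h.τ_pos
  have hl := h.one_le
  have hp2 := H.norm_le_two p hp
  have hlip := Convex.norm_image_sub_le_of_norm_hasFDerivWithin_le
    (f := fun y => spot τ B y - newt B y)
    (f' := fun y => reMul (spotGrad τ B y) - reMul (newtGrad B y)) (s := Metric.closedBall 0 2)
    (C := 1800 * (2 * τ + τ * -log τ)) (x := (0 : ℂ)) (y := p)
    (fun z hz => by
      have hz' : ‖z‖ ≤ 2 := by simpa using hz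
      exact ((h.hasFDerivAt_spot (h.mul_norm_lt hτ10 hz')).sub
        (hasFDerivAt_newt (isDensity_ind h.measurableSet H.norm_le_two) z)).hasFDerivWithinAt)
    (fun z hz => by
      have hz' : ‖z‖ ≤ 2 := by simpa using hz
      have e : reMul (spotGrad τ B z) - reMul (newtGrad B z)
          = reMul (spotGrad τ B z - newtGrad B z) := by
        ext v; simp [reMul_apply, sub_mul]
      rw [e]
      exact (norm_reMul_le _).trans (h.norm_spotGrad_sub_le h.volume_eq (by linarith)
        (fun w hw => by nlinarith [H.norm_le_two w hw]) (by nlinarith)))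
    (convex_closedBall 0 2) (by simp) (by simpa using hp2)
  rw [sub_zero, norm_eq_abs] at hlip
  have hv := H.abs_newt_sub_sub_le h.measurableSet p 0
  rw [sub_zero] at hv
  have h0 : newt (Metric.ball 0 1) 0 = 1 / 4 := by
    rw [newt_ball_inside (by simp)]; simp
  have hD : newt (Metric.ball 0 1) p ≤ 1 / 4 - ‖p‖ ^ 2 / 16 := by
    rcases le_total ‖p‖ 1 with h1 | h1
    · rw [newt_ball_inside (by simpa using h1), sub_zero, log_one]
      nlinarith [sq_nonneg ‖p‖]
    · rw [newt_ball_outside zero_le_one (by simpa using h1), sub_zero]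
      have := log_nonneg h1
      nlinarith
  rw [h0] at hv
  have hτl : τ ≤ τ * -log τ := le_mul_of_one_le_right hτ.le hl
  have hkey : ‖p‖ ^ 2 / 16 ≤ (5400 * (τ * -log τ) + 4 * √(a + b)) * ‖p‖ := by
    have h1 : 1800 * (2 * τ + τ * -log τ) * ‖p‖ ≤ 5400 * (τ * -log τ) * ‖p‖ :=
      mul_le_mul_of_nonneg_right (by linarith) (norm_nonneg p)
    rw [abs_le] at hlip hv
    linarith
  by_contra! hcon
  have hp0 : 0 < ‖p‖ := lt_of_le_of_lt (by positivity) hcon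
  nlinarith

/-- The asymptotics of a thin vortex core. -/
lemma exists_asymptotics (c₀ C₀ : ℝ) (hc₀ : 0 < c₀) (hC₀ : 0 < C₀) :
    ∃ Λ C : ℝ, 0 < C ∧ ∀ (τ ω m : ℝ) (B : Set ℂ), IsCore τ ω m B →
      c₀ * -log τ ≤ ω → ω ≤ C₀ * -log τ → Λ ≤ -log τ →
      τ ≤ 1 / 10 ∧ |ω - 1 / 4 * (-log τ + log 8 - 1 / 4)| ≤ C * (τ ^ 2 * -log τ) ∧
      (∃ a b, IsNearDisc B a b ∧ a + b ≤ C * (τ ^ 2 * -log τ)) ∧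
      ∀ p ∈ B, spot τ B 0 ≤ spot τ B p → ‖p‖ ≤ C * (τ * -log τ) := by
  obtain ⟨Λ, C₁, hC₁, h1⟩ := exists_isNearDisc c₀ C₀ hc₀ hC₀
  obtain ⟨C₂, hC₂, h2⟩ := exists_abs_speed_sub_le
  refine ⟨Λ, C₂ * (C₁ + 1) + 64 * (C₁ + 1) + 86400, by positivity,
    fun τ ω m B h hω1 hω2 hl => ?_⟩
  have hτ := h.τ_pos
  have hl1 := h.one_le
  obtain ⟨hτ10, a, b, H, hab⟩ := h1 τ ω m B h hω1 hω2 hl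
  have hQ : 0 < τ ^ 2 * -log τ := by positivity
  have hsq : √(a + b) ≤ (C₁ + 1) * (τ * -log τ) := by
    rw [sqrt_le_left (by positivity)]
    refine hab.trans ?_
    have h3 : C₁ ≤ (C₁ + 1) ^ 2 := by nlinarith
    have h4 : τ ^ 2 * -log τ ≤ (τ * -log τ) ^ 2 := by
      rw [mul_pow]
      gcongr
      nlinarith
    rw [mul_pow]
    gcongr
  refine ⟨hτ10, ?_, ⟨a, b, H, hab.trans ?_⟩, fun p hp hs => ?_⟩
  · refine (h2 τ ω m B a b h H (by linarith)).trans ?_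
    calc _ ≤ C₂ * (C₁ * (τ ^ 2 * -log τ) + τ ^ 2 * -log τ) := by gcongr
      _ = C₂ * (C₁ + 1) * (τ ^ 2 * -log τ) := by ring
      _ ≤ _ := by gcongr; linarith
  · gcongr
    nlinarith [mul_pos hC₂ hC₁]
  · refine (h.norm_le_of_spot_le hτ10 H hp hs).trans ?_
    calc _ ≤ 86400 * (τ * -log τ) + 64 * ((C₁ + 1) * (τ * -log τ)) := by gcongr
      _ = (64 * (C₁ + 1) + 86400) * (τ * -log τ) := by ring
      _ ≤ _ := by gcongr; nlinarith [mul_pos hC₂ hC₁]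

end IsCore

section Transfer
open scoped Pointwise

/-- The point of the plane with rescaled coordinate `y` about the centre `c`. -/
def ringPt (c : ℂ) (R : ℝ) (y : ℂ) : Plane := Complex.orthonormalBasisOneI.repr (c + R • y)

lemma ringPt_zero (c : ℂ) (R : ℝ) (y : ℂ) : ringPt c R y 0 = c.re + R * y.re := by
  rw [ringPt, Complex.orthonormalBasisOneI_repr_apply]
  simp

lemma ringPt_one (c : ℂ) (R : ℝ) (y : ℂ) : ringPt c R y 1 = c.im + R * y.im := by
  rw [ringPt, Complex.orthonormalBasisOneI_repr_apply]
  simp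

lemma continuous_ringPt (c : ℂ) (R : ℝ) : Continuous (ringPt c R) :=
  Complex.orthonormalBasisOneI.repr.continuous.comp (by fun_prop)

/-- The rescaled coordinate about `c` of a point of the plane. -/
def ringCoord (c : ℂ) (R : ℝ) (x : Plane) : ℂ :=
  R⁻¹ • (Complex.orthonormalBasisOneI.repr.symm x - c)

lemma ringPt_ringCoord (c : ℂ) {R : ℝ} (hR : 0 < R) (x : Plane) :
    ringPt c R (ringCoord c R x) = x := by
  rw [ringPt, ringCoord, smul_inv_smul₀ hR.ne', add_sub_cancel,
    LinearIsometryEquiv.apply_symm_apply]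

lemma ringCoord_ringPt (c : ℂ) {R : ℝ} (hR : 0 < R) (y : ℂ) :
    ringCoord c R (ringPt c R y) = y := by
  rw [ringPt, ringCoord, LinearIsometryEquiv.symm_apply_apply, add_sub_cancel_left,
    inv_smul_smul₀ hR.ne']

lemma continuous_ringCoord (c : ℂ) (R : ℝ) : Continuous (ringCoord c R) := by
  have := Complex.orthonormalBasisOneI.repr.symm.continuous
  unfold ringCoord
  fun_prop

lemma preimage_ringPt (c : ℂ) {R : ℝ} (hR : 0 < R) (A : Set Plane) :
    ringPt c R ⁻¹' A = ringCoord c R '' A := by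
  ext y
  constructor
  · exact fun h => ⟨_, h, ringCoord_ringPt c hR y⟩
  · rintro ⟨x, hx, rfl⟩
    rwa [Set.mem_preimage, ringPt_ringCoord c hR]

lemma diam_preimage_ringPt (c : ℂ) {R : ℝ} (hR : 0 < R) (A : Set Plane) :
    Metric.diam A = R * Metric.diam (ringPt c R ⁻¹' A) := by
  have h1 : A = Complex.orthonormalBasisOneI.repr '' ((fun y => c + y) ''
      (R • (ringPt c R ⁻¹' A))) := by
    ext x
    simp only [← Set.image_smul, Set.image_image]
    constructor
    · exact fun hx => ⟨ringCoord c R x, by rwa [Set.mem_preimage, ringPt_ringCoord c hR],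
        ringPt_ringCoord c hR x⟩
    · rintro ⟨y, hy, rfl⟩
      exact hy
  conv_lhs => rw [h1]
  rw [Complex.orthonormalBasisOneI.repr.isometry.diam_image,
    (isometry_add_left c).diam_image, diam_smul₀, norm_eq_abs, abs_of_pos hR]

lemma setIntegral_ringPt {E : Type*} [NormedAddCommGroup E] [NormedSpace ℝ E]
    (c : ℂ) {R : ℝ} (hR : 0 < R) {A : Set Plane} (hA : MeasurableSet A) (F : Plane → E) :
    ∫ x in A, F x = R ^ 2 • ∫ y in ringPt c R ⁻¹' A, F (ringPt c R y) := by
  have hB : MeasurableSet (ringPt c R ⁻¹' A) := (continuous_ringPt c R).measurable hA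
  set G : ℂ → E := fun w => A.indicator F (Complex.orthonormalBasisOneI.repr w) with hG
  have h1 : ∫ x, A.indicator F x = ∫ w, G w :=
    (Complex.orthonormalBasisOneI.repr.measurePreserving.integral_comp
      Complex.orthonormalBasisOneI.repr.toHomeomorph.measurableEmbedding _).symm
  have h2 : ∫ w, G w = R ^ 2 • ∫ y : ℂ, G (c + R • y) := by
    rw [Measure.integral_comp_smul volume (fun w => G (c + w)) R,
      integral_add_left_eq_self G c, Complex.finrank_real_complex, abs_of_pos (by positivity),
      smul_smul, mul_inv_cancel₀ (by positivity), one_smul]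
  have h3 : (fun y : ℂ => G (c + R • y))
      = (ringPt c R ⁻¹' A).indicator fun y => F (ringPt c R y) := by
    ext y
    rfl
  rw [← integral_indicator hA, h1, h2, h3, integral_indicator hB]

lemma Gstar_ringPt (c : ℂ) (R : ℝ) (ha : 0 < c.re) {y z : ℂ}
    (hy : 0 < hgt (R / c.re) y) (hz : 0 < hgt (R / c.re) z) :
    Gstar (ringPt c R y) (ringPt c R z) = c.re ^ 2 * kern (R / c.re) y z := by
  have e (w : ℂ) : ringPt c R w 0 = c.re * hgt (R / c.re) w := by
    rw [ringPt_zero, hgt]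
    field_simp
  have hn : ‖y - z‖ ^ 2 = (y.re - z.re) ^ 2 + (y.im - z.im) ^ 2 := by
    rw [← Complex.normSq_eq_norm_sq, Complex.normSq_apply]
    simp only [Complex.sub_re, Complex.sub_im]
    ring
  rw [Gstar, kern, ringF, e, e, ringPt_one, ringPt_one]
  set u := hgt (R / c.re) y with hu
  set v := hgt (R / c.re) z with hv
  have hs : 0 < √(u * v) := by positivity
  have hs2 : √(u * v) ^ 2 = u * v := sq_sqrt (by positivity)
  have h1 (θ : ℝ) : cos θ / √((c.im + R * y.im - (c.im + R * z.im)) ^ 2 + (c.re * u) ^ 2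
      + (c.re * v) ^ 2 - 2 * (c.re * u) * (c.re * v) * cos θ)
      = (c.re * √(u * v))⁻¹ * (cos θ / √(rho (R / c.re) y z + 2 - 2 * cos θ)) := by
    have h2 : (c.im + R * y.im - (c.im + R * z.im)) ^ 2 + (c.re * u) ^ 2
        + (c.re * v) ^ 2 - 2 * (c.re * u) * (c.re * v) * cos θ
        = (c.re * √(u * v)) ^ 2 * (rho (R / c.re) y z + 2 - 2 * cos θ) := by
      have h3 : c.re * (u - v) = R * (y.re - z.re) := by
        rw [hu, hv, hgt, hgt]
        field_simp
        ring
      have h4 : (u * v) * rho (R / c.re) y z = (R / c.re) ^ 2 * ‖y - z‖ ^ 2 := by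
        rw [rho, ← hu, ← hv]
        field_simp
      have h5 : c.re ^ 2 * ((R / c.re) ^ 2 * ‖y - z‖ ^ 2) = R ^ 2 * ‖y - z‖ ^ 2 := by
        field_simp
      rw [mul_pow c.re √(u * v) 2, hs2]
      have h6 : R ^ 2 * ‖y - z‖ ^ 2 = (c.re * (u - v)) ^ 2 + R ^ 2 * (y.im - z.im) ^ 2 := by
        rw [h3, hn]
        ring
      linear_combination -c.re ^ 2 * h4 - h5 - h6
    rw [h2, sqrt_mul (by positivity), sqrt_sq (by positivity), mul_comm (c.re * _) (√_),
      ← div_div, div_eq_mul_inv _ (c.re * √(u * v)), mul_comm]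
  rw [intervalIntegral.integral_congr (fun θ _ => h1 θ), intervalIntegral.integral_const_mul]
  have h7 : u = √(u * v) ^ 2 / v := by
    rw [hs2]
    field_simp
  set s := √(u * v)
  generalize ∫ θ in (-π)..π, cos θ / √(rho (R / c.re) y z + 2 - 2 * cos θ) = I
  rw [h7]
  field_simp

end Transfer

lemma isOpen_halfPlane : IsOpen halfPlane :=
  isOpen_lt continuous_const (by fun_prop : Continuous fun x : Plane => x 0)

lemma isOpen_crossSection {ψ : Plane → ℝ} {ε W μ : ℝ} (h : IsVortexRingStream ψ ε W μ) :
    IsOpen (crossSection ψ ε W μ) := by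
  have h1 : ContinuousOn (fun x : Plane => ψ x - W / 2 * (x 0) ^ 2 * log (1 / ε)) halfPlane :=
    h.continuousOn.sub (by fun_prop)
  exact h1.isOpen_inter_preimage isOpen_halfPlane isOpen_Ioi

lemma integral_ringPt_centroid {A : Set Plane} (hA : MeasurableSet A)
    (hb : Bornology.IsBounded A) {c : ℂ} {R : ℝ} (hR : 0 < R)
    (hV : volume.real A = π * R ^ 2)
    (hc : c = ⨍ x in A, Complex.orthonormalBasisOneI.repr.symm x) :
    volume.real (ringPt c R ⁻¹' A) = π ∧ ∫ y in ringPt c R ⁻¹' A, y = 0 := by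
  have hBb : Bornology.IsBounded (ringPt c R ⁻¹' A) := by
    rw [preimage_ringPt c hR]
    exact (hb.isCompact_closure.image (continuous_ringCoord c R)).isBounded.subset
      (Set.image_mono subset_closure)
  have hBf := hBb.measure_lt_top (μ := volume)
  have : IsFiniteMeasure (volume.restrict (ringPt c R ⁻¹' A)) :=
    isFiniteMeasure_restrict.2 hBf.ne
  have h1 : volume.real (ringPt c R ⁻¹' A) = π := by
    have h2 := setIntegral_ringPt c hR hA fun _ => (1 : ℝ)
    rw [setIntegral_const, setIntegral_const, hV] at h2
    simp only [smul_eq_mul, mul_one] at h2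
    have h3 : R ^ 2 * volume.real (ringPt c R ⁻¹' A) = R ^ 2 * π := by linarith
    exact mul_left_cancel₀ (by positivity) h3
  refine ⟨h1, ?_⟩
  have h2 : (R : ℝ) ^ 2 • ∫ y in ringPt c R ⁻¹' A, (c + R • y) = (π * R ^ 2) • c := by
    have h3 := setIntegral_ringPt c hR hA fun x => Complex.orthonormalBasisOneI.repr.symm x
    have h4 : (fun y => Complex.orthonormalBasisOneI.repr.symm (ringPt c R y))
        = fun y : ℂ => c + R • y := by
      ext1 y
      rw [ringPt, LinearIsometryEquiv.symm_apply_apply]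
    rw [h4] at h3
    rw [← h3, ← hV]
    rw [hc, setAverage_eq, smul_inv_smul₀ (by rw [hV]; positivity)]
  have hi : IntegrableOn (fun y : ℂ => y) (ringPt c R ⁻¹' A) :=
    (continuous_id.continuousOn.integrableOn_compact hBb.isCompact_closure).mono_set
      subset_closure
  have h5 : ∫ y in ringPt c R ⁻¹' A, (c + R • y) = π • c + R • ∫ y in ringPt c R ⁻¹' A, y := by
    have hi2 : IntegrableOn (fun y : ℂ => R • y) (ringPt c R ⁻¹' A) := hi.smul R
    rw [integral_add (integrable_const c) hi2, setIntegral_const, h1,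
      integral_smul]
  rw [h5, smul_add, smul_smul, smul_smul, mul_comm (R ^ 2) π] at h2
  exact (smul_eq_zero.1 (add_eq_left.1 h2)).resolve_left (by positivity)

lemma exists_core {κ W δ₀ ε μ : ℝ} {ψ : Plane → ℝ} (hW : 0 < W) (hδ : 0 < δ₀) (hε : 0 < ε)
    (hμ : 0 ≤ μ) (hL : 0 < log (1 / ε)) (h : IsVortexRingStream ψ ε W μ)
    (hcirc : circulation ψ ε W μ = κ) (hconn : SimplyConnectedSpace ↥(crossSection ψ ε W μ))
    (hsub : crossSection ψ ε W μ ⊆ {x : Plane | δ₀ ≤ x 0 ∧ x 0 ≤ 1 / δ₀})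
    (hdiam : Metric.diam (crossSection ψ ε W μ) ≤ δ₀ / 8)
    (hε2 : κ * ε ^ 2 / (π * δ₀ ^ 3) ≤ exp (-2)) {p : Plane} (hp : p ∈ crossSection ψ ε W μ)
    (hmax : ∀ x ∈ closure (crossSection ψ ε W μ), ψ x ≤ ψ p) :
    ∃ (a R : ℝ) (B : Set ℂ), δ₀ ≤ a ∧ a ≤ 1 / δ₀ ∧ 0 < R ∧ κ * ε ^ 2 = π * a * R ^ 2 ∧
      IsCore (R / a) (W * log (1 / ε) * ε ^ 2 / R ^ 2) (μ * ε ^ 2 / (R ^ 2 * a ^ 2)) B ∧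
      Metric.diam (crossSection ψ ε W μ) = R * Metric.diam B ∧
      ∃ q ∈ B, p 0 = a + R * q.re ∧ ∀ y ∈ B, spot (R / a) B y ≤ spot (R / a) B q := by
  have hopen := isOpen_crossSection h
  set A := crossSection ψ ε W μ with hAdef
  have hA := hopen.measurableSet
  have hAf := h.bounded.measure_lt_top (μ := volume)
  have hA0 : volume A ≠ 0 := (hopen.measure_pos volume ⟨p, hp⟩).ne'
  have hV : 0 < volume.real A := ENNReal.toReal_pos hA0 hAf.ne
  obtain ⟨R, hR, hVR⟩ : ∃ R : ℝ, 0 < R ∧ volume.real A = π * R ^ 2 := by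
    refine ⟨√(volume.real A / π), by positivity, ?_⟩
    rw [sq_sqrt (by positivity)]
    field_simp
  set T := Complex.orthonormalBasisOneI.repr with hT
  have hTc : Continuous fun x => T.symm x := T.symm.continuous
  have hTi : IntegrableOn (fun x => T.symm x) A :=
    (hTc.continuousOn.integrableOn_compact h.bounded.isCompact_closure).mono_set subset_closure
  set c := ⨍ x in A, T.symm x with hc
  have hTx (x : Plane) : (T.symm x).re = x 0 := by
    have h1 := congrFun (Complex.orthonormalBasisOneI_repr_apply (T.symm x)) 0
    rw [← hT, T.apply_symm_apply] at h1
    exact h1.symm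
  have ha1 : δ₀ ≤ c.re :=
    (convex_halfSpace_re_ge δ₀).set_average_mem (isClosed_le continuous_const Complex.continuous_re)
      hA0 hAf.ne ((ae_restrict_iff' hA).2 (.of_forall fun x hx => by
        show δ₀ ≤ _
        rw [hTx]
        exact (hsub hx).1)) hTi
  have ha2 : c.re ≤ 1 / δ₀ :=
    (convex_halfSpace_re_le (1 / δ₀)).set_average_mem
      (isClosed_le Complex.continuous_re continuous_const)
      hA0 hAf.ne ((ae_restrict_iff' hA).2 (.of_forall fun x hx => by
        show _ ≤ 1 / δ₀
        rw [hTx]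
        exact (hsub hx).2)) hTi
  have hcd (x : Plane) (hx : x ∈ A) : ‖T.symm x - c‖ ≤ δ₀ / 8 := by
    have := (convex_closedBall (T.symm x) (δ₀ / 8)).set_average_mem Metric.isClosed_closedBall
      hA0 hAf.ne ((ae_restrict_iff' hA).2 (.of_forall fun z hz => by
        rw [Metric.mem_closedBall, T.symm.dist_map]
        exact (Metric.dist_le_diam_of_mem h.bounded hz hx).trans hdiam)) hTi
    rwa [Metric.mem_closedBall, dist_comm, dist_eq_norm] at this
  set a := c.re with hadef
  have ha : 0 < a := hδ.trans_le ha1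
  set B := ringPt c R ⁻¹' A with hB
  obtain ⟨hBV, hBc⟩ := integral_ringPt_centroid hA h.bounded hR hVR hc
  have hBm : MeasurableSet B := (continuous_ringPt c R).measurable hA
  have hBle (z : ℂ) (hz : z ∈ B) : R / a * ‖z‖ ≤ 1 / 8 := by
    have h1 := hcd _ hz
    rw [ringPt, ← hT, T.symm_apply_apply, add_sub_cancel_left, norm_smul, norm_eq_abs,
      abs_of_pos hR] at h1
    rw [div_mul_eq_mul_div, div_le_iff₀ ha]
    linarith
  have hτ : 0 < R / a := by positivity
  have hx1 (y : ℂ) : ringPt c R y 0 = a * hgt (R / a) y := by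
    have h1 : a * (R / a) = R := mul_div_cancel₀ R ha.ne'
    rw [ringPt_zero, hgt, ← hadef]
    linear_combination -y.re * h1
  have hhgt (y : ℂ) (hy : R / a * ‖y‖ ≤ 1 / 4) : 0 < hgt (R / a) y := by
    have := abs_le.1 (abs_re_le_of_norm_le hτ hy)
    rw [hgt]
    linarith [this.1]
  have hψ (y : ℂ) (hy : 0 < hgt (R / a) y) :
      ψ (ringPt c R y) = R ^ 2 * a ^ 2 / ε ^ 2 * spot (R / a) B y := by
    have h1 : ringPt c R y ∈ halfPlane := by
      show 0 < ringPt c R y 0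
      rw [hx1]
      positivity
    rw [h.repr _ h1, ← hAdef, setIntegral_ringPt c hR hA, ← hB, spot,
      setIntegral_congr_fun hBm (fun z hz => Gstar_ringPt c R ha hy
        (hhgt z ((hBle z hz).trans (by norm_num)))), integral_const_mul, smul_eq_mul]
    ring
  have hκε : κ * ε ^ 2 = π * a * R ^ 2 := by
    rw [← hcirc, circulation, ← hAdef, div_mul_cancel₀ _ (by positivity)]
    have h1 : ∫ x in A, x 0 = (∫ x in A, T.symm x).re := by
      rw [← Complex.reCLM_apply, ← Complex.reCLM.integral_comp_comm hTi]
      exact setIntegral_congr_fun hA fun x _ => (hTx x).symm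
    have h2 : ∫ x in A, T.symm x = volume.real A • c := by
      rw [hc, setAverage_eq, smul_inv_smul₀ hV.ne']
    rw [h1, h2, Complex.real_smul, Complex.re_ofReal_mul, hVR]
    ring
  have hone : 1 ≤ -log (R / a) := by
    have h1 : (R / a) ^ 2 ≤ exp (-1) ^ 2 := by
      rw [← exp_nat_mul]
      refine le_trans ?_ (hε2.trans (by norm_num))
      rw [hκε, div_pow, div_le_div_iff₀ (by positivity) (by positivity)]
      have := pow_le_pow_left₀ hδ.le ha1 3
      calc R ^ 2 * (π * δ₀ ^ 3) ≤ R ^ 2 * (π * a ^ 3) := by gcongr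
        _ = _ := by ring
    have h2 := log_le_log hτ (abs_le_of_sq_le_sq' h1 (exp_pos _).le).2
    rw [log_exp] at h2
    linarith
  have hpq : ringPt c R (ringCoord c R p) = p := ringPt_ringCoord c hR p
  have hq : ringCoord c R p ∈ B := by
    rw [hB, Set.mem_preimage, hpq]
    exact hp
  have hk : 0 < R ^ 2 * a ^ 2 / ε ^ 2 := by positivity
  refine ⟨a, R, B, ha1, ha2, hR, hκε, ⟨⟨hτ, hone, hBm, hBle⟩, by positivity, by positivity, hBV,
    hBc, ?_, ?_⟩, diam_preimage_ringPt c hR A, ringCoord c R p, hq, ?_, ?_⟩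
  · rw [hB, preimage_ringPt c hR]
    have : IsPreconnected A := isPreconnected_iff_preconnectedSpace.2 inferInstance
    exact this.image _ (continuous_ringCoord c R).continuousOn
  · intro y hy
    have hy1 := hhgt y hy.le
    have h1 : ringPt c R y ∈ halfPlane := by
      show 0 < ringPt c R y 0
      rw [hx1]
      positivity
    have h2 : lev (R / a) (W * log (1 / ε) * ε ^ 2 / R ^ 2) (μ * ε ^ 2 / (R ^ 2 * a ^ 2)) B y
        = (R ^ 2 * a ^ 2 / ε ^ 2)⁻¹ * (ψ (ringPt c R y)
          - W / 2 * (ringPt c R y 0) ^ 2 * log (1 / ε) - μ) := by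
      rw [hψ y hy1, hx1, lev]
      field_simp
    rw [h2, mul_pos_iff_of_pos_left (inv_pos.2 hk), sub_pos]
    exact ⟨fun h => h.2, fun h => ⟨h1, h⟩⟩
  · rw [← hpq, ringPt_zero, ringCoord_ringPt c hR]
  · intro y hy
    have h1 := hmax _ (subset_closure hy)
    rw [← hpq, hψ y (hhgt y ((hBle y hy).trans (by norm_num))),
      hψ _ (hhgt _ ((hBle _ hq).trans (by norm_num)))] at h1
    exact le_of_mul_le_mul_left h1 hk

lemma abs_log_one_add_le_two_mul {x X : ℝ} (hx : |x| ≤ X) (hX : X ≤ 1 / 2) :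
    |log (1 + x)| ≤ 2 * X := by
  obtain ⟨h1, h2⟩ := abs_le.1 hx
  have h3 : 0 < 1 + x := by linarith
  rw [abs_le]
  constructor
  · refine le_trans ?_ (one_sub_inv_le_log_of_pos h3)
    have h4 : (1 + x)⁻¹ ≤ 1 + 2 * X := by
      rw [inv_le_iff_one_le_mul₀ h3]
      nlinarith
    linarith
  · linarith [log_le_sub_one_of_pos h3]

lemma IsNearDisc.abs_diam_le {B : Set ℂ} {a b : ℝ} (H : IsNearDisc B a b) :
    |Metric.diam B / 2 - 1| ≤ a + b := by
  have ha := H.a_pos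
  have hb := H.b_pos
  have hb1 := H.b_le
  have hB : B ⊆ Metric.closedBall 0 (1 + a) := fun z hz => by
    rw [mem_closedBall_zero_iff]
    exact H.norm_le z hz
  have h1 := Metric.diam_mono hB Metric.isBounded_closedBall
  have h2 := Metric.diam_mono H.ball_subset (Metric.isBounded_closedBall.subset hB)
  have h3 := Metric.diam_closedBall (x := (0 : ℂ)) (r := 1 + a) (by linarith)
  rw [Metric.diam_ball_eq (0 : ℂ) (by linarith)] at h2
  rw [abs_le]
  constructor <;> linarith

lemma mul_exp_sq_le {l K : ℝ} (hK : 0 < K) (hl : 2 * K ≤ l) : K * (exp (-l) ^ 2 * l) ≤ 1 / 2 := by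
  have hl0 : 0 < l := by linarith
  have h1 : exp (-l) * l ≤ 1 := by
    rw [exp_neg, inv_mul_le_iff₀ (exp_pos _)]
    linarith [add_one_le_exp l]
  have h2 : exp (-l) * K ≤ 1 / 2 := by
    have := mul_le_mul_of_nonneg_left hl (exp_pos (-l)).le
    linarith
  calc K * (exp (-l) ^ 2 * l) = exp (-l) * K * (exp (-l) * l) := by ring
    _ ≤ 1 / 2 * 1 := by gcongr
    _ = 1 / 2 := by norm_num

lemma abs_kelvin_hicks_le {κ W L a R ω q e X δ : ℝ} (hκ : 0 < κ) (hW : 0 < W) (hL : 1 ≤ L)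
    (hδ : 0 < δ) (ha : 0 < a) (haδ : a ≤ 1 / δ) (hR : 0 < R) (hω : W * a * L = κ * ω / π)
    (hωX : |ω - 1 / 4 * (-log (R / a) + log 8 - 1 / 4)| ≤ X) (hq : R / a * |q| ≤ X)
    (he : |e| ≤ X) (hX : X ≤ 1 / 2) :
    |W * (a + R * q) * L - κ / (4 * π) * (log (8 * (a + R * q) / (R * (1 + e))) - 1 / 4)|
      ≤ X * (L * (2 * κ / π + W / δ)) := by
  have hx : |R / a * q| ≤ X := by rwa [abs_mul, abs_of_pos (by positivity : 0 < R / a)]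
  have hX0 : 0 ≤ X := (abs_nonneg _).trans he
  have h1 : 0 < 1 + R / a * q := by linarith [(abs_le.1 hx).1]
  have h2 : 0 < 1 + e := by linarith [(abs_le.1 he).1]
  have h3 : 8 * (a + R * q) / (R * (1 + e))
      = 8 * ((R / a)⁻¹ * ((1 + R / a * q) / (1 + e))) := by
    field_simp
  have h4 : log (8 * (a + R * q) / (R * (1 + e)))
      = log 8 - log (R / a) + (log (1 + R / a * q) - log (1 + e)) := by
    rw [h3, log_mul (by norm_num) (by positivity), log_mul (by positivity) (by positivity),
      log_inv, log_div h1.ne' h2.ne']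
    ring
  have h5 : W * (a + R * q) * L - κ / (4 * π) * (log (8 * (a + R * q) / (R * (1 + e))) - 1 / 4)
      = κ / π * (ω - 1 / 4 * (-log (R / a) + log 8 - 1 / 4)) + W * L * a * (R / a * q)
        - κ / (4 * π) * log (1 + R / a * q) + κ / (4 * π) * log (1 + e) := by
    have h6 : W * L * a * (R / a * q) = W * L * (R * q) := by field_simp
    rw [h4, h6]
    linear_combination hω
  have b1 : |κ / π * (ω - 1 / 4 * (-log (R / a) + log 8 - 1 / 4))| ≤ κ / π * X := by
    rw [abs_mul, abs_of_pos (by positivity : 0 < κ / π)]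
    gcongr
  have b2 : |W * L * a * (R / a * q)| ≤ W * L * (1 / δ) * X := by
    rw [abs_mul, abs_of_pos (by positivity : 0 < W * L * a)]
    gcongr
  have b3 : |κ / (4 * π) * log (1 + R / a * q)| ≤ κ / (4 * π) * (2 * X) := by
    rw [abs_mul, abs_of_pos (by positivity : 0 < κ / (4 * π))]
    exact mul_le_mul_of_nonneg_left (abs_log_one_add_le_two_mul hx hX) (by positivity)
  have b4 : |κ / (4 * π) * log (1 + e)| ≤ κ / (4 * π) * (2 * X) := by
    rw [abs_mul, abs_of_pos (by positivity : 0 < κ / (4 * π))]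
    exact mul_le_mul_of_nonneg_left (abs_log_one_add_le_two_mul he hX) (by positivity)
  have b5 : 2 * (κ / π * X) ≤ L * (2 * (κ / π * X)) := le_mul_of_one_le_left (by positivity) hL
  have b6 : κ / (4 * π) * (2 * X) = 1 / 2 * (κ / π * X) := by
    field_simp
    norm_num
  have b7 : X * (L * (2 * κ / π + W / δ)) = L * (2 * (κ / π * X)) + W * L * (1 / δ) * X := by
    ring
  rw [h5, b7]
  rw [abs_le] at b1 b2 b3 b4 ⊢
  constructor <;> linarith [b1.1, b1.2, b2.1, b2.2, b3.1, b3.2, b4.1, b4.2]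

/-- A bound for the logarithm of the ratio of the two small parameters. -/
def logBound (κ δ : ℝ) : ℝ := |log (κ * δ ^ 3 / π)| + |log (κ / (π * δ ^ 3))|

lemma abs_neg_log_sub_le {κ δ a R ε : ℝ} (hκ : 0 < κ) (hδ : 0 < δ) (hε : 0 < ε) (hR : 0 < R)
    (ha1 : δ ≤ a) (ha2 : a ≤ 1 / δ) (h : κ * ε ^ 2 = π * a * R ^ 2) :
    |-log (R / a) - log (1 / ε)| ≤ logBound κ δ / 2 := by
  have ha : 0 < a := hδ.trans_le ha1
  have h1 : R / a = √(κ / (π * a ^ 3)) * ε := by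
    rw [← sqrt_sq hε.le, ← sqrt_mul (by positivity), ← sqrt_sq (by positivity : 0 ≤ R / a)]
    congr 1
    have : κ / (π * a ^ 3) * ε ^ 2 = κ * ε ^ 2 / (π * a ^ 3) := by ring
    rw [this, h]
    field_simp
  have h2 : -log (R / a) - log (1 / ε) = -(log (κ / (π * a ^ 3)) / 2) := by
    rw [h1, log_mul (by positivity) hε.ne', log_sqrt (by positivity), one_div, log_inv]
    ring
  have h3 : log (κ / (π * a ^ 3)) ≤ log (κ / (π * δ ^ 3)) :=
    log_le_log (by positivity) (by gcongr)
  have h4 : log (κ * δ ^ 3 / π) ≤ log (κ / (π * a ^ 3)) := by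
    have h5 : κ * δ ^ 3 / π = κ / (π * (1 / δ) ^ 3) := by field_simp
    rw [h5]
    exact log_le_log (by positivity) (by gcongr)
  rw [h2, abs_neg, abs_div, abs_two, logBound]
  refine div_le_div_of_nonneg_right (abs_le.2 ⟨?_, ?_⟩) zero_le_two
  · linarith [neg_abs_le (log (κ * δ ^ 3 / π)), abs_nonneg (log (κ / (π * δ ^ 3)))]
  · linarith [le_abs_self (log (κ / (π * δ ^ 3))), abs_nonneg (log (κ * δ ^ 3 / π))]

end VortexRing

open VortexRing

/-- **Refined Kelvin–Hicks formula** (Proposition 3.2). For a centralized steady vortex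
ring of small cross-section with circulation `κ`, flux constant `μ ≥ m₀`, maximum point
`p = (p₁, 0)` of the stream function, and cross-section parameter `σ = diam A / 2`, one has
`|W p₁ ln(1/ε) − (κ/4π)(ln(8p₁/σ) − 1/4)| ≤ C ε² (ln(1/ε))²`. -/
theorem refined_kelvin_hicks (κ W δ₀ m₀ : ℝ)
    (hκ : 0 < κ) (hW : 0 < W) (hδ₀ : 0 < δ₀) (hm₀ : 0 < m₀) :
    ∃ ε₀ > (0 : ℝ), ∃ d₀ > (0 : ℝ), ∃ C > (0 : ℝ), ∀ ε ∈ Set.Ioc (0 : ℝ) ε₀,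
      ∀ ψ : Plane → ℝ, ∀ μ : ℝ, m₀ ≤ μ →
        IsVortexRingStream ψ ε W μ → Centralized ψ →
        circulation ψ ε W μ = κ →
        SimplyConnectedSpace ↥(crossSection ψ ε W μ) →
        crossSection ψ ε W μ ⊆ {x : Plane | δ₀ ≤ x 0 ∧ x 0 ≤ 1 / δ₀} →
        Metric.diam (crossSection ψ ε W μ) ≤ d₀ →
        ∀ p₁ : ℝ, mk2 p₁ 0 ∈ crossSection ψ ε W μ →
          (∀ x ∈ closure (crossSection ψ ε W μ), ψ x ≤ ψ (mk2 p₁ 0)) →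
          |W * p₁ * Real.log (1 / ε)
              - κ / (4 * π) *
                (Real.log (8 * p₁ / ((1 / 2) * Metric.diam (crossSection ψ ε W μ))) - 1 / 4)|
            ≤ C * ε ^ 2 * (Real.log (1 / ε)) ^ 2 := by
  obtain ⟨Λ, K, hK, H⟩ := IsCore.exists_asymptotics (π * δ₀ * W / (2 * κ)) (2 * π * W / (κ * δ₀))
    (by positivity) (by positivity)
  have hb : 0 ≤ logBound κ δ₀ := by rw [logBound]; positivity
  set M := 1 + logBound κ δ₀ + 2 * |Λ| + 4 * K with hM
  have hΛ := abs_nonneg Λ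
  refine ⟨exp (-M), exp_pos _, δ₀ / 8, by positivity,
    2 * K * κ / (π * δ₀ ^ 3) * (2 * κ / π + W / δ₀), by positivity, ?_⟩
  intro ε ⟨hε, hεM⟩ ψ μ hμ hψ _ hcirc hconn hsub hdiam p₁ hp hmax
  have hL : M ≤ log (1 / ε) := by
    have := log_le_log hε hεM
    rw [log_exp] at this
    rw [one_div, log_inv]
    linarith
  set L := log (1 / ε) with hLdef
  have hL1 : 1 ≤ L := by linarith
  have hε2 : κ * ε ^ 2 / (π * δ₀ ^ 3) ≤ exp (-2) := by
    rw [← log_le_iff_le_exp (by positivity), mul_div_right_comm, log_mul (by positivity)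
      (by positivity), log_pow]
    have h1 : log ε = -L := by rw [hLdef, one_div, log_inv, neg_neg]
    have h2 := le_abs_self (log (κ / (π * δ₀ ^ 3)))
    have h3 := abs_nonneg (log (κ * δ₀ ^ 3 / π))
    rw [logBound] at hM
    rw [h1]
    push_cast
    linarith
  obtain ⟨a, R, B, ha1, ha2, hR, hκε, hcore, hdB, q, hqB, hpq, hqmax⟩ :=
    exists_core hW hδ₀ hε (hm₀.le.trans hμ) (by linarith) hψ hcirc hconn hsub hdiam hε2 hp hmax
  have ha : 0 < a := hδ₀.trans_le ha1
  have hlam := abs_le.1 (abs_neg_log_sub_le hκ hδ₀ hε hR ha1 ha2 hκε)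
  rw [← hLdef] at hlam
  set l := -log (R / a) with hl
  have hl1 : l ≤ 2 * L := by linarith [hlam.2]
  have hl2 : L ≤ 2 * l := by linarith [hlam.1]
  have hl0 : 0 ≤ l := by linarith
  set ω := W * L * ε ^ 2 / R ^ 2 with hω
  have hεR : ε ^ 2 / R ^ 2 = π * a / κ := by
    field_simp
    linarith
  have hω1 : ω = π * W / κ * (a * L) := by
    rw [hω, mul_div_assoc, hεR]
    ring
  have hωlow : π * δ₀ * W / (2 * κ) * l ≤ ω := by
    have h1 : δ₀ * l ≤ a * (2 * L) := by gcongr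
    rw [hω1]
    calc π * δ₀ * W / (2 * κ) * l = π * W / (2 * κ) * (δ₀ * l) := by ring
      _ ≤ π * W / (2 * κ) * (a * (2 * L)) := by gcongr
      _ = _ := by field_simp
  have hωup : ω ≤ 2 * π * W / (κ * δ₀) * l := by
    have h1 : a * L ≤ 1 / δ₀ * (2 * l) := by gcongr
    rw [hω1]
    calc π * W / κ * (a * L) ≤ π * W / κ * (1 / δ₀ * (2 * l)) := by gcongr
      _ = _ := by field_simp
  obtain ⟨-, hωX, ⟨a', b', hnear, hab⟩, hpX⟩ := H (R / a) ω _ B hcore hωlow hωup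
    (by linarith [le_abs_self Λ])
  have hτ : 0 < R / a := by positivity
  have hτl : R / a = exp (-l) := by rw [hl, neg_neg, exp_log hτ]
  set X := K * ((R / a) ^ 2 * l) with hX
  have hX2 : X ≤ 1 / 2 := by
    rw [hX, hτl]
    exact mul_exp_sq_le hK (by linarith)
  have h0B : (0 : ℂ) ∈ B := hnear.ball_subset
    (Metric.mem_ball_self (by linarith [hnear.b_le]))
  have hq := (Complex.abs_re_le_norm q).trans (hpX q hqB (hqmax 0 h0B))
  have hqX : R / a * |q.re| ≤ X := by
    calc R / a * |q.re| ≤ R / a * (K * (R / a * l)) := by gcongr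
      _ = X := by rw [hX]; ring
  have he : |Metric.diam B / 2 - 1| ≤ X := hnear.abs_diam_le.trans hab
  have hp1 : p₁ = a + R * q.re := by
    rw [← hpq]
    simp [mk2]
  have hσ : 1 / 2 * Metric.diam (crossSection ψ ε W μ)
      = R * (1 + (Metric.diam B / 2 - 1)) := by
    rw [hdB]
    ring
  have hWaL : W * a * L = κ * ω / π := by
    rw [hω1]
    field_simp
  have hmain := abs_kelvin_hicks_le hκ hW hL1 hδ₀ ha ha2 hR hWaL hωX hqX he hX2
  rw [hp1, hσ]
  refine hmain.trans ?_
  have hτ2 : (R / a) ^ 2 ≤ κ * ε ^ 2 / (π * δ₀ ^ 3) := by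
    rw [hκε, div_pow, div_le_div_iff₀ (by positivity) (by positivity)]
    calc R ^ 2 * (π * δ₀ ^ 3) ≤ R ^ 2 * (π * a ^ 3) := by gcongr
      _ = _ := by ring
  calc X * (L * (2 * κ / π + W / δ₀))
      ≤ K * (κ * ε ^ 2 / (π * δ₀ ^ 3) * (2 * L)) * (L * (2 * κ / π + W / δ₀)) := by
        rw [hX]
        gcongr
    _ = _ := by ring
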